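/- Let f : D^I_{q,p} → D^I_{q',p'} be a proper holomorphic map, where p ≥ q ≥ 2 and p > q' ≥ 3. Then: (1) f is fibral-image-preserving, i.e. for every (A,B) ∈ Ω_{q,p} there exists (C,D) ∈ Ω_{q',p'} such that C·f(Z) = D for every Z ∈ D^I_{q,p} with A·Z = B; (2) f has a global rational proper moduli map: there is a tuple P = (P',P'') representing a rational proper map from the generalized ball D_{q,p} to D_{q',p'} and a dense open subset U ⊆ Ω_{q,p} such that for every (A,B) ∈ U one has P(A,B) ≠ 0 and P'(A,B)·f(Z) = P''(A,B) for every Z ∈ D^I_{q,p} with A·Z = B; and (3) if in addition q' < 2q−1, then f is of diagonal type. -/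

import Mathlib

open Matrix
open scoped ComplexOrder

attribute [local instance] Matrix.normedAddCommGroup Matrix.normedSpace

/-- The type-I irreducible bounded symmetric domain `D^I_{m,n}`,
realized as the set of complex `m × n` matrices `Z` with `I - Zᴴ Z` positive definite. -/
def typeIDomain (m n : ℕ) : Set (Matrix (Fin m) (Fin n) ℂ) :=
  {Z | (1 - Zᴴ * Z).PosDef}

/-- `f` maps `D` into `D'` and the `f`-preimage of every compact subset of `D'`
is a compact subset of `D`. -/
def ProperOn {E F : Type*} [TopologicalSpace E] [TopologicalSpace F]
    (f : E → F) (D : Set E) (D' : Set F) : Prop :=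
  Set.MapsTo f D D' ∧ ∀ K : Set F, K ⊆ D' → IsCompact K → IsCompact (D ∩ f ⁻¹' K)

/-- `Φ` is a (biholomorphic) automorphism of the type-I domain `D^I_{m,n}`. -/
def IsAutOf {m n : ℕ} (Φ : Matrix (Fin m) (Fin n) ℂ → Matrix (Fin m) (Fin n) ℂ) : Prop :=
  Set.MapsTo Φ (typeIDomain m n) (typeIDomain m n) ∧
  DifferentiableOn ℂ Φ (typeIDomain m n) ∧
  ∃ Ψ, Set.MapsTo Ψ (typeIDomain m n) (typeIDomain m n) ∧
    DifferentiableOn ℂ Ψ (typeIDomain m n) ∧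
    (∀ Z ∈ typeIDomain m n, Ψ (Φ Z) = Z) ∧
    (∀ Z ∈ typeIDomain m n, Φ (Ψ Z) = Z)

/-- The block-diagonal matrix `[[Z, 0], [0, W]]`, reindexed to size `p' × q'`. -/
def diagBlock {p q a b p' q' : ℕ} (hp : p + a = p') (hq : q + b = q')
    (Z : Matrix (Fin p) (Fin q) ℂ) (W : Matrix (Fin a) (Fin b) ℂ) :
    Matrix (Fin p') (Fin q') ℂ :=
  Matrix.reindex (finCongr hp) (finCongr hq)
    (Matrix.reindex finSumFinEquiv finSumFinEquiv (Matrix.fromBlocks Z 0 0 W))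


/-- The affine cone over the generalized ball `D_{r,s} ⊂ ℙ^{r+s-1}`:
pairs of row vectors `(A,B)` with `‖A‖ > ‖B‖`. -/
def genBallCone (r s : ℕ) : Set ((Fin r → ℂ) × (Fin s → ℂ)) :=
  {x | ∑ j, ‖x.2 j‖ ^ 2 < ∑ i, ‖x.1 i‖ ^ 2}

/-- `(P1, P2)` represents a rational proper map of degree `d` from the generalized ball
`D_{r,s}` to `D_{r',s'}`: the components are homogeneous polynomials of common degree
`d ≥ 1`, not all zero, with no common non-constant factor, sending (where defined) the
cone over `D_{r,s}` into the cone over `D_{r',s'}` and the boundary cone into the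
boundary cone. -/
def IsRatProperRep (r s r' s' d : ℕ)
    (P1 : Fin r' → MvPolynomial (Fin (r + s)) ℂ)
    (P2 : Fin s' → MvPolynomial (Fin (r + s)) ℂ) : Prop :=
  1 ≤ d ∧
  (∀ i, (P1 i).IsHomogeneous d) ∧
  (∀ j, (P2 j).IsHomogeneous d) ∧
  ¬ ((∀ i, P1 i = 0) ∧ (∀ j, P2 j = 0)) ∧
  (∀ g : MvPolynomial (Fin (r + s)) ℂ,
    (∀ i, g ∣ P1 i) → (∀ j, g ∣ P2 j) → g.totalDegree = 0) ∧
  (∀ (A : Fin r → ℂ) (B : Fin s → ℂ),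
    ∑ j, ‖B j‖ ^ 2 < ∑ i, ‖A i‖ ^ 2 →
    ¬ ((∀ i, MvPolynomial.eval (Fin.append A B) (P1 i) = 0) ∧
       (∀ j, MvPolynomial.eval (Fin.append A B) (P2 j) = 0)) →
    ∑ j, ‖MvPolynomial.eval (Fin.append A B) (P2 j)‖ ^ 2
      < ∑ i, ‖MvPolynomial.eval (Fin.append A B) (P1 i)‖ ^ 2) ∧
  (∀ (A : Fin r → ℂ) (B : Fin s → ℂ), ¬ (A = 0 ∧ B = 0) →
    ∑ i, ‖A i‖ ^ 2 = ∑ j, ‖B j‖ ^ 2 →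
    ¬ ((∀ i, MvPolynomial.eval (Fin.append A B) (P1 i) = 0) ∧
       (∀ j, MvPolynomial.eval (Fin.append A B) (P2 j) = 0)) →
    ∑ i, ‖MvPolynomial.eval (Fin.append A B) (P1 i)‖ ^ 2
      = ∑ j, ‖MvPolynomial.eval (Fin.append A B) (P2 j)‖ ^ 2)

set_option linter.unusedSimpArgs false

section

/-! ### Part 1: squared norms and the domain -/

/-- squared euclidean norm -/
noncomputable def nsq {ι : Type*} [Fintype ι] (v : ι → ℂ) : ℝ := ∑ i, ‖v i‖ ^ 2

section nsq
variable {ι κ : Type*} [Fintype ι] [Fintype κ]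

lemma nsq_eq_norm (v : ι → ℂ) : nsq v = ‖WithLp.toLp 2 v‖ ^ 2 := by
  rw [EuclideanSpace.norm_sq_eq]; rfl

lemma nsq_nonneg (v : ι → ℂ) : 0 ≤ nsq v := Finset.sum_nonneg fun _ _ => sq_nonneg _

lemma nsq_zero : nsq (0 : ι → ℂ) = 0 := by simp [nsq]

lemma nsq_eq_zero {v : ι → ℂ} : nsq v = 0 ↔ v = 0 := by
  rw [nsq, Finset.sum_eq_zero_iff_of_nonneg (fun _ _ => sq_nonneg _)]
  simp [funext_iff]

lemma nsq_pos {v : ι → ℂ} (h : v ≠ 0) : 0 < nsq v :=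
  lt_of_le_of_ne (nsq_nonneg v) fun h' => h (nsq_eq_zero.1 h'.symm)

lemma nsq_smul (c : ℂ) (v : ι → ℂ) : nsq (c • v) = ‖c‖ ^ 2 * nsq v := by
  simp [nsq, mul_pow, Finset.mul_sum]

lemma nsq_star (v : ι → ℂ) : nsq (star v) = nsq v := by simp [nsq]

lemma norm_sq_le_nsq (v : ι → ℂ) (i : ι) : ‖v i‖ ^ 2 ≤ nsq v :=
  Finset.single_le_sum (f := fun i => ‖v i‖ ^ 2) (fun _ _ => sq_nonneg _) (Finset.mem_univ i)

lemma continuous_nsq : Continuous (nsq : (ι → ℂ) → ℝ) := by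
  unfold nsq; fun_prop

lemma dot_star_self (v : ι → ℂ) : v ⬝ᵥ star v = (nsq v : ℂ) := by
  simp [nsq, dotProduct, Complex.mul_conj, Complex.normSq_eq_norm_sq]

lemma star_dot_self (v : ι → ℂ) : star v ⬝ᵥ v = (nsq v : ℂ) := by
  rw [dotProduct_comm, dot_star_self]

lemma dot_cs (x y : ι → ℂ) : ‖x ⬝ᵥ y‖ ^ 2 ≤ nsq x * nsq y := by
  have := norm_inner_le_norm (𝕜 := ℂ) (WithLp.toLp 2 (star x)) (WithLp.toLp 2 y)
  have h2 : inner ℂ (WithLp.toLp 2 (star x)) (WithLp.toLp 2 y) = x ⬝ᵥ y := by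
    simp [PiLp.inner_apply, dotProduct, mul_comm]
  rw [h2] at this
  rw [← nsq_star x, nsq_eq_norm, nsq_eq_norm, ← mul_pow]
  gcongr

lemma sqrt_nsq (v : ι → ℂ) : √(nsq v) = ‖WithLp.toLp 2 v‖ := by
  rw [nsq_eq_norm, Real.sqrt_sq (norm_nonneg _)]

lemma sqrt_nsq_add (v w : ι → ℂ) : √(nsq (v + w)) ≤ √(nsq v) + √(nsq w) := by
  simp only [sqrt_nsq]
  exact norm_add_le (WithLp.toLp 2 v) (WithLp.toLp 2 w)

/-- adjoint trick: if `|Z v| < |v|` for all `v` then `|A Z| < |A|` for all `A`. -/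
lemma contr_dual (Z : Matrix ι κ ℂ) (h : ∀ v ≠ 0, nsq (Z *ᵥ v) < nsq v)
    (A : ι → ℂ) (hA : A ≠ 0) : nsq (A ᵥ* Z) < nsq A := by
  by_cases hv : A ᵥ* Z = 0
  · rw [hv, nsq_zero]; exact nsq_pos hA
  have h1 := h (star (A ᵥ* Z)) (by simpa using hv)
  have h2 := dot_cs A (Z *ᵥ star (A ᵥ* Z))
  rw [dotProduct_mulVec, dot_star_self] at h2
  rw [nsq_star] at h1
  rw [Complex.norm_real, Real.norm_eq_abs, sq_abs] at h2
  have h3 := nsq_pos hv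
  have h4 := nsq_pos hA
  nlinarith

end nsq

section dom
variable {q p : ℕ}

lemma mem_dom_iff_col {Z : Matrix (Fin q) (Fin p) ℂ} :
    Z ∈ typeIDomain q p ↔ ∀ v ≠ 0, nsq (Z *ᵥ v) < nsq v := by
  have key : ∀ v : Fin p → ℂ, star v ⬝ᵥ ((1 - Zᴴ * Z) *ᵥ v) = ((nsq v - nsq (Z *ᵥ v) : ℝ) : ℂ) := by
    intro v
    rw [Matrix.sub_mulVec, dotProduct_sub, one_mulVec, star_dot_self, ← mulVec_mulVec,
      dotProduct_mulVec, ← star_mulVec, star_dot_self]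
    push_cast; rfl
  show (1 - Zᴴ * Z).PosDef ↔ _
  rw [Matrix.posDef_iff_dotProduct_mulVec]
  constructor
  · rintro ⟨_, h⟩ v hv
    have := h hv
    rw [key, Complex.zero_lt_real] at this
    linarith
  · intro h
    refine ⟨?_, fun {v} hv => ?_⟩
    · exact (Matrix.isHermitian_one).sub (Matrix.isHermitian_conjTranspose_mul_self Z)
    · rw [key, Complex.zero_lt_real]
      linarith [h v hv]

lemma mem_dom_iff {Z : Matrix (Fin q) (Fin p) ℂ} :
    Z ∈ typeIDomain q p ↔ ∀ A ≠ 0, nsq (A ᵥ* Z) < nsq A := by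
  rw [mem_dom_iff_col]
  constructor
  · exact contr_dual Z
  · intro h v hv
    have := contr_dual Zᵀ (fun w hw => by rw [mulVec_transpose]; exact h w hw) v hv
    rwa [vecMul_transpose] at this

lemma dom_le {Z : Matrix (Fin q) (Fin p) ℂ} (h : Z ∈ typeIDomain q p) (A : Fin q → ℂ) :
    nsq (A ᵥ* Z) ≤ nsq A := by
  by_cases hA : A = 0
  · simp [hA, nsq_zero]
  · exact (mem_dom_iff.1 h A hA).le

lemma dom_le_col {Z : Matrix (Fin q) (Fin p) ℂ} (h : Z ∈ typeIDomain q p) (v : Fin p → ℂ) :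
    nsq (Z *ᵥ v) ≤ nsq v := by
  by_cases hA : v = 0
  · simp [hA, nsq_zero]
  · exact (mem_dom_iff_col.1 h v hA).le

lemma zero_mem_dom : (0 : Matrix (Fin q) (Fin p) ℂ) ∈ typeIDomain q p := by
  rw [mem_dom_iff]; intro A hA; simpa [nsq_zero] using nsq_pos hA

lemma compact_sphere (q : ℕ) : IsCompact {A : Fin q → ℂ | nsq A = 1} := by
  apply Metric.isCompact_of_isClosed_isBounded
  · exact isClosed_eq continuous_nsq continuous_const
  · refine (Metric.isBounded_closedBall (x := (0 : Fin q → ℂ)) (r := 1)).subset ?_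
    intro A hA
    rw [mem_closedBall_zero_iff, pi_norm_le_iff_of_nonneg zero_le_one]
    intro i
    have := norm_sq_le_nsq A i
    rw [hA] at this
    nlinarith [norm_nonneg (A i)]

lemma exists_unit {A : Fin q → ℂ} (hA : A ≠ 0) :
    ∃ c : ℂ, c ≠ 0 ∧ nsq (c • A) = 1 := by
  have h := nsq_pos hA
  refine ⟨((√(nsq A))⁻¹ : ℝ), ?_, ?_⟩
  · simpa using (Real.sqrt_pos.2 h).ne'
  · rw [nsq_smul, Complex.norm_real, norm_inv, Real.norm_eq_abs, abs_of_nonneg (Real.sqrt_nonneg _), inv_pow,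
      Real.sq_sqrt h.le, inv_mul_cancel₀ h.ne']

lemma mem_dom_iff_unit {Z : Matrix (Fin q) (Fin p) ℂ} :
    Z ∈ typeIDomain q p ↔ ∀ A ∈ {A : Fin q → ℂ | nsq A = 1}, nsq (A ᵥ* Z) < 1 := by
  rw [mem_dom_iff]
  constructor
  · intro h A hA
    have hA : nsq A = 1 := hA
    have := h A (by rintro rfl; simp [nsq_zero] at hA)
    rwa [hA] at this
  · intro h A hA
    obtain ⟨c, hc, h1⟩ := exists_unit hA
    have := h _ h1
    rw [← h1, smul_vecMul, nsq_smul, nsq_smul] at this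
    exact lt_of_mul_lt_mul_left this (by positivity)

lemma continuous_vecMul' :
    Continuous fun x : Matrix (Fin q) (Fin p) ℂ × (Fin q → ℂ) => x.2 ᵥ* x.1 :=
  Continuous.matrix_vecMul continuous_snd continuous_fst

lemma isOpen_dom : IsOpen (typeIDomain q p) := by
  rw [isOpen_iff_mem_nhds]
  intro Z hZ
  have h := mem_dom_iff_unit.1 hZ
  have := (compact_sphere q).eventually_forall_of_forall_eventually
    (x₀ := Z) (P := fun Z A => nsq (A ᵥ* Z) < 1) (fun A hA => ?_)
  · filter_upwards [this] with W hW
    exact mem_dom_iff_unit.2 hW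
  · have hc : Continuous fun x : Matrix (Fin q) (Fin p) ℂ × (Fin q → ℂ) => nsq (x.2 ᵥ* x.1) :=
      continuous_nsq.comp continuous_vecMul'
    exact (isOpen_lt hc continuous_const).mem_nhds (h A hA)

lemma convex_dom : Convex ℝ (typeIDomain q p) := by
  intro Z hZ W hW a b ha hb hab
  rw [mem_dom_iff]
  intro A hA
  have h1 : √(nsq (A ᵥ* Z)) < √(nsq A) := Real.sqrt_lt_sqrt (nsq_nonneg _) (mem_dom_iff.1 hZ A hA)
  have h2 : √(nsq (A ᵥ* W)) < √(nsq A) := Real.sqrt_lt_sqrt (nsq_nonneg _) (mem_dom_iff.1 hW A hA)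
  have h3 := sqrt_nsq_add ((a : ℂ) • (A ᵥ* Z)) ((b : ℂ) • (A ᵥ* W))
  rw [nsq_smul, nsq_smul, Real.sqrt_mul (by positivity), Real.sqrt_mul (by positivity),
    Real.sqrt_sq (norm_nonneg _), Real.sqrt_sq (norm_nonneg _), Complex.norm_real, Complex.norm_real,
    Real.norm_of_nonneg ha, Real.norm_of_nonneg hb] at h3
  have h4 : A ᵥ* (a • Z + b • W) = (a : ℂ) • (A ᵥ* Z) + (b : ℂ) • (A ᵥ* W) := by
    rw [vecMul_add, ← vecMul_smul, ← vecMul_smul]; rfl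
  rw [h4]
  refine lt_of_not_ge fun hcon => ?_
  have h5 := Real.sqrt_le_sqrt hcon
  rcases ha.eq_or_lt with rfl | ha'
  · obtain rfl : b = 1 := by linarith
    linarith
  · have e1 := mul_lt_mul_of_pos_left h1 ha'
    have e2 := mul_le_mul_of_nonneg_left h2.le hb
    have e3 : a * √(nsq A) + b * √(nsq A) = √(nsq A) := by rw [← add_mul, hab, one_mul]
    linarith

lemma smul_mem_dom {Z : Matrix (Fin q) (Fin p) ℂ} (hZ : Z ∈ typeIDomain q p) {c : ℂ}
    (hc : ‖c‖ ≤ 1) : c • Z ∈ typeIDomain q p := by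
  rw [mem_dom_iff] at *
  intro A hA
  rw [vecMul_smul, nsq_smul]
  have := hZ A hA
  have h0 := nsq_nonneg (A ᵥ* Z)
  have : ‖c‖ ^ 2 ≤ 1 := pow_le_one₀ (norm_nonneg _) hc
  nlinarith

/-- compact exhaustion -/
def Kset (q p : ℕ) (r : ℝ) : Set (Matrix (Fin q) (Fin p) ℂ) := {Z | ∀ A, nsq (A ᵥ* Z) ≤ r * nsq A}

lemma Kset_sub {r : ℝ} (hr : r < 1) : Kset q p r ⊆ typeIDomain q p := by
  intro Z hZ
  rw [mem_dom_iff]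
  intro A hA
  have := hZ A
  have := nsq_pos hA
  nlinarith

lemma entry_le {Z : Matrix (Fin q) (Fin p) ℂ} {r : ℝ} (h : Z ∈ Kset q p r) (i : Fin q) (j : Fin p) :
    ‖Z i j‖ ^ 2 ≤ r := by
  have h1 := h (Pi.single i 1)
  have h2 := norm_sq_le_nsq (Pi.single i 1 ᵥ* Z) j
  have h3 : nsq (Pi.single i (1 : ℂ)) = 1 := by
    simp [nsq, Pi.single_apply, apply_ite]
  rw [single_one_vecMul] at h1 h2
  rw [h3] at h1
  have : Z.row i j = Z i j := rfl
  rw [this] at h2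
  linarith

lemma isCompact_Kset (r : ℝ) : IsCompact (Kset q p r) := by
  apply Metric.isCompact_of_isClosed_isBounded
  · have : Kset q p r = ⋂ A : Fin q → ℂ, {Z | nsq (A ᵥ* Z) ≤ r * nsq A} := by
      ext Z; simp [Kset]
    rw [this]
    refine isClosed_iInter fun A => isClosed_le ?_ continuous_const
    exact continuous_nsq.comp (Continuous.matrix_vecMul continuous_const continuous_id)
  · refine (Metric.isBounded_closedBall (x := (0 : Matrix (Fin q) (Fin p) ℂ)) (r := √r)).subset ?_
    intro Z hZ
    rw [mem_closedBall_zero_iff, Matrix.norm_le_iff (Real.sqrt_nonneg _)]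
    intro i j
    exact Real.le_sqrt_of_sq_le (entry_le hZ i j)

lemma compact_sub_Kset {K : Set (Matrix (Fin q) (Fin p) ℂ)} (hK : IsCompact K)
    (hs : K ⊆ typeIDomain q p) : ∃ r < 1, K ⊆ Kset q p r := by
  have hc : Continuous fun x : Matrix (Fin q) (Fin p) ℂ × (Fin q → ℂ) => nsq (x.2 ᵥ* x.1) :=
      continuous_nsq.comp continuous_vecMul'
  by_cases hne : (K ×ˢ {A : Fin q → ℂ | nsq A = 1}).Nonempty
  · obtain ⟨⟨Z0, A0⟩, hm, hmax⟩ := (hK.prod (compact_sphere q)).exists_isMaxOn hne hc.continuousOn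
    refine ⟨nsq (A0 ᵥ* Z0), mem_dom_iff_unit.1 (hs hm.1) A0 hm.2, fun Z hZ A => ?_⟩
    by_cases hA : A = 0
    · simp [hA, nsq_zero]
    obtain ⟨c, hc, h1⟩ := exists_unit hA
    have h2 : nsq ((c • A) ᵥ* Z) ≤ nsq (A0 ᵥ* Z0) := hmax (a := (Z, c • A)) ⟨hZ, h1⟩
    rw [smul_vecMul, nsq_smul] at h2
    rw [nsq_smul] at h1
    have h3 : 0 < ‖c‖ ^ 2 := by positivity
    refine le_of_mul_le_mul_left (a := ‖c‖ ^ 2) ?_ h3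
    calc _ ≤ _ := h2
      _ = _ := by rw [mul_left_comm, h1, mul_one]
  · refine ⟨0, zero_lt_one, fun Z hZ A => ?_⟩
    by_cases hA : A = 0
    · simp [hA, nsq_zero]
    obtain ⟨c, hc, h1⟩ := exists_unit hA
    exact absurd ⟨(Z, c • A), hZ, h1⟩ hne

end dom

end

section

/-! ### Part 2: the unitary group of signature (q,p) -/

/-- vectors of the indefinite space -/
abbrev Vec (q p : ℕ) := Fin q ⊕ Fin p → ℂ

section grp
variable {q p : ℕ}

/-- the sign of a coordinate -/
def eps (s : Fin q ⊕ Fin p) : ℂ := Sum.elim (fun _ => 1) (fun _ => -1) s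

@[simp] lemma eps_inl (i : Fin q) : (eps (Sum.inl i : Fin q ⊕ Fin p)) = 1 := rfl
@[simp] lemma eps_inr (i : Fin p) : (eps (Sum.inr i : Fin q ⊕ Fin p)) = -1 := rfl
lemma eps_mul_self (s : Fin q ⊕ Fin p) : eps s * eps s = 1 := by cases s <;> simp
lemma eps_ne (s : Fin q ⊕ Fin p) : eps s ≠ 0 := by cases s <;> simp
lemma star_eps (s : Fin q ⊕ Fin p) : star (eps s) = eps s := by cases s <;> simp

/-- the hermitian form -/
noncomputable def hf (x y : Vec q p) : ℂ := ∑ s, eps s * x s * star (y s)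

/-- the quadratic form -/
noncomputable def hq (x : Vec q p) : ℝ := nsq (x ∘ Sum.inl) - nsq (x ∘ Sum.inr)

lemma hf_eq (x y : Vec q p) : hf x y =
    (x ∘ Sum.inl) ⬝ᵥ star (y ∘ Sum.inl) - (x ∘ Sum.inr) ⬝ᵥ star (y ∘ Sum.inr) := by
  simp [hf, dotProduct, Fintype.sum_sum_type, sub_eq_add_neg]

lemma hf_self (x : Vec q p) : hf x x = (hq x : ℂ) := by
  rw [hf_eq, dot_star_self, dot_star_self, hq]; push_cast; rfl

lemma hf_add_left (x y z : Vec q p) : hf (x + y) z = hf x z + hf y z := by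
  simp only [hf, ← Finset.sum_add_distrib]
  exact Finset.sum_congr rfl fun s _ => by rw [Pi.add_apply]; ring
lemma hf_sub_left (x y z : Vec q p) : hf (x - y) z = hf x z - hf y z := by
  simp only [hf, ← Finset.sum_sub_distrib]
  exact Finset.sum_congr rfl fun s _ => by rw [Pi.sub_apply]; ring
lemma hf_smul_left (c : ℂ) (x z : Vec q p) : hf (c • x) z = c * hf x z := by
  simp only [hf, Finset.mul_sum]
  exact Finset.sum_congr rfl fun s _ => by rw [Pi.smul_apply, smul_eq_mul]; ring
lemma hf_conj (x y : Vec q p) : star (hf x y) = hf y x := by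
  simp only [hf, star_sum, star_mul', star_star, star_eps]
  exact Finset.sum_congr rfl fun s _ => by ring
lemma hf_add_right (x y z : Vec q p) : hf x (y + z) = hf x y + hf x z := by
  rw [← hf_conj, hf_add_left, star_add, hf_conj, hf_conj]
lemma hf_sub_right (x y z : Vec q p) : hf x (y - z) = hf x y - hf x z := by
  rw [← hf_conj, hf_sub_left, star_sub, hf_conj, hf_conj]
lemma hf_smul_right (c : ℂ) (x z : Vec q p) : hf x (c • z) = star c * hf x z := by
  rw [← hf_conj, hf_smul_left, star_mul', hf_conj]
@[simp] lemma hf_zero_left (z : Vec q p) : hf 0 z = 0 := by simp [hf]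
@[simp] lemma hf_zero_right (z : Vec q p) : hf z 0 = 0 := by simp [hf]
lemma hf_sum_left {ι : Type*} (s : Finset ι) (x : ι → Vec q p) (z : Vec q p) :
    hf (∑ i ∈ s, x i) z = ∑ i ∈ s, hf (x i) z := by
  classical
  induction s using Finset.induction_on with
  | empty => simp
  | insert a s ha ih => rw [Finset.sum_insert ha, Finset.sum_insert ha, hf_add_left, ih]
lemma hf_symm_zero {x y : Vec q p} (h : hf x y = 0) : hf y x = 0 := by
  rw [← hf_conj, h, star_zero]

/-- basis vectors -/
noncomputable def eb (s : Fin q ⊕ Fin p) : Vec q p := Pi.single s 1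

lemma hf_eb_left (s : Fin q ⊕ Fin p) (y : Vec q p) : hf (eb s) y = eps s * star (y s) := by
  classical
  simp [hf, eb, Pi.single_apply]
lemma hf_eb_right (s : Fin q ⊕ Fin p) (y : Vec q p) : hf y (eb s) = eps s * y s := by
  rw [← hf_conj, hf_eb_left, star_mul', star_star, star_eps]
lemma hf_eb (s t : Fin q ⊕ Fin p) : hf (eb s) (eb t) = if s = t then eps s else 0 := by
  rw [hf_eb_left, eb, Pi.single_apply]; split_ifs <;> simp

lemma hf_nondeg {x : Vec q p} (h : ∀ y, hf x y = 0) : x = 0 := by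
  ext s
  have := h (eb s)
  rw [hf_eb_right] at this
  simpa [eps_ne] using this

lemma sum_eb (x : Vec q p) : x = ∑ s, x s • eb s := by
  ext t; simp [eb, Finset.sum_apply, Pi.single_apply]

lemma hq_eq_of {x y : Vec q p} (h : hf x x = hf y y) : hq x = hq y := by
  rw [hf_self, hf_self] at h; exact_mod_cast h

lemma continuous_hq : Continuous (hq : Vec q p → ℝ) := by
  unfold hq
  refine (continuous_nsq.comp ?_).sub (continuous_nsq.comp ?_) <;> fun_prop

lemma hq_smul (c : ℂ) (x : Vec q p) : hq (c • x) = ‖c‖ ^ 2 * hq x := by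
  have h1 : (c • x) ∘ Sum.inl = c • (x ∘ Sum.inl) := rfl
  have h2 : (c • x) ∘ Sum.inr = c • (x ∘ Sum.inr) := rfl
  rw [hq, hq, h1, h2, nsq_smul, nsq_smul]; ring

/-- isometries -/
def IsU (g : Vec q p ≃ₗ[ℂ] Vec q p) : Prop := ∀ x y, hf (g x) (g y) = hf x y

lemma IsU.symm {g : Vec q p ≃ₗ[ℂ] Vec q p} (h : IsU g) : IsU g.symm := fun x y => by
  rw [← h, g.apply_symm_apply, g.apply_symm_apply]
lemma IsU.trans {g h : Vec q p ≃ₗ[ℂ] Vec q p} (hg : IsU g) (hh : IsU h) : IsU (g.trans h) :=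
  fun x y => by rw [LinearEquiv.trans_apply, LinearEquiv.trans_apply, hh, hg]
lemma IsU.refl : IsU (LinearEquiv.refl ℂ (Vec q p)) := fun _ _ => rfl
lemma IsU.hq {g : Vec q p ≃ₗ[ℂ] Vec q p} (h : IsU g) (x) : hq (g x) = hq x := hq_eq_of (h x x)

/-- an isometric endomorphism is an equivalence -/
lemma exists_isU (g : Vec q p →ₗ[ℂ] Vec q p) (h : ∀ x y, hf (g x) (g y) = hf x y) :
    ∃ g' : Vec q p ≃ₗ[ℂ] Vec q p, IsU g' ∧ ∀ x, g' x = g x := by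
  have hi : Function.Injective g := by
    rw [← LinearMap.ker_eq_bot, LinearMap.ker_eq_bot']
    intro x hx
    exact hf_nondeg fun y => by rw [← h, hx, hf_zero_left]
  exact ⟨LinearEquiv.ofInjectiveEndo g hi, fun x y => by simpa using h x y, fun x => rfl⟩

/-- the reflection in `v` -/
noncomputable def refl' (v : Vec q p) : Vec q p →ₗ[ℂ] Vec q p where
  toFun x := x - (2 * hf x v / hf v v) • v
  map_add' x y := by rw [hf_add_left]; module
  map_smul' c x := by rw [hf_smul_left]; simp only [RingHom.id_apply]; module

lemma refl'_apply (v x : Vec q p) : refl' v x = x - (2 * hf x v / hf v v) • v := rfl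

lemma refl'_iso {v : Vec q p} (hv : hf v v ≠ 0) (x y) : hf (refl' v x) (refl' v y) = hf x y := by
  have h1 : star (hf v v) = hf v v := hf_conj v v
  simp only [refl'_apply, hf_sub_left, hf_sub_right, hf_smul_left, hf_smul_right, star_div₀, star_mul',
    h1, hf_conj, star_ofNat]
  field_simp
  ring

lemma refl'_fix {v x : Vec q p} (h : hf x v = 0) : refl' v x = x := by simp [refl'_apply, h]

lemma refl'_swap {e w : Vec q p} (h1 : hf e e = hf w w) (h2 : hf e w = hf w e)
    (h3 : hf e e + hf e w ≠ 0) : refl' (e + w) e = - w := by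
  have h4 : hf (e + w) (e + w) = 2 * (hf e e + hf e w) := by
    rw [hf_add_left, hf_add_right, hf_add_right, ← h1, ← h2]; ring
  rw [refl'_apply, h4, hf_add_right, div_self (by simpa using h3)]
  simp

lemma witt_step (S : Finset (Fin q ⊕ Fin p)) (a : Fin q ⊕ Fin p) (ha : a ∉ S) (w : Vec q p)
    (hw : hf w w = eps a) (hS : ∀ b ∈ S, hf (eb b) w = 0) :
    ∃ h : Vec q p ≃ₗ[ℂ] Vec q p, IsU h ∧ h (eb a) = w ∧ ∀ b ∈ S, h (eb b) = eb b := by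
  classical
  obtain ⟨c, hc1, r, hr0, hc⟩ : ∃ c : ℂ, c * star c = 1 ∧ ∃ r : ℝ, 0 ≤ r ∧ c * w a = r := by
    by_cases h : w a = 0
    · exact ⟨1, by simp, 0, le_rfl, by simp [h]⟩
    · have h' : (‖w a‖ : ℂ) ≠ 0 := by simpa using h
      have h2 : w a * (starRingEnd ℂ) (w a) = (‖w a‖ : ℂ) ^ 2 := by
        rw [Complex.mul_conj, Complex.normSq_eq_norm_sq]; push_cast; rfl
      refine ⟨star (w a) / ‖w a‖, ?_, ‖w a‖, norm_nonneg _, ?_⟩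
      · simp only [star_div₀, Complex.star_def, Complex.conj_ofReal, Complex.conj_conj]
        field_simp
        rw [mul_comm, h2]
      · simp only [Complex.star_def]
        field_simp
        rw [mul_comm, h2]
  have hr1 : (1 : ℂ) + r ≠ 0 := by
    have : (1 : ℝ) + r ≠ 0 := by positivity
    exact_mod_cast this
  set w' := c • w with hw'
  have hw'a : w' a = r := hc
  have e1 : hf (eb a) (eb a) = hf w' w' := by
    rw [hf_eb, if_pos rfl, hw', hf_smul_left, hf_smul_right, hw, ← mul_assoc, hc1, one_mul]
  have e2 : hf (eb a) w' = eps a * r := by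
    rw [hf_eb_left, hw'a]; simp
  have e3 : hf w' (eb a) = eps a * r := by rw [hf_eb_right, hw'a]
  have e4 : hf (eb a) (eb a) + hf (eb a) w' ≠ 0 := by
    rw [e2, hf_eb, if_pos rfl]
    have : eps a + eps a * r = eps a * (1 + r) := by ring
    rw [this]
    exact mul_ne_zero (eps_ne a) hr1
  have hvv : hf (eb a + w') (eb a + w') ≠ 0 := by
    have : hf (eb a + w') (eb a + w') = 2 * (hf (eb a) (eb a) + hf (eb a) w') := by
      rw [hf_add_left, hf_add_right, hf_add_right, ← e1, e2, e3]; ring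
    rw [this]
    exact mul_ne_zero two_ne_zero e4
  -- the diagonal phase
  let d : Fin q ⊕ Fin p → ℂ := fun s => if s = a then - star c else 1
  let Dg : Vec q p →ₗ[ℂ] Vec q p :=
    { toFun := fun x s => d s * x s
      map_add' := fun x y => by ext s; simp [mul_add]
      map_smul' := fun k x => by ext s; simp; ring }
  have hd : ∀ s, d s * star (d s) = 1 := by
    intro s
    simp only [d]; split_ifs
    · simp only [star_neg, star_star]; rw [neg_mul_neg, mul_comm]; exact hc1
    · simp
  have hD : ∀ x y, hf (Dg x) (Dg y) = hf x y := by
    intro x y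
    simp only [hf]
    refine Finset.sum_congr rfl fun s _ => ?_
    show eps s * (d s * x s) * star (d s * y s) = _
    rw [star_mul']
    linear_combination (eps s * x s * star (y s)) * hd s
  obtain ⟨g1, hg1, h1⟩ := exists_isU Dg hD
  obtain ⟨g2, hg2, h2⟩ := exists_isU (refl' (eb a + w')) (refl'_iso hvv)
  refine ⟨g1.trans g2, hg1.trans hg2, ?_, fun b hb => ?_⟩
  · rw [LinearEquiv.trans_apply, h1]
    have : Dg (eb a) = (- star c) • eb a := by
      ext s
      show d s * (eb a) s = _
      by_cases hs : s = a
      · subst hs; simp [d, eb]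
      · simp [eb, Pi.single_apply, hs]
    rw [this, map_smul, h2, refl'_swap e1 (e2.trans e3.symm) e4, hw', smul_neg, ← neg_smul, neg_neg, smul_smul,
      mul_comm, hc1, one_smul]
  · have hba : b ≠ a := fun h => ha (h ▸ hb)
    rw [LinearEquiv.trans_apply, h1]
    have : Dg (eb b) = eb b := by
      ext s
      show d s * (eb b) s = _
      by_cases hs : s = a
      · subst hs; simp [eb, Pi.single_apply, hba.symm]
      · simp [d, hs]
    rw [this, h2, refl'_fix]
    rw [hf_add_right, hf_eb, if_neg hba, hw', hf_smul_right, hS b hb]; simp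

/-- Witt's theorem for orthonormal families -/
lemma witt (S : Finset (Fin q ⊕ Fin p)) (y : Fin q ⊕ Fin p → Vec q p)
    (h : ∀ a ∈ S, ∀ b ∈ S, hf (y a) (y b) = if a = b then eps a else 0) :
    ∃ g : Vec q p ≃ₗ[ℂ] Vec q p, IsU g ∧ ∀ a ∈ S, g (eb a) = y a := by
  classical
  induction S using Finset.induction_on with
  | empty => exact ⟨_, IsU.refl, by simp⟩
  | insert a S ha ih =>
    obtain ⟨g0, hg0, h0⟩ := ih fun a ha b hb => h a (Finset.mem_insert_of_mem ha) b (Finset.mem_insert_of_mem hb)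
    obtain ⟨k, hk, hka, hkb⟩ := witt_step S a ha (g0.symm (y a))
      (by rw [hg0.symm, h a (Finset.mem_insert_self _ _) a (Finset.mem_insert_self _ _), if_pos rfl])
      (fun b hb => by
        rw [← hg0, g0.apply_symm_apply, h0 b hb, h b (Finset.mem_insert_of_mem hb) a (Finset.mem_insert_self _ _),
          if_neg (fun h' : b = a => ha (h' ▸ hb))])
    refine ⟨k.trans g0, hk.trans hg0, fun b hb => ?_⟩
    rw [Finset.mem_insert] at hb
    rcases hb with rfl | hb
    · rw [LinearEquiv.trans_apply, hka, g0.apply_symm_apply]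
    · rw [LinearEquiv.trans_apply, hkb b hb, h0 b hb]

/-! #### graphs and the action -/

/-- `x` lies on the graph of `Z` -/
def On (x : Vec q p) (Z : Matrix (Fin q) (Fin p) ℂ) : Prop := (x ∘ Sum.inl) ᵥ* Z = x ∘ Sum.inr

/-- graph vector -/
noncomputable def gv (A : Fin q → ℂ) (Z : Matrix (Fin q) (Fin p) ℂ) : Vec q p := Sum.elim A (A ᵥ* Z)

@[simp] lemma gv_inl (A : Fin q → ℂ) (Z : Matrix (Fin q) (Fin p) ℂ) : gv A Z ∘ Sum.inl = A := rfl
@[simp] lemma gv_inr (A : Fin q → ℂ) (Z : Matrix (Fin q) (Fin p) ℂ) : gv A Z ∘ Sum.inr = A ᵥ* Z := rfl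
@[simp] lemma gv_apply_inl (A : Fin q → ℂ) (Z : Matrix (Fin q) (Fin p) ℂ) (i) : gv A Z (Sum.inl i) = A i := rfl
@[simp] lemma gv_apply_inr (A : Fin q → ℂ) (Z : Matrix (Fin q) (Fin p) ℂ) (j) :
    gv A Z (Sum.inr j) = (A ᵥ* Z) j := rfl
lemma on_gv (A : Fin q → ℂ) (Z : Matrix (Fin q) (Fin p) ℂ) : On (gv A Z) Z := rfl
lemma On.eq_gv {x : Vec q p} {Z} (h : On x Z) : x = gv (x ∘ Sum.inl) Z := by
  ext s; cases s with
  | inl i => rfl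
  | inr j => exact (congrFun h j).symm
lemma gv_add (A B : Fin q → ℂ) (Z : Matrix (Fin q) (Fin p) ℂ) : gv (A + B) Z = gv A Z + gv B Z := by
  ext s; cases s with
  | inl i => rfl
  | inr j => exact congrFun (add_vecMul Z A B) j
lemma gv_smul (c : ℂ) (A : Fin q → ℂ) (Z : Matrix (Fin q) (Fin p) ℂ) : gv (c • A) Z = c • gv A Z := by
  ext s; cases s with
  | inl i => rfl
  | inr j => exact congrFun (smul_vecMul c A Z) j

lemma On.add {x y : Vec q p} {Z} (hx : On x Z) (hy : On y Z) : On (x + y) Z := by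
  rw [hx.eq_gv, hy.eq_gv, ← gv_add]; exact on_gv _ _
lemma On.smul {x : Vec q p} {Z} (c : ℂ) (hx : On x Z) : On (c • x) Z := by
  rw [hx.eq_gv, ← gv_smul]; exact on_gv _ _
lemma On.zero (Z : Matrix (Fin q) (Fin p) ℂ) : On 0 Z := by
  show (0 : Fin q → ℂ) ᵥ* Z = 0
  simp

lemma mem_dom_iff_on {Z : Matrix (Fin q) (Fin p) ℂ} :
    Z ∈ typeIDomain q p ↔ ∀ x, x ≠ 0 → On x Z → 0 < hq x := by
  rw [mem_dom_iff]
  constructor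
  · intro h x hx hxZ
    have : x ∘ Sum.inl ≠ 0 := by
      intro h0
      apply hx
      rw [hxZ.eq_gv, h0]
      ext s; cases s <;> simp [gv]
    have := h _ this
    rw [hxZ] at this
    simpa [hq] using this
  · intro h A hA
    have := h (gv A Z) (fun h0 => hA (by rw [← gv_inl A Z, h0]; rfl)) (on_gv _ _)
    simpa [hq] using this

lemma eq_of_on {Z W : Matrix (Fin q) (Fin p) ℂ} (h : ∀ x, On x Z → On x W) : Z = W := by
  ext i j
  have := h _ (on_gv (Pi.single i 1) Z)
  have := congrFun this j
  simpa using this.symm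

/-- first block of the action -/
noncomputable def M1 (g : Vec q p ≃ₗ[ℂ] Vec q p) (Z : Matrix (Fin q) (Fin p) ℂ) : Matrix (Fin q) (Fin q) ℂ :=
  of fun i k => g (gv (Pi.single i 1) Z) (Sum.inl k)
/-- second block of the action -/
noncomputable def M2 (g : Vec q p ≃ₗ[ℂ] Vec q p) (Z : Matrix (Fin q) (Fin p) ℂ) : Matrix (Fin q) (Fin p) ℂ :=
  of fun i k => g (gv (Pi.single i 1) Z) (Sum.inr k)
/-- the action -/
noncomputable def act (g : Vec q p ≃ₗ[ℂ] Vec q p) (Z : Matrix (Fin q) (Fin p) ℂ) : Matrix (Fin q) (Fin p) ℂ :=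
  (M1 g Z)⁻¹ * M2 g Z

lemma gv_sum (A : Fin q → ℂ) (Z : Matrix (Fin q) (Fin p) ℂ) :
    gv A Z = ∑ i, A i • gv (Pi.single i 1) Z := by
  ext s; cases s with
  | inl i => simp [gv, Finset.sum_apply, Pi.single_apply]
  | inr j => simp [gv, Finset.sum_apply, vecMul, dotProduct]

lemma vecMul_M1 (g : Vec q p ≃ₗ[ℂ] Vec q p) (A : Fin q → ℂ) (Z : Matrix (Fin q) (Fin p) ℂ) :
    A ᵥ* M1 g Z = g (gv A Z) ∘ Sum.inl := by
  rw [gv_sum]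
  ext k; simp [M1, vecMul, dotProduct, Finset.sum_apply]
lemma vecMul_M2 (g : Vec q p ≃ₗ[ℂ] Vec q p) (A : Fin q → ℂ) (Z : Matrix (Fin q) (Fin p) ℂ) :
    A ᵥ* M2 g Z = g (gv A Z) ∘ Sum.inr := by
  rw [gv_sum]
  ext k; simp [M2, vecMul, dotProduct, Finset.sum_apply]

lemma M1_unit {g : Vec q p ≃ₗ[ℂ] Vec q p} (hg : IsU g) {Z : Matrix (Fin q) (Fin p) ℂ}
    (hZ : Z ∈ typeIDomain q p) : IsUnit (M1 g Z).det := by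
  rw [isUnit_iff_ne_zero]
  intro h0
  obtain ⟨A, hA, h⟩ := Matrix.exists_vecMul_eq_zero_iff.2 h0
  rw [vecMul_M1] at h
  have h1 := mem_dom_iff_on.1 hZ (gv A Z) (fun h0 => hA (by rw [← gv_inl A Z, h0]; rfl)) (on_gv _ _)
  rw [← hg.hq, hq, h, nsq_zero] at h1
  linarith [nsq_nonneg (g (gv A Z) ∘ Sum.inr)]

lemma on_act {g : Vec q p ≃ₗ[ℂ] Vec q p} (hg : IsU g) {Z : Matrix (Fin q) (Fin p) ℂ}
    (hZ : Z ∈ typeIDomain q p) {x : Vec q p} (h : On x Z) : On (g x) (act g Z) := by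
  rw [h.eq_gv]
  show _ ᵥ* _ = _
  rw [← vecMul_M1, ← vecMul_M2, act, vecMul_vecMul, ← Matrix.mul_assoc, Matrix.mul_nonsing_inv _ (M1_unit hg hZ), Matrix.one_mul]

lemma on_act' {g : Vec q p ≃ₗ[ℂ] Vec q p} (hg : IsU g) {Z : Matrix (Fin q) (Fin p) ℂ}
    (hZ : Z ∈ typeIDomain q p) {x : Vec q p} (h : On x (act g Z)) : On (g.symm x) Z := by
  set A := (x ∘ Sum.inl) ᵥ* (M1 g Z)⁻¹
  have h1 : g (gv A Z) = x := by
    have h2 := on_act hg hZ (on_gv A Z)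
    have h3 : g (gv A Z) ∘ Sum.inl = x ∘ Sum.inl := by
      rw [← vecMul_M1, vecMul_vecMul, Matrix.nonsing_inv_mul _ (M1_unit hg hZ), vecMul_one]
    rw [h2.eq_gv, h3, ← h.eq_gv]
  rw [← h1, g.symm_apply_apply]; exact on_gv _ _

lemma act_mem {g : Vec q p ≃ₗ[ℂ] Vec q p} (hg : IsU g) {Z : Matrix (Fin q) (Fin p) ℂ}
    (hZ : Z ∈ typeIDomain q p) : act g Z ∈ typeIDomain q p := by
  rw [mem_dom_iff_on]
  intro x hx h
  have := mem_dom_iff_on.1 hZ (g.symm x) (by simpa using hx) (on_act' hg hZ h)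
  rwa [hg.symm.hq] at this

lemma act_symm_act {g : Vec q p ≃ₗ[ℂ] Vec q p} (hg : IsU g) {Z : Matrix (Fin q) (Fin p) ℂ}
    (hZ : Z ∈ typeIDomain q p) : act g.symm (act g Z) = Z := by
  symm
  apply eq_of_on
  intro x h
  have := on_act hg.symm (act_mem hg hZ) (on_act hg hZ h)
  rwa [g.symm_apply_apply] at this

lemma act_act_symm {g : Vec q p ≃ₗ[ℂ] Vec q p} (hg : IsU g) {Z : Matrix (Fin q) (Fin p) ℂ}
    (hZ : Z ∈ typeIDomain q p) : act g (act g.symm Z) = Z := by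
  have := act_symm_act hg.symm hZ
  rwa [LinearEquiv.symm_symm] at this

lemma on_act_iff {g : Vec q p ≃ₗ[ℂ] Vec q p} (hg : IsU g) {Z : Matrix (Fin q) (Fin p) ℂ}
    (hZ : Z ∈ typeIDomain q p) {x : Vec q p} : On (g x) (act g Z) ↔ On x Z :=
  ⟨fun h => by simpa using on_act' hg hZ h, on_act hg hZ⟩

lemma diff_mat {E : Type*} [NormedAddCommGroup E] [NormedSpace ℂ E] {m n : ℕ} {s : Set E}
    {F : E → Matrix (Fin m) (Fin n) ℂ} (h : ∀ i j, DifferentiableOn ℂ (fun x => F x i j) s) :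
    DifferentiableOn ℂ F s :=
  differentiableOn_pi.2 fun i => differentiableOn_pi.2 fun j => h i j

lemma diff_entry {E : Type*} [NormedAddCommGroup E] [NormedSpace ℂ E] {m n : ℕ} {s : Set E}
    {F : E → Matrix (Fin m) (Fin n) ℂ} (h : DifferentiableOn ℂ F s) (i : Fin m) (j : Fin n) :
    DifferentiableOn ℂ (fun x => F x i j) s :=
  differentiableOn_pi.1 (differentiableOn_pi.1 h i) j

lemma diff_gent (g : Vec q p ≃ₗ[ℂ] Vec q p) (i : Fin q) (s : Fin q ⊕ Fin p) :
    Differentiable ℂ fun Z : Matrix (Fin q) (Fin p) ℂ => g (gv (Pi.single i 1) Z) s := by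
  have h : ∀ Z : Matrix (Fin q) (Fin p) ℂ, g (gv (Pi.single i 1) Z) s
      = g (gv (Pi.single i 1) 0) s + ∑ j, Z i j * g (eb (Sum.inr j)) s := by
    intro Z
    have : gv (Pi.single i 1) Z = gv (Pi.single i 1) 0 + ∑ j, Z i j • eb (Sum.inr j) := by
      ext t; cases t with
      | inl k => simp [eb, Finset.sum_apply]
      | inr k => simp [eb, Finset.sum_apply, Pi.single_apply]
    rw [this, map_add, map_sum]
    simp only [Pi.add_apply, Finset.sum_apply, map_smul, Pi.smul_apply, smul_eq_mul]
  rw [funext h]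
  have : ∀ i j, Differentiable ℂ fun Z : Matrix (Fin q) (Fin p) ℂ => Z i j := fun i j =>
    differentiable_pi.1 (differentiable_pi.1 differentiable_id i) j
  refine (differentiable_const _).add ?_
  exact Differentiable.fun_sum fun j _ => (this i j).mul_const _

lemma diff_prod {E ι : Type*} [NormedAddCommGroup E] [NormedSpace ℂ E] {s : Set E} (t : Finset ι)
    {F : ι → E → ℂ} (h : ∀ i, DifferentiableOn ℂ (F i) s) :
    DifferentiableOn ℂ (fun x => ∏ i ∈ t, F i x) s := by
  classical
  induction t using Finset.induction_on with
  | empty => simp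
  | insert a t ha ih => simp_rw [Finset.prod_insert ha]; exact (h a).mul ih

lemma diff_det {E : Type*} [NormedAddCommGroup E] [NormedSpace ℂ E] {n : ℕ} {s : Set E}
    {F : E → Matrix (Fin n) (Fin n) ℂ} (h : ∀ i j, DifferentiableOn ℂ (fun x => F x i j) s) :
    DifferentiableOn ℂ (fun x => (F x).det) s := by
  simp_rw [Matrix.det_apply']
  refine DifferentiableOn.fun_sum fun σ _ => ?_
  refine (differentiableOn_const _).mul ?_
  exact diff_prod _ fun i => h _ _

lemma diff_adj {E : Type*} [NormedAddCommGroup E] [NormedSpace ℂ E] {n : ℕ} {s : Set E}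
    {F : E → Matrix (Fin n) (Fin n) ℂ} (h : ∀ i j, DifferentiableOn ℂ (fun x => F x i j) s) (i j) :
    DifferentiableOn ℂ (fun x => (F x).adjugate i j) s := by
  simp_rw [Matrix.adjugate_apply]
  refine diff_det fun k l => ?_
  by_cases hk : k = j
  · subst hk; simp
  · simpa [Matrix.updateRow_apply, hk] using h k l

lemma diff_act {g : Vec q p ≃ₗ[ℂ] Vec q p} (hg : IsU g) :
    DifferentiableOn ℂ (act g) (typeIDomain q p) := by
  refine diff_mat fun i j => ?_
  have h : ∀ Z, act g Z i j = (M1 g Z).det⁻¹ * ∑ k, (M1 g Z).adjugate i k * M2 g Z k j := by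
    intro Z
    rw [act, Matrix.inv_def, Ring.inverse_eq_inv', Matrix.smul_mul, Matrix.smul_apply, Matrix.mul_apply, smul_eq_mul]
  simp_rw [h]
  have h1 : ∀ i j, DifferentiableOn ℂ (fun Z => M1 g Z i j) (typeIDomain q p) :=
    fun i j => (diff_gent g i (Sum.inl j)).differentiableOn
  have h2 : ∀ i j, DifferentiableOn ℂ (fun Z => M2 g Z i j) (typeIDomain q p) :=
    fun i j => (diff_gent g i (Sum.inr j)).differentiableOn
  refine DifferentiableOn.mul ((diff_det h1).inv fun Z hZ => (M1_unit hg hZ).ne_zero) ?_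
  exact DifferentiableOn.fun_sum fun k _ => (diff_adj h1 i k).mul (h2 k j)

lemma isAut_act {g : Vec q p ≃ₗ[ℂ] Vec q p} (hg : IsU g) : IsAutOf (act g) :=
  ⟨fun _ => act_mem hg, diff_act hg, act g.symm, fun _ => act_mem hg.symm, diff_act hg.symm,
    fun _ => act_symm_act hg, fun _ => act_act_symm hg⟩

end grp

/-- proper holomorphic maps -/
def PH {q p q' p' : ℕ} (f : Matrix (Fin q) (Fin p) ℂ → Matrix (Fin q') (Fin p') ℂ) : Prop :=
  DifferentiableOn ℂ f (typeIDomain q p) ∧ ProperOn f (typeIDomain q p) (typeIDomain q' p')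

lemma PH.comp_act {q p q' p' : ℕ} {f : Matrix (Fin q) (Fin p) ℂ → Matrix (Fin q') (Fin p') ℂ}
    (hf : PH f) {g : Vec q p ≃ₗ[ℂ] Vec q p} (hg : IsU g) : PH (f ∘ act g) := by
  refine ⟨hf.1.comp (diff_act hg) (fun _ => act_mem hg), fun Z hZ => hf.2.1 (act_mem hg hZ), fun K hK hKc => ?_⟩
  have h1 := hf.2.2 K hK hKc
  have h2 : typeIDomain q p ∩ (f ∘ act g) ⁻¹' K = act g.symm '' (typeIDomain q p ∩ f ⁻¹' K) := by
    ext Z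
    constructor
    · rintro ⟨hZ, hZK⟩
      exact ⟨act g Z, ⟨act_mem hg hZ, hZK⟩, act_symm_act hg hZ⟩
    · rintro ⟨W, ⟨hW, hWK⟩, rfl⟩
      refine ⟨act_mem hg.symm hW, ?_⟩
      show f (act g (act g.symm W)) ∈ K
      rwa [act_act_symm hg hW]
  rw [h2]
  exact h1.image_of_continuousOn ((diff_act hg.symm).continuousOn.mono Set.inter_subset_left)

end

section

/-! ### Part 3: one-variable complex analysis and boundary behaviour -/

open Filter Topology Metric

lemma ident {E F : Type*} [NormedAddCommGroup E] [NormedSpace ℂ E] [NormedAddCommGroup F]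
    [NormedSpace ℂ F] [CompleteSpace F] {S : Set E} (hS : IsOpen S) (hc : Convex ℝ S)
    (W : Submodule ℂ E) {h : E → F} (hh : DifferentiableOn ℂ h S) {z0 : E} (h0 : z0 ∈ S)
    (hz : ∀ᶠ z in 𝓝 z0, z - z0 ∈ W → h z = 0) {z : E} (hzS : z ∈ S) (hzW : z - z0 ∈ W) : h z = 0 := by
  let l : ℂ → E := fun t => z0 + t • (z - z0)
  have hl : Differentiable ℂ l := by unfold l; fun_prop
  let U := l ⁻¹' S
  have hU : IsOpen U := hS.preimage hl.continuous
  have hUc : Convex ℝ U := by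
    intro s hs t ht a b ha hb hab
    have : l (a • s + b • t) = a • l s + b • l t := by
      simp only [l, smul_add, add_smul, smul_assoc]
      have : z0 = a • z0 + b • z0 := by rw [← add_smul, hab, one_smul]
      nth_rewrite 1 [this]; abel
    show l _ ∈ S
    rw [this]; exact hc hs ht ha hb hab
  have hd : DifferentiableOn ℂ (h ∘ l) U := hh.comp hl.differentiableOn fun t ht => ht
  have ha : AnalyticOnNhd ℂ (h ∘ l) U := hd.analyticOnNhd hU
  have hl0 : l 0 = z0 := by simp [l]
  have hl1 : l 1 = z := by simp [l]
  have h00 : (0 : ℂ) ∈ U := by show l 0 ∈ S; rwa [hl0]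
  have hev : h ∘ l =ᶠ[𝓝 0] 0 := by
    have : Tendsto l (𝓝 0) (𝓝 z0) := by rw [← hl0]; exact hl.continuous.continuousAt
    filter_upwards [this.eventually hz] with t ht
    apply ht
    simp only [l, add_sub_cancel_left]
    exact W.smul_mem t hzW
  have := ha.eqOn_zero_of_preconnected_of_eventuallyEq_zero hUc.isPreconnected h00 hev
    (show (1 : ℂ) ∈ U by show l 1 ∈ S; rwa [hl1])
  simpa [hl1] using this

lemma ident' {E F : Type*} [NormedAddCommGroup E] [NormedSpace ℂ E] [NormedAddCommGroup F]
    [NormedSpace ℂ F] [CompleteSpace F] {S : Set E} (hS : IsOpen S) (hc : Convex ℝ S)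
    {h : E → F} (hh : DifferentiableOn ℂ h S) {z0 : E} (h0 : z0 ∈ S)
    (hz : ∀ᶠ z in 𝓝 z0, h z = 0) {z : E} (hzS : z ∈ S) : h z = 0 :=
  ident hS hc ⊤ hh h0 (hz.mono fun _ h _ => h) hzS trivial

lemma det_lemma {K T : Type*} [Field K] {m : ℕ} (w : T → Fin m → K)
    (h : ∀ τ : Fin m → T, (of fun i => w (τ i)).det = 0) : ∃ c : Fin m → K, c ≠ 0 ∧ ∀ t, c ⬝ᵥ w t = 0 := by
  classical
  by_cases hs : Submodule.span K (Set.range w) = ⊤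
  · exfalso
    obtain ⟨v, hv, -, hi⟩ := Submodule.exists_fun_fin_finrank_span_eq K (Set.range w)
    have hn : Module.finrank K (Submodule.span K (Set.range w)) = m := by
      rw [hs, finrank_top]; simp
    choose τ hτ using hv
    have hi' := hi.comp _ (finCongr hn.symm).injective
    have h1 := h (τ ∘ finCongr hn.symm)
    have h2 : (of fun i => w ((τ ∘ finCongr hn.symm) i)).row = v ∘ finCongr hn.symm := by
      ext i j; simp [hτ]
    rw [← h2, Matrix.linearIndependent_rows_iff_isUnit, Matrix.isUnit_iff_isUnit_det, h1] at hi'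
    exact not_isUnit_zero hi'
  · obtain ⟨φ, hφ, hφ'⟩ := Submodule.exists_dual_map_eq_bot_of_lt_top (lt_top_iff_ne_top.2 hs) inferInstance
    have hφe : ∀ x, φ x = (fun i => φ (Pi.single i 1)) ⬝ᵥ x := by
      intro x
      conv_lhs => rw [← Finset.univ_sum_single x, map_sum]
      refine Finset.sum_congr rfl fun i _ => ?_
      have : (Pi.single i (x i) : Fin m → K) = x i • Pi.single i 1 := by
        rw [← Pi.single_smul]; simp
      rw [this, map_smul, smul_eq_mul, mul_comm]
    refine ⟨fun i => φ (Pi.single i 1), ?_, fun t => ?_⟩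
    · intro h0
      apply hφ
      refine LinearMap.ext fun x => ?_
      rw [hφe, h0]; simp
    · rw [← hφe]
      have : φ (w t) ∈ (Submodule.span K (Set.range w)).map φ :=
        Submodule.mem_map_of_mem (Submodule.subset_span ⟨t, rfl⟩)
      rwa [hφ', Submodule.mem_bot] at this

lemma bc_lemma {g : ℂ → ℂ} {R : ℝ} (hg : DifferentiableOn ℂ g (ball 0 R))
    (hre : ∀ z ∈ ball (0 : ℂ) R, (g z).re ≤ 0) {z : ℂ} (hz : ‖z‖ < R) :
    ‖g z‖ ≤ ‖g 0‖ * (R + ‖z‖) / (R - ‖z‖) := by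
  have hR : 0 < R := lt_of_le_of_lt (norm_nonneg z) hz
  have h1 : ∀ M > 0, ‖g z‖ ≤ 2 * M * ‖z‖ / (R - ‖z‖) + ‖g 0‖ * (R + ‖z‖) / (R - ‖z‖) := fun M hM =>
    Complex.borelCaratheodory hM hg (fun w hw => (hre w hw).trans hM.le) hR (by simpa using hz)
  have h2 : Tendsto (fun M : ℝ => 2 * M * ‖z‖ / (R - ‖z‖) + ‖g 0‖ * (R + ‖z‖) / (R - ‖z‖)) (𝓝[>] 0)
      (𝓝 (2 * 0 * ‖z‖ / (R - ‖z‖) + ‖g 0‖ * (R + ‖z‖) / (R - ‖z‖))) := by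
    apply Tendsto.mono_left _ nhdsWithin_le_nhds
    apply Continuous.tendsto; fun_prop
  have := ge_of_tendsto h2 (eventually_nhdsWithin_of_forall h1)
  simpa using this

/-- ultrafilters approaching the unit circle from inside -/
def Bdry (u : Ultrafilter ℂ) : Prop := (∀ᶠ t in (u : Filter ℂ), ‖t‖ < 1) ∧ Tendsto (fun t : ℂ => ‖t‖) u (𝓝 1)

lemma maxp {h : ℂ → ℂ} (hd : DifferentiableOn ℂ h (ball 0 1))
    (hb : ∀ u : Ultrafilter ℂ, Bdry u → Tendsto h u (𝓝 0)) {t : ℂ} (ht : ‖t‖ < 1) : h t = 0 := by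
  have h1 : Tendsto h (comap (fun t : ℂ => ‖t‖) (𝓝 1) ⊓ 𝓟 (ball 0 1)) (𝓝 0) := by
    rw [tendsto_iff_ultrafilter]
    intro u hu
    rw [le_inf_iff] at hu
    exact hb u ⟨by
      have := hu.2
      rw [le_principal_iff] at this
      filter_upwards [this] with t ht
      simpa using ht, tendsto_iff_comap.2 hu.1⟩
  rw [← norm_le_zero_iff]
  refine le_of_forall_pos_le_add fun ε hε => ?_
  rw [zero_add]
  have h2 : ∀ᶠ s in comap (fun t : ℂ => ‖t‖) (𝓝 1) ⊓ 𝓟 (ball 0 1), ‖h s‖ < ε := by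
    have := h1.eventually (ball_mem_nhds 0 hε)
    simpa using this
  rw [eventually_inf_principal, eventually_comap] at h2
  obtain ⟨δ, hδ, h3⟩ := Metric.eventually_nhds_iff.1 h2
  obtain ⟨ρ, hρ1, hρ2⟩ := exists_between (show max ‖t‖ (max (1 - δ) 0) < 1 by
    simp [ht, hδ])
  have hρ0 : 0 < ρ := lt_of_le_of_lt (by simp) hρ1
  refine Complex.norm_le_of_forall_mem_frontier_norm_le (U := ball (0 : ℂ) ρ) isBounded_ball ?_ ?_ ?_
  · apply DifferentiableOn.diffContOnCl
    rw [closure_ball _ hρ0.ne']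
    exact hd.mono (closedBall_subset_ball hρ2)
  · rw [frontier_ball _ hρ0.ne']
    intro z hz
    have hz : ‖z‖ = ρ := by simpa using hz
    refine (h3 (y := ρ) ?_ z hz (by simpa [hz] using hρ2)).le
    rw [Real.dist_eq, abs_lt]
    have : 1 - δ < ρ := lt_of_le_of_lt (by simp) hρ1
    constructor <;> linarith
  · rw [closure_ball _ hρ0.ne']
    have : ‖t‖ < ρ := lt_of_le_of_lt (by simp) hρ1
    simpa using this.le

lemma eq_of_dot {ι : Type*} [Fintype ι] {x y : ι → ℂ} (hx : nsq x ≤ 1) (hy : nsq y = 1) (h : x ⬝ᵥ star y = 1) :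
    x = y := by
  have h1 : ((nsq (x - y) : ℝ) : ℂ) = nsq x + nsq y - 2 := by
    have h2 : y ⬝ᵥ star x = 1 := by
      have : star (x ⬝ᵥ star y) = y ⬝ᵥ star x := by
        simp [dotProduct, mul_comm]
      rw [← this, h, star_one]
    rw [← dot_star_self, star_sub, dotProduct_sub, sub_dotProduct, sub_dotProduct, h, h2, dot_star_self,
      dot_star_self]
    ring
  have h2 : nsq (x - y) = nsq x + nsq y - 2 := by exact_mod_cast h1
  have h3 := nsq_nonneg (x - y)
  exact sub_eq_zero.1 (nsq_eq_zero.1 (by linarith))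

section bd
variable {q p q' p' : ℕ}

/-- the standard flag slice -/
def FlagS (i0 : Fin q) (j0 : Fin p) : Set (Matrix (Fin q) (Fin p) ℂ) :=
  {Z | Z ∈ typeIDomain q p ∧ (∀ j, Z i0 j = 0) ∧ ∀ i, Z i j0 = 0}

lemma zero_mem_flag (i0 : Fin q) (j0 : Fin p) : 0 ∈ FlagS i0 j0 := ⟨zero_mem_dom, by simp, by simp⟩

lemma nsq_update {n : ℕ} (v : Fin n → ℂ) (i : Fin n) : nsq v = nsq (Function.update v i 0) + ‖v i‖ ^ 2 := by
  unfold nsq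
  rw [← Finset.add_sum_erase _ _ (Finset.mem_univ i), ← Finset.add_sum_erase Finset.univ (fun j => ‖Function.update v i 0 j‖ ^ 2) (Finset.mem_univ i)]
  have : ∑ x ∈ Finset.univ.erase i, ‖Function.update v i 0 x‖ ^ 2 = ∑ x ∈ Finset.univ.erase i, ‖v x‖ ^ 2 :=
    Finset.sum_congr rfl fun j hj => by rw [Function.update_of_ne (Finset.ne_of_mem_erase hj)]
  rw [this]; simp [add_comm]

lemma line_mem {i0 : Fin q} {j0 : Fin p} {Z : Matrix (Fin q) (Fin p) ℂ} (hZ : Z ∈ FlagS i0 j0) {t : ℂ}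
    (ht : ‖t‖ < 1) : Z + t • Matrix.single i0 j0 1 ∈ typeIDomain q p := by
  rw [mem_dom_iff]
  intro A hA
  set A' := Function.update A i0 0 with hA'
  have h1 : A' ᵥ* Z = A ᵥ* Z := by
    ext j
    simp only [vecMul, dotProduct]
    refine Finset.sum_congr rfl fun i _ => ?_
    by_cases hi : i = i0
    · subst hi; simp [hZ.2.1]
    · simp [A', hi]
  have h2 : nsq (A ᵥ* (Z + t • Matrix.single i0 j0 1)) = nsq (A' ᵥ* Z) + ‖t‖ ^ 2 * ‖A i0‖ ^ 2 := by
    rw [nsq_update _ j0, h1]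
    have e1 : (A ᵥ* (Z + t • Matrix.single i0 j0 1)) j0 = t * A i0 := by
      simp [vecMul, dotProduct, hZ.2.2, Matrix.single_apply, mul_comm]
    have e2 : Function.update (A ᵥ* (Z + t • Matrix.single i0 j0 1)) j0 0 = A ᵥ* Z := by
      ext j
      by_cases hj : j = j0
      · subst hj; simp [vecMul, dotProduct, hZ.2.2]
      · simp [hj, vecMul, dotProduct, Matrix.single_apply, Ne.symm hj]
    rw [e1, e2, norm_mul, mul_pow]
  rw [h2, nsq_update A i0]
  have ht2 : ‖t‖ ^ 2 < 1 := by nlinarith [norm_nonneg t]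
  by_cases h0 : A' = 0
  · rw [← hA', h0, zero_vecMul, nsq_zero, zero_add]
    have : A i0 ≠ 0 := by
      intro h
      apply hA
      rw [← Function.update_eq_self i0 A, h, ← hA', h0]
    have : 0 < ‖A i0‖ ^ 2 := by positivity
    simp only [nsq_zero]
    nlinarith
  · have := mem_dom_iff.1 hZ.1 A' h0
    nlinarith [sq_nonneg ‖A i0‖]

lemma flag_scale {i0 : Fin q} {j0 : Fin p} {Z : Matrix (Fin q) (Fin p) ℂ} (hZ : Z ∈ FlagS i0 j0) :
    ∃ R > 1, ∀ c : ℂ, ‖c‖ < R → c • Z ∈ FlagS i0 j0 := by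
  have h1 : ∀ᶠ r : ℝ in 𝓝 1, (r : ℂ) • Z ∈ typeIDomain q p := by
    have : ContinuousAt (fun r : ℝ => (r : ℂ) • Z) 1 := by fun_prop
    apply this.eventually
    simp only [Complex.ofReal_one, one_smul]
    exact isOpen_dom.mem_nhds hZ.1
  obtain ⟨R, hR1, hR⟩ : ∃ R : ℝ, R ∈ Set.Ioi (1 : ℝ) ∧ (R : ℂ) • Z ∈ typeIDomain q p :=
    (eventually_mem_nhdsWithin.and (h1.filter_mono nhdsWithin_le_nhds)).exists
  have hR1 : 1 < R := hR1
  refine ⟨R, hR1, fun c hc => ⟨?_, fun j => by simp [hZ.2.1], fun i => by simp [hZ.2.2]⟩⟩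
  have hR0 : (R : ℂ) ≠ 0 := by exact_mod_cast (by linarith : R ≠ 0)
  have : c • Z = (c / R) • ((R : ℂ) • Z) := by rw [smul_smul, div_mul_cancel₀ _ hR0]
  rw [this]
  refine smul_mem_dom hR ?_
  rw [norm_div, Complex.norm_real, Real.norm_of_nonneg (by linarith), div_le_one (by linarith)]
  exact hc.le

lemma dom_sub_K : typeIDomain q p ⊆ Kset q p 1 := fun Z hZ A => by
  rw [one_mul]; exact dom_le hZ A

lemma diff_form {E : Type*} [NormedAddCommGroup E] [NormedSpace ℂ E] {s : Set E}
    {F : E → Matrix (Fin q) (Fin p) ℂ} (h : DifferentiableOn ℂ F s) (C : Fin q → ℂ) (v : Fin p → ℂ) :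
    DifferentiableOn ℂ (fun x => (C ᵥ* F x) ⬝ᵥ v) s := by
  simp only [vecMul, dotProduct]
  refine DifferentiableOn.fun_sum fun j _ => ?_
  refine DifferentiableOn.mul_const ?_ _
  exact DifferentiableOn.fun_sum fun i _ => (diff_entry h i j).const_mul _

lemma re_form_le {Z : Matrix (Fin q) (Fin p) ℂ} (hZ : Z ∈ typeIDomain q p) {C : Fin q → ℂ} {v : Fin p → ℂ}
    (hC : nsq C = 1) (hv : nsq v = 1) : ‖(C ᵥ* Z) ⬝ᵥ v‖ ≤ 1 := by
  have h1 := dot_cs (C ᵥ* Z) v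
  have h2 := dom_le hZ C
  rw [hv, mul_one] at h1
  rw [hC] at h2
  nlinarith [norm_nonneg ((C ᵥ* Z) ⬝ᵥ v)]

lemma boundary {f : Matrix (Fin q) (Fin p) ℂ → Matrix (Fin q') (Fin p') ℂ} (hf : PH f) (i0 : Fin q) (j0 : Fin p)
    (u : Ultrafilter ℂ) (hu : Bdry u) :
    ∃ (ts : ℂ) (F : Matrix (Fin q) (Fin p) ℂ → Matrix (Fin q') (Fin p') ℂ) (C : Fin q' → ℂ) (D : Fin p' → ℂ),
      ‖ts‖ = 1 ∧ Tendsto id (u : Filter ℂ) (𝓝 ts) ∧ nsq C = 1 ∧ nsq D = 1 ∧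
      ∀ Z ∈ FlagS i0 j0, Tendsto (fun t : ℂ => f (Z + t • Matrix.single i0 j0 1)) (u : Filter ℂ) (𝓝 (F Z)) ∧
        C ᵥ* F Z = D ∧ F Z *ᵥ star D = star C ∧ F Z ∈ Kset q' p' 1 := by
  obtain ⟨ts, -, hts⟩ := (isCompact_closedBall (0 : ℂ) 1).ultrafilter_le_nhds u (by
    rw [le_principal_iff]; filter_upwards [hu.1] with t ht; simpa using ht.le)
  have hn : ‖ts‖ = 1 := tendsto_nhds_unique ((continuous_norm.tendsto ts).mono_left hts) hu.2
  have hF : ∀ Z, ∃ W, Z ∈ FlagS i0 j0 → W ∈ Kset q' p' 1 ∧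
      Tendsto (fun t : ℂ => f (Z + t • Matrix.single i0 j0 1)) (u : Filter ℂ) (𝓝 W) := by
    intro Z
    by_cases hZ : Z ∈ FlagS i0 j0
    · obtain ⟨W, hW, hW'⟩ := (isCompact_Kset (q := q') (p := p') 1).ultrafilter_le_nhds
        (u.map (fun t => f (Z + t • Matrix.single i0 j0 1))) (by
          rw [le_principal_iff]
          show ∀ᶠ t in (u : Filter ℂ), _
          filter_upwards [hu.1] with t ht
          exact dom_sub_K (hf.2.1 (line_mem hZ ht)))
      exact ⟨W, fun _ => ⟨hW, hW'⟩⟩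
    · exact ⟨0, fun h => absurd h hZ⟩
  choose F hF using hF
  have h0 := hF 0 (zero_mem_flag i0 j0)
  -- the limit at `0` is not in the domain
  have hnot : F 0 ∉ typeIDomain q' p' := by
    intro hin
    have : LocallyCompactSpace (Matrix (Fin q') (Fin p') ℂ) :=
      inferInstanceAs (LocallyCompactSpace (Fin q' → Fin p' → ℂ))
    obtain ⟨K, hK, hKs, hKc⟩ := local_compact_nhds (isOpen_dom.mem_nhds hin)
    obtain ⟨r, hr, hrK⟩ := compact_sub_Kset (hf.2.2 K hKs hKc) Set.inter_subset_left
    have h1 : ∀ᶠ t in (u : Filter ℂ), ‖t‖ ^ 2 ≤ r := by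
      filter_upwards [hu.1, h0.2.eventually hK] with t ht htK
      have := entry_le (hrK ⟨line_mem (zero_mem_flag i0 j0) ht, htK⟩) i0 j0
      simpa using this
    have h2 := le_of_tendsto (hu.2.pow 2) h1
    linarith
  obtain ⟨C, hC, hCF⟩ : ∃ C, nsq C = 1 ∧ nsq (C ᵥ* F 0) = 1 := by
    by_contra hcon
    push Not at hcon
    apply hnot
    rw [mem_dom_iff_unit]
    intro A hA
    have := h0.1 A
    have hA : nsq A = 1 := hA
    rw [hA, mul_one] at this
    exact lt_of_le_of_ne this (hcon A hA)
  refine ⟨ts, F, C, C ᵥ* F 0, hn, hts, hC, hCF, fun Z hZ => ?_⟩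
  set D := C ᵥ* F 0 with hD
  obtain ⟨hZK, hZt⟩ := hF Z hZ
  have hsD : nsq (star D) = 1 := by rw [nsq_star, hCF]
  obtain ⟨R, hR1, hR⟩ := flag_scale hZ
  have key : ∀ᶠ t in (u : Filter ℂ), ‖(C ᵥ* f (Z + t • Matrix.single i0 j0 1)) ⬝ᵥ star D - 1‖ ≤
      ‖(C ᵥ* f (0 + t • Matrix.single i0 j0 1)) ⬝ᵥ star D - 1‖ * (R + 1) / (R - 1) := by
    filter_upwards [hu.1] with t ht
    have hl : Differentiable ℂ fun c : ℂ => c • Z + t • Matrix.single i0 j0 (1 : ℂ) := by fun_prop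
    have hm : Set.MapsTo (fun c : ℂ => c • Z + t • Matrix.single i0 j0 (1 : ℂ)) (ball 0 R) (typeIDomain q p) :=
      fun c hc => line_mem (hR c (by simpa using hc)) ht
    have := bc_lemma (g := fun c : ℂ => (C ᵥ* f (c • Z + t • Matrix.single i0 j0 1)) ⬝ᵥ star D - 1) (R := R)
      ((diff_form (hf.1.comp hl.differentiableOn hm) C (star D)).sub_const 1) (fun c hc => ?_) (z := 1)
      (by simpa using hR1)
    · simpa using this
    · have := re_form_le (hf.2.1 (hm hc)) hC hsD
      have := (Complex.re_le_norm _).trans this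
      simpa using this
  have ct : Continuous fun W : Matrix (Fin q') (Fin p') ℂ => ‖(C ᵥ* W) ⬝ᵥ star D - 1‖ := by fun_prop
  have hlim := le_of_tendsto_of_tendsto ((ct.tendsto _).comp hZt)
    ((((ct.tendsto _).comp h0.2).mul_const (R + 1)).div_const (R - 1)) key
  have e0 : (C ᵥ* F 0) ⬝ᵥ star D - 1 = 0 := by rw [← hD, dot_star_self, hCF]; simp
  rw [e0, norm_zero, zero_mul, zero_div, norm_le_zero_iff, sub_eq_zero] at hlim
  refine ⟨hZt, ?_, ?_, hZK⟩
  · refine eq_of_dot ?_ hCF hlim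
    have := hZK C
    rwa [hC, mul_one] at this
  · refine eq_of_dot ?_ (by rw [nsq_star, hC]) ?_
    · -- column contraction in the limit
      have ct2 : Continuous fun W : Matrix (Fin q') (Fin p') ℂ => nsq (W *ᵥ star D) :=
        continuous_nsq.comp (by fun_prop)
      refine le_of_tendsto ((ct2.tendsto _).comp hZt) ?_
      filter_upwards [hu.1] with t ht
      have := dom_le_col (hf.2.1 (line_mem hZ ht)) (star D)
      rwa [hsD] at this
    · rw [star_star, dotProduct_comm, dotProduct_mulVec, hlim]

/-- Hopf type estimate -/
lemma hopf {f : Matrix (Fin q) (Fin p) ℂ → Matrix (Fin q') (Fin p') ℂ} (hf : PH f) (i0 : Fin q) (j0 : Fin p) :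
    ∃ c > 0, ∀ t : ℂ, ‖t‖ < 1 → ∀ A, nsq (A ᵥ* f (t • Matrix.single i0 j0 1)) ≤ (1 - c * (1 - ‖t‖)) * nsq A := by
  obtain ⟨r, hr, hrK⟩ := compact_sub_Kset (isCompact_singleton (x := f 0)) (by
    simpa using hf.2.1 zero_mem_dom)
  have hK := hrK rfl
  set r' := max r 0 with hr'
  have hr'1 : √r' < 1 := by
    rw [Real.sqrt_lt' one_pos]; simp [hr', hr]
  set c := (1 - √r') / 2
  have hline : ∀ t ∈ ball (0 : ℂ) 1, t • Matrix.single i0 j0 (1 : ℂ) ∈ typeIDomain q p := by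
    intro t ht
    have := line_mem (zero_mem_flag i0 j0) (t := t) (by simpa using ht)
    simpa using this
  refine ⟨c, by simp only [c]; linarith, fun t ht A => ?_⟩
  have htb : t ∈ ball (0 : ℂ) 1 := by simpa using ht
  -- reduce to unit vectors
  suffices hs : ∀ C, nsq C = 1 → nsq (C ᵥ* f (t • Matrix.single i0 j0 1)) ≤ 1 - c * (1 - ‖t‖) by
    by_cases hA : A = 0
    · simp [hA, nsq_zero]
    obtain ⟨k, hk, h1⟩ := exists_unit hA
    have h2 := hs _ h1
    rw [smul_vecMul, nsq_smul] at h2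
    rw [nsq_smul] at h1
    have h3 : 0 < ‖k‖ ^ 2 := by positivity
    refine le_of_mul_le_mul_left (a := ‖k‖ ^ 2) ?_ h3
    calc _ ≤ _ := h2
      _ = _ := by rw [mul_left_comm, h1, mul_one]
  intro C hC
  set v := C ᵥ* f (t • Matrix.single i0 j0 1) with hv
  have hv1 : nsq v ≤ 1 := by
    have := dom_le (hf.2.1 (hline t htb)) C
    rwa [hC] at this
  have hc1 : c ≤ 1 / 2 := by
    simp only [c]; linarith [Real.sqrt_nonneg r']
  have hc0 : 0 < c := by simp only [c]; linarith
  by_cases hv0 : v = 0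
  · rw [hv0, nsq_zero]; nlinarith [norm_nonneg t]
  set N := √(nsq v) with hN
  have hN0 : 0 < N := Real.sqrt_pos.2 (nsq_pos hv0)
  have hN1 : N ≤ 1 := Real.sqrt_le_one.2 hv1
  have hNN : N ^ 2 = nsq v := Real.sq_sqrt (nsq_nonneg v)
  set D : Fin p' → ℂ := ((N⁻¹ : ℝ) : ℂ) • star v with hD
  have hD1 : nsq D = 1 := by
    rw [hD, nsq_smul, nsq_star, Complex.norm_real, norm_inv, Real.norm_of_nonneg hN0.le, inv_pow, hNN,
      inv_mul_cancel₀ (nsq_pos hv0).ne']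
  let ψ : ℂ → ℂ := fun s => (C ᵥ* f (s • Matrix.single i0 j0 1)) ⬝ᵥ D
  have hψd : DifferentiableOn ℂ ψ (ball 0 1) := by
    refine diff_form (hf.1.comp (f := fun s : ℂ => s • Matrix.single i0 j0 (1 : ℂ)) ?_ hline) C D
    exact (Differentiable.differentiableOn (by fun_prop))
  have hψt : ψ t = N := by
    show v ⬝ᵥ D = N
    rw [hD, dotProduct_smul, dot_star_self, ← hNN, smul_eq_mul, ← Complex.ofReal_mul]
    congr 1; field_simp
  have hψlt : ∀ s ∈ ball (0 : ℂ) 1, ‖ψ s‖ < 1 := by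
    intro s hs
    have h1 := dot_cs (C ᵥ* f (s • Matrix.single i0 j0 1)) D
    have h2 := mem_dom_iff_unit.1 (hf.2.1 (hline s hs)) C hC
    rw [hD1, mul_one] at h1
    have : ‖ψ s‖ ^ 2 < 1 := lt_of_le_of_lt h1 h2
    nlinarith [norm_nonneg (ψ s)]
  have hψ0 : ‖ψ 0‖ ≤ √r' := by
    apply Real.le_sqrt_of_sq_le
    have h1 := dot_cs (C ᵥ* f ((0 : ℂ) • Matrix.single i0 j0 1)) D
    have h2 := hK C
    rw [hD1, mul_one] at h1
    rw [hC, mul_one] at h2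
    rw [zero_smul] at h1
    have h3 : ψ 0 = C ᵥ* f 0 ⬝ᵥ D := by simp only [ψ, zero_smul]
    rw [h3]
    exact (h1.trans h2).trans (le_max_left _ _)
  have hre : ∀ s ∈ ball (0 : ℂ) 1, 0 < (1 - ψ s).re := by
    intro s hs
    have := (Complex.re_le_norm (ψ s)).trans_lt (hψlt s hs)
    simpa using this
  have hne : ∀ s ∈ ball (0 : ℂ) 1, 1 - ψ s ≠ 0 := fun s hs h => by
    have := hre s hs
    rw [h] at this; simp at this
  have h5 := bc_lemma (g := fun s => - (1 - ψ s)⁻¹) (R := 1)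
    (((hψd.const_sub 1).inv hne).neg) (fun s hs => by
      rw [Complex.neg_re, Complex.inv_re, neg_nonpos]
      exact div_nonneg (hre s hs).le (Complex.normSq_nonneg _)) ht
  simp only [norm_neg, norm_inv] at h5
  have h6 : ‖1 - ψ t‖ = 1 - N := by
    rw [hψt, ← Complex.ofReal_one, ← Complex.ofReal_sub, Complex.norm_real, Real.norm_of_nonneg (by linarith)]
  have h7 : 2 * c ≤ ‖1 - ψ 0‖ := by
    have := norm_sub_norm_le (1 : ℂ) (ψ 0)
    rw [norm_one] at this
    simp only [c]; linarith
  have h8 : 0 < 1 - N := by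
    rw [← h6]; exact norm_pos_iff.2 (hne t htb)
  have h9 : 0 < 1 - ‖t‖ := by linarith
  have h10 : 0 < ‖1 - ψ 0‖ := by linarith
  rw [h6, inv_mul_eq_div, div_div, inv_eq_one_div, div_le_div_iff₀ h8 (by positivity)] at h5
  have h11 : c * (1 - ‖t‖) ≤ 1 - N := by nlinarith [norm_nonneg t]
  nlinarith

end bd

end

section

/-! ### Part 4: constant functionals on flags and on fibres -/

open Filter Topology Metric

section stepA
variable {q p q' p' : ℕ}

/-- functionals which are constant on a set -/
def Cst (f : Matrix (Fin q) (Fin p) ℂ → Matrix (Fin q') (Fin p') ℂ) (S : Set (Matrix (Fin q) (Fin p) ℂ)) :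
    Submodule ℂ (Fin q' → ℂ) where
  carrier := {C | ∀ Z ∈ S, ∀ Z' ∈ S, C ᵥ* f Z = C ᵥ* f Z'}
  add_mem' := fun {a b} ha hb Z hZ Z' hZ' => by rw [add_vecMul, add_vecMul, ha Z hZ Z' hZ', hb Z hZ Z' hZ']
  zero_mem' := fun Z _ Z' _ => by rw [zero_vecMul, zero_vecMul]
  smul_mem' := fun c {a} ha Z hZ Z' hZ' => by rw [smul_vecMul, smul_vecMul, ha Z hZ Z' hZ']

lemma mem_Cst {f : Matrix (Fin q) (Fin p) ℂ → Matrix (Fin q') (Fin p') ℂ} {S : Set (Matrix (Fin q) (Fin p) ℂ)}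
    {C} : C ∈ Cst f S ↔ ∀ Z ∈ S, ∀ Z' ∈ S, C ᵥ* f Z = C ᵥ* f Z' := Iff.rfl

lemma Cst_mono {f : Matrix (Fin q) (Fin p) ℂ → Matrix (Fin q') (Fin p') ℂ} {S S' : Set (Matrix (Fin q) (Fin p) ℂ)}
    (h : S ⊆ S') : Cst f S' ≤ Cst f S := fun _ hC Z hZ Z' hZ' => hC Z (h hZ) Z' (h hZ')

lemma Cst_iff_base {f : Matrix (Fin q) (Fin p) ℂ → Matrix (Fin q') (Fin p') ℂ} {S : Set (Matrix (Fin q) (Fin p) ℂ)}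
    {Z0} (h0 : Z0 ∈ S) {C} : C ∈ Cst f S ↔ ∀ Z ∈ S, ∀ j, C ⬝ᵥ (f Z - f Z0)ᵀ j = 0 := by
  have : ∀ Z, (∀ j, C ⬝ᵥ (f Z - f Z0)ᵀ j = 0) ↔ C ᵥ* f Z = C ᵥ* f Z0 := by
    intro Z
    rw [← sub_eq_zero, ← vecMul_sub, funext_iff]
    rfl
  simp_rw [this]
  exact ⟨fun h Z hZ => h Z hZ Z0 h0, fun h Z hZ Z' hZ' => (h Z hZ).trans (h Z' hZ').symm⟩

lemma det_zero_of_mulVec {n : ℕ} {M : Matrix (Fin n) (Fin n) ℂ} {C : Fin n → ℂ} (hC : C ≠ 0) (h : M *ᵥ C = 0) :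
    M.det = 0 := Matrix.exists_mulVec_eq_zero_iff.1 ⟨C, hC, h⟩

lemma stepA {f : Matrix (Fin q) (Fin p) ℂ → Matrix (Fin q') (Fin p') ℂ} (hf : PH f) (i0 : Fin q) (j0 : Fin p) :
    ∃ C ∈ Cst f (FlagS i0 j0), C ≠ 0 := by
  obtain ⟨C, hC, h⟩ := det_lemma (T := FlagS (p := p) i0 j0 × Fin p') (fun t => (f t.1.1 - f 0)ᵀ t.2) (fun τ => by
    let M : ℂ → Matrix (Fin q') (Fin q') ℂ := fun t => of fun i =>
      (f ((τ i).1.1 + t • Matrix.single i0 j0 1) - f (0 + t • Matrix.single i0 j0 1))ᵀ (τ i).2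
    have hd : DifferentiableOn ℂ (fun t => (M t).det) (ball 0 1) := by
      apply diff_det
      intro i j
      have : ∀ Z ∈ FlagS i0 j0, DifferentiableOn ℂ (fun t : ℂ => f (Z + t • Matrix.single i0 j0 1)) (ball 0 1) := by
        intro Z hZ
        refine hf.1.comp (f := fun t : ℂ => Z + t • Matrix.single i0 j0 (1 : ℂ))
          (Differentiable.differentiableOn (by fun_prop)) fun t ht => line_mem hZ (by simpa using ht)
      exact (diff_entry (this _ (τ i).1.2) j (τ i).2).sub (diff_entry (this _ (zero_mem_flag i0 j0)) j (τ i).2)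
    have := maxp hd (fun u hu => by
      obtain ⟨ts, F, C, D, h1, h2, h3, h4, h5⟩ := boundary hf i0 j0 u hu
      have hlim : Tendsto M (u : Filter ℂ) (𝓝 (of fun i => (F (τ i).1.1 - F 0)ᵀ (τ i).2)) := by
        refine tendsto_pi_nhds.2 fun i => tendsto_pi_nhds.2 fun j => ?_
        have ct : Continuous fun W : Matrix (Fin q') (Fin p') ℂ => W j (τ i).2 := by fun_prop
        exact ((ct.tendsto _).comp (h5 _ (τ i).1.2).1).sub ((ct.tendsto _).comp (h5 _ (zero_mem_flag i0 j0)).1)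
      have hdet : (of fun i => (F (τ i).1.1 - F 0)ᵀ (τ i).2).det = 0 := by
        refine det_zero_of_mulVec (C := C) (fun h => by simp [h, nsq_zero] at h3) ?_
        ext i
        have e1 := congrFun ((h5 _ (τ i).1.2).2.1.trans (h5 _ (zero_mem_flag i0 j0)).2.1.symm) (τ i).2
        rw [← sub_eq_zero] at e1
        show (F (τ i).1.1 - F 0)ᵀ (τ i).2 ⬝ᵥ C = 0
        rw [dotProduct_comm, ← e1]
        show _ = (C ᵥ* F (τ i).1.1 - C ᵥ* F 0) _
        rw [← vecMul_sub]; rfl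
      rw [← hdet]
      exact ((continuous_id.matrix_det).tendsto _).comp hlim) (t := 0) (by simp)
    simpa [M] using this)
  refine ⟨C, ?_, hC⟩
  rw [Cst_iff_base (zero_mem_flag i0 j0)]
  intro Z hZ j
  exact h (⟨Z, hZ⟩, j)

/-- slices -/
def Sl (x y : Vec q p) : Set (Matrix (Fin q) (Fin p) ℂ) :=
  {Z | Z ∈ typeIDomain q p ∧ On x Z ∧ ∀ a, On a Z → hf a y = 0}

lemma Sl_smul {x y : Vec q p} {c : ℂ} (hc : c ≠ 0) : Sl x (c • y) = Sl x y := by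
  ext Z
  simp [Sl, hf_smul_right, hc]

lemma On_smul_iff {x : Vec q p} {Z} {c : ℂ} (hc : c ≠ 0) : On (c • x) Z ↔ On x Z :=
  ⟨fun h => by simpa [smul_smul, hc] using h.smul c⁻¹, fun h => h.smul c⟩

lemma act_Sl {g : Vec q p ≃ₗ[ℂ] Vec q p} (hg : IsU g) {x y : Vec q p} {Z} (hZ : Z ∈ Sl x y) :
    act g Z ∈ Sl (g x) (g y) := by
  refine ⟨act_mem hg hZ.1, on_act hg hZ.1 hZ.2.1, fun a ha => ?_⟩
  have := hZ.2.2 _ (on_act' hg hZ.1 ha)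
  rw [← hg, LinearEquiv.apply_symm_apply] at this
  exact this

lemma Cst_act {f : Matrix (Fin q) (Fin p) ℂ → Matrix (Fin q') (Fin p') ℂ} {g : Vec q p ≃ₗ[ℂ] Vec q p} (hg : IsU g)
    (x y : Vec q p) : Cst (f ∘ act g) (Sl x y) = Cst f (Sl (g x) (g y)) := by
  have key : ∀ Z ∈ Sl (g x) (g y), act g.symm Z ∈ Sl x y := fun Z hZ => by
    simpa using act_Sl hg.symm hZ
  ext C
  constructor
  · intro h Z hZ Z' hZ'
    have := h _ (key Z hZ) _ (key Z' hZ')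
    simpa [act_act_symm hg hZ.1, act_act_symm hg hZ'.1] using this
  · intro h Z hZ Z' hZ'
    exact h _ (act_Sl hg hZ) _ (act_Sl hg hZ')

lemma on_eb_iff {i0 : Fin q} {Z : Matrix (Fin q) (Fin p) ℂ} : On (eb (Sum.inl i0)) Z ↔ ∀ j, Z i0 j = 0 := by
  have h1 : (eb (Sum.inl i0) : Vec q p) ∘ Sum.inl = Pi.single i0 1 := by
    ext i; simp [eb, Pi.single_apply]
  have h2 : (eb (Sum.inl i0) : Vec q p) ∘ Sum.inr = 0 := by
    ext i; simp [eb, Pi.single_apply]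
  rw [On, h1, h2, single_one_vecMul, funext_iff]
  rfl

lemma hf_gv_col {A : Fin q → ℂ} {Z : Matrix (Fin q) (Fin p) ℂ} (v : Fin p → ℂ) (w : Fin q → ℂ) :
    hf (gv A Z) (Sum.elim (star w) (star v)) = A ⬝ᵥ (w - Z *ᵥ v) := by
  rw [hf_eq, dotProduct_sub, dotProduct_mulVec]
  simp

lemma mem_Sl_col {i0 : Fin q} {v : Fin p → ℂ} {w : Fin q → ℂ} {Z : Matrix (Fin q) (Fin p) ℂ} :
    Z ∈ Sl (eb (Sum.inl i0)) (Sum.elim (star w) (star v)) ↔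
      Z ∈ typeIDomain q p ∧ (∀ j, Z i0 j = 0) ∧ Z *ᵥ v = w := by
  simp only [Sl, Set.mem_ofPred_eq, on_eb_iff]
  refine and_congr_right fun _ => and_congr_right fun _ => ?_
  constructor
  · intro h
    have : ∀ A, A ⬝ᵥ (w - Z *ᵥ v) = 0 := fun A => by rw [← hf_gv_col]; exact h _ (on_gv A Z)
    have := (dotProduct_eq_zero (w - Z *ᵥ v) (fun A => by rw [dotProduct_comm]; exact this A))
    exact (sub_eq_zero.1 this).symm
  · intro h a ha
    rw [ha.eq_gv, hf_gv_col, h, sub_self, dotProduct_zero]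

lemma eb_inr_eq (j0 : Fin p) : (eb (Sum.inr j0) : Vec q p) = Sum.elim (star (0 : Fin q → ℂ)) (star (Pi.single j0 1 : Fin p → ℂ)) := by
  ext s
  rcases s with i | j
  · simp [eb]
  · by_cases h : j = j0
    · subst h; simp [eb]
    · simp [eb, h]

lemma flag_eq (i0 : Fin q) (j0 : Fin p) : FlagS i0 j0 = Sl (eb (Sum.inl i0)) (eb (Sum.inr j0)) := by
  ext Z
  rw [eb_inr_eq, mem_Sl_col]
  refine and_congr_right fun _ => and_congr_right fun _ => ?_
  rw [mulVec_single_one, funext_iff]; exact Iff.rfl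

end stepA

lemma exists_left_inv {n e : ℕ} (X : Matrix (Fin n) (Fin e) ℂ) (hX : LinearIndependent ℂ X.col) :
    ∃ Y : Matrix (Fin e) (Fin n) ℂ, Y * X = 1 := by
  have h1 : LinearMap.ker X.mulVecLin = ⊥ := by
    rw [LinearMap.ker_eq_bot]
    exact Matrix.mulVec_injective_iff.2 hX
  obtain ⟨g, hg⟩ := LinearMap.exists_leftInverse_of_injective X.mulVecLin h1
  refine ⟨LinearMap.toMatrix' g, ?_⟩
  have : LinearMap.toMatrix' (g ∘ₗ X.mulVecLin) = 1 := by rw [hg, LinearMap.toMatrix'_id]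
  rw [LinearMap.toMatrix'_comp, ← Matrix.toLin'_apply', LinearMap.toMatrix'_toLin'] at this
  exact this

lemma exists_span_basis {E : Type*} [AddCommGroup E] [Module ℂ E] [FiniteDimensional ℂ E] (s : Set E) :
    ∃ (e : ℕ) (v : Fin e → E),
    e = Module.finrank ℂ (Submodule.span ℂ s) ∧ (∀ i, v i ∈ s) ∧
    Submodule.span ℂ (Set.range v) = Submodule.span ℂ s ∧ LinearIndependent ℂ v := by
  obtain ⟨v, hv, hsp, hi⟩ := Submodule.exists_fun_fin_finrank_span_eq ℂ s
  exact ⟨_, v, rfl, hv, hsp, hi⟩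

lemma finrank_ker_vecMul {n e : ℕ} (X : Matrix (Fin n) (Fin e) ℂ) (Y : Matrix (Fin e) (Fin n) ℂ) (h : Y * X = 1) :
    Module.finrank ℂ (LinearMap.ker X.vecMulLinear) + e = n := by
  have h1 : LinearMap.range X.vecMulLinear = ⊤ := by
    rw [LinearMap.range_eq_top]
    intro y
    exact ⟨y ᵥ* Y, by simp [vecMul_vecMul, h]⟩
  have := LinearMap.finrank_range_add_finrank_ker X.vecMulLinear
  rw [h1, finrank_top] at this
  simp at this
  omega

/-- continuous sections of a kernel bundle of constant rank -/
lemma sect {H T : Type*} [TopologicalSpace H] {n : ℕ} (h0 : H) (w : T → H → Fin n → ℂ)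
    (L : H → Submodule ℂ (Fin n → ℂ)) (hc : ∀ t, ∀ᶠ h in 𝓝 h0, ContinuousAt (w t) h)
    (hL0 : ∀ C, C ∈ L h0 ↔ ∀ t, C ⬝ᵥ w t h0 = 0)
    (hL : ∀ t, ∀ᶠ h in 𝓝 h0, ∀ C ∈ L h, C ⬝ᵥ w t h = 0)
    (hk : ∀ᶠ h in 𝓝 h0, Module.finrank ℂ (L h0) ≤ Module.finrank ℂ (L h)) :
    ∃ (e : ℕ) (Y : Matrix (Fin e) (Fin n) ℂ) (S : H → (Fin n → ℂ) →ₗ[ℂ] (Fin n → ℂ)),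
      (∀ v ∈ Submodule.span ℂ (Set.range fun t => w t h0), Y *ᵥ v = 0 → v = 0) ∧
      Module.finrank ℂ (L h0) + e = n ∧
      e = Module.finrank ℂ (Submodule.span ℂ (Set.range fun t => w t h0)) ∧
      ∀ᶠ h in 𝓝 h0, (∀ c, ContinuousAt (fun h => S h c) h) ∧ ∀ c ∈ L h0, S h c ∈ L h ∧
        (S h c = 0 → c = 0) ∧ ∃ y, S h c = c + y ᵥ* Y := by
  obtain ⟨e, v, he, hv, hsp, hi⟩ := exists_span_basis (Set.range fun t => w t h0)
  choose τ hτ using hv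
  let X : H → Matrix (Fin n) (Fin e) ℂ := fun h => of fun i r => w (τ r) h i
  have hX0 : (X h0).col = v := by
    ext r i; simp [X, Matrix.col, ← hτ]
  obtain ⟨Y, hY⟩ := exists_left_inv (X h0) (by rw [hX0]; exact hi)
  let S : H → (Fin n → ℂ) →ₗ[ℂ] (Fin n → ℂ) := fun h =>
    LinearMap.id - (X h * ((Y * X h).det⁻¹ • (Y * X h).adjugate) * Y).vecMulLinear
  have hSapp : ∀ h c, S h c = c - c ᵥ* (X h * ((Y * X h).det⁻¹ • (Y * X h).adjugate) * Y) := fun h c => rfl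
  have hcX : ∀ᶠ h in 𝓝 h0, ContinuousAt X h := by
    have : ∀ᶠ h in 𝓝 h0, ∀ r, ContinuousAt (w (τ r)) h := eventually_all.2 fun r => hc (τ r)
    filter_upwards [this] with h hh
    exact continuousAt_pi.2 fun i => continuousAt_pi.2 fun r => (continuousAt_pi.1 (hh r) i)
  have hcd : ∀ h, ContinuousAt X h → ContinuousAt (fun h => (Y * X h).det) h := fun h hh => by
    have : Continuous fun M : Matrix (Fin n) (Fin e) ℂ => (Y * M).det := by fun_prop
    exact ContinuousAt.comp (f := X) (this.continuousAt) hh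
  have hd : ∀ᶠ h in 𝓝 h0, (Y * X h).det ≠ 0 := by
    have := hcd h0 hcX.self_of_nhds
    apply this.eventually_ne
    rw [hY]; simp
  have hkerL0 : L h0 = LinearMap.ker (X h0).vecMulLinear := by
    ext C
    rw [LinearMap.mem_ker, hL0]
    have e1 : (X h0).vecMulLinear C = 0 ↔ ∀ r, C ⬝ᵥ v r = 0 := by
      rw [← hX0, funext_iff]; rfl
    rw [e1]
    constructor
    · intro h r
      rw [← hτ r]; exact h (τ r)
    · intro h t
      have : w t h0 ∈ Submodule.span ℂ (Set.range v) := by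
        rw [hsp]; exact Submodule.subset_span ⟨t, rfl⟩
      generalize w t h0 = wt at this
      induction this using Submodule.span_induction with
      | mem x hx => obtain ⟨r, rfl⟩ := hx; exact h r
      | zero => simp
      | add x y _ _ hx hy => rw [dotProduct_add, hx, hy, add_zero]
      | smul a x _ hx => rw [dotProduct_smul, hx, smul_zero]
  have hdim := finrank_ker_vecMul (X h0) Y hY
  refine ⟨e, Y, S, ?_, by rw [hkerL0]; exact hdim, he, ?_⟩
  · intro u hu hYu
    rw [← hsp, Submodule.mem_span_range_iff_exists_fun] at hu
    obtain ⟨a, ha⟩ := hu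
    have : u = X h0 *ᵥ a := by
      rw [← ha, ← hX0]; ext i
      simp [mulVec, dotProduct, mul_comm, Matrix.col]
    rw [this, mulVec_mulVec, hY, one_mulVec] at hYu
    rw [this, hYu, mulVec_zero]
  have hLX : ∀ᶠ h in 𝓝 h0, ∀ C ∈ L h, C ᵥ* X h = 0 := by
    have : ∀ᶠ h in 𝓝 h0, ∀ r, ∀ C ∈ L h, C ⬝ᵥ w (τ r) h = 0 := eventually_all.2 fun r => hL (τ r)
    filter_upwards [this] with h hh C hC
    ext r; exact hh r C hC
  filter_upwards [hcX, hd, hLX, hk] with h h1 h2 h3 h4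
  set δ := (Y * X h).det
  have hinv : (δ⁻¹ • (Y * X h).adjugate) * (Y * X h) = 1 := by
    rw [smul_mul_assoc, adjugate_mul, smul_smul, inv_mul_cancel₀ h2, one_smul]
  have hLeq : L h = LinearMap.ker (X h).vecMulLinear := by
    apply Submodule.eq_of_le_of_finrank_le
    · intro C hC; exact h3 C hC
    · have := finrank_ker_vecMul (X h) ((δ⁻¹ • (Y * X h).adjugate) * Y) (by rw [Matrix.mul_assoc, hinv])
      rw [hkerL0] at h4
      omega
  refine ⟨fun c => ?_, fun c hcL => ⟨?_, ?_, ?_⟩⟩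
  · simp only [hSapp]
    have e1 := (hcd h h1).inv₀ h2
    have e2 : ContinuousAt (fun h => (Y * X h).adjugate) h := by
      have : Continuous fun M : Matrix (Fin n) (Fin e) ℂ => (Y * M).adjugate := by fun_prop
      exact ContinuousAt.comp (f := X) (this.continuousAt) h1
    have e4 : Continuous fun M : Matrix (Fin n) (Fin e) ℂ × Matrix (Fin e) (Fin e) ℂ => c - c ᵥ* (M.1 * M.2 * Y) := by
      fun_prop
    exact ContinuousAt.comp (f := fun h => (X h, (Y * X h).det⁻¹ • (Y * X h).adjugate)) e4.continuousAt
      (h1.prodMk (e1.smul e2))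
  · rw [hLeq, LinearMap.mem_ker, vecMulLinear_apply, hSapp, sub_vecMul, vecMul_vecMul, Matrix.mul_assoc,
      Matrix.mul_assoc, hinv, Matrix.mul_one, sub_self]
  · intro hS
    rw [hSapp, sub_eq_zero] at hS
    have hcX0 : c ᵥ* X h0 = 0 := by
      rw [hkerL0] at hcL; exact hcL
    have : c ᵥ* (X h * (δ⁻¹ • (Y * X h).adjugate)) = 0 := by
      have h5 := congrArg (fun b => b ᵥ* X h0) hS
      simp only [hcX0, vecMul_vecMul] at h5
      rw [Matrix.mul_assoc, hY, Matrix.mul_one] at h5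
      exact h5.symm
    rw [hS, ← vecMul_vecMul, this, zero_vecMul]
  · refine ⟨- (c ᵥ* (X h * (δ⁻¹ • (Y * X h).adjugate))), ?_⟩
    rw [hSapp, neg_vecMul, vecMul_vecMul, sub_eq_add_neg]

end

section

/-! ### Part 5: flags versus fibres -/

open Filter Topology Metric

lemma exists_min {α : Type*} (P : α → Prop) (φ : α → ℕ) (h : ∃ a, P a) : ∃ a, P a ∧ ∀ a', P a' → φ a ≤ φ a' := by
  classical
  have h' : ∃ n, ∃ a, P a ∧ φ a = n := by obtain ⟨a, ha⟩ := h; exact ⟨_, a, ha, rfl⟩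
  obtain ⟨a, ha, he⟩ := Nat.find_spec h'
  exact ⟨a, ha, fun a' ha' => he ▸ Nat.find_min' h' ⟨a', ha', rfl⟩⟩

lemma exists_max {α : Type*} (P : α → Prop) (φ : α → ℕ) (b : ℕ) (h : ∃ a, P a) (hb : ∀ a, P a → φ a ≤ b) :
    ∃ a, P a ∧ ∀ a', P a' → φ a' ≤ φ a := by
  obtain ⟨a, ha, h1⟩ := exists_min P (fun a => b - φ a) h
  refine ⟨a, ha, fun a' ha' => ?_⟩
  have := h1 a' ha'
  have := hb a ha
  have := hb a' ha'
  omega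

section stepB
variable {q p q' p' : ℕ}

/-- fibres -/
def Fib (x : Vec q p) : Set (Matrix (Fin q) (Fin p) ℂ) := {Z | Z ∈ typeIDomain q p ∧ On x Z}

lemma witt_slice (i0 : Fin q) (j0 : Fin p) {y : Vec q p} (h1 : hf (eb (Sum.inl i0)) y = 0) (h2 : hq y < 0) :
    ∃ g : Vec q p ≃ₗ[ℂ] Vec q p, IsU g ∧ g (eb (Sum.inl i0)) = eb (Sum.inl i0) ∧
      ∃ c : ℂ, c ≠ 0 ∧ g (eb (Sum.inr j0)) = c • y := by
  classical
  set r := √(- hq y) with hr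
  have hr0 : 0 < r := Real.sqrt_pos.2 (by linarith)
  have hr2 : r ^ 2 = - hq y := Real.sq_sqrt (by linarith)
  let c : ℂ := ((r⁻¹ : ℝ) : ℂ)
  have hc : c ≠ 0 := by simp [c, hr0.ne']
  have hcy : hf (c • y) (c • y) = -1 := by
    rw [hf_self, hq_smul, Complex.norm_real, norm_inv, Real.norm_of_nonneg hr0.le]
    have : (r⁻¹) ^ 2 * hq y = -1 := by
      rw [show hq y = - r ^ 2 by linarith]; field_simp
    rw [this]; simp
  obtain ⟨g, hg, hga⟩ := witt {Sum.inl i0, Sum.inr j0}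
    (fun s => if s = Sum.inl i0 then eb (Sum.inl i0) else c • y) (by
      intro a ha b hb
      simp only [Finset.mem_insert, Finset.mem_singleton] at ha hb
      rcases ha with rfl | rfl <;> rcases hb with rfl | rfl
      · simp [hf_eb]
      · simp [hf_smul_right, h1]
      · simp [hf_smul_left, hf_symm_zero h1]
      · simp [hcy])
  refine ⟨g, hg, ?_, c, hc, ?_⟩
  · simpa using hga (Sum.inl i0) (by simp)
  · simpa using hga (Sum.inr j0) (by simp)

lemma vmv (a : Fin q → ℂ) (b v : Fin p → ℂ) : vecMulVec a b *ᵥ v = (b ⬝ᵥ v) • a := by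
  ext i
  simp [mulVec, vecMulVec_apply, dotProduct, Finset.mul_sum, Finset.sum_mul]
  exact Finset.sum_congr rfl fun j _ => by ring

set_option maxHeartbeats 1000000 in
lemma stepB_core {f : Matrix (Fin q) (Fin p) ℂ → Matrix (Fin q') (Fin p') ℂ} (hf : PH f) (i0 : Fin q) (j0 : Fin p)
    (hp : q' < p)
    (Hmin : ∀ g : Vec q p ≃ₗ[ℂ] Vec q p, IsU g → g (eb (Sum.inl i0)) = eb (Sum.inl i0) →
      Module.finrank ℂ (Cst f (FlagS i0 j0)) ≤ Module.finrank ℂ (Cst (f ∘ act g) (FlagS i0 j0))) :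
    Cst f (FlagS i0 j0) = Cst f (Fib (eb (Sum.inl i0))) := by
  classical
  have hfc : ∀ Z ∈ typeIDomain q p, ContinuousAt f Z := fun Z hZ =>
    hf.1.continuousOn.continuousAt (isOpen_dom.mem_nhds hZ)
  let upd : (Fin q → ℂ) → Fin q → ℂ := fun w => Function.update w i0 0
  have updc : Continuous upd := continuous_id.update i0 continuous_const
  let h0 : (Fin p → ℂ) × (Fin q → ℂ) := (Pi.single j0 1, 0)
  let ZZ : Matrix (Fin q) (Fin p) ℂ → (Fin p → ℂ) × (Fin q → ℂ) → Matrix (Fin q) (Fin p) ℂ := fun Z h =>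
    Z + vecMulVec (upd h.2 - Z *ᵥ h.1) (Pi.single j0 (h.1 j0)⁻¹)
  have ZZc : ∀ Z h, h.1 j0 ≠ 0 → ContinuousAt (ZZ Z) h := by
    intro Z h hh
    refine continuousAt_pi.2 fun i => continuousAt_pi.2 fun j => ?_
    simp only [ZZ, Matrix.add_apply, vecMulVec_apply, Pi.single_apply]
    refine continuousAt_const.add (ContinuousAt.mul ?_ ?_)
    · have : Continuous fun h : (Fin p → ℂ) × (Fin q → ℂ) => (upd h.2 - Z *ᵥ h.1) i := by fun_prop
      exact this.continuousAt
    · by_cases hj : j = j0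
      · simp only [hj, if_true]
        exact ContinuousAt.inv₀ (by fun_prop) hh
      · simp only [hj, if_false]; exact continuousAt_const
  have ZZv : ∀ Z h, h.1 j0 ≠ 0 → ZZ Z h *ᵥ h.1 = upd h.2 := by
    intro Z h hh
    simp only [ZZ, add_mulVec, vmv]
    rw [single_dotProduct, inv_mul_cancel₀ hh, one_smul]; abel
  have ZZr : ∀ Z h, (∀ j, Z i0 j = 0) → ∀ j, ZZ Z h i0 j = 0 := by
    intro Z h hZ j
    have : (Z *ᵥ h.1) i0 = 0 := by simp [mulVec, dotProduct, hZ]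
    simp [ZZ, vecMulVec_apply, hZ, this, upd]
  have ZZ0 : ∀ Z ∈ FlagS i0 j0, ZZ Z h0 = Z := by
    intro Z hZ
    have : Z *ᵥ (Pi.single j0 1) = 0 := by rw [mulVec_single_one]; ext i; exact hZ.2.2 i
    simp [ZZ, h0, this, upd]
  have ev1 : ∀ᶠ h in 𝓝 h0, h.1 j0 ≠ 0 := by
    have : ContinuousAt (fun h : (Fin p → ℂ) × (Fin q → ℂ) => h.1 j0) h0 := by fun_prop
    exact this.eventually_ne (by simp [h0])
  have ev2 : ∀ Z ∈ FlagS i0 j0, ∀ᶠ h in 𝓝 h0, ZZ Z h ∈ typeIDomain q p := by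
    intro Z hZ
    refine (ZZc Z h0 ev1.self_of_nhds).eventually ?_
    rw [ZZ0 Z hZ]
    exact isOpen_dom.mem_nhds hZ.1
  let yv : (Fin p → ℂ) × (Fin q → ℂ) → Vec q p := fun h => Sum.elim (star (upd h.2)) (star h.1)
  have yvc : Continuous yv := by
    refine continuous_pi fun s => ?_
    rcases s with i | j
    · simp only [yv, Sum.elim_inl]; fun_prop
    · simp only [yv, Sum.elim_inr]; fun_prop
  let L : (Fin p → ℂ) × (Fin q → ℂ) → Submodule ℂ (Fin q' → ℂ) := fun h => Cst f (Sl (eb (Sum.inl i0)) (yv h))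
  have yv0 : yv h0 = eb (Sum.inr j0) := by
    rw [eb_inr_eq]; simp [yv, h0, upd]
  have hL0e : L h0 = Cst f (FlagS i0 j0) := by
    simp only [L]; rw [yv0, flag_eq]
  have ZZS : ∀ Z h, (∀ j, Z i0 j = 0) → h.1 j0 ≠ 0 → ZZ Z h ∈ typeIDomain q p →
      ZZ Z h ∈ Sl (eb (Sum.inl i0)) (yv h) := fun Z h h1 h2 h3 => by
    rw [mem_Sl_col]; exact ⟨h3, ZZr Z h h1, ZZv Z h h2⟩
  obtain ⟨e, Y, S, -, -, -, hS⟩ := sect h0 (T := FlagS (p := p) i0 j0 × Fin p')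
    (fun t h => (f (ZZ t.1.1 h) - f (ZZ 0 h))ᵀ t.2) L (by
      intro t
      filter_upwards [ev1, ev2 _ t.1.2, ev2 0 (zero_mem_flag i0 j0)] with h h1 h2 h3
      have e1 := ContinuousAt.comp (f := ZZ t.1.1) (hfc _ h2) (ZZc t.1.1 h h1)
      have e2 := ContinuousAt.comp (f := ZZ 0) (hfc _ h3) (ZZc 0 h h1)
      have e3 : Continuous fun M : Matrix (Fin q') (Fin p') ℂ => Mᵀ t.2 := by fun_prop
      exact ContinuousAt.comp (f := fun h => f (ZZ t.1.1 h) - f (ZZ 0 h)) e3.continuousAt (e1.sub e2)) (by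
      intro C
      rw [hL0e, Cst_iff_base (zero_mem_flag i0 j0)]
      constructor
      · intro h t
        rw [ZZ0 _ t.1.2, ZZ0 _ (zero_mem_flag i0 j0)]
        exact h _ t.1.2 _
      · intro h Z hZ j
        have := h (⟨Z, hZ⟩, j)
        rwa [ZZ0 _ hZ, ZZ0 _ (zero_mem_flag i0 j0)] at this) (by
      intro t
      filter_upwards [ev1, ev2 _ t.1.2, ev2 0 (zero_mem_flag i0 j0)] with h h1 h2 h3 C hC
      exact (Cst_iff_base (ZZS 0 h (by simp) h1 h3)).1 hC _ (ZZS _ h t.1.2.2.1 h1 h2) t.2) (by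
      have : ∀ᶠ h in 𝓝 h0, hq (yv h) < 0 := by
        refine (continuous_hq.comp yvc).continuousAt.eventually (gt_mem_nhds ?_)
        show hq (yv h0) < 0
        rw [yv0]
        have : ((hq (eb (Sum.inr j0) : Vec q p) : ℝ) : ℂ) = -1 := by
          rw [← hf_self, hf_eb]; simp
        have : hq (eb (Sum.inr j0) : Vec q p) = -1 := by exact_mod_cast this
        linarith
      filter_upwards [this] with h hh
      obtain ⟨g, hg, hg1, c, hc, hg2⟩ := witt_slice i0 j0 (y := yv h) (by
        rw [hf_eb_left]; simp [yv, upd]) hh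
      have := Hmin g hg hg1
      rw [hL0e]
      refine this.trans_eq ?_
      rw [flag_eq, Cst_act hg, hg1, hg2, Sl_smul hc])
  -- the good open sets
  have hev : ∀ᶠ x : (Fin p → ℂ) × Matrix (Fin q) (Fin p) ℂ in 𝓝 (Pi.single j0 1, 0),
      ((x.1 j0 ≠ 0 ∧ ZZ 0 (x.1, x.2 *ᵥ x.1) ∈ typeIDomain q p) ∧ x.2 ∈ typeIDomain q p) ∧
      (∀ c, ContinuousAt (fun h => S h c) (x.1, x.2 *ᵥ x.1)) ∧ ∀ c ∈ L h0, S (x.1, x.2 *ᵥ x.1) c ∈ L (x.1, x.2 *ᵥ x.1) ∧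
        (S (x.1, x.2 *ᵥ x.1) c = 0 → c = 0) ∧ ∃ y, S (x.1, x.2 *ᵥ x.1) c = c + y ᵥ* Y := by
    have ct : Continuous fun x : (Fin p → ℂ) × Matrix (Fin q) (Fin p) ℂ => (x.1, x.2 *ᵥ x.1) := by fun_prop
    have tt : Tendsto (fun x : (Fin p → ℂ) × Matrix (Fin q) (Fin p) ℂ => (x.1, x.2 *ᵥ x.1))
        (𝓝 (Pi.single j0 1, 0)) (𝓝 h0) := by
      have := ct.tendsto (Pi.single j0 1, 0)
      simpa only [h0, zero_mulVec] using this
    have t2 : ∀ᶠ x : (Fin p → ℂ) × Matrix (Fin q) (Fin p) ℂ in 𝓝 (Pi.single j0 1, 0), x.2 ∈ typeIDomain q p :=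
      continuous_snd.continuousAt.eventually (isOpen_dom.mem_nhds zero_mem_dom)
    exact ((tt.eventually (ev1.and (ev2 0 (zero_mem_flag i0 j0)))).and t2).and (tt.eventually hS)
  obtain ⟨B, B', hBo, hB0, hB'o, hB'0, hBB⟩ := mem_nhds_prod_iff'.1 hev
  have good := fun v (hv : v ∈ B) Z (hZ : Z ∈ B') => hBB (Set.mk_mem_prod hv hZ)
  simp only [Set.mem_ofPred_eq] at good
  let cc : (Fin p → ℂ) × (Fin q → ℂ) → (Fin q' → ℂ) → Vec q' p' := fun h c => gv (S h c) (f (ZZ 0 h))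
  have ccc : ∀ v ∈ B, ∀ Z ∈ B', ∀ c, ContinuousAt (fun h => cc h c) (v, Z *ᵥ v) := by
    intro v hv Z hZ c
    obtain ⟨⟨⟨g1, g2⟩, g3⟩, g4, g5⟩ := good v hv Z hZ
    have e2 := ContinuousAt.comp (f := ZZ 0) (hfc _ g2) (ZZc 0 _ g1)
    have e3 : Continuous fun x : (Fin q' → ℂ) × Matrix (Fin q') (Fin p') ℂ => gv x.1 x.2 := by
      refine continuous_pi fun s => ?_
      rcases s with i | j
      · simp only [gv_apply_inl]; fun_prop
      · simp only [gv_apply_inr]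
        have : Continuous fun x : (Fin q' → ℂ) × Matrix (Fin q') (Fin p') ℂ => x.1 ᵥ* x.2 :=
          Continuous.matrix_vecMul continuous_fst continuous_snd
        fun_prop
    exact ContinuousAt.comp (f := fun h => (S h c, f (ZZ 0 h))) e3.continuousAt ((g4 c).prodMk e2)
  let SS : Matrix (Fin q) (Fin p) ℂ → Submodule ℂ (Vec q' p') := fun Z =>
    Submodule.span ℂ {x | ∃ c ∈ L h0, ∃ v ∈ B, x = cc (v, Z *ᵥ v) c}
  have SSon : ∀ Z ∈ B', (∀ j, Z i0 j = 0) → ∀ s ∈ SS Z, On s (f Z) := by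
    intro Z hZ hZr s hs
    induction hs using Submodule.span_induction with
    | mem x hx =>
      obtain ⟨c, hc, v, hv, rfl⟩ := hx
      obtain ⟨⟨⟨g1, g2⟩, g3⟩, g4, g5⟩ := good v hv Z hZ
      have h1 := (g5 c hc).1
      have hup : upd (Z *ᵥ v) = Z *ᵥ v := by
        simp only [upd]
        rw [Function.update_eq_self_iff]; simp [mulVec, dotProduct, hZr]
      have h2 : Z ∈ Sl (eb (Sum.inl i0)) (yv (v, Z *ᵥ v)) := by
        rw [mem_Sl_col]; exact ⟨g3, hZr, hup.symm⟩
      have h3 := h1 _ (ZZS 0 _ (by simp) g1 g2) _ h2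
      show _ ᵥ* _ = _
      simp only [cc, gv_inl, gv_inr]
      exact h3.symm
    | zero => exact On.zero _
    | add x y _ _ hx hy => exact hx.add hy
    | smul a x _ hx => exact hx.smul a
  have SSle : ∀ Z, (Z ∈ B' ∧ ∀ j, Z i0 j = 0) → Module.finrank ℂ (SS Z) ≤ q' := by
    intro Z hZ
    let π : SS Z →ₗ[ℂ] (Fin q' → ℂ) := (LinearMap.funLeft ℂ ℂ (Sum.inl : Fin q' → Fin q' ⊕ Fin p')) ∘ₗ (SS Z).subtype
    have hπ : Function.Injective π := by
      rw [injective_iff_map_eq_zero]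
      intro s hs
      have h1 := (SSon Z hZ.1 hZ.2 s s.2).eq_gv
      have h2 : (s : Vec q' p') ∘ Sum.inl = 0 := hs
      rw [h2] at h1
      ext1
      rw [h1]
      ext t; rcases t with i | j <;> simp [gv]
    simpa using LinearMap.finrank_le_finrank_of_injective hπ
  obtain ⟨Z0, ⟨hZ0, hZ0r⟩, hmax⟩ := exists_max _ (fun Z => Module.finrank ℂ (SS Z)) q' ⟨0, hB'0, by simp⟩ SSle
  obtain ⟨ρ, b, hρ, hb, hbs, hbi⟩ := exists_span_basis {x | ∃ c ∈ L h0, ∃ v ∈ B, x = cc (v, Z0 *ᵥ v) c}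
  choose c hcL v hvB hbe using hb
  have hρp : ρ < p := by rw [hρ]; exact (SSle Z0 ⟨hZ0, hZ0r⟩).trans_lt hp
  obtain ⟨κ, hκ, hκ0⟩ : ∃ κ : Fin p → ℂ, (∀ r, κ ⬝ᵥ v r = 0) ∧ κ ≠ 0 := by
    have := LinearMap.ker_ne_bot_of_finrank_lt (f := (of fun r => v r : Matrix (Fin ρ) (Fin p) ℂ).mulVecLin) (by simpa)
    obtain ⟨κ, h1, h2⟩ := Submodule.exists_mem_ne_zero_of_ne_bot this
    refine ⟨κ, fun r => ?_, h2⟩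
    rw [dotProduct_comm]
    exact congrFun h1 r
  have SSeq : ∀ u : Fin q → ℂ, u i0 = 0 → Z0 + vecMulVec u κ ∈ B' → SS (Z0 + vecMulVec u κ) = SS Z0 := by
    intro u hu hB'
    symm
    apply Submodule.eq_of_le_of_finrank_le
    · show Submodule.span ℂ _ ≤ _
      rw [← hbs, Submodule.span_le]
      rintro _ ⟨r, rfl⟩
      refine Submodule.subset_span ⟨c r, hcL r, v r, hvB r, ?_⟩
      rw [hbe r, add_mulVec, vmv, hκ, zero_smul, add_zero]
    · refine hmax _ ⟨hB', fun j => ?_⟩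
      simp [hZ0r, vecMulVec_apply, hu]
  let η : Fin p → ℂ := star κ
  have hη : κ ⬝ᵥ η ≠ 0 := by
    simp only [η]; rw [dot_star_self]; exact_mod_cast (nsq_pos hκ0).ne'
  have evp : ∀ᶠ x : ℂ × Matrix (Fin q) (Fin p) ℂ in 𝓝 (0, Z0),
      LinearIndependent ℂ (fun r => cc (v r + x.1 • η, x.2 *ᵥ (v r + x.1 • η)) (c r)) ∧
      (∀ r, v r + x.1 • η ∈ B) ∧ x.2 ∈ B' := by
    refine Eventually.and ?_ (Eventually.and (eventually_all.2 fun r => ?_) ?_)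
    · have hcont : ContinuousAt (fun x : ℂ × Matrix (Fin q) (Fin p) ℂ =>
          (fun r => cc (v r + x.1 • η, x.2 *ᵥ (v r + x.1 • η)) (c r))) (0, Z0) := by
        refine continuousAt_pi.2 fun r => ?_
        have ct : Continuous fun x : ℂ × Matrix (Fin q) (Fin p) ℂ => (v r + x.1 • η, x.2 *ᵥ (v r + x.1 • η)) := by
          fun_prop
        refine ContinuousAt.comp (f := fun x : ℂ × Matrix (Fin q) (Fin p) ℂ => (v r + x.1 • η, x.2 *ᵥ (v r + x.1 • η)))
          (g := fun h => cc h (c r)) ?_ ct.continuousAt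
        simp only [zero_smul, add_zero]
        exact ccc _ (hvB r) _ hZ0 _
      refine hcont.eventually (p := fun b => LinearIndependent ℂ b) ?_
      apply LinearIndependent.eventually
      simp only [zero_smul, add_zero]
      have : (fun r => cc (v r, Z0 *ᵥ v r) (c r)) = b := funext fun r => (hbe r).symm
      rwa [this]
    · have ct : Continuous fun x : ℂ × Matrix (Fin q) (Fin p) ℂ => v r + x.1 • η := by fun_prop
      refine ct.continuousAt.eventually (hBo.mem_nhds ?_)
      simpa using hvB r
    · exact continuous_snd.continuousAt.eventually (hB'o.mem_nhds hZ0)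
  have evp2 := evp.curry_nhds
  obtain ⟨τ, hτ, hτ0⟩ := ((evp2.filter_mono (nhdsWithin_le_nhds (s := {0}ᶜ))).and eventually_mem_nhdsWithin).exists
  have hτ0 : τ ≠ 0 := hτ0
  have hkv : ∀ r, κ ⬝ᵥ (v r + τ • η) ≠ 0 := fun r => by
    rw [dotProduct_add, hκ, zero_add, dotProduct_smul]; exact mul_ne_zero hτ0 hη
  let u : Fin ρ → Matrix (Fin q) (Fin p) ℂ → Fin q → ℂ := fun r Z =>
    (κ ⬝ᵥ (v r + τ • η))⁻¹ • ((Z - Z0) *ᵥ (v r + τ • η))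
  have evu : ∀ᶠ Z in 𝓝 Z0, ∀ r, Z0 + vecMulVec (u r Z) κ ∈ B' := by
    refine eventually_all.2 fun r => ?_
    have ct : Continuous fun Z => Z0 + vecMulVec (u r Z) κ := by
      refine continuous_pi fun i => continuous_pi fun j => ?_
      simp only [Matrix.add_apply, vecMulVec_apply, u, Pi.smul_apply]
      have : Continuous fun Z : Matrix (Fin q) (Fin p) ℂ => (Z - Z0) *ᵥ (v r + τ • η) := by fun_prop
      fun_prop
    refine ct.continuousAt.eventually (hB'o.mem_nhds ?_)
    have : vecMulVec (u r Z0) κ = 0 := by ext; simp [u, vecMulVec_apply]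
    show Z0 + vecMulVec (u r Z0) κ ∈ B'
    rwa [this, add_zero]
  have evS : ∀ᶠ Z in 𝓝 Z0, (∀ j, Z i0 j = 0) → ∀ s ∈ SS Z0, On s (f Z) := by
    filter_upwards [hτ, evu] with Z ⟨h1, h2, h3⟩ h4 hZr s hs
    have hsp : Submodule.span ℂ (Set.range fun r => cc (v r + τ • η, Z *ᵥ (v r + τ • η)) (c r)) = SS Z0 := by
      apply Submodule.eq_of_le_of_finrank_le
      · rw [Submodule.span_le]
        rintro _ ⟨r, rfl⟩
        have hu0 : u r Z i0 = 0 := by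
          simp [u, mulVec, dotProduct, hZr, hZ0r]
        rw [← SSeq (u r Z) hu0 (h4 r)]
        refine Submodule.subset_span ⟨c r, hcL r, _, h2 r, ?_⟩
        rw [add_mulVec, vmv]
        simp only [u]
        rw [smul_smul, mul_inv_cancel₀ (hkv r), one_smul, sub_mulVec]
        simp
      · rw [finrank_span_eq_card h1, Fintype.card_fin]
        exact hρ.ge
    rw [← hsp] at hs
    refine SSon Z h3 hZr s (Submodule.span_le.2 ?_ hs)
    rintro _ ⟨r, rfl⟩
    exact Submodule.subset_span ⟨c r, hcL r, _, h2 r, rfl⟩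
  have hall : ∀ s ∈ SS Z0, ∀ Z ∈ Fib (eb (Sum.inl i0)), On s (f Z) := by
    intro s hs Z hZ
    let W : Submodule ℂ (Matrix (Fin q) (Fin p) ℂ) :=
      { carrier := {Z | ∀ j, Z i0 j = 0}
        add_mem' := fun {a b} ha hb j => by simp [ha j, hb j]
        zero_mem' := fun j => rfl
        smul_mem' := fun c {a} ha j => by simp [ha j] }
    have hZr := on_eb_iff.1 hZ.2
    have hd : DifferentiableOn ℂ (fun Z => (s ∘ Sum.inl) ᵥ* f Z - s ∘ Sum.inr) (typeIDomain q p) := by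
      refine differentiableOn_pi.2 fun j => ?_
      have : (fun Z => ((s ∘ Sum.inl) ᵥ* f Z - s ∘ Sum.inr) j) = fun Z => ((s ∘ Sum.inl) ᵥ* f Z) ⬝ᵥ (Pi.single j 1) - s (Sum.inr j) := by
        ext Z; simp
      rw [this]
      exact (diff_form hf.1 _ _).sub_const _
    have := ident isOpen_dom convex_dom W hd (z0 := Z0) (good _ hB0 _ hZ0).1.2 (by
      filter_upwards [evS] with Z' h hW
      have := h (fun j => by
        have := hW j
        simpa [hZ0r] using this) s hs
      rw [sub_eq_zero]; exact this) hZ.1 (fun j => by simp [hZr, hZ0r])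
    exact sub_eq_zero.1 this
  -- conclusion
  symm
  apply Submodule.eq_of_le_of_finrank_le
  · exact Cst_mono fun Z hZ => ⟨hZ.1, on_eb_iff.2 hZ.2.1⟩
  · rw [← hL0e]
    obtain ⟨-, -, g5⟩ := good _ hB0 _ hZ0
    have hmem : ∀ c ∈ L h0, S (Pi.single j0 1, Z0 *ᵥ Pi.single j0 1) c ∈ Cst f (Fib (eb (Sum.inl i0))) := by
      intro c hc Z hZ Z' hZ'
      have hs : cc (Pi.single j0 1, Z0 *ᵥ Pi.single j0 1) c ∈ SS Z0 := Submodule.subset_span ⟨c, hc, _, hB0, rfl⟩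
      exact (hall _ hs Z hZ : _ ᵥ* _ = _).trans (hall _ hs Z' hZ' : _ ᵥ* _ = _).symm
    refine LinearMap.finrank_le_finrank_of_injective
      (f := (S (Pi.single j0 1, Z0 *ᵥ Pi.single j0 1)).restrict hmem) ?_
    rw [injective_iff_map_eq_zero]
    intro c hc
    ext1
    exact (g5 c c.2).2.1 (congrArg Subtype.val hc)

end stepB

section stepB2
variable {q p q' p' : ℕ}
lemma act_Fib {g : Vec q p ≃ₗ[ℂ] Vec q p} (hg : IsU g) {x : Vec q p} {Z} (hZ : Z ∈ Fib x) :
    act g Z ∈ Fib (g x) := ⟨act_mem hg hZ.1, on_act hg hZ.1 hZ.2⟩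

lemma Cst_act_Fib {f : Matrix (Fin q) (Fin p) ℂ → Matrix (Fin q') (Fin p') ℂ} {g : Vec q p ≃ₗ[ℂ] Vec q p} (hg : IsU g)
    (x : Vec q p) : Cst (f ∘ act g) (Fib x) = Cst f (Fib (g x)) := by
  have key : ∀ Z ∈ Fib (g x), act g.symm Z ∈ Fib x := fun Z hZ => by
    simpa using act_Fib hg.symm hZ
  ext C
  constructor
  · intro h Z hZ Z' hZ'
    have := h _ (key Z hZ) _ (key Z' hZ')
    simpa [act_act_symm hg hZ.1, act_act_symm hg hZ'.1] using this
  · intro h Z hZ Z' hZ'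
    exact h _ (act_Fib hg hZ) _ (act_Fib hg hZ')

lemma Fib_smul {x : Vec q p} {c : ℂ} (hc : c ≠ 0) : Fib (c • x) = Fib x := by
  ext Z; simp [Fib, On_smul_iff hc]

lemma witt_pos (i0 : Fin q) {y : Vec q p} (h2 : 0 < hq y) :
    ∃ g : Vec q p ≃ₗ[ℂ] Vec q p, IsU g ∧ ∃ c : ℂ, c ≠ 0 ∧ g (eb (Sum.inl i0)) = c • y := by
  classical
  set r := √(hq y) with hr
  have hr0 : 0 < r := Real.sqrt_pos.2 (by linarith)
  have hr2 : r ^ 2 = hq y := Real.sq_sqrt (by linarith)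
  let c : ℂ := ((r⁻¹ : ℝ) : ℂ)
  have hc : c ≠ 0 := by simp [c, hr0.ne']
  have hcy : hf (c • y) (c • y) = 1 := by
    rw [hf_self, hq_smul, Complex.norm_real, norm_inv, Real.norm_of_nonneg hr0.le]
    have : (r⁻¹) ^ 2 * hq y = 1 := by
      rw [← hr2]; field_simp
    rw [this]; simp
  obtain ⟨g, hg, hga⟩ := witt {Sum.inl i0}
    (fun s => c • y) (by
      intro a ha b hb
      simp only [Finset.mem_singleton] at ha hb
      subst ha; subst hb
      simp [hcy, hf_eb])
  exact ⟨g, hg, c, hc, by simpa using hga (Sum.inl i0) (by simp)⟩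

/-- Step B: a frame at `x` for which the flag functionals are the fibre functionals -/
lemma stepB {f : Matrix (Fin q) (Fin p) ℂ → Matrix (Fin q') (Fin p') ℂ} (hf : PH f) (i0 : Fin q) (j0 : Fin p)
    (hp : q' < p) {x : Vec q p} (hx : 0 < hq x) :
    ∃ g : Vec q p ≃ₗ[ℂ] Vec q p, IsU g ∧ (∃ c : ℂ, c ≠ 0 ∧ g (eb (Sum.inl i0)) = c • x) ∧
      Cst (f ∘ act g) (FlagS i0 j0) = Cst f (Fib x) := by
  obtain ⟨g0, hg0, h0⟩ := witt_pos i0 hx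
  obtain ⟨g, ⟨hg, c, hc, hgx⟩, hmin⟩ := exists_min
    (fun g : Vec q p ≃ₗ[ℂ] Vec q p => IsU g ∧ ∃ c : ℂ, c ≠ 0 ∧ g (eb (Sum.inl i0)) = c • x)
    (fun g => Module.finrank ℂ (Cst (f ∘ act g) (FlagS i0 j0))) ⟨g0, hg0, h0⟩
  refine ⟨g, hg, ⟨c, hc, hgx⟩, ?_⟩
  have := stepB_core (hf.comp_act hg) i0 j0 hp (fun g1 hg1 h1 => by
    have h2 := hmin (g1.trans g) ⟨hg1.trans hg, c, hc, by simp [h1, hgx]⟩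
    refine h2.trans_eq ?_
    rw [flag_eq, Cst_act hg1, Cst_act hg, Cst_act (hg1.trans hg)]
    rfl)
  rw [this, Cst_act_Fib hg, hgx, Fib_smul hc]

lemma part1 {f : Matrix (Fin q) (Fin p) ℂ → Matrix (Fin q') (Fin p') ℂ} (hf : PH f) (i0 : Fin q) (j0 : Fin p)
    (hp : q' < p) {x : Vec q p} (hx : 0 < hq x) : ∃ C ∈ Cst f (Fib x), C ≠ 0 := by
  obtain ⟨g, hg, -, h⟩ := stepB hf i0 j0 hp hx
  obtain ⟨C, hC, hC0⟩ := stepA (hf.comp_act hg) i0 j0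
  exact ⟨C, h ▸ hC, hC0⟩

/-- explicit point of the fibre -/
lemma exists_fib {x : Vec q p} (hx : 0 < hq x) : ∃ Z, Z ∈ Fib x := by
  have hq0 : 0 < q := by
    rcases Nat.eq_zero_or_pos q with rfl | h
    · exfalso
      have h1 := nsq_nonneg (x ∘ Sum.inr)
      have h2 : nsq (x ∘ Sum.inl) = 0 := by simp [nsq]
      have : hq x ≤ 0 := by simp only [hq]; linarith
      linarith
    · exact h
  obtain ⟨g, hg, c, hc, hgx⟩ := witt_pos (⟨0, hq0⟩ : Fin q) hx
  refine ⟨act g 0, ?_⟩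
  rw [← Fib_smul hc, ← hgx]
  exact act_Fib hg ⟨zero_mem_dom, on_eb_iff.2 (by simp)⟩

end stepB2

end

section

/-! ### Part 6: Taylor coefficients and separately rational functions -/

open Filter Topology Metric MeasureTheory
open scoped ContDiff

lemma diffOn_clm {D E F : Type} [NormedAddCommGroup D] [NormedSpace ℂ D] [NormedAddCommGroup E] [NormedSpace ℂ E] [FiniteDimensional ℂ E]
    [NormedAddCommGroup F] [NormedSpace ℂ F] {s : Set D} {f : D → E →L[ℂ] F}
    (h : ∀ v, DifferentiableOn ℂ (fun z => f z v) s) : DifferentiableOn ℂ f s := by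
  let b := Module.finBasis ℂ E
  have : f = fun z => ∑ i, ContinuousLinearMap.smulRightL ℂ E F (LinearMap.toContinuousLinearMap (b.coord i)) (f z (b i)) := by
    ext z v
    have h1 : f z v = f z (∑ i, b.repr v i • b i) := by rw [b.sum_repr]
    rw [h1, map_sum]
    simp [_root_.sum_apply]
  rw [this]
  exact DifferentiableOn.fun_sum fun i _ => (ContinuousLinearMap.differentiable _).comp_differentiableOn (h _)

lemma fderiv_diff {E F : Type} [NormedAddCommGroup E] [NormedSpace ℂ E] [FiniteDimensional ℂ E]
    [NormedAddCommGroup F] [NormedSpace ℂ F] [FiniteDimensional ℂ F] {s : Set E} (hs : IsOpen s) {f : E → F}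
    (hf : DifferentiableOn ℂ f s) : DifferentiableOn ℂ (fderiv ℂ f) s := by
  have : CompleteSpace F := FiniteDimensional.complete ℂ F
  refine diffOn_clm fun v => ?_
  intro z0 hz0
  apply DifferentiableAt.differentiableWithinAt
  have hfa : ∀ z ∈ s, DifferentiableAt ℂ f z := fun z hz => hf.differentiableAt (hs.mem_nhds hz)
  obtain ⟨R, hR, hRs⟩ : ∃ R > 0, ball z0 (4 * R) ⊆ s ∩ f ⁻¹' (closedBall (f z0) 1) := by
    have := (hfa z0 hz0).continuousAt (closedBall_mem_nhds (f z0) one_pos)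
    obtain ⟨R, hR, h⟩ := Metric.mem_nhds_iff.1 (inter_mem (hs.mem_nhds hz0) this)
    exact ⟨R / 4, by positivity, by convert h using 2; ring⟩
  have hfd : ∀ x ∈ ball z0 (2 * R), ‖fderiv ℂ f x‖ ≤ 2 / (2 * R) := by
    intro x hx
    have hsub : ball x (2 * R) ⊆ ball z0 (4 * R) := ball_subset_ball' (by rw [mem_ball] at hx; linarith)
    apply Complex.norm_fderiv_le_div_of_mapsTo_ball
    · exact hf.mono (hsub.trans fun y hy => (hRs hy).1)
    · intro y hy
      have h1 : f y ∈ closedBall (f z0) 1 := (hRs (hsub hy)).2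
      have h2 : f x ∈ closedBall (f z0) 1 := (hRs (hsub (mem_ball_self (by positivity)))).2
      rw [mem_closedBall] at *
      linarith [dist_triangle_right (f y) (f x) (f z0)]
    · positivity
  set r := R / (‖v‖ + 1) with hr
  have hr0 : 0 < r := by positivity
  have hrv : r * ‖v‖ < R := by
    rw [hr, div_mul_eq_mul_div, div_lt_iff₀ (by positivity)]; nlinarith [norm_nonneg v]
  have hmem : ∀ x ∈ ball z0 R, ∀ ζ : ℂ, ‖ζ‖ ≤ r → x + ζ • v ∈ ball z0 (2 * R) := by
    intro x hx ζ hζ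
    rw [mem_ball, dist_eq_norm] at *
    calc ‖x + ζ • v - z0‖ = ‖(x - z0) + ζ • v‖ := by congr 1; abel
      _ ≤ ‖x - z0‖ + ‖ζ‖ * ‖v‖ := (norm_add_le _ _).trans (by rw [norm_smul])
      _ < 2 * R := by nlinarith [norm_nonneg v]
  have hsub2 : ball z0 (2 * R) ⊆ s := fun y hy => (hRs (ball_subset_ball (by linarith) hy)).1
  have hcn : ∀ θ : ℝ, ‖circleMap 0 r θ‖ ≤ r := fun θ => by simp [abs_of_pos hr0]
  let κ : ℝ → ℂ := fun θ => deriv (circleMap 0 r) θ * ((circleMap 0 r θ - 0) ^ 2)⁻¹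
  have hκ : Continuous κ := by
    have h1 : ∀ θ, (circleMap 0 r θ - 0) ^ 2 ≠ 0 := fun θ => by simp [hr0.ne']
    have h2 : Continuous fun θ => (circleMap 0 r θ - 0) ^ 2 := by
      have := continuous_circleMap 0 r
      fun_prop
    have h3 : Continuous (deriv (circleMap 0 r)) := by
      have : deriv (circleMap 0 r) = fun θ => circleMap 0 r θ * Complex.I := by ext θ; simp
      rw [this]
      have := continuous_circleMap 0 r
      fun_prop
    exact h3.mul (h2.inv₀ h1)
  have hform : ∀ x ∈ ball z0 R, fderiv ℂ f x v = (2 * Real.pi * Complex.I : ℂ)⁻¹ •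
      ∫ θ in (0:ℝ)..2 * Real.pi, κ θ • f (x + circleMap 0 r θ • v) := by
    intro x hx
    have hl : Differentiable ℂ fun ζ : ℂ => x + ζ • v := by fun_prop
    have := Complex.two_pi_I_inv_smul_circleIntegral_sub_sq_inv_smul_of_differentiable
      (U := (fun ζ : ℂ => x + ζ • v) ⁻¹' s) (c := 0) (w₀ := 0) (R := r) (f := fun ζ => f (x + ζ • v)) (hs.preimage hl.continuous)
      (fun ζ hζ => hsub2 (hmem x hx ζ (by simpa using hζ)))
      (fun ζ hζ => ((hfa _ hζ).comp ζ (hl ζ)).differentiableWithinAt) (mem_ball_self hr0)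
    have h2 : deriv (fun ζ : ℂ => f (x + ζ • v)) 0 = fderiv ℂ f x v := by
      have h3 : HasDerivAt (fun ζ : ℂ => x + ζ • v) v 0 := by
        simpa using ((hasDerivAt_id (0:ℂ)).smul_const v).const_add x
      have h4 : HasFDerivAt f (fderiv ℂ f x) (x + (0:ℂ) • v) := by
        rw [zero_smul, add_zero]
        exact (hfa x (hsub2 (ball_subset_ball (by linarith) hx))).hasFDerivAt
      exact (h4.comp_hasDerivAt (0:ℂ) h3).deriv
    rw [← h2, ← this, circleIntegral]
    simp only [κ, smul_smul, mul_comm]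
  let _ : MeasurableSpace E := borel E
  have : BorelSpace E := ⟨rfl⟩
  have : ProperSpace E := FiniteDimensional.proper ℂ E
  have : SecondCountableTopology E := inferInstance
  have : SecondCountableTopology (E →L[ℂ] F) := by
    have : ProperSpace (E →L[ℂ] F) := FiniteDimensional.proper ℂ _
    infer_instance
  let _ : MeasurableSpace (E →L[ℂ] F) := borel _
  have : BorelSpace (E →L[ℂ] F) := ⟨rfl⟩
  have hcx : ∀ x, Continuous fun θ => x + circleMap 0 r θ • v := fun x => by
    have := continuous_circleMap 0 r
    fun_prop
  have hFc : ∀ x ∈ ball z0 R, Continuous fun θ => κ θ • f (x + circleMap 0 r θ • v) := by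
    intro x hx
    refine hκ.smul (continuous_iff_continuousAt.2 fun θ => ?_)
    exact ContinuousAt.comp (f := fun θ => x + circleMap 0 r θ • v) (hfa _ (hsub2 (hmem x hx _ (hcn θ)))).continuousAt (hcx x).continuousAt
  have hd := intervalIntegral.hasFDerivAt_integral_of_dominated_of_fderiv_le (𝕜 := ℂ) (μ := volume) (a := 0) (b := 2 * Real.pi)
    (F := fun x θ => κ θ • f (x + circleMap 0 r θ • v)) (F' := fun x θ => κ θ • fderiv ℂ f (x + circleMap 0 r θ • v))
    (x₀ := z0) (s := ball z0 R) (bound := fun θ => ‖κ θ‖ * (2 / (2 * R))) (ball_mem_nhds z0 hR)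
    (by
      filter_upwards [ball_mem_nhds z0 hR] with x hx
      exact (hFc x hx).aestronglyMeasurable)
    ((hFc z0 (mem_ball_self hR)).intervalIntegrable _ _)
    (by
      refine (hκ.aestronglyMeasurable).smul ?_
      exact ((measurable_fderiv ℂ f).comp (hcx z0).measurable).aestronglyMeasurable)
    (by
      refine Eventually.of_forall fun θ _ x hx => ?_
      rw [norm_smul]
      exact mul_le_mul_of_nonneg_left (hfd _ (hmem x hx _ (hcn θ))) (norm_nonneg _))
    ((hκ.norm.mul continuous_const).intervalIntegrable _ _)
    (by
      refine Eventually.of_forall fun θ _ x hx => ?_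
      refine HasFDerivAt.const_smul ?_ _
      have h1 := (hfa _ (hsub2 (hmem x hx _ (hcn θ)))).hasFDerivAt
      have h2 : HasFDerivAt (fun x => x + circleMap 0 r θ • v) (ContinuousLinearMap.id ℂ E) x :=
        (hasFDerivAt_id x).add_const _
      have h3 := h1.comp x h2
      rw [ContinuousLinearMap.comp_id] at h3
      exact h3)
  have := (hd.const_smul ((2 * Real.pi * Complex.I : ℂ)⁻¹)).differentiableAt
  refine this.congr_of_eventuallyEq ?_
  filter_upwards [ball_mem_nhds z0 hR] with x hx
  rw [hform x hx]; rfl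

lemma contDiff_of_diff {E F : Type} [NormedAddCommGroup E] [NormedSpace ℂ E] [FiniteDimensional ℂ E]
    [NormedAddCommGroup F] [NormedSpace ℂ F] [FiniteDimensional ℂ F] {s : Set E} (hs : IsOpen s) {f : E → F}
    (hf : DifferentiableOn ℂ f s) (n : ℕ) : ContDiffOn ℂ n f s := by
  induction n generalizing F with
  | zero => exact contDiffOn_zero.2 hf.continuousOn
  | succ n ih =>
    have := (contDiffOn_succ_iff_fderiv_of_isOpen (n := (n : WithTop ℕ∞)) hs (f := f)).2
      ⟨hf, fun h => absurd h (by simp), ih (fderiv_diff hs hf)⟩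
    exact_mod_cast this

/-- homogeneous Taylor coefficients -/
noncomputable def GT {E F : Type} [NormedAddCommGroup E] [NormedSpace ℂ E] [NormedAddCommGroup F] [NormedSpace ℂ F]
    (f : E → F) (k : ℕ) (u Z : E) : F := iteratedFDeriv ℂ k f Z (fun _ => u)

section GT
variable {E F : Type} [NormedAddCommGroup E] [NormedSpace ℂ E] [FiniteDimensional ℂ E]
    [NormedAddCommGroup F] [NormedSpace ℂ F] [FiniteDimensional ℂ F] {s : Set E} {f : E → F}

lemma GT_diff_aux (hs : IsOpen s) (hf : DifferentiableOn ℂ f s) (k : ℕ) {Z : E} (hZ : Z ∈ s) :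
    DifferentiableAt ℂ (iteratedFDeriv ℂ k f) Z := by
  have h1 : ContDiffAt ℂ (k + 1 : ℕ) f Z := (contDiff_of_diff hs hf (k+1)).contDiffAt (hs.mem_nhds hZ)
  exact h1.differentiableAt_iteratedFDeriv (by exact_mod_cast Nat.lt_succ_self k)

lemma GT_cont (hs : IsOpen s) (hf : DifferentiableOn ℂ f s) (k : ℕ) {u Z : E} (hZ : Z ∈ s) :
    ContinuousAt (fun x : E × E => GT f k x.1 x.2) (u, Z) := by
  have h1 := (GT_diff_aux hs hf k hZ).continuousAt
  have h2 : ContinuousAt (fun x : E × E => iteratedFDeriv ℂ k f x.2) (u, Z) :=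
    ContinuousAt.comp (f := fun x : E × E => x.2) (g := iteratedFDeriv ℂ k f) h1 continuous_snd.continuousAt
  have h3 : ContinuousAt (fun x : E × E => (fun _ : Fin k => x.1)) (u, Z) := by fun_prop
  have h4 : Continuous fun p : (ContinuousMultilinearMap ℂ (fun _ : Fin k => E) F) × (Fin k → E) => p.1 p.2 := by
    fun_prop
  exact ContinuousAt.comp (f := fun x : E × E => (iteratedFDeriv ℂ k f x.2, (fun _ : Fin k => x.1))) h4.continuousAt
    (h2.prodMk h3)

lemma GT_poly (k : ℕ) (u u1 Z : E) (ℓ : F →ₗ[ℂ] ℂ) :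
    ∃ P : Polynomial ℂ, P.natDegree ≤ k ∧ ∀ t : ℂ, ℓ (GT f k (u + t • u1) Z) = P.eval t := by
  classical
  refine ⟨∑ S : Finset (Fin k), Polynomial.C (ℓ (iteratedFDeriv ℂ k f Z (S.piecewise (fun _ => u) (fun _ => u1)))) *
    Polynomial.X ^ (Sᶜ.card), ?_, fun t => ?_⟩
  · refine Polynomial.natDegree_sum_le_of_forall_le _ _ fun S _ => ?_
    refine (Polynomial.natDegree_C_mul_X_pow_le _ _).trans ?_
    exact (Finset.card_le_univ _).trans (by simp)
  · have h1 : (fun _ : Fin k => u + t • u1) = (fun _ => u) + (fun _ => t • u1) := rfl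
    rw [GT, h1]
    have := (iteratedFDeriv ℂ k f Z).toMultilinearMap.map_add_univ (fun _ => u) (fun _ => t • u1)
    simp only [ContinuousMultilinearMap.coe_coe] at this
    rw [this, map_sum, Polynomial.eval_finsetSum]
    refine Finset.sum_congr rfl fun S _ => ?_
    have h2 : (S.piecewise (fun _ : Fin k => u) (fun _ => t • u1)) =
        fun i => (if i ∈ S then (1:ℂ) else t) • (S.piecewise (fun _ : Fin k => u) (fun _ => u1)) i := by
      ext i; by_cases hi : i ∈ S <;> simp [hi]
    rw [h2, ContinuousMultilinearMap.map_smul_univ, map_smul, Polynomial.eval_mul, Polynomial.eval_C, Polynomial.eval_pow,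
      Polynomial.eval_X, smul_eq_mul, mul_comm]
    congr 1
    rw [Finset.prod_ite]
    simp [Finset.compl_eq_univ_sdiff, Finset.filter_not]

lemma GT_iter (hs : IsOpen s) (hf : DifferentiableOn ℂ f s) (ℓ : F →L[ℂ] ℂ) (u Z : E) (k : ℕ) :
    ∀ ζ : ℂ, Z + ζ • u ∈ s → iteratedDeriv k (fun ζ : ℂ => ℓ (f (Z + ζ • u))) ζ = ℓ (GT f k u (Z + ζ • u)) := by
  induction k with
  | zero => intro ζ _; simp [GT]
  | succ k ih =>
    intro ζ hζ
    rw [iteratedDeriv_succ]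
    have hc : Continuous fun ζ : ℂ => Z + ζ • u := by fun_prop
    have he : iteratedDeriv k (fun ζ : ℂ => ℓ (f (Z + ζ • u))) =ᶠ[𝓝 ζ] fun ζ => ℓ (GT f k u (Z + ζ • u)) := by
      filter_upwards [hc.continuousAt.eventually (hs.mem_nhds hζ)] with ζ' h' using ih ζ' h'
    rw [he.deriv_eq]
    have h3 : HasDerivAt (fun ζ : ℂ => Z + ζ • u) u ζ := by
      simpa using ((hasDerivAt_id ζ).smul_const u).const_add Z
    have h4 := (GT_diff_aux hs hf k hζ).hasFDerivAt.comp_hasDerivAt ζ h3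
    have h5 := ((ContinuousMultilinearMap.apply ℂ (fun _ : Fin k => E) F (fun _ => u)).hasFDerivAt).comp_hasDerivAt ζ h4
    have h6 := (ℓ.hasFDerivAt).comp_hasDerivAt ζ h5
    have h7 := h6.deriv
    refine Eq.trans ?_ (h7.trans ?_)
    · rfl
    · simp only [GT, ContinuousMultilinearMap.apply_apply]
      rw [iteratedFDeriv_succ_apply_left]
      rfl

lemma GT_of_const (hs : IsOpen s) (hf : DifferentiableOn ℂ f s) (ℓ : F →L[ℂ] ℂ) {u Z : E} (hZ : Z ∈ s) {k : ℕ} (hk : k ≠ 0)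
    (h : ∀ ζ : ℂ, Z + ζ • u ∈ s → ℓ (f (Z + ζ • u)) = ℓ (f Z)) : ℓ (GT f k u Z) = 0 := by
  have h1 := GT_iter hs hf ℓ u Z k 0 (by simpa)
  rw [zero_smul, add_zero] at h1
  rw [← h1]
  have hc : Continuous fun ζ : ℂ => Z + ζ • u := by fun_prop
  have he : (fun ζ : ℂ => ℓ (f (Z + ζ • u))) =ᶠ[𝓝 0] fun _ => ℓ (f Z) := by
    filter_upwards [hc.continuousAt.eventually (hs.mem_nhds (by simpa : Z + (0:ℂ) • u ∈ s))] with ζ' h' using h ζ' h'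
  rw [he.iteratedDeriv_eq k, iteratedDeriv_const]
  simp [hk]

lemma GT_const (hs : IsOpen s) (hcv : Convex ℝ s) (hf : DifferentiableOn ℂ f s) (ℓ : F →L[ℂ] ℂ) {u Z : E} (hZ : Z ∈ s)
    (h : ∀ k, ℓ (GT f (k + 1) u Z) = 0) (hu : Z + u ∈ s) : ℓ (f (Z + u)) = ℓ (f Z) := by
  have hc : Continuous fun ζ : ℂ => Z + ζ • u := by fun_prop
  have hd : DifferentiableOn ℂ (fun ζ : ℂ => ℓ (f (Z + ζ • u))) ((fun ζ : ℂ => Z + ζ • u) ⁻¹' s) := by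
    have h1 : DifferentiableOn ℂ (fun ζ : ℂ => Z + ζ • u) ((fun ζ : ℂ => Z + ζ • u) ⁻¹' s) := by fun_prop
    exact ℓ.differentiable.comp_differentiableOn (hf.comp h1 fun _ h => h)
  obtain ⟨r, hr, hrs⟩ := Metric.isOpen_iff.1 (hs.preimage hc) 0 (by simpa using hZ)
  have hcvx : Convex ℝ ((fun ζ : ℂ => Z + ζ • u) ⁻¹' s) := by
    have := hcv.translate_preimage_left Z
    intro a ha b hb x y hx hy hxy
    have := hcv ha hb hx hy hxy
    simp only [Set.mem_preimage] at *
    convert this using 1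
    rw [smul_add, smul_add, add_add_add_comm, ← add_smul x y Z, hxy, one_smul, add_smul, smul_assoc, smul_assoc]
  have := ident' (hs.preimage hc) hcvx (hd.sub_const (ℓ (f Z))) (z0 := 0) (by simpa using hZ) (by
    filter_upwards [ball_mem_nhds (0:ℂ) hr] with ζ hζ
    have h2 := Complex.taylorSeries_eq_on_ball (hd.mono hrs) hζ
    rw [← h2, tsum_eq_single 0]
    · simp
    · intro k hk
      obtain ⟨k, rfl⟩ := Nat.exists_eq_succ_of_ne_zero hk
      have h1 := GT_iter hs hf ℓ u Z (k+1) 0 (by simpa)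
      rw [zero_smul, add_zero, h] at h1
      rw [Nat.succ_eq_add_one, h1]; simp) (z := 1) (by simpa using hu)
  rw [sub_eq_zero] at this
  simpa using this

end GT
lemma mv_ball_nonzero {n : ℕ} {P : MvPolynomial (Fin n) ℂ} (hP : P ≠ 0) (c : Fin n → ℂ) {r : ℝ} (hr : 0 < r) :
    ∃ x ∈ ball c r, MvPolynomial.eval x P ≠ 0 := by
  by_contra! h
  apply hP
  refine MvPolynomial.funext_set (fun i => ball (c i) r) (fun i => ?_) ?_
  · exact infinite_of_mem_nhds (c i) (ball_mem_nhds _ hr)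
  · intro x hx
    rw [h x (by rwa [ball_pi _ hr]), map_zero]

lemma mv_ball_sub {n : ℕ} {P : MvPolynomial (Fin n) ℂ} (hP : P ≠ 0) (c : Fin n → ℂ) {r : ℝ} (hr : 0 < r) :
    ∃ c' r', 0 < r' ∧ ball c' r' ⊆ ball c r ∧ ∀ x ∈ ball c' r', MvPolynomial.eval x P ≠ 0 := by
  obtain ⟨x, hx, h⟩ := mv_ball_nonzero hP c hr
  have hc : Continuous fun x => MvPolynomial.eval x P := MvPolynomial.continuous_eval P
  have h1 : ∀ᶠ y in 𝓝 x, MvPolynomial.eval y P ≠ 0 := hc.continuousAt.eventually_ne h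
  obtain ⟨r', hr', h2⟩ := Metric.mem_nhds_iff.1 (h1.and (isOpen_ball.mem_nhds hx))
  exact ⟨x, r', hr', fun y hy => (h2 hy).2, fun y hy => (h2 hy).1⟩

lemma mem_ball_cons {n : ℕ} {c : Fin (n + 1) → ℂ} {r : ℝ} (hr : 0 < r) (t : ℂ) (s : Fin n → ℂ) :
    (Fin.cons t s : Fin (n + 1) → ℂ) ∈ ball c r ↔ t ∈ ball (c 0) r ∧ s ∈ ball (Fin.tail c) r := by
  rw [ball_pi _ hr, ball_pi _ hr, Set.mem_univ_pi, Set.mem_univ_pi, Fin.forall_fin_succ]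
  rfl

set_option maxHeartbeats 1000000 in
lemma sepRat (D n : ℕ) : ∀ (ι : Type) [Fintype ι] (φ : ι → (Fin n → ℂ) → ℂ) (c : Fin n → ℂ) (r : ℝ), 0 < r →
    (∀ i, ContinuousOn (φ i) (ball c r)) →
    (∀ i, ∀ x ∈ ball c r, ∀ l, ∃ P Q : Polynomial ℂ, P.natDegree ≤ D ∧ Q.natDegree ≤ D ∧ Q ≠ 0 ∧
      ∀ t, Function.update x l t ∈ ball c r → Q.eval t * φ i (Function.update x l t) = P.eval t) →
    ∃ c' r', 0 < r' ∧ ball c' r' ⊆ ball c r ∧ ∃ P Q : ι → MvPolynomial (Fin n) ℂ, ∀ i, Q i ≠ 0 ∧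
      ∀ x ∈ ball c' r', MvPolynomial.eval x (Q i) * φ i x = MvPolynomial.eval x (P i) := by
  classical
  induction n with
  | zero =>
    intro ι _ φ c r hr _ _
    refine ⟨c, r, hr, subset_rfl, fun i => MvPolynomial.C (φ i c), fun i => 1, fun i => ⟨one_ne_zero, fun x _ => ?_⟩⟩
    simp [Subsingleton.elim x c]
  | succ n ih =>
    intro ι _ φ c r hr hcont hrat
    let T : Fin (2 * D + 1) → ℂ := fun j => c 0 + ((r / (2 * D + 2) * (j : ℕ) : ℝ) : ℂ)
    have hT : ∀ j, T j ∈ ball (c 0) r := by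
      intro j
      rw [mem_ball, dist_eq_norm]
      simp only [T, add_sub_cancel_left, Complex.norm_real]
      rw [Real.norm_of_nonneg (by positivity), div_mul_eq_mul_div, div_lt_iff₀ (by positivity)]
      have : ((j : ℕ) : ℝ) < 2 * D + 2 := by exact_mod_cast (by omega : (j : ℕ) < 2 * D + 2)
      nlinarith
    have hTi : Function.Injective T := by
      intro a b hab
      simp only [T, add_right_inj, Complex.ofReal_inj] at hab
      have h1 : r / (2 * D + 2) ≠ 0 := by positivity
      have := mul_left_cancel₀ h1 hab
      exact Fin.ext (by exact_mod_cast this)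
    obtain ⟨c1, r1, hr1, hsub1, P, Q, hPQ⟩ := ih (ι × Fin (2 * D + 1)) (fun ij s => φ ij.1 (Fin.cons (T ij.2) s)) (Fin.tail c) r hr
      (by
        intro ij
        refine (hcont ij.1).comp (Continuous.continuousOn (by fun_prop)) fun s hs => ?_
        exact (mem_ball_cons hr _ _).2 ⟨hT _, hs⟩)
      (by
        intro ij s hs l
        obtain ⟨P, Q, h1, h2, h3, h4⟩ := hrat ij.1 (Fin.cons (T ij.2) s) ((mem_ball_cons hr _ _).2 ⟨hT _, hs⟩) l.succ
        refine ⟨P, Q, h1, h2, h3, fun t ht => ?_⟩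
        have := h4 t (by rw [← Fin.cons_update]; exact (mem_ball_cons hr _ _).2 ⟨hT _, ht⟩)
        rwa [← Fin.cons_update] at this)
    have hprod : ∏ ij, Q ij ≠ 0 := Finset.prod_ne_zero_iff.2 fun ij _ => (hPQ ij).1
    obtain ⟨c2, r2, hr2, hsub2, hne⟩ := mv_ball_sub hprod c1 hr1
    have hne' : ∀ s ∈ ball c2 r2, ∀ ij, MvPolynomial.eval s (Q ij) ≠ 0 := by
      intro s hs ij
      have := hne s hs
      rw [map_prod] at this
      exact Finset.prod_ne_zero_iff.1 this ij (Finset.mem_univ _)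
    -- solve the linear systems
    have hsol : ∀ i, ∃ ab : Fin (D + 1) ⊕ Fin (D + 1) → MvPolynomial (Fin n) ℂ, ab ≠ 0 ∧ ∀ j,
        Q (i, j) * ∑ k : Fin (D + 1), ab (Sum.inl k) * MvPolynomial.C (T j ^ (k : ℕ)) =
        P (i, j) * ∑ k : Fin (D + 1), ab (Sum.inr k) * MvPolynomial.C (T j ^ (k : ℕ)) := by
      intro i
      let M : Matrix (Fin (2 * D + 1)) (Fin (D + 1) ⊕ Fin (D + 1)) (MvPolynomial (Fin n) ℂ) := of fun j =>
        Sum.elim (fun k => Q (i, j) * MvPolynomial.C (T j ^ (k : ℕ))) (fun k => - P (i, j) * MvPolynomial.C (T j ^ (k : ℕ)))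
      have hni : ¬ Function.Injective M.mulVecLin := by
        intro hinj
        have := card_le_of_injective (MvPolynomial (Fin n) ℂ) M.mulVecLin hinj
        simp at this
        omega
      rw [injective_iff_map_eq_zero] at hni
      push Not at hni
      obtain ⟨ab, h1, h2⟩ := hni
      refine ⟨ab, h2, fun j => ?_⟩
      have := congrFun h1 j
      simp only [mulVecLin_apply, mulVec, dotProduct, Fintype.sum_sum_type, M, of_apply, Sum.elim_inl, Sum.elim_inr, Pi.zero_apply] at this
      rw [← sub_eq_zero, Finset.mul_sum, Finset.mul_sum, ← this, sub_eq_add_neg, ← Finset.sum_neg_distrib]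
      congr 1 <;> exact Finset.sum_congr rfl fun k _ => by ring
    choose ab hab0 hab using hsol
    let pa : ι → (Fin n → ℂ) → Polynomial ℂ := fun i s =>
      ∑ k : Fin (D + 1), Polynomial.C (MvPolynomial.eval s (ab i (Sum.inl k))) * Polynomial.X ^ (k : ℕ)
    let pb : ι → (Fin n → ℂ) → Polynomial ℂ := fun i s =>
      ∑ k : Fin (D + 1), Polynomial.C (MvPolynomial.eval s (ab i (Sum.inr k))) * Polynomial.X ^ (k : ℕ)
    have hpad : ∀ i s, (pa i s).natDegree ≤ D := fun i s =>
      Polynomial.natDegree_sum_le_of_forall_le _ _ fun k _ =>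
        (Polynomial.natDegree_C_mul_X_pow_le _ _).trans (by omega)
    have hpbd : ∀ i s, (pb i s).natDegree ≤ D := fun i s =>
      Polynomial.natDegree_sum_le_of_forall_le _ _ fun k _ =>
        (Polynomial.natDegree_C_mul_X_pow_le _ _).trans (by omega)
    have hcoef : ∀ (v : Fin (D + 1) → ℂ), (∑ k : Fin (D + 1), Polynomial.C (v k) * Polynomial.X ^ (k : ℕ) : Polynomial ℂ) = 0 →
        ∀ k, v k = 0 := by
      intro v hv k
      have := congrArg (fun p => Polynomial.coeff p k) hv
      simp only [Polynomial.finsetSum_coeff, Polynomial.coeff_C_mul, Polynomial.coeff_X_pow, Polynomial.coeff_zero] at this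
      rw [Finset.sum_eq_single k] at this
      · simpa using this
      · intro b _ hb
        have : (k : ℕ) ≠ b := fun h => hb (Fin.ext h.symm)
        simp [this]
      · simp
    -- the key identity
    have hkey : ∀ i, ∀ s ∈ ball c2 r2, ∃ Qs : Polynomial ℂ, ∃ Ps : Polynomial ℂ, Qs ≠ 0 ∧ pa i s * Qs = Ps * pb i s ∧
        ∀ t ∈ ball (c 0) r, Qs.eval t * φ i (Fin.cons t s) = Ps.eval t := by
      intro i s hs
      have hs' := hsub1 (hsub2 hs)
      obtain ⟨Ps, Qs, h1, h2, h3, h4⟩ := hrat i (Fin.cons (c 0) s) ((mem_ball_cons hr _ _).2 ⟨mem_ball_self hr, hs'⟩) 0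
      have h5 : ∀ t ∈ ball (c 0) r, Qs.eval t * φ i (Fin.cons t s) = Ps.eval t := by
        intro t ht
        have := h4 t (by rw [Fin.update_cons_zero]; exact (mem_ball_cons hr _ _).2 ⟨ht, hs'⟩)
        rwa [Fin.update_cons_zero] at this
      refine ⟨Qs, Ps, h3, ?_, h5⟩
      rw [← sub_eq_zero]
      refine Polynomial.eq_zero_of_natDegree_lt_card_of_eval_eq_zero _ hTi (fun j => ?_) ?_
      · have e1 := congrArg (MvPolynomial.eval s) (hab i j)
        simp only [map_mul, map_sum, MvPolynomial.eval_C] at e1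
        have e2 := (hPQ (i, j)).2 s (hsub2 hs)
        have e3 := h5 (T j) (hT j)
        have e4 := hne' s hs (i, j)
        have e5 : (pa i s).eval (T j) = ∑ k : Fin (D + 1), MvPolynomial.eval s (ab i (Sum.inl k)) * T j ^ (k : ℕ) := by
          simp [pa, Polynomial.eval_finsetSum]
        have e6 : (pb i s).eval (T j) = ∑ k : Fin (D + 1), MvPolynomial.eval s (ab i (Sum.inr k)) * T j ^ (k : ℕ) := by
          simp [pb, Polynomial.eval_finsetSum]
        rw [← e5, ← e6] at e1
        rw [Polynomial.eval_sub, Polynomial.eval_mul, Polynomial.eval_mul]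
        refine mul_left_cancel₀ e4 ?_
        rw [← e3]
        simp only at e2
        rw [mul_zero]
        linear_combination (Polynomial.eval (T j) Qs) * e1 - Polynomial.eval (T j) Qs * Polynomial.eval (T j) (pb i s) * e2
      · rw [Fintype.card_fin]
        refine Nat.lt_succ_of_le ((Polynomial.natDegree_sub_le _ _).trans (max_le ?_ ?_))
        · exact Polynomial.natDegree_mul_le.trans (by have := hpad i s; omega)
        · exact Polynomial.natDegree_mul_le.trans (by have := hpbd i s; omega)
    have hr3 : 0 < min r r2 := lt_min hr hr2
    have hmem : ∀ x ∈ ball (Fin.cons (c 0) c2 : Fin (n + 1) → ℂ) (min r r2), x 0 ∈ ball (c 0) r ∧ Fin.tail x ∈ ball c2 r2 := by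
      intro x hx
      rw [← Fin.cons_self_tail x, mem_ball_cons hr3] at hx
      exact ⟨ball_subset_ball (min_le_left _ _) hx.1, ball_subset_ball (min_le_right _ _) hx.2⟩
    refine ⟨Fin.cons (c 0) c2, min r r2, hr3, ?_,
      fun i => ∑ k : Fin (D + 1), MvPolynomial.rename Fin.succ (ab i (Sum.inl k)) * MvPolynomial.X 0 ^ (k : ℕ),
      fun i => ∑ k : Fin (D + 1), MvPolynomial.rename Fin.succ (ab i (Sum.inr k)) * MvPolynomial.X 0 ^ (k : ℕ), fun i => ⟨?_, ?_⟩⟩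
    · intro x hx
      obtain ⟨h1, h2⟩ := hmem x hx
      rw [← Fin.cons_self_tail x, mem_ball_cons hr]
      exact ⟨h1, hsub1 (hsub2 h2)⟩
    · intro h0
      have hb : ∀ s, pb i s = 0 := by
        intro s
        refine Polynomial.funext fun t => ?_
        have := congrArg (MvPolynomial.eval (Fin.cons t s : Fin (n + 1) → ℂ)) h0
        simp only [map_sum, map_mul, MvPolynomial.eval_rename, map_pow, MvPolynomial.eval_X, Fin.cons_zero, map_zero] at this
        simp only [pb, Polynomial.eval_finsetSum, Polynomial.eval_mul, Polynomial.eval_C, Polynomial.eval_pow, Polynomial.eval_X,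
          Polynomial.eval_zero]
        rw [← this]
        refine Finset.sum_congr rfl fun k _ => ?_
        congr 1
      apply hab0 i
      ext1 k
      rcases k with k | k
      · by_contra hk
        obtain ⟨s, hs, hs0⟩ := mv_ball_nonzero hk c2 hr2
        obtain ⟨Qs, Ps, h1, h2, -⟩ := hkey i s hs
        rw [hb s, mul_zero] at h2
        have h3 := (mul_eq_zero.1 h2).resolve_right h1
        exact hs0 (hcoef _ h3 k)
      · refine MvPolynomial.funext fun s => ?_
        rw [Pi.zero_apply, map_zero]
        exact hcoef _ (hb s) k
    · intro x hx
      obtain ⟨hx0, hxs⟩ := hmem x hx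
      obtain ⟨Qs, Ps, h1, h2, h3⟩ := hkey i _ hxs
      have ev : ∀ t, (pb i (Fin.tail x)).eval t = ∑ k : Fin (D + 1), MvPolynomial.eval (Fin.tail x) (ab i (Sum.inr k)) * t ^ (k : ℕ) := by
        intro t; simp [pb, Polynomial.eval_finsetSum]
      have ev' : ∀ t, (pa i (Fin.tail x)).eval t = ∑ k : Fin (D + 1), MvPolynomial.eval (Fin.tail x) (ab i (Sum.inl k)) * t ^ (k : ℕ) := by
        intro t; simp [pa, Polynomial.eval_finsetSum]
      simp only [map_sum, map_mul, MvPolynomial.eval_rename, map_pow, MvPolynomial.eval_X]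
      have e0 : x ∘ Fin.succ = Fin.tail x := rfl
      rw [e0, ← ev, ← ev']
      -- continuity
      let ψ : ℂ → ℂ := fun t => (pb i (Fin.tail x)).eval t * φ i (Fin.cons t (Fin.tail x)) - (pa i (Fin.tail x)).eval t
      have hψc : ContinuousOn ψ (ball (c 0) r) := by
        refine ContinuousOn.sub (ContinuousOn.mul (Polynomial.continuous _).continuousOn ?_) (Polynomial.continuous _).continuousOn
        refine (hcont i).comp (Continuous.continuousOn (by fun_prop)) fun t ht => ?_
        exact (mem_ball_cons hr _ _).2 ⟨ht, hsub1 (hsub2 hxs)⟩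
      have hψ0 : ψ (x 0) = 0 := by
        have hca : ContinuousAt ψ (x 0) := hψc.continuousAt (isOpen_ball.mem_nhds hx0)
        have hev : ∀ᶠ t in 𝓝[≠] (x 0), ψ t = 0 := by
          have hfin : ∀ᶠ t in 𝓝[≠] (x 0), Qs.eval t ≠ 0 := by
            have := (Qs.roots.toFinset.erase (x 0)).finite_toSet.isClosed.isOpen_compl.mem_nhds (x := x 0) (by simp)
            filter_upwards [nhdsWithin_le_nhds this, eventually_mem_nhdsWithin] with t ht ht' h
            apply ht
            simp only [Finset.coe_erase, Set.mem_sdiff, Finset.mem_coe, Multiset.mem_toFinset, Set.mem_singleton_iff]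
            exact ⟨(Polynomial.mem_roots h1).2 h, ht'⟩
          filter_upwards [hfin, nhdsWithin_le_nhds (isOpen_ball.mem_nhds hx0)] with t ht htb
          refine mul_left_cancel₀ ht ?_
          have e1 := h3 t htb
          have e2 := congrArg (Polynomial.eval t) h2
          simp only [Polynomial.eval_mul] at e2
          simp only [ψ]
          linear_combination (Polynomial.eval t (pb i (Fin.tail x))) * e1 - e2
        exact tendsto_nhds_unique (hca.tendsto.mono_left nhdsWithin_le_nhds) (tendsto_nhds_of_eventually_eq hev)
      have := sub_eq_zero.1 hψ0
      rwa [Fin.cons_self_tail] at this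

end

section

/-! ### Part 7: polynomial sections -/

open Filter Topology Metric

section P7
variable {q p q' p' : ℕ}

/-- linear functional `W ↦ (C ᵥ* W) j` -/
noncomputable def colF (C : Fin q' → ℂ) (j : Fin p') : Matrix (Fin q') (Fin p') ℂ →L[ℂ] ℂ :=
  LinearMap.toContinuousLinearMap
    { toFun := fun W => (C ᵥ* W) j
      map_add' := fun a b => by simp [vecMul_add]
      map_smul' := fun c a => by simp [vecMul_smul] }

@[simp] lemma colF_apply (C : Fin q' → ℂ) (j : Fin p') (W) : colF C j W = (C ᵥ* W) j := rfl

lemma Cst_GT_mp {f : Matrix (Fin q) (Fin p) ℂ → Matrix (Fin q') (Fin p') ℂ} (hf : DifferentiableOn ℂ f (typeIDomain q p))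
    {x : Vec q p} {Z U : Matrix (Fin q) (Fin p) ℂ} (hZ : Z ∈ Fib x) (hU : (x ∘ Sum.inl) ᵥ* U = 0) {C}
    (hC : C ∈ Cst f (Fib x)) (k : ℕ) : C ᵥ* GT f (k + 1) U Z = 0 := by
  ext j
  refine GT_of_const (isOpen_dom) hf (colF C j) hZ.1 (Nat.succ_ne_zero k) fun ζ hζ => ?_
  have : Z + ζ • U ∈ Fib x := ⟨hζ, by
    have := hZ.2
    unfold On at *
    rw [vecMul_add, vecMul_smul, hU, smul_zero, add_zero, this]⟩
  exact congrFun (hC _ this _ hZ) j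

lemma Cst_GT_iff {f : Matrix (Fin q) (Fin p) ℂ → Matrix (Fin q') (Fin p') ℂ} (hf : DifferentiableOn ℂ f (typeIDomain q p))
    {x : Vec q p} {Z : Matrix (Fin q) (Fin p) ℂ} (hZ : Z ∈ Fib x) {C} :
    C ∈ Cst f (Fib x) ↔ ∀ k U, (x ∘ Sum.inl) ᵥ* U = 0 → C ᵥ* GT f (k + 1) U Z = 0 := by
  refine ⟨fun h k U hU => Cst_GT_mp hf hZ hU h k, fun h => (Cst_iff_base hZ).2 fun Z' hZ' j => ?_⟩
  have h1 : (x ∘ Sum.inl) ᵥ* (Z' - Z) = 0 := by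
    rw [vecMul_sub, hZ'.2, hZ.2, sub_self]
  have h2 := GT_const (isOpen_dom) convex_dom hf (colF C j) hZ.1
    (fun k => congrFun (h k _ h1) j) (u := Z' - Z) (by simpa using hZ'.1)
  simp only [add_sub_cancel, colF_apply] at h2
  show C ⬝ᵥ (fun i => f Z' i j - f Z i j) = 0
  have h3 : C ⬝ᵥ (fun i => f Z' i j - f Z i j) = (C ᵥ* f Z') j - (C ᵥ* f Z) j := by
    simp [vecMul, dotProduct, mul_sub]
  rw [h3, sub_eq_zero]
  exact h2

/-- correct `Z` in direction `α` so that `a` gets mapped to `b` -/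
noncomputable def corr (Z : Matrix (Fin q) (Fin p) ℂ) (α a : Fin q → ℂ) (b : Fin p → ℂ) : Matrix (Fin q) (Fin p) ℂ :=
  Z + vecMulVec α ((a ⬝ᵥ α)⁻¹ • (b - a ᵥ* Z))

lemma vmv' (c α : Fin q → ℂ) (b : Fin p → ℂ) : c ᵥ* vecMulVec α b = (c ⬝ᵥ α) • b := by
  ext j; simp [vecMul, dotProduct, vecMulVec_apply, Finset.sum_mul, mul_assoc]

lemma corr_self {Z : Matrix (Fin q) (Fin p) ℂ} {α a : Fin q → ℂ} {b : Fin p → ℂ} (h : a ⬝ᵥ α ≠ 0) :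
    a ᵥ* corr Z α a b = b := by
  rw [corr, vecMul_add, vmv', smul_smul, mul_inv_cancel₀ h, one_smul, add_sub_cancel]

lemma corr_other {Z : Matrix (Fin q) (Fin p) ℂ} {α a c : Fin q → ℂ} {b : Fin p → ℂ} (h : c ⬝ᵥ α = 0) :
    c ᵥ* corr Z α a b = c ᵥ* Z := by
  rw [corr, vecMul_add, vmv', h, zero_smul, add_zero]

lemma corr_id {Z : Matrix (Fin q) (Fin p) ℂ} {α a : Fin q → ℂ} {b : Fin p → ℂ} (h : a ᵥ* Z = b) :
    corr Z α a b = Z := by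
  have : vecMulVec α (0 : Fin p → ℂ) = 0 := by ext; simp [vecMulVec_apply]
  rw [corr, h, sub_self, smul_zero, this, add_zero]

lemma corr_cont {H : Type*} [TopologicalSpace H] {Z : H → Matrix (Fin q) (Fin p) ℂ} {α a : H → Fin q → ℂ}
    {b : H → Fin p → ℂ} {h : H} (hZ : ContinuousAt Z h) (hα : ContinuousAt α h) (ha : ContinuousAt a h)
    (hb : ContinuousAt b h) (h0 : a h ⬝ᵥ α h ≠ 0) : ContinuousAt (fun h => corr (Z h) (α h) (a h) (b h)) h := by
  have hdot : ContinuousAt (fun h => a h ⬝ᵥ α h) h := by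
    have : Continuous fun x : (Fin q → ℂ) × (Fin q → ℂ) => x.1 ⬝ᵥ x.2 := by fun_prop
    exact this.continuousAt.comp (ha.prodMk hα)
  have hvm : ContinuousAt (fun h => a h ᵥ* Z h) h := by
    have : Continuous fun x : (Fin q → ℂ) × (Matrix (Fin q) (Fin p) ℂ) => x.1 ᵥ* x.2 := by fun_prop
    exact this.continuousAt.comp (ha.prodMk hZ)
  have h1 : ContinuousAt (fun h => (a h ⬝ᵥ α h)⁻¹ • (b h - a h ᵥ* Z h)) h := (hdot.inv₀ h0).smul (hb.sub hvm)
  have h2 : ContinuousAt (fun h => vecMulVec (α h) ((a h ⬝ᵥ α h)⁻¹ • (b h - a h ᵥ* Z h))) h := by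
    have : Continuous fun x : (Fin q → ℂ) × (Fin p → ℂ) => vecMulVec x.1 x.2 := by
      refine continuous_matrix fun i j => ?_
      simp only [vecMulVec_apply]
      fun_prop
    exact this.continuousAt.comp (hα.prodMk h1)
  exact hZ.add h2

/-- Cramer's rule along a polynomial curve, with uniform degree bound -/
lemma cramer_poly {n e : ℕ} (Y : Matrix (Fin e) (Fin n) ℂ) (c : Fin n → ℂ) (K : ℕ) :
    ∃ D : ℕ, ∀ W : Fin n → Fin e → Polynomial ℂ, (∀ i r, (W i r).natDegree ≤ K) →
      ∃ (Q : Polynomial ℂ) (P : Fin n → Polynomial ℂ), Q.natDegree ≤ D ∧ (∀ i, (P i).natDegree ≤ D) ∧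
        ∀ t, Q.eval t = (Y * (of fun i r => (W i r).eval t)).det ∧
          ∀ C : Fin n → ℂ, (∃ y, C = c + y ᵥ* Y) → C ᵥ* (of fun i r => (W i r).eval t) = 0 →
            ∀ i, Q.eval t * C i = (P i).eval t := by
  classical
  let Wg : Matrix (Fin n) (Fin e) (MvPolynomial (Fin n × Fin e) ℂ) := of fun i r => MvPolynomial.X (i, r)
  let Yg : Matrix (Fin e) (Fin n) (MvPolynomial (Fin n × Fin e) ℂ) := Y.map MvPolynomial.C
  let cg : Fin n → MvPolynomial (Fin n × Fin e) ℂ := fun i => MvPolynomial.C (c i)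
  let Qg : MvPolynomial (Fin n × Fin e) ℂ := (Yg * Wg).det
  let Pg : Fin n → MvPolynomial (Fin n × Fin e) ℂ := Qg • cg - cg ᵥ* (Wg * (Yg * Wg).adjugate * Yg)
  let m := Qg.totalDegree + ∑ i, (Pg i).totalDegree
  refine ⟨m * K, fun W hW => ⟨MvPolynomial.aeval (fun x => W x.1 x.2) Qg, fun i => MvPolynomial.aeval (fun x => W x.1 x.2) (Pg i), ?_, ?_, ?_⟩⟩
  · exact MvPolynomial.aeval_natDegree_le Qg (Nat.le_add_right _ _) _ fun x => hW _ _
  · intro i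
    refine MvPolynomial.aeval_natDegree_le (Pg i) ?_ _ fun x => hW _ _
    exact (Finset.single_le_sum (f := fun i => (Pg i).totalDegree) (fun _ _ => Nat.zero_le _) (Finset.mem_univ i)).trans (Nat.le_add_left _ _)
  · intro t
    let W1 : Matrix (Fin n) (Fin e) ℂ := of fun i r => (W i r).eval t
    let φ : MvPolynomial (Fin n × Fin e) ℂ →+* ℂ :=
      (Polynomial.evalRingHom t).comp (MvPolynomial.aeval (R := ℂ) (fun x : Fin n × Fin e => W x.1 x.2)).toRingHom
    have hφ : ∀ F, φ F = Polynomial.eval t (MvPolynomial.aeval (fun x => W x.1 x.2) F) := fun F => rfl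
    have hW1 : Wg.map φ = W1 := by
      ext i r; simp [Wg, W1, hφ]
    have hY1 : Yg.map φ = Y := by
      ext i r; simp [Yg, hφ]
    have hc1 : φ ∘ cg = c := by
      ext i; simp [cg, hφ]
    have hYW : (Yg * Wg).map φ = Y * W1 := by rw [Matrix.map_mul, hY1, hW1]
    have hQ : φ Qg = (Y * W1).det := by
      rw [RingHom.map_det, RingHom.mapMatrix_apply, hYW]
    refine ⟨hQ, ?_⟩
    rintro C ⟨y, rfl⟩ hC i
    have hP : φ (Pg i) = (Y * W1).det * c i - (c ᵥ* (W1 * (Y * W1).adjugate * Y)) i := by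
      have h1 : φ ((cg ᵥ* (Wg * (Yg * Wg).adjugate * Yg)) i) = (c ᵥ* (W1 * (Y * W1).adjugate * Y)) i := by
        rw [RingHom.map_vecMul, hc1, Matrix.map_mul, Matrix.map_mul, hY1, hW1]
        have := RingHom.map_adjugate φ (Yg * Wg)
        rw [RingHom.mapMatrix_apply, RingHom.mapMatrix_apply, hYW] at this
        rw [this]
      have h2 : φ (cg i) = c i := congrFun hc1 i
      rw [← h1, ← hQ, ← h2]
      simp [Pg]
    rw [← hφ, ← hφ, hP, hQ]
    have h3 : c ᵥ* W1 = - ((y ᵥ* Y) ᵥ* W1) := by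
      rw [add_vecMul] at hC
      exact eq_neg_of_add_eq_zero_left hC
    have h4 : c ᵥ* (W1 * (Y * W1).adjugate * Y) = - ((Y * W1).det • (y ᵥ* Y)) := by
      have h5 : (y ᵥ* Y) ᵥ* W1 = y ᵥ* (Y * W1) := vecMul_vecMul _ _ _
      have h6 : y ᵥ* (Y * W1) ᵥ* (Y * W1).adjugate = (Y * W1).det • y := by
        rw [vecMul_vecMul, mul_adjugate, vecMul_smul, vecMul_one]
      rw [← vecMul_vecMul, ← vecMul_vecMul, h3, neg_vecMul, neg_vecMul, h5, h6, smul_vecMul]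
    rw [h4]
    simp
    ring

end P7
section P7b
variable {q p q' p' : ℕ}

lemma exists_perp (h2q : 2 ≤ q) (A : Fin q → ℂ) : ∃ α : Fin q → ℂ, A ⬝ᵥ α = 0 ∧ α ≠ 0 := by
  have h : LinearMap.ker (dotProductBilin ℂ ℂ A : (Fin q → ℂ) →ₗ[ℂ] ℂ) ≠ ⊥ :=
    LinearMap.ker_ne_bot_of_finrank_lt (by simp; omega)
  obtain ⟨α, hα, h0⟩ := Submodule.exists_mem_ne_zero_of_ne_bot h
  exact ⟨α, by simpa using hα, h0⟩

lemma cont_fst {X Y Z : Type*} [TopologicalSpace X] [TopologicalSpace Y] [TopologicalSpace Z] {g : X → Z} {a : X}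
    (b : Y) (h : ContinuousAt g a) : ContinuousAt (fun x : X × Y => g x.1) (a, b) :=
  h.comp_of_eq continuous_fst.continuousAt rfl

lemma GT_cont_comp {H : Type*} [TopologicalSpace H] {f : Matrix (Fin q) (Fin p) ℂ → Matrix (Fin q') (Fin p') ℂ}
    (hf : DifferentiableOn ℂ f (typeIDomain q p)) (k : ℕ) {u z : H → Matrix (Fin q) (Fin p) ℂ} {h : H}
    (hu : ContinuousAt u h) (hz : ContinuousAt z h) (h0 : z h ∈ typeIDomain q p) :
    ContinuousAt (fun h => GT f k (u h) (z h)) h :=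
  (GT_cont isOpen_dom hf k (u := u h) h0).comp_of_eq (hu.prodMk hz) rfl

lemma GT_cont_comp' {H : Type*} [TopologicalSpace H] {f : Matrix (Fin q) (Fin p) ℂ → Matrix (Fin q') (Fin p') ℂ}
    (hf : DifferentiableOn ℂ f (typeIDomain q p)) (k : ℕ) {u z : H → Matrix (Fin q) (Fin p) ℂ} {h : H}
    (hu : ContinuousAt u h) (hz : ContinuousAt z h) (h0 : z h ∈ typeIDomain q p) (i j) :
    ContinuousAt (fun h => GT f k (u h) (z h) i j) h := by
  have h5 : Continuous fun M : Matrix (Fin q') (Fin p') ℂ => M i j := by fun_prop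
  exact h5.continuousAt.comp (GT_cont_comp hf k hu hz h0)

lemma cont_inl : Continuous fun x : Vec q p => (x ∘ Sum.inl : Fin q → ℂ) := by
  unfold Vec; fun_prop
lemma cont_inr : Continuous fun x : Vec q p => (x ∘ Sum.inr : Fin p → ℂ) := by
  unfold Vec; fun_prop

set_option maxHeartbeats 1600000 in
lemma stepC_local {f : Matrix (Fin q) (Fin p) ℂ → Matrix (Fin q') (Fin p') ℂ} (hf : PH f) (h2q : 2 ≤ q)
    {x0 : Vec q p} (hx0 : 0 < hq x0)
    (hmin : ∀ x, 0 < hq x → Module.finrank ℂ (Cst f (Fib x0)) ≤ Module.finrank ℂ (Cst f (Fib x))) :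
    ∃ (v0 : Vec q p) (D k : ℕ) (φ : Fin k → Vec q p → (Fin q' ⊕ Fin p') → ℂ) (N1 N2 : Set (Vec q p)),
      IsOpen N1 ∧ IsOpen N2 ∧ x0 ∈ N1 ∧ v0 ∈ N2 ∧
      (∀ i s, ContinuousOn (fun x => φ i x s) N1) ∧
      (∀ x ∈ N1, 0 < hq x ∧ LinearIndependent ℂ (fun i => φ i x ∘ Sum.inl) ∧
        Cst f (Fib x) ≤ Submodule.span ℂ (Set.range fun i => φ i x ∘ Sum.inl) ∧
        ∀ i, ∀ Z ∈ Fib x, On (φ i x) (f Z)) ∧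
      (∀ i s, ∀ x ∈ N1, ∀ v ∈ N2, ∃ P Q : Polynomial ℂ, P.natDegree ≤ D ∧ Q.natDegree ≤ D ∧ Q ≠ 0 ∧
        ∀ t : ℂ, x + t • v ∈ N1 → Q.eval t * φ i (x + t • v) s = P.eval t) := by
  classical
  obtain ⟨Z0, hZ0⟩ := exists_fib hx0
  set A0 : Fin q → ℂ := x0 ∘ Sum.inl with hA0
  have hA0n : A0 ⬝ᵥ star A0 ≠ 0 := by
    rw [dot_star_self]
    have : 0 < nsq A0 := by
      unfold hq at hx0
      have := nsq_nonneg (x0 ∘ Sum.inr)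
      linarith
    exact_mod_cast this.ne'
  obtain ⟨α0, hα0, hα0n⟩ := exists_perp h2q A0
  let a0 : Fin q → ℂ := star α0
  have ha0 : a0 ⬝ᵥ α0 ≠ 0 := by
    simp only [a0]
    rw [star_dot_self]
    exact_mod_cast (nsq_pos hα0n).ne'
  let v0 : Vec q p := gv a0 Z0
  let ZZ : Vec q p → Matrix (Fin q) (Fin p) ℂ := fun x => corr Z0 (star A0) (x ∘ Sum.inl) (x ∘ Sum.inr)
  let UU : Matrix (Fin q) (Fin p) ℂ → Vec q p → Matrix (Fin q) (Fin p) ℂ := fun U x => corr U (star A0) (x ∘ Sum.inl) 0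
  let α : Vec q p → Fin q → ℂ := fun x => α0 - (((x ∘ Sum.inl) ⬝ᵥ star A0)⁻¹ * ((x ∘ Sum.inl) ⬝ᵥ α0)) • star A0
  let Z1 : Vec q p × Vec q p → Matrix (Fin q) (Fin p) ℂ := fun x =>
    corr (ZZ x.1) (α x.1) (x.2 ∘ Sum.inl) (x.2 ∘ Sum.inr)
  have hZZ0 : ZZ x0 = Z0 := corr_id hZ0.2
  have hα00 : α x0 = α0 := by
    simp only [α]; rw [← hA0, hα0, mul_zero, zero_smul, sub_zero]
  have hZ10 : Z1 (x0, v0) = Z0 := by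
    simp only [Z1, hZZ0]; exact corr_id (on_gv a0 Z0)
  have hUU0 : ∀ U, A0 ᵥ* U = 0 → UU U x0 = U := fun U hU => corr_id hU
  have hdotc : ∀ b : Fin q → ℂ, Continuous fun x : Vec q p => (x ∘ Sum.inl) ⬝ᵥ b := by
    intro b
    have : Continuous fun x : Fin q → ℂ => x ⬝ᵥ b := by fun_prop
    exact this.comp cont_inl
  have hZZc : ∀ x : Vec q p, (x ∘ Sum.inl) ⬝ᵥ star A0 ≠ 0 → ContinuousAt ZZ x := fun x hx =>
    corr_cont continuousAt_const continuousAt_const cont_inl.continuousAt cont_inr.continuousAt hx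
  have hUUc : ∀ U, ∀ x : Vec q p, (x ∘ Sum.inl) ⬝ᵥ star A0 ≠ 0 → ContinuousAt (UU U) x := fun U x hx =>
    corr_cont continuousAt_const continuousAt_const cont_inl.continuousAt continuousAt_const hx
  have hαc : ∀ x : Vec q p, (x ∘ Sum.inl) ⬝ᵥ star A0 ≠ 0 → ContinuousAt α x := fun x hx =>
    continuousAt_const.sub ((((hdotc _).continuousAt.inv₀ hx).mul (hdotc _).continuousAt).smul continuousAt_const)
  have hAα : ∀ x : Vec q p, (x ∘ Sum.inl) ⬝ᵥ star A0 ≠ 0 → (x ∘ Sum.inl) ⬝ᵥ α x = 0 := by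
    intro x hx
    simp only [α, dotProduct_sub, dotProduct_smul, smul_eq_mul]
    field_simp
    ring
  have hA : ∀ᶠ x : Vec q p in 𝓝 x0, (x ∘ Sum.inl) ⬝ᵥ star A0 ≠ 0 := (hdotc _).continuousAt.eventually_ne hA0n
  have hZZm : ∀ᶠ x : Vec q p in 𝓝 x0, ZZ x ∈ typeIDomain q p :=
    (hZZc x0 hA0n).eventually (isOpen_dom.mem_nhds (by rw [hZZ0]; exact hZ0.1))
  have hZZF : ∀ x : Vec q p, (x ∘ Sum.inl) ⬝ᵥ star A0 ≠ 0 → ZZ x ∈ typeIDomain q p → ZZ x ∈ Fib x :=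
    fun x h h' => ⟨h', corr_self h⟩
  have hUUz : ∀ U, ∀ x : Vec q p, (x ∘ Sum.inl) ⬝ᵥ star A0 ≠ 0 → (x ∘ Sum.inl) ᵥ* UU U x = 0 := fun U x hx =>
    corr_self hx
  let T := ℕ × {U : Matrix (Fin q) (Fin p) ℂ // A0 ᵥ* U = 0} × Fin p'
  let w : T → Vec q p → Fin q' → ℂ := fun t x => (GT f (t.1 + 1) (UU t.2.1.1 x) (ZZ x))ᵀ t.2.2
  have hvm : ∀ (C : Fin q' → ℂ) (M : Matrix (Fin q') (Fin p') ℂ) j, C ⬝ᵥ Mᵀ j = (C ᵥ* M) j := fun C M j => rfl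
  obtain ⟨e, Y, S, hYi, hke, he, hS⟩ := sect x0 w (fun x => Cst f (Fib x))
    (by
      intro t
      filter_upwards [hA, hZZm] with x h1 h2
      have h3 := GT_cont isOpen_dom hf.1 (t.1 + 1) (u := UU t.2.1.1 x) h2
      have h4 : ContinuousAt (fun x => GT f (t.1 + 1) (UU t.2.1.1 x) (ZZ x)) x :=
        ContinuousAt.comp (f := fun x => (UU t.2.1.1 x, ZZ x)) h3 ((hUUc _ x h1).prodMk (hZZc x h1))
      have h5 : Continuous fun M : Matrix (Fin q') (Fin p') ℂ => Mᵀ t.2.2 := by fun_prop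
      exact h5.continuousAt.comp h4)
    (by
      intro C
      rw [Cst_GT_iff hf.1 hZ0]
      constructor
      · intro h t
        simp only [w]
        rw [hvm, hZZ0, hUU0 _ t.2.1.2, h t.1 t.2.1.1 t.2.1.2]; rfl
      · intro h k U hU
        ext j
        have := h (k, ⟨U, hU⟩, j)
        simp only [w] at this
        rwa [hvm, hZZ0, hUU0 _ hU] at this)
    (by
      intro t
      filter_upwards [hA, hZZm] with x h1 h2 C hC
      simp only [w]
      rw [hvm, Cst_GT_mp hf.1 (hZZF x h1 h2) (hUUz _ x h1) hC]; rfl)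
    (by
      filter_upwards [continuous_hq.continuousAt.eventually (lt_mem_nhds hx0)] with x hx using hmin x hx)
  obtain ⟨e', vv, he', hv, hsp, hi⟩ := exists_span_basis (Set.range fun t => w t x0)
  obtain rfl : e' = e := he'.trans he.symm
  choose τ hτ using hv
  let X : Vec q p × Vec q p → Matrix (Fin q') (Fin e') ℂ := fun x => of fun i r =>
    GT f ((τ r).1 + 1) (UU (τ r).2.1.1 x.1) (Z1 x) i (τ r).2.2
  have hX0 : ∀ r i, X (x0, v0) i r = vv r i := by
    intro r i
    rw [← hτ r]
    simp only [X, w, of_apply, transpose_apply, hZ10, hZZ0]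
  have hdet0 : (Y * X (x0, v0)).det ≠ 0 := by
    intro h0
    obtain ⟨c, hc, h1⟩ := Matrix.exists_mulVec_eq_zero_iff.2 h0
    have h2 : X (x0, v0) *ᵥ c = ∑ r, c r • vv r := by
      ext i
      simp only [mulVec, dotProduct, Finset.sum_apply, Pi.smul_apply, smul_eq_mul, hX0, mul_comm]
    rw [← mulVec_mulVec] at h1
    have h3 := hYi _ (by
      rw [h2, ← hsp]
      exact Submodule.sum_mem _ fun r _ => Submodule.smul_mem _ _ (Submodule.subset_span ⟨r, rfl⟩)) h1
    rw [h2] at h3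
    exact hc (funext fun r => (Fintype.linearIndependent_iff.1 hi) c h3 r)
  have hvα : ContinuousAt (fun x : Vec q p × Vec q p => (x.2 ∘ Sum.inl) ⬝ᵥ α x.1) (x0, v0) := by
    have h1 : Continuous fun x : (Fin q → ℂ) × (Fin q → ℂ) => x.1 ⬝ᵥ x.2 := by fun_prop
    have h2 : ContinuousAt (fun x : Vec q p × Vec q p => α x.1) (x0, v0) :=
      cont_fst _ (hαc x0 hA0n)
    exact ContinuousAt.comp (f := fun x : Vec q p × Vec q p => ((x.2 ∘ Sum.inl : Fin q → ℂ), α x.1)) h1.continuousAt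
      ((cont_inl.comp continuous_snd).continuousAt.prodMk h2)
  have hvα0 : (v0 ∘ Sum.inl) ⬝ᵥ α x0 ≠ 0 := by rw [hα00]; exact ha0
  have hZ1c : ContinuousAt Z1 (x0, v0) := by
    refine corr_cont ?_ ?_ (cont_inl.comp continuous_snd).continuousAt (cont_inr.comp continuous_snd).continuousAt hvα0
    · exact cont_fst _ (hZZc x0 hA0n)
    · exact cont_fst _ (hαc x0 hA0n)
  have hXc : ContinuousAt X (x0, v0) := by
    refine continuousAt_pi.2 fun i => continuousAt_pi.2 fun r => ?_
    have h2 : Z1 (x0, v0) ∈ typeIDomain q p := by rw [hZ10]; exact hZ0.1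
    have h6 : ContinuousAt (fun x : Vec q p × Vec q p => UU (τ r).2.1.1 x.1) (x0, v0) :=
      cont_fst _ (hUUc _ x0 hA0n)
    exact GT_cont_comp' hf.1 ((τ r).1 + 1) h6 hZ1c h2 i (τ r).2.2
  have hdetc : ContinuousAt (fun x => (Y * X x).det) (x0, v0) := by
    have h7 : Continuous fun M : Matrix (Fin q') (Fin e') ℂ => (Y * M).det := by fun_prop
    exact h7.continuousAt.comp_of_eq hXc rfl
  have hE : ∀ᶠ x in 𝓝 (x0, v0), (x.2 ∘ Sum.inl) ⬝ᵥ α x.1 ≠ 0 ∧ Z1 x ∈ typeIDomain q p ∧ (Y * X x).det ≠ 0 :=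
    (hvα.eventually_ne hvα0).and ((hZ1c.eventually (isOpen_dom.mem_nhds (by rw [hZ10]; exact hZ0.1))).and
      (hdetc.eventually_ne hdet0))
  obtain ⟨N1', N2, hN1'o, hx0N1', hN2o, hv0N2, hN⟩ := mem_nhds_prod_iff'.1 hE
  obtain ⟨N1, hN1, hN1o, hx0N1⟩ := _root_.eventually_nhds_iff.1 ((hN1'o.eventually_mem hx0N1').and
    ((hA.and hZZm).and (hS.and (continuous_hq.continuousAt.eventually (lt_mem_nhds hx0)))))
  have hE1 : ∀ x ∈ N1, ∀ v ∈ N2, (v ∘ Sum.inl) ⬝ᵥ α x ≠ 0 ∧ Z1 (x, v) ∈ typeIDomain q p ∧ (Y * X (x, v)).det ≠ 0 :=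
    fun x hx v hv => hN (⟨(hN1 x hx).1, hv⟩ : (x, v) ∈ N1' ×ˢ N2)
  have hZ1on : ∀ x ∈ N1, ∀ v ∈ N2, On x (Z1 (x, v)) ∧ On v (Z1 (x, v)) := by
    intro x hx v hv
    have h1 := (hN1 x hx).2.1.1
    refine ⟨?_, corr_self (hE1 x hx v hv).1⟩
    show (x ∘ Sum.inl) ᵥ* corr _ _ _ _ = x ∘ Sum.inr
    rw [corr_other (hAα x h1)]
    exact corr_self h1
  let b := Module.finBasis ℂ (Cst f (Fib x0))
  have hrank : ∀ x ∈ N1, Module.finrank ℂ (Cst f (Fib x)) ≤ Module.finrank ℂ (Cst f (Fib x0)) := by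
    intro x hx
    have h1 := (hN1 x hx).2.1.1
    have h2 := hE1 x hx v0 hv0N2
    have h3 : Cst f (Fib x) ≤ LinearMap.ker (X (x, v0)).vecMulLinear := by
      intro C hC
      rw [LinearMap.mem_ker]
      ext r
      have := congrFun (Cst_GT_mp hf.1 ⟨h2.2.1, (hZ1on x hx v0 hv0N2).1⟩ (hUUz (τ r).2.1.1 x h1) hC (τ r).1) (τ r).2.2
      exact this
    have h4 := finrank_ker_vecMul (X (x, v0)) ((Y * X (x, v0))⁻¹ * Y) (by
      rw [Matrix.mul_assoc, Matrix.nonsing_inv_mul _ (Ne.isUnit h2.2.2)])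
    have h5 := Submodule.finrank_mono h3
    omega
  choose Dd hDd using fun i => cramer_poly Y ((b i : Cst f (Fib x0)) : Fin q' → ℂ) (∑ r, ((τ r).1 + 1))
  refine ⟨v0, ∑ i, Dd i, Module.finrank ℂ (Cst f (Fib x0)),
    fun i x => Sum.elim (S x (b i)) (S x (b i) ᵥ* f (ZZ x)), N1, N2, hN1o, hN2o, hx0N1, hv0N2, ?_, ?_, ?_⟩
  · intro i s x hx
    refine ContinuousAt.continuousWithinAt ?_
    have h1 := (hN1 x hx).2.2.1.1 (b i)
    have h3 := (hN1 x hx).2.1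
    have h2 : ContinuousAt (fun x => f (ZZ x)) x :=
      ContinuousAt.comp (f := ZZ) ((hf.1.continuousOn.continuousAt (isOpen_dom.mem_nhds h3.2))) (hZZc x h3.1)
    cases s with
    | inl a => exact (continuous_apply a).continuousAt.comp h1
    | inr j =>
      have h4 : Continuous fun x : (Fin q' → ℂ) × (Matrix (Fin q') (Fin p') ℂ) => (x.1 ᵥ* x.2) j := by fun_prop
      exact ContinuousAt.comp (f := fun x => (S x (b i), f (ZZ x))) h4.continuousAt (h1.prodMk h2)
  · intro x hx
    have h1 := (hN1 x hx).2
    have hLI : LinearIndependent ℂ (fun i => (S x (b i) : Fin q' → ℂ)) := by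
      refine b.linearIndependent.map' ((S x).comp (Cst f (Fib x0)).subtype) ?_
      rw [LinearMap.ker_eq_bot']
      intro c hc
      exact Subtype.ext ((h1.2.1.2 c.1 c.2).2.1 hc)
    refine ⟨h1.2.2, hLI, ?_, ?_⟩
    · have h3 : Submodule.span ℂ (Set.range fun i => (S x (b i) : Fin q' → ℂ)) ≤ Cst f (Fib x) := by
        rw [Submodule.span_le]
        rintro _ ⟨i, rfl⟩
        exact (h1.2.1.2 _ (b i).2).1
      have h4 := Submodule.eq_of_le_of_finrank_le h3 (by
        rw [finrank_span_eq_card hLI, Fintype.card_fin]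
        exact hrank x hx)
      exact h4.ge
    · intro i Z hZ
      have h3 := (h1.2.1.2 _ (b i).2).1
      exact h3 _ hZ _ (hZZF x h1.1.1 h1.1.2)
  · intro i s x hx v hv
    have h1 := (hN1 x hx).2
    have h2 := hE1 x hx v hv
    obtain ⟨ho1, ho2⟩ := hZ1on x hx v hv
    let β : Fin q → ℂ := ((x ∘ Sum.inl) ⬝ᵥ star A0)⁻¹ • (star A0 - (((v ∘ Sum.inl) ⬝ᵥ α x)⁻¹ * ((v ∘ Sum.inl) ⬝ᵥ star A0)) • α x)
    have hβ1 : (x ∘ Sum.inl) ⬝ᵥ β = 1 := by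
      simp only [β, dotProduct_smul, dotProduct_sub, hAα x h1.1.1, smul_eq_mul, mul_zero, sub_zero]
      exact inv_mul_cancel₀ h1.1.1
    have hβ2 : (v ∘ Sum.inl) ⬝ᵥ β = 0 := by
      simp only [β, dotProduct_smul, dotProduct_sub, smul_eq_mul]
      have := h2.1
      field_simp
      ring
    let u1 : Fin e' → Matrix (Fin q) (Fin p) ℂ := fun r => - vecMulVec β ((v ∘ Sum.inl) ᵥ* UU (τ r).2.1.1 x)
    choose W hWd hW using fun (i : Fin q') (r : Fin e') => GT_poly (f := f) ((τ r).1 + 1) (UU (τ r).2.1.1 x) (u1 r) (Z1 (x, v))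
      ((colF (Pi.single i 1) (τ r).2.2 : Matrix (Fin q') (Fin p') ℂ →L[ℂ] ℂ) : Matrix (Fin q') (Fin p') ℂ →ₗ[ℂ] ℂ)
    have hW' : ∀ i r t, (W i r).eval t = GT f ((τ r).1 + 1) (UU (τ r).2.1.1 x + t • u1 r) (Z1 (x, v)) i (τ r).2.2 := by
      intro i r t
      rw [← hW]
      simp
    obtain ⟨Q, P, hQd, hPd, hQP⟩ := hDd i W (fun i r => (hWd i r).trans
      (Finset.single_le_sum (f := fun r => (τ r).1 + 1) (fun _ _ => Nat.zero_le _) (Finset.mem_univ r)))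
    have hQ0 : Q ≠ 0 := by
      rintro rfl
      have h3 := (hQP 0).1
      simp only [hW', zero_smul, add_zero, Polynomial.eval_zero] at h3
      exact h2.2.2 h3.symm
    have hDi : Dd i ≤ ∑ i, Dd i := Finset.single_le_sum (f := Dd) (fun _ _ => Nat.zero_le _) (Finset.mem_univ i)
    have hkey : ∀ t : ℂ, x + t • v ∈ N1 → Z1 (x, v) ∈ Fib (x + t • v) ∧ ∀ i', Q.eval t * (S (x + t • v) (b i)) i' = (P i').eval t := by
      intro t ht
      have hF : Z1 (x, v) ∈ Fib (x + t • v) := ⟨h2.2.1, ho1.add (ho2.smul t)⟩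
      refine ⟨hF, ?_⟩
      have h3 := ((hN1 _ ht).2.2.1.2 _ (b i).2)
      refine (hQP t).2 _ h3.2.2 ?_
      ext r
      have h4 : ((x + t • v) ∘ Sum.inl) ᵥ* (UU (τ r).2.1.1 x + t • u1 r) = 0 := by
        have h5 : (x + t • v) ∘ Sum.inl = (x ∘ Sum.inl) + t • (v ∘ Sum.inl : Fin q → ℂ) := rfl
        rw [h5, vecMul_add, add_vecMul, add_vecMul, hUUz _ x h1.1.1]
        simp only [u1, smul_vecMul, vecMul_smul, vecMul_neg, vmv', hβ1, hβ2]
        simp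
      have h6 := congrFun (Cst_GT_mp hf.1 hF h4 h3.1 (τ r).1) (τ r).2.2
      simp only [vecMul, dotProduct, of_apply, hW'] at h6 ⊢
      exact h6
    cases s with
    | inl a =>
      refine ⟨P a, Q, (hPd a).trans hDi, hQd.trans hDi, hQ0, fun t ht => ?_⟩
      exact (hkey t ht).2 a
    | inr j =>
      refine ⟨∑ a, P a * Polynomial.C (f (Z1 (x, v)) a j), Q, ?_, hQd.trans hDi, hQ0, fun t ht => ?_⟩
      · refine Polynomial.natDegree_sum_le_of_forall_le _ _ fun a _ => ?_
        exact ((Polynomial.natDegree_mul_C_le _ _).trans (hPd a)).trans hDi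
      · obtain ⟨hF, h3⟩ := hkey t ht
        have h4 := ((hN1 _ ht).2.2.1.2 _ (b i).2).1
        have h5 := (hN1 _ ht).2.1
        have h6 := congrFun (h4 _ (hZZF _ h5.1 h5.2) _ hF) j
        simp only [Sum.elim_inr]
        rw [h6, Polynomial.eval_finsetSum]
        simp only [vecMul, dotProduct, Finset.mul_sum, Polynomial.eval_mul, Polynomial.eval_C, ← h3, mul_assoc]

end P7b
section P7c
variable {q p q' p' : ℕ}

/-- evaluation of a vector of polynomials -/
noncomputable def pv {ι σ : Type*} (N : ι → MvPolynomial σ ℂ) (x : σ → ℂ) : ι → ℂ := fun s => MvPolynomial.eval x (N s)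

/-- polynomial sections over a map `f` -/
def IsSec (f : Matrix (Fin q) (Fin p) ℂ → Matrix (Fin q') (Fin p') ℂ)
    (N : Fin q' ⊕ Fin p' → MvPolynomial (Fin q ⊕ Fin p) ℂ) : Prop :=
  ∀ Z ∈ typeIDomain q p, ∀ x : Vec q p, On x Z → On (q := q') (p := p') (pv N x) (f Z)

lemma diff_eval {σ : Type*} [Fintype σ] (P : MvPolynomial σ ℂ) : Differentiable ℂ fun x : σ → ℂ => MvPolynomial.eval x P := by
  induction P using MvPolynomial.induction_on with
  | C a => simp
  | add p q hp hq => simp only [map_add]; exact hp.add hq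
  | mul_X p i hp => simp only [map_mul, MvPolynomial.eval_X]; exact hp.mul (differentiable_apply i)

lemma diff_gv : Differentiable ℂ fun x : (Fin q → ℂ) × Matrix (Fin q) (Fin p) ℂ => gv x.1 x.2 := by
  refine differentiable_pi.2 fun s => ?_
  cases s with
  | inl i =>
    simp only [gv_apply_inl]
    fun_prop
  | inr j =>
    have : ∀ x : (Fin q → ℂ) × Matrix (Fin q) (Fin p) ℂ, gv x.1 x.2 (Sum.inr j) = ∑ i, x.1 i * x.2 i j := fun x => rfl
    simp only [this]
    refine Differentiable.fun_sum fun i _ => ?_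
    refine Differentiable.fun_mul (by fun_prop) ?_
    have h1 : Differentiable ℂ fun M : Fin q → Fin p → ℂ => M i j := by fun_prop
    have h2 : Differentiable ℂ fun x : (Fin q → ℂ) × (Matrix (Fin q) (Fin p) ℂ) => x.2 := by fun_prop
    exact Differentiable.comp (g := fun M : Fin q → Fin p → ℂ => M i j) h1 h2

set_option maxHeartbeats 1000000 in
lemma isSec_of_open {f : Matrix (Fin q) (Fin p) ℂ → Matrix (Fin q') (Fin p') ℂ} (hf : DifferentiableOn ℂ f (typeIDomain q p))
    {N : Fin q' ⊕ Fin p' → MvPolynomial (Fin q ⊕ Fin p) ℂ} {O : Set (Vec q p)} (hO : IsOpen O) {x0 : Vec q p} (hx0 : x0 ∈ O)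
    (h0 : 0 < hq x0) (h : ∀ x ∈ O, ∀ Z ∈ Fib x, On (q := q') (p := p') (pv N x) (f Z)) : IsSec f N := by
  obtain ⟨Z0, hZ0⟩ := exists_fib h0
  let F : (Fin q → ℂ) × Matrix (Fin q) (Fin p) ℂ → Fin p' → ℂ := fun y =>
    (pv N (gv y.1 y.2) ∘ Sum.inl) ᵥ* f y.2 - (pv N (gv y.1 y.2) ∘ Sum.inr)
  have hN : ∀ s, Differentiable ℂ fun y : (Fin q → ℂ) × Matrix (Fin q) (Fin p) ℂ => pv N (gv y.1 y.2) s := fun s =>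
    (diff_eval (N s)).comp diff_gv
  have hF : DifferentiableOn ℂ F (Set.univ ×ˢ typeIDomain q p) := by
    refine differentiableOn_pi.2 fun j => ?_
    have : ∀ y, F y j = (∑ i, pv N (gv y.1 y.2) (Sum.inl i) * f y.2 i j) - pv N (gv y.1 y.2) (Sum.inr j) := fun y => rfl
    simp only [this]
    refine DifferentiableOn.sub (DifferentiableOn.fun_sum fun i _ => (hN _).differentiableOn.mul ?_) (hN _).differentiableOn
    exact (diff_entry hf i j).comp differentiable_snd.differentiableOn fun y hy => hy.2
  intro Z hZ x hx
  have hgO : gv (x0 ∘ Sum.inl) Z0 ∈ O := by rw [← hZ0.2.eq_gv]; exact hx0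
  have hz : ∀ᶠ y : (Fin q → ℂ) × Matrix (Fin q) (Fin p) ℂ in 𝓝 (x0 ∘ Sum.inl, Z0), F y = 0 := by
    have h2 : ContinuousAt (fun y : (Fin q → ℂ) × Matrix (Fin q) (Fin p) ℂ => gv y.1 y.2) (x0 ∘ Sum.inl, Z0) :=
      diff_gv.continuous.continuousAt
    have h3 : ∀ᶠ y : (Fin q → ℂ) × Matrix (Fin q) (Fin p) ℂ in 𝓝 (x0 ∘ Sum.inl, Z0), y.2 ∈ typeIDomain q p :=
      continuous_snd.continuousAt.eventually (isOpen_dom.mem_nhds hZ0.1)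
    filter_upwards [h2.eventually (hO.mem_nhds hgO), h3] with y hy hy2
    have h4 := h _ hy _ ⟨hy2, on_gv y.1 y.2⟩
    unfold On at h4
    simp only [F]
    rw [h4, sub_self]
  have h1 : F (x ∘ Sum.inl, Z) = 0 := ident' (S := Set.univ ×ˢ typeIDomain q p) (isOpen_univ.prod isOpen_dom)
    (by
      intro a ha b hb s t hs ht hst
      exact ⟨trivial, convex_dom ha.2 hb.2 hs ht hst⟩) hF (z0 := (x0 ∘ Sum.inl, Z0)) ⟨trivial, hZ0.1⟩ hz ⟨trivial, hZ⟩
  have h2 : F (x ∘ Sum.inl, Z) = (pv N x ∘ Sum.inl) ᵥ* f Z - (pv N x ∘ Sum.inr) := by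
    simp only [F]
    rw [← hx.eq_gv]
  rw [h2] at h1
  exact sub_eq_zero.1 h1

lemma IsSec.smul {f : Matrix (Fin q) (Fin p) ℂ → Matrix (Fin q') (Fin p') ℂ} {N} (h : IsSec f N)
    (c : MvPolynomial (Fin q ⊕ Fin p) ℂ) : IsSec f (c • N) := by
  intro Z hZ x hx
  have := (h Z hZ x hx).smul (MvPolynomial.eval x c)
  convert this using 1
  ext s; simp [pv]

lemma IsSec.add {f : Matrix (Fin q) (Fin p) ℂ → Matrix (Fin q') (Fin p') ℂ} {N M} (h : IsSec f N) (h' : IsSec f M) :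
    IsSec f (N + M) := by
  intro Z hZ x hx
  have := (h Z hZ x hx).add (h' Z hZ x hx)
  convert this using 1
  ext s; simp [pv]

lemma IsSec.zero (f : Matrix (Fin q) (Fin p) ℂ → Matrix (Fin q') (Fin p') ℂ) : IsSec f 0 := by
  intro Z hZ x hx
  have := On.zero (f Z)
  convert this using 1
  ext s; simp [pv]

lemma IsSec.sum {f : Matrix (Fin q) (Fin p) ℂ → Matrix (Fin q') (Fin p') ℂ} {ι : Type*} (t : Finset ι)
    {N : ι → Fin q' ⊕ Fin p' → MvPolynomial (Fin q ⊕ Fin p) ℂ} (h : ∀ i ∈ t, IsSec f (N i)) : IsSec f (∑ i ∈ t, N i) := by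
  classical
  induction t using Finset.induction_on with
  | empty => simpa using IsSec.zero f
  | insert a s ha ih =>
    rw [Finset.sum_insert ha]
    exact (h a (Finset.mem_insert_self _ _)).add (ih fun i hi => h i (Finset.mem_insert_of_mem hi))

lemma span_open {E : Type*} [NormedAddCommGroup E] [NormedSpace ℂ E] {N : Set E} (hN : IsOpen N) (h : N.Nonempty) :
    Submodule.span ℂ N = ⊤ := by
  apply Submodule.eq_top_of_nonempty_interior'
  obtain ⟨x, hx⟩ := h
  exact ⟨x, mem_interior.2 ⟨N, Submodule.subset_span, hN, hx⟩⟩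

set_option maxHeartbeats 800000 in
lemma stepC {f : Matrix (Fin q) (Fin p) ℂ → Matrix (Fin q') (Fin p') ℂ} (hf : PH f) (h2q : 2 ≤ q) (hp : q' < p) :
    ∃ (k : ℕ) (N : Fin k → Fin q' ⊕ Fin p' → MvPolynomial (Fin q ⊕ Fin p) ℂ) (O : Set (Vec q p)),
      IsOpen O ∧ O.Nonempty ∧ 0 < k ∧ (∀ i, IsSec f (N i)) ∧ ∀ x ∈ O, 0 < hq x ∧
        LinearIndependent ℂ (fun i => (pv (N i) x ∘ Sum.inl : Fin q' → ℂ)) ∧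
        Cst f (Fib x) ≤ Submodule.span ℂ (Set.range fun i => (pv (N i) x ∘ Sum.inl : Fin q' → ℂ)) := by
  classical
  have hq0 : 0 < q := by omega
  have hp0 : 0 < p := by omega
  obtain ⟨x0, hx0, hmin⟩ := exists_min (fun x : Vec q p => 0 < hq x) (fun x => Module.finrank ℂ (Cst f (Fib x)))
    ⟨eb (Sum.inl ⟨0, hq0⟩), by
      have h1 := hf_self (eb (Sum.inl ⟨0, hq0⟩) : Vec q p)
      rw [hf_eb] at h1
      simp at h1
      have h2 : hq (eb (Sum.inl ⟨0, hq0⟩) : Vec q p) = 1 := by exact_mod_cast h1.symm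
      rw [h2]; norm_num⟩
  obtain ⟨v0, D, k, φ, N1, N2, hN1o, hN2o, hx0N, hv0N, hcont, hloc, hline⟩ := stepC_local hf h2q hx0 hmin
  obtain ⟨e, v, he, hv, hsp, hi⟩ := exists_span_basis N2
  rw [span_open hN2o ⟨v0, hv0N⟩, finrank_top] at he
  rw [span_open hN2o ⟨v0, hv0N⟩] at hsp
  let B : Module.Basis (Fin e) ℂ (Vec q p) := Module.Basis.mk hi hsp.ge
  let L : (Fin e → ℂ) → Vec q p := fun y => x0 + ∑ l, y l • v l
  have hLc : Continuous L := by
    simp only [L]; fun_prop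
  have hLu : ∀ y l t, L (Function.update y l t) = L y + (t - y l) • v l := by
    intro y l t
    simp only [L]
    rw [← Finset.add_sum_erase _ _ (Finset.mem_univ l), ← Finset.add_sum_erase _ (fun m => y m • v m) (Finset.mem_univ l),
      Function.update_self, Finset.sum_congr rfl (fun m hm => by
        rw [Function.update_of_ne (Finset.ne_of_mem_erase hm)])]
    rw [sub_smul]; abel
  have hLB : ∀ x, L (B.repr (x - x0)) = x := by
    intro x
    have h1 := B.sum_repr (x - x0)
    simp only [B, Module.Basis.mk_apply] at h1
    simp only [L, B]
    rw [h1, add_sub_cancel]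
  obtain ⟨r, hr, hrN⟩ := Metric.isOpen_iff.1 (hN1o.preimage hLc) 0 (by
    show x0 + ∑ l, (0 : Fin e → ℂ) l • v l ∈ N1
    simpa using hx0N)
  obtain ⟨c', r', hr', hsub, P, Q, hPQ⟩ := sepRat D e (Fin k × (Fin q' ⊕ Fin p')) (fun a y => φ a.1 (L y) a.2) 0 r hr
    (fun a => (hcont a.1 a.2).comp hLc.continuousOn fun y hy => hrN hy)
    (by
      intro a y hy l
      obtain ⟨P, Q, hP, hQ, hQ0, h⟩ := hline a.1 a.2 (L y) (hrN hy) (v l) (hv l)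
      refine ⟨P.comp (Polynomial.X - Polynomial.C (y l)), Q.comp (Polynomial.X - Polynomial.C (y l)), ?_, ?_, ?_, ?_⟩
      · rw [Polynomial.natDegree_comp]; simpa using hP
      · rw [Polynomial.natDegree_comp]; simpa using hQ
      · intro h0
        apply hQ0
        have := congrArg (fun R => R.comp (Polynomial.X + Polynomial.C (y l))) h0
        simpa [Polynomial.comp_assoc] using this
      · intro t ht
        have h1 := hrN ht
        simp only [Set.mem_preimage, hLu] at h1
        rw [Polynomial.eval_comp, Polynomial.eval_comp, hLu]
        simpa using h _ h1)
  -- change of variables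
  let aff : Fin e → MvPolynomial (Fin q ⊕ Fin p) ℂ := fun l =>
    ∑ s, MvPolynomial.C (B.repr (eb s) l) * (MvPolynomial.X s - MvPolynomial.C (x0 s))
  have haff : ∀ x : Vec q p, ∀ l, MvPolynomial.eval x (aff l) = B.repr (x - x0) l := by
    intro x l
    have h1 : x - x0 = ∑ s, (x s - x0 s) • (eb s : Vec q p) := by
      conv_lhs => rw [sum_eb (x - x0)]
      rfl
    rw [h1]
    simp [aff, mul_comm]
  let sub : MvPolynomial (Fin e) ℂ → MvPolynomial (Fin q ⊕ Fin p) ℂ := fun R => MvPolynomial.bind₁ aff R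
  have hsube : ∀ R, ∀ x : Vec q p, MvPolynomial.eval x (sub R) = MvPolynomial.eval (B.repr (x - x0)) R := by
    intro R x
    simp only [sub]
    show MvPolynomial.eval₂Hom (RingHom.id ℂ) x (MvPolynomial.bind₁ aff R) = MvPolynomial.eval₂Hom (RingHom.id ℂ) _ R
    rw [MvPolynomial.eval₂Hom_bind₁]
    congr 1
    congr 1
    exact funext fun l => haff x l
  have hQsum : (∏ a, Q a) ≠ 0 := Finset.prod_ne_zero_iff.2 fun a _ => (hPQ a).1
  obtain ⟨c2, r2, hr2, hsub2, hQ2⟩ := mv_ball_sub hQsum c' hr'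
  let N : Fin k → Fin q' ⊕ Fin p' → MvPolynomial (Fin q ⊕ Fin p) ℂ := fun i s =>
    sub (P (i, s) * ∏ a ∈ Finset.univ.erase (i, s), Q a)
  have hRc : Continuous fun x : Vec q p => (B.repr (x - x0) : Fin e → ℂ) := by
    have h1 : Continuous (B.equivFun : Vec q p → Fin e → ℂ) := LinearMap.continuous_of_finiteDimensional B.equivFun.toLinearMap
    exact h1.comp (continuous_id.sub continuous_const)
  let O : Set (Vec q p) := (fun x : Vec q p => (B.repr (x - x0) : Fin e → ℂ)) ⁻¹' ball c2 r2
  have hON : ∀ x ∈ O, x ∈ N1 := by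
    intro x hx
    have h1 := hrN (hsub (hsub2 hx))
    simp only [Set.mem_preimage] at h1
    rwa [hLB] at h1
  have hev : ∀ x ∈ O, ∀ i s, pv (N i) x s = MvPolynomial.eval (B.repr (x - x0)) (∏ a, Q a) * φ i x s := by
    intro x hx i s
    simp only [pv, N]
    rw [hsube, ← Finset.mul_prod_erase Finset.univ Q (Finset.mem_univ (i, s)), map_mul, map_mul, ← (hPQ (i, s)).2 _ (hsub2 hx), hLB]
    ring
  have hev' : ∀ x ∈ O, ∀ i, (pv (N i) x : Vec q' p') = MvPolynomial.eval (B.repr (x - x0)) (∏ a, Q a) • φ i x :=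
    fun x hx i => funext fun s => hev x hx i s
  have hOo : IsOpen O := isOpen_ball.preimage hRc
  have hOne : O.Nonempty := by
    refine ⟨L c2, ?_⟩
    have : (B.repr (L c2 - x0) : Fin e → ℂ) = c2 := by
      have h1 : L c2 - x0 = ∑ l, c2 l • B l := by
        simp [L, B]
      have h2 := B.equivFun.apply_symm_apply c2
      rw [B.equivFun_symm_apply] at h2
      rw [h1]
      exact h2
    show (B.repr (L c2 - x0) : Fin e → ℂ) ∈ ball c2 r2
    rw [this]; exact mem_ball_self hr2
  have hspan : ∀ x ∈ O, LinearIndependent ℂ (fun i => (pv (N i) x ∘ Sum.inl : Fin q' → ℂ)) ∧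
        Cst f (Fib x) ≤ Submodule.span ℂ (Set.range fun i => (pv (N i) x ∘ Sum.inl : Fin q' → ℂ)) := by
    intro x hx
    obtain ⟨h1, h2, h3, h4⟩ := hloc x (hON x hx)
    have h5 : (fun i => (pv (N i) x ∘ Sum.inl : Fin q' → ℂ)) = (fun i => MvPolynomial.eval (B.repr (x - x0)) (∏ a, Q a) • (φ i x ∘ Sum.inl)) :=
      funext fun i => funext fun a => hev x hx i (Sum.inl a)
    have h6 := hQ2 _ hx
    rw [h5]
    refine ⟨h2.units_smul (fun _ => Units.mk0 _ h6), h3.trans ?_⟩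
    rw [Submodule.span_le]
    rintro _ ⟨i, rfl⟩
    have h7 := Submodule.smul_mem (Submodule.span ℂ (Set.range fun i => MvPolynomial.eval (B.repr (x - x0)) (∏ a, Q a) • (φ i x ∘ Sum.inl)))
      (MvPolynomial.eval (B.repr (x - x0)) (∏ a, Q a))⁻¹ (Submodule.subset_span ⟨i, rfl⟩)
    simp only [smul_smul] at h7
    rw [inv_mul_cancel₀ h6, one_smul] at h7
    exact h7
  refine ⟨k, N, O, hOo, hOne, ?_, ?_, fun x hx => ⟨(hloc x (hON x hx)).1, hspan x hx⟩⟩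
  · obtain ⟨x, hx⟩ := hOne
    obtain ⟨C, hC, hC0⟩ := part1 hf ⟨0, hq0⟩ ⟨0, hp0⟩ hp (hloc x (hON x hx)).1
    have h1 := (hspan x hx).2 hC
    rcases Nat.eq_zero_or_pos k with rfl | hk
    · simp at h1; exact absurd h1 hC0
    · exact hk
  · intro i
    obtain ⟨x, hx⟩ := hOne
    refine isSec_of_open hf.1 hOo hx (hloc x (hON x hx)).1 fun y hy Z hZ => ?_
    rw [hev' y hy]
    exact ((hloc y (hON y hy)).2.2.2 i Z hZ).smul _

end P7c

end

section

open Filter Topology Metric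
section P8a
variable {q p q' p' : ℕ}

/-- entire sections over a map `f` -/
def ESec (f : Matrix (Fin q) (Fin p) ℂ → Matrix (Fin q') (Fin p') ℂ) (Q : Vec q p → Vec q' p') : Prop :=
  Differentiable ℂ Q ∧ ∀ Z ∈ typeIDomain q p, ∀ x : Vec q p, On x Z → On (Q x) (f Z)

lemma IsSec.eSec {f : Matrix (Fin q) (Fin p) ℂ → Matrix (Fin q') (Fin p') ℂ} {N} (h : IsSec f N) :
    ESec f (pv N) :=
  ⟨differentiable_pi.2 fun s => diff_eval (N s), h⟩

lemma diff_lin (g : Vec q p ≃ₗ[ℂ] Vec q p) : Differentiable ℂ g :=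
  (LinearMap.toContinuousLinearMap (g : Vec q p →ₗ[ℂ] Vec q p)).differentiable

lemma ESec.comp_act {f : Matrix (Fin q) (Fin p) ℂ → Matrix (Fin q') (Fin p') ℂ} {Q} (h : ESec f Q)
    {g : Vec q p ≃ₗ[ℂ] Vec q p} (hg : IsU g) : ESec (f ∘ act g) (Q ∘ g) :=
  ⟨h.1.comp (diff_lin g), fun _ hZ _ hx => h.2 _ (act_mem hg hZ) _ (on_act hg hZ hx)⟩

lemma on_lim {α : Type*} {l : Filter α} [l.NeBot] {a : α → Vec q p} {a0 : Vec q p} {W : α → Matrix (Fin q) (Fin p) ℂ}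
    {W0 : Matrix (Fin q) (Fin p) ℂ} (ha : Tendsto a l (𝓝 a0)) (hW : Tendsto W l (𝓝 W0))
    (h : ∀ᶠ t in l, On (a t) (W t)) : On a0 W0 := by
  have e0 : Tendsto (fun t => (W t, a t ∘ Sum.inl)) l (𝓝 (W0, a0 ∘ Sum.inl)) :=
    hW.prodMk_nhds ((cont_inl.tendsto a0).comp ha)
  have e1 := (continuous_vecMul'.tendsto (W0, a0 ∘ Sum.inl)).comp e0
  have e2 := (cont_inr.tendsto a0).comp ha
  refine tendsto_nhds_unique e1 (e2.congr' ?_)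
  filter_upwards [h] with t ht
  exact ht.symm

lemma vecMul_E (A : Fin q → ℂ) (i0 : Fin q) (j0 j : Fin p) :
    (A ᵥ* Matrix.single i0 j0 (1 : ℂ)) j = if j = j0 then A i0 else 0 := by
  simp only [vecMul, dotProduct, Matrix.single_apply]
  split_ifs with h
  · subst h; simp
  · simp [Ne.symm h]

lemma vmv_mem {A : Fin q → ℂ} {B : Fin p → ℂ} (h : nsq B < nsq A) :
    vecMulVec ((nsq A : ℂ)⁻¹ • star A) B ∈ typeIDomain q p := by
  have hA : 0 < nsq A := lt_of_le_of_lt (nsq_nonneg B) h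
  rw [mem_dom_iff]
  intro X hX
  rw [vmv', nsq_smul, dotProduct_smul, smul_eq_mul, norm_mul, norm_inv, Complex.norm_real, Real.norm_of_nonneg hA.le]
  have h1 := dot_cs X (star A)
  rw [nsq_star] at h1
  have hX' := nsq_pos hX
  have h2 : ‖X ⬝ᵥ star A‖ ^ 2 ≤ nsq X * nsq A := by
    exact h1
  calc ((nsq A)⁻¹ * ‖X ⬝ᵥ star A‖) ^ 2 * nsq B ≤ ((nsq A)⁻¹ ^ 2 * (nsq X * nsq A)) * nsq B := by
        rw [mul_pow]; gcongr; exact nsq_nonneg _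
    _ < ((nsq A)⁻¹ ^ 2 * (nsq X * nsq A)) * nsq A := by
        gcongr
    _ = nsq X := by field_simp

lemma flag_pt {i0 : Fin q} {j0 : Fin p} {ts : ℂ} {v : Vec q p} (h : v (Sum.inr j0) = ts * v (Sum.inl i0))
    (hn : nsq (Function.update (v ∘ Sum.inr) j0 0) < nsq (Function.update (v ∘ Sum.inl) i0 0)) :
    ∃ Z ∈ FlagS i0 j0, v = gv (v ∘ Sum.inl) (Z + ts • Matrix.single i0 j0 1) := by
  set A := Function.update (v ∘ Sum.inl) i0 0 with hA
  set B := Function.update (v ∘ Sum.inr) j0 0 with hB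
  have hA0 : 0 < nsq A := lt_of_le_of_lt (nsq_nonneg B) hn
  have hA0' : (nsq A : ℂ) ≠ 0 := by exact_mod_cast hA0.ne'
  refine ⟨_, ⟨vmv_mem hn, fun j => by simp [vecMulVec_apply, hA], fun i => by simp [vecMulVec_apply, hB]⟩, ?_⟩
  have h1 : (v ∘ Sum.inl) ⬝ᵥ ((nsq A : ℂ)⁻¹ • star A) = 1 := by
    have : (v ∘ Sum.inl) ⬝ᵥ star A = A ⬝ᵥ star A := by
      simp only [dotProduct]
      refine Finset.sum_congr rfl fun i _ => ?_
      by_cases hi : i = i0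
      · subst hi; simp [hA]
      · simp [hA, hi]
    rw [dotProduct_smul, this, dot_star_self, smul_eq_mul, inv_mul_cancel₀ hA0']
  ext s
  cases s with
  | inl i => rfl
  | inr j =>
    rw [gv_apply_inr, vecMul_add, vmv', h1, one_smul, vecMul_smul]
    simp only [Pi.add_apply, Pi.smul_apply, smul_eq_mul, vecMul_E, hB]
    by_cases hj : j = j0
    · subst hj; simp [h]
    · simp [hj, Function.update_of_ne hj]

lemma bdry_orth {f : Matrix (Fin q) (Fin p) ℂ → Matrix (Fin q') (Fin p') ℂ} {i0 : Fin q} {j0 : Fin p} {i1 : Fin q}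
    (hi : i1 ≠ i0) {u : Ultrafilter ℂ} (hu : Bdry u) {ts : ℂ} {F : Matrix (Fin q) (Fin p) ℂ → Matrix (Fin q') (Fin p') ℂ}
    {C : Fin q' → ℂ} {D : Fin p' → ℂ} (hts : Tendsto id (u : Filter ℂ) (𝓝 ts))
    (hF : ∀ Z ∈ FlagS i0 j0, Tendsto (fun t : ℂ => f (Z + t • Matrix.single i0 j0 1)) (u : Filter ℂ) (𝓝 (F Z)) ∧
        C ᵥ* F Z = D ∧ F Z *ᵥ star D = star C ∧ F Z ∈ Kset q' p' 1) {Q : Vec q p → Vec q' p'} (hQ : ESec f Q)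
    {v : Vec q p} (hv : v (Sum.inr j0) = ts * v (Sum.inl i0)) :
    hf (Q v) (Sum.elim C D) = 0 := by
  have key : ∀ A, ∀ Z ∈ FlagS i0 j0, hf (Q (gv A (Z + ts • Matrix.single i0 j0 1))) (Sum.elim C D) = 0 := by
    intro A Z hZ
    obtain ⟨h1, h2, h3, -⟩ := hF Z hZ
    have hl : Tendsto (fun t : ℂ => Q (gv A (Z + t • Matrix.single i0 j0 1))) (u : Filter ℂ)
        (𝓝 (Q (gv A (Z + ts • Matrix.single i0 j0 1)))) := by
      have hc : Continuous fun t : ℂ => Q (gv A (Z + t • Matrix.single i0 j0 1)) :=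
        hQ.1.continuous.comp (diff_gv.continuous.comp
          (f := fun t : ℂ => (A, Z + t • Matrix.single i0 j0 (1 : ℂ))) (by fun_prop))
      exact (hc.tendsto ts).comp hts
    have ho : On (Q (gv A (Z + ts • Matrix.single i0 j0 1))) (F Z) := by
      refine on_lim hl h1 ?_
      filter_upwards [hu.1] with t ht
      exact hQ.2 _ (line_mem hZ ht) _ (on_gv _ _)
    rw [hf_eq]
    simp only [Sum.elim_comp_inl, Sum.elim_comp_inr]
    rw [← ho, ← h3, ← dotProduct_mulVec, sub_self]
  let W : Submodule ℂ (Vec q p) :=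
    { carrier := {v | v (Sum.inr j0) = ts * v (Sum.inl i0)}
      add_mem' := by
        intro a b ha hb
        simp only [Set.mem_ofPred_eq, Pi.add_apply] at *
        rw [ha, hb]; ring
      zero_mem' := by simp
      smul_mem' := by
        intro c a ha
        simp only [Set.mem_ofPred_eq, Pi.smul_apply, smul_eq_mul] at *
        rw [ha]; ring }
  have hz : (eb (Sum.inl i1) : Vec q p) ∈ W := by
    show _ = _
    simp [eb, Pi.single_apply, hi.symm]
  have hd : Differentiable ℂ fun v => hf (Q v) (Sum.elim C D) := by
    have : ∀ s, Differentiable ℂ fun v => Q v s := differentiable_pi.1 hQ.1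
    unfold hf
    fun_prop
  refine ident (S := Set.univ) isOpen_univ convex_univ W (h := fun v => hf (Q v) (Sum.elim C D)) hd.differentiableOn
    (z0 := eb (Sum.inl i1)) trivial ?_ trivial (W.sub_mem hv hz)
  have hcont : Continuous fun v : Vec q p => nsq (Function.update (v ∘ Sum.inl) i0 0) - nsq (Function.update (v ∘ Sum.inr) j0 0) := by
    refine (continuous_nsq.comp ?_).sub (continuous_nsq.comp ?_)
    · exact Continuous.update cont_inl i0 continuous_const
    · exact Continuous.update cont_inr j0 continuous_const
  have hpos : 0 < nsq (Function.update ((eb (Sum.inl i1) : Vec q p) ∘ Sum.inl) i0 0) - nsq (Function.update ((eb (Sum.inl i1) : Vec q p) ∘ Sum.inr) j0 0) := by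
    have a1 : Function.update ((eb (Sum.inl i1) : Vec q p) ∘ Sum.inr) j0 0 = 0 := by
      ext j; by_cases hj : j = j0
      · subst hj; simp
      · simp [hj, eb, Pi.single_apply]
    rw [a1, nsq_zero, sub_zero]
    apply nsq_pos
    intro h
    have := congrFun h i1
    simp [hi, eb] at this
  filter_upwards [hcont.continuousAt.eventually (lt_mem_nhds hpos)] with w hw hwW
  have hw' : w ∈ W := by simpa using W.add_mem hwW hz
  obtain ⟨Z, hZ, hwZ⟩ := flag_pt (v := w) hw' (by linarith)
  rw [hwZ]
  exact key _ _ hZ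

end P8a
section P8b
variable {q p q' p' : ℕ}

lemma diff_conj {h : ℂ → ℂ} (hh : Differentiable ℂ h) : Differentiable ℂ fun t => star (h (star t)) := fun t => by
  have := (hh (star t)).star_star
  rw [star_star] at this
  exact this

/-- rows of the boundary matrix -/
noncomputable def rowD (f : Matrix (Fin q) (Fin p) ℂ → Matrix (Fin q') (Fin p') ℂ) (i0 : Fin q) (j0 : Fin p)
    (Q : Vec q p → Vec q' p') (y : Vec q p) (t : ℂ) : Fin q' → ℂ :=
  star (Q (y + (star t * y (Sum.inr j0)) • eb (Sum.inl i0)) ∘ Sum.inl) -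
    f (0 + t • Matrix.single i0 j0 1) *ᵥ star (Q (y + (star t * y (Sum.inr j0)) • eb (Sum.inl i0)) ∘ Sum.inr)

lemma rowD_dot (C : Fin q' → ℂ) (Q : Vec q' p') (W : Matrix (Fin q') (Fin p') ℂ) :
    C ⬝ᵥ (star (Q ∘ Sum.inl) - W *ᵥ star (Q ∘ Sum.inr)) = star (hf Q (Sum.elim C (C ᵥ* W))) := by
  rw [hf_conj, hf_eq, dotProduct_sub, dotProduct_mulVec]
  rfl

lemma stepD1 {f : Matrix (Fin q) (Fin p) ℂ → Matrix (Fin q') (Fin p') ℂ} (hf' : PH f) {i0 i1 : Fin q} (hi : i1 ≠ i0) (j0 : Fin p) :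
    ∃ C ∈ Cst f (FlagS i0 j0), C ≠ 0 ∧ ∀ Q, ESec f Q → ∀ y : Vec q p, y (Sum.inl i0) = 0 →
      hf (Q y) (Sum.elim C (C ᵥ* f 0)) = 0 := by
  have hdl : ∀ Z ∈ FlagS i0 j0, DifferentiableOn ℂ (fun t : ℂ => f (Z + t • Matrix.single i0 j0 1)) (ball 0 1) := by
    intro Z hZ
    refine hf'.1.comp (f := fun t : ℂ => Z + t • Matrix.single i0 j0 (1 : ℂ))
      (Differentiable.differentiableOn (by fun_prop)) fun t ht => line_mem hZ (by simpa using ht)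
  let R : ((FlagS (p := p) i0 j0 × Fin p') ⊕ ({Q // ESec f Q} × {y : Vec q p // y (Sum.inl i0) = 0})) → ℂ → Fin q' → ℂ :=
    Sum.elim (fun s t => (f (s.1.1 + t • Matrix.single i0 j0 1) - f (0 + t • Matrix.single i0 j0 1))ᵀ s.2)
      (fun s t => rowD f i0 j0 s.1.1 s.2.1 t)
  have hRd : ∀ s j, DifferentiableOn ℂ (fun t => R s t j) (ball 0 1) := by
    rintro (s | s) j
    · exact (diff_entry (hdl _ s.1.2) j s.2).sub (diff_entry (hdl _ (zero_mem_flag i0 j0)) j s.2)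
    · have e : ∀ r, Differentiable ℂ fun t : ℂ => star (s.1.1 (s.2.1 + (star t * s.2.1 (Sum.inr j0)) • eb (Sum.inl i0)) r) := by
        intro r
        refine diff_conj (h := fun t => s.1.1 (s.2.1 + (t * s.2.1 (Sum.inr j0)) • eb (Sum.inl i0)) r) ?_
        have := differentiable_pi.1 s.1.2.1 r
        exact this.comp (f := fun t : ℂ => s.2.1 + (t * s.2.1 (Sum.inr j0)) • (eb (Sum.inl i0) : Vec q p)) (by fun_prop)
      show DifferentiableOn ℂ (fun t => star (s.1.1 (s.2.1 + (star t * s.2.1 (Sum.inr j0)) • eb (Sum.inl i0)) (Sum.inl j)) -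
        ∑ a, f (0 + t • Matrix.single i0 j0 1) j a * star (s.1.1 (s.2.1 + (star t * s.2.1 (Sum.inr j0)) • eb (Sum.inl i0)) (Sum.inr a))) _
      exact (e _).differentiableOn.sub (DifferentiableOn.fun_sum fun a _ =>
        (diff_entry (hdl _ (zero_mem_flag i0 j0)) j a).mul (e _).differentiableOn)
  obtain ⟨C, hC, h⟩ := det_lemma (fun s => R s 0) (fun τ => by
    let M : ℂ → Matrix (Fin q') (Fin q') ℂ := fun t => of fun i => R (τ i) t
    have hd : DifferentiableOn ℂ (fun t => (M t).det) (ball 0 1) := diff_det fun i j => hRd (τ i) j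
    refine maxp hd (fun u hu => ?_) (t := 0) (by simp)
    obtain ⟨ts, F, C, D, h1, h2, h3, h4, h5⟩ := boundary hf' i0 j0 u hu
    have hrow : ∀ s, ∃ w, Tendsto (R s) (u : Filter ℂ) (𝓝 w) ∧ C ⬝ᵥ w = 0 := by
      rintro (s | s)
      · refine ⟨(F s.1.1 - F 0)ᵀ s.2, ?_, ?_⟩
        · refine tendsto_pi_nhds.2 fun j => ?_
          have ct : Continuous fun W : Matrix (Fin q') (Fin p') ℂ => W j s.2 := by fun_prop
          exact ((ct.tendsto _).comp (h5 _ s.1.2).1).sub ((ct.tendsto _).comp (h5 _ (zero_mem_flag i0 j0)).1)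
        · have e1 := congrFun ((h5 _ s.1.2).2.1.trans (h5 _ (zero_mem_flag i0 j0)).2.1.symm) s.2
          rw [← sub_eq_zero] at e1
          rw [← e1]
          show _ = (C ᵥ* F s.1.1 - C ᵥ* F 0) _
          rw [← vecMul_sub]; rfl
      · obtain ⟨⟨Q, hQ⟩, ⟨y, hy⟩⟩ := s
        set ys : Vec q p := y + (star ts * y (Sum.inr j0)) • eb (Sum.inl i0) with hys
        refine ⟨star (Q ys ∘ Sum.inl) - F 0 *ᵥ star (Q ys ∘ Sum.inr), ?_, ?_⟩
        · have e : ∀ r, Tendsto (fun t : ℂ => star (Q (y + (star t * y (Sum.inr j0)) • eb (Sum.inl i0)) r)) (u : Filter ℂ) (𝓝 (star (Q ys r))) := by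
            intro r
            have c1 := (differentiable_pi.1 hQ.1 r).continuous
            have c2 : Continuous fun t : ℂ => y + (star t * y (Sum.inr j0)) • (eb (Sum.inl i0) : Vec q p) := by fun_prop
            exact ((continuous_star.comp (c1.comp c2)).tendsto ts).comp h2
          refine tendsto_pi_nhds.2 fun j => ?_
          show Tendsto (fun t => star (Q (y + (star t * y (Sum.inr j0)) • eb (Sum.inl i0)) (Sum.inl j)) -
              ∑ a, f (0 + t • Matrix.single i0 j0 1) j a * star (Q (y + (star t * y (Sum.inr j0)) • eb (Sum.inl i0)) (Sum.inr a))) _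
              (𝓝 (star (Q ys (Sum.inl j)) - ∑ a, F 0 j a * star (Q ys (Sum.inr a))))
          refine (e _).sub (tendsto_finsetSum _ fun a _ => Tendsto.mul ?_ (e _))
          have ct : Continuous fun W : Matrix (Fin q') (Fin p') ℂ => W j a := by fun_prop
          exact (ct.tendsto _).comp (h5 _ (zero_mem_flag i0 j0)).1
        · rw [rowD_dot, (h5 _ (zero_mem_flag i0 j0)).2.1, bdry_orth hi hu h2 h5 hQ, star_zero]
          have e1 : ts * star ts = 1 := by
            rw [Complex.star_def, Complex.mul_conj, Complex.normSq_eq_norm_sq, h1]; simp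
          simp only [hys, Pi.add_apply, Pi.smul_apply, smul_eq_mul, eb, Pi.single_apply]
          simp only [reduceCtorEq, if_false, if_true, hy]
          linear_combination (-(y (Sum.inr j0))) * e1
    choose w hw hCw using hrow
    have hlim : Tendsto M (u : Filter ℂ) (𝓝 (of fun i => w (τ i))) :=
      tendsto_pi_nhds.2 fun i => hw (τ i)
    have hdet : (of fun i => w (τ i)).det = 0 := by
      refine det_zero_of_mulVec (C := C) (fun h => by simp [h, nsq_zero] at h3) ?_
      ext i
      show w (τ i) ⬝ᵥ C = 0
      rw [dotProduct_comm, hCw]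
    rw [← hdet]
    exact ((continuous_id.matrix_det).tendsto _).comp hlim)
  refine ⟨C, ?_, hC, fun Q hQ y hy => ?_⟩
  · rw [Cst_iff_base (zero_mem_flag i0 j0)]
    intro Z hZ j
    simpa [R] using h (Sum.inl (⟨Z, hZ⟩, j))
  · have := h (Sum.inr (⟨Q, hQ⟩, ⟨y, hy⟩))
    simp only [R, Sum.elim_inr, rowD, rowD_dot] at this
    simpa using this

lemma stepD0 {f : Matrix (Fin q) (Fin p) ℂ → Matrix (Fin q') (Fin p') ℂ} (hf' : PH f) (h2q : 2 ≤ q) (hp : q' < p)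
    {x : Vec q p} (hx : 0 < hq x) :
    ∃ C ∈ Cst f (Fib x), C ≠ 0 ∧ ∀ Q, ESec f Q → ∀ y, hf y x = 0 → ∀ Z ∈ Fib x,
      hf (Q y) (Sum.elim C (C ᵥ* f Z)) = 0 := by
  let i0 : Fin q := ⟨0, by omega⟩
  let i1 : Fin q := ⟨1, by omega⟩
  let j0 : Fin p := ⟨0, by omega⟩
  obtain ⟨g, hg, ⟨c, hc, hgx⟩, hCst⟩ := stepB hf' i0 j0 hp hx
  obtain ⟨C, hC, hC0, h⟩ := stepD1 (hf'.comp_act hg) (i1 := i1) (i0 := i0) (by simp [i0, i1]) j0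
  rw [hCst] at hC
  refine ⟨C, hC, hC0, fun Q hQ y hy Z hZ => ?_⟩
  have h1 := h _ (hQ.comp_act hg) (g.symm y) (by
    have : hf (g.symm y) (eb (Sum.inl i0)) = 0 := by
      rw [← hg, LinearEquiv.apply_symm_apply, hgx, hf_smul_right, hy, mul_zero]
    rw [hf_eb_right] at this
    simpa using this)
  have h2 : act g 0 ∈ Fib x := by
    rw [← Fib_smul hc, ← hgx]
    exact act_Fib hg ⟨zero_mem_dom, on_eb_iff.2 (by simp)⟩
  simp only [Function.comp_apply, LinearEquiv.apply_symm_apply] at h1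
  rwa [hC _ h2 _ hZ] at h1

end P8b

end

section

open Filter Topology Metric
section P9a
variable {q p q' p' : ℕ}

lemma poly_zero_of_open {σ : Type*} [Fintype σ] {P : MvPolynomial σ ℂ} {O : Set (σ → ℂ)} (hO : IsOpen O) (hne : O.Nonempty)
    (h : ∀ x ∈ O, MvPolynomial.eval x P = 0) : P = 0 := by
  obtain ⟨x0, hx0⟩ := hne
  apply MvPolynomial.funext
  intro x
  rw [map_zero]
  exact ident' isOpen_univ convex_univ (diff_eval P).differentiableOn (z0 := x0) trivial
    (by filter_upwards [hO.mem_nhds hx0] with z hz using h z hz) trivial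

lemma eval_map_conj {σ : Type*} (P : MvPolynomial σ ℂ) (v : σ → ℂ) :
    MvPolynomial.eval v (MvPolynomial.map (starRingEnd ℂ) P) = star (MvPolynomial.eval (star v) P) := by
  induction P using MvPolynomial.induction_on with
  | C a => simp
  | add a b ha hb => simp only [map_add, ha, hb, star_add]
  | mul_X a i ha => simp only [map_mul, ha, MvPolynomial.map_X, MvPolynomial.eval_X, star_mul', Pi.star_apply, star_star]

/-- coefficient matrices of conjugate-linear maps with `y(x) ⟂ x` -/
def IsAlt (A : Matrix (Fin q ⊕ Fin p) (Fin q ⊕ Fin p) ℂ) : Prop := ∀ x : Vec q p, hf x (star (A *ᵥ x)) = 0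

/-- polarized orthogonality polynomial -/
noncomputable def cp (A : Matrix (Fin q ⊕ Fin p) (Fin q ⊕ Fin p) ℂ)
    (N Q : Fin q' ⊕ Fin p' → MvPolynomial (Fin q ⊕ Fin p) ℂ) : MvPolynomial (Fin q ⊕ Fin p) ℂ :=
  ∑ s, MvPolynomial.C (eps s) * N s * MvPolynomial.bind₁ (fun s => ∑ r, MvPolynomial.C (A s r) * MvPolynomial.X r)
    (MvPolynomial.map (starRingEnd ℂ) (Q s))

lemma eval_cp (A : Matrix (Fin q ⊕ Fin p) (Fin q ⊕ Fin p) ℂ)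
    (N Q : Fin q' ⊕ Fin p' → MvPolynomial (Fin q ⊕ Fin p) ℂ) (x : Vec q p) :
    MvPolynomial.eval x (cp A N Q) = hf (pv N x) (pv Q (star (A *ᵥ x))) := by
  simp only [cp, map_sum, map_mul, MvPolynomial.eval_C, hf, pv]
  refine Finset.sum_congr rfl fun s _ => ?_
  congr 1
  rw [← eval_map_conj]
  have := MvPolynomial.eval₂Hom_bind₁ (RingHom.id ℂ) x (fun s => ∑ r, MvPolynomial.C (A s r) * MvPolynomial.X r) (MvPolynomial.map (starRingEnd ℂ) (Q s))
  refine this.trans ?_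
  have e : (fun i => (MvPolynomial.eval₂Hom (RingHom.id ℂ) x) (∑ r, MvPolynomial.C (A i r) * MvPolynomial.X r)) = A *ᵥ x := by
    ext i
    simp [mulVec, dotProduct]
  rw [e]; rfl

lemma exists_alt {x y : Vec q p} (hx : x ≠ 0) (h : hf x y = 0) : ∃ A, IsAlt A ∧ star (A *ᵥ x) = y := by
  obtain ⟨s0, hs0⟩ := Function.ne_iff.1 hx
  simp only [Pi.zero_apply] at hs0
  let v : Fin q ⊕ Fin p → ℂ := fun s => eps s * star (y s)
  have hv : ∀ z : Vec q p, v ⬝ᵥ z = hf z y := fun z => by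
    simp only [dotProduct, hf, v]; exact Finset.sum_congr rfl fun s _ => by ring
  let A : Matrix (Fin q ⊕ Fin p) (Fin q ⊕ Fin p) ℂ := of fun s r =>
    (x s0)⁻¹ * eps s * (v s * (if r = s0 then 1 else 0) - (if s = s0 then 1 else 0) * v r)
  have hA : ∀ (z : Vec q p) s, (A *ᵥ z) s = (x s0)⁻¹ * eps s * (v s * z s0 - (if s = s0 then 1 else 0) * hf z y) := by
    intro z s
    rw [← hv]
    simp only [A, mulVec, dotProduct, of_apply]
    have : ∀ r, (x s0)⁻¹ * eps s * (v s * (if r = s0 then 1 else 0) - (if s = s0 then 1 else 0) * v r) * z r =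
        (x s0)⁻¹ * eps s * (v s * (if r = s0 then z r else 0) - (if s = s0 then 1 else 0) * (v r * z r)) := by
      intro r; split_ifs <;> ring
    rw [Finset.sum_congr rfl fun r _ => this r, ← Finset.mul_sum, Finset.sum_sub_distrib, ← Finset.mul_sum, ← Finset.mul_sum]
    simp
  refine ⟨A, fun z => ?_, ?_⟩
  · have h0 : hf z (star (A *ᵥ z)) = ∑ s, eps s * z s * ((x s0)⁻¹ * eps s * (v s * z s0 - (if s = s0 then 1 else 0) * hf z y)) := by
      rw [hf]; simp only [Pi.star_apply, star_star, hA]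
    rw [h0]
    have : ∀ s, eps s * z s * ((x s0)⁻¹ * eps s * (v s * z s0 - (if s = s0 then 1 else 0) * hf z y)) =
        (x s0)⁻¹ * (z s0 * (v s * z s) - hf z y * (if s = s0 then z s else 0)) := by
      intro s
      have := eps_mul_self s
      split_ifs
      · linear_combination ((x s0)⁻¹ * z s * (v s * z s0 - hf z y)) * this
      · linear_combination ((x s0)⁻¹ * z s * (v s * z s0)) * this
    rw [Finset.sum_congr rfl fun r _ => this r, ← Finset.mul_sum, Finset.sum_sub_distrib, ← Finset.mul_sum, ← Finset.mul_sum]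
    have h2 : ∑ s, v s * z s = hf z y := hv z
    rw [h2]
    simp; right; ring
  · ext s
    rw [Pi.star_apply, hA, h]
    have := eps_mul_self s
    have e : (x s0)⁻¹ * eps s * (v s * x s0 - (if s = s0 then 1 else 0) * 0) = star (y s) := by
      simp only [v]; field_simp
      linear_combination (x s0 * star (y s)) * this
    rw [e, star_star]

/-- null sections -/
def IsNull (f : Matrix (Fin q) (Fin p) ℂ → Matrix (Fin q') (Fin p') ℂ)
    (N : Fin q' ⊕ Fin p' → MvPolynomial (Fin q ⊕ Fin p) ℂ) : Prop :=
  N ≠ 0 ∧ IsSec f N ∧ ∀ Q, IsSec f Q → ∀ A, IsAlt A → cp A N Q = 0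

lemma IsNull.orth {f : Matrix (Fin q) (Fin p) ℂ → Matrix (Fin q') (Fin p') ℂ} {N} (h : IsNull f N) {Q} (hQ : IsSec f Q)
    {x y : Vec q p} (hx : x ≠ 0) (hxy : hf x y = 0) : hf (pv N x) (pv Q y) = 0 := by
  obtain ⟨A, hA, rfl⟩ := exists_alt hx hxy
  rw [← eval_cp, h.2.2 Q hQ A hA, map_zero]

lemma exists_null {f : Matrix (Fin q) (Fin p) ℂ → Matrix (Fin q') (Fin p') ℂ} (hf' : PH f) (h2q : 2 ≤ q) (hp : q' < p) :
    ∃ N, IsNull f N := by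
  classical
  obtain ⟨k, N, O, hO, hne, hk, hN, h⟩ := stepC hf' h2q hp
  let K := FractionRing (MvPolynomial (Fin q ⊕ Fin p) ℂ)
  let w : {Q // IsSec f Q} × {A : Matrix (Fin q ⊕ Fin p) (Fin q ⊕ Fin p) ℂ // IsAlt A} → Fin k → MvPolynomial (Fin q ⊕ Fin p) ℂ :=
    fun t i => cp t.2.1 (N i) t.1.1
  have hdet : ∀ τ : Fin k → _, (of fun i => w (τ i)).det = 0 := by
    intro τ
    refine poly_zero_of_open hO hne fun x hx => ?_
    obtain ⟨hx0, hli, hsp⟩ := h x hx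
    rw [RingHom.map_det]
    obtain ⟨C, hC, hC0, hCo⟩ := stepD0 hf' h2q hp hx0
    obtain ⟨a, ha⟩ := (Submodule.mem_span_range_iff_exists_fun ℂ).1 (hsp hC)
    obtain ⟨Z, hZ⟩ := exists_fib hx0
    have hne : a ≠ 0 := by
      rintro rfl
      simp at ha; exact hC0 ha.symm
    have hn : Sum.elim C (C ᵥ* f Z) = ∑ i, a i • pv (N i) x := by
      ext s
      cases s with
      | inl i => rw [← ha]; simp [Finset.sum_apply]
      | inr j =>
        rw [← ha]
        have e : ∀ i, pv (N i) x (Sum.inr j) = ((pv (N i) x ∘ Sum.inl) ᵥ* f Z) j := fun i =>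
          (congrFun (hN i Z hZ.1 x hZ.2) j).symm
        simp only [Sum.elim_inr, Finset.sum_apply, Pi.smul_apply, e]
        rw [sum_vecMul, Finset.sum_apply]
        simp [smul_vecMul]
    refine det_zero_of_mulVec (C := a) hne ?_
    ext r
    rcases hτ : τ r with ⟨⟨Q, hQ⟩, ⟨A, hA⟩⟩
    have h1 := hCo _ hQ.eSec (star (A *ᵥ x)) (hf_symm_zero (hA x)) Z hZ
    have h2 := hf_symm_zero h1
    rw [hn, hf_sum_left] at h2
    simp only [mulVec, dotProduct, RingHom.mapMatrix_apply, map_apply, of_apply, w, hτ, eval_cp]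
    rw [Pi.zero_apply, ← h2]
    exact Finset.sum_congr rfl fun i _ => by rw [hf_smul_left, mul_comm]
  obtain ⟨c, hc, hcw⟩ := det_lemma (K := K) (fun t i => algebraMap _ K (w t i)) (fun τ => by
    have := congrArg (algebraMap (MvPolynomial (Fin q ⊕ Fin p) ℂ) K) (hdet τ)
    rw [map_zero, RingHom.map_det] at this
    exact this)
  obtain ⟨b, hb⟩ := IsLocalization.exist_integer_multiples (nonZeroDivisors (MvPolynomial (Fin q ⊕ Fin p) ℂ)) Finset.univ c
  choose c' hc' using fun i => hb i (Finset.mem_univ i)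
  have hinj := IsFractionRing.injective (MvPolynomial (Fin q ⊕ Fin p) ℂ) K
  have hc'w : ∀ t, ∑ i, c' i * w t i = 0 := by
    intro t
    apply hinj
    rw [map_zero, map_sum]
    have := hcw t
    simp only [map_mul, hc']
    calc _ = (b : MvPolynomial (Fin q ⊕ Fin p) ℂ) • (c ⬝ᵥ fun i => algebraMap _ K (w t i)) := by
          simp only [dotProduct, Finset.smul_sum]
          exact Finset.sum_congr rfl fun i _ => smul_mul_assoc _ _ _
      _ = 0 := by rw [this, smul_zero]
  have hcne : ∃ i, c' i ≠ 0 := by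
    by_contra! hcon
    apply hc
    ext i
    have := hc' i
    rw [hcon i, map_zero] at this
    have hb0 : (b : MvPolynomial (Fin q ⊕ Fin p) ℂ) ≠ 0 := nonZeroDivisors.coe_ne_zero b
    exact (smul_eq_zero.1 this.symm).resolve_left hb0
  refine ⟨∑ i, c' i • N i, ?_, IsSec.sum _ fun i _ => (hN i).smul _, fun Q hQ A hA => ?_⟩
  · intro h0
    obtain ⟨i, hi⟩ := hcne
    apply hi
    refine poly_zero_of_open hO hne fun x hx => ?_
    have hli := (h x hx).2.1
    rw [Fintype.linearIndependent_iff] at hli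
    refine hli (fun i => MvPolynomial.eval x (c' i)) ?_ i
    ext a
    have := congrArg (MvPolynomial.eval x) (congrFun h0 (Sum.inl a))
    simpa [Finset.sum_apply, pv] using this
  · rw [← hc'w (⟨Q, hQ⟩, ⟨A, hA⟩)]
    simp only [cp, w, Finset.sum_apply, Pi.smul_apply, smul_eq_mul, Finset.mul_sum, Finset.sum_mul]
    rw [Finset.sum_comm]
    refine Finset.sum_congr rfl fun i _ => Finset.sum_congr rfl fun s _ => by ring

end P9a

end

section

open Filter Topology Metric
section P10a
variable {q p q' p' : ℕ}

lemma eval_smul_hom {σ : Type*} [Fintype σ] {P : MvPolynomial σ ℂ} {n : ℕ} (h : P.IsHomogeneous n) (t : ℂ) (x : σ → ℂ) :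
    MvPolynomial.eval (t • x) P = t ^ n * MvPolynomial.eval x P := by
  rw [MvPolynomial.eval_eq', MvPolynomial.eval_eq', Finset.mul_sum]
  refine Finset.sum_congr rfl fun d hd => ?_
  have h1 := h (MvPolynomial.mem_support_iff.1 hd)
  have h2 : ∑ i, d i = n := by
    rw [← h1, Finsupp.weight_apply, Finsupp.sum_fintype _ _ (by simp)]; simp
  simp only [Pi.smul_apply, smul_eq_mul, mul_pow, Finset.prod_mul_distrib, Finset.prod_pow_eq_pow_sum, h2]
  ring

/-- homogeneous component of a vector of polynomials -/
noncomputable def hc {ι σ : Type*} (d : ℕ) (N : ι → MvPolynomial σ ℂ) : ι → MvPolynomial σ ℂ :=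
  fun s => MvPolynomial.homogeneousComponent d (N s)

lemma pv_sum_hc {ι σ : Type*} [Fintype σ] [Fintype ι] (N : ι → MvPolynomial σ ℂ) :
    ∃ D, ∀ (t : ℂ) x, pv N (t • x) = ∑ d ∈ Finset.range D, t ^ d • pv (hc d N) x ∧ ∀ d, D ≤ d → hc d N = 0 := by
  refine ⟨(∑ s, (N s).totalDegree) + 1, fun t x => ⟨?_, ?_⟩⟩
  · ext s
    have h1 : (N s).totalDegree ≤ ∑ s, (N s).totalDegree :=
      Finset.single_le_sum (f := fun s => (N s).totalDegree) (fun _ _ => Nat.zero_le _) (Finset.mem_univ s)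
    have h2 : N s = ∑ d ∈ Finset.range ((∑ s, (N s).totalDegree) + 1), hc d N s := by
      conv_lhs => rw [← MvPolynomial.sum_homogeneousComponent (N s)]
      refine Finset.sum_subset (Finset.range_mono (by omega)) fun d _ hd => ?_
      apply MvPolynomial.homogeneousComponent_eq_zero
      simp at hd; omega
    rw [pv, h2, map_sum, Finset.sum_apply]
    refine Finset.sum_congr rfl fun d _ => ?_
    rw [Pi.smul_apply, smul_eq_mul, pv]
    exact eval_smul_hom (MvPolynomial.homogeneousComponent_isHomogeneous _ _) t x
  · intro d hd
    ext1 s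
    apply MvPolynomial.homogeneousComponent_eq_zero
    have h1 : (N s).totalDegree ≤ ∑ s, (N s).totalDegree :=
      Finset.single_le_sum (f := fun s => (N s).totalDegree) (fun _ _ => Nat.zero_le _) (Finset.mem_univ s)
    omega

lemma hc_lin {ι σ : Type*} [Fintype σ] [Fintype ι] (N : ι → MvPolynomial σ ℂ) (L : (ι → ℂ) →ₗ[ℂ] ℂ) {x : σ → ℂ}
    (h : ∀ t : ℂ, t ≠ 0 → L (pv N (t • x)) = 0) (d : ℕ) : L (pv (hc d N) x) = 0 := by
  obtain ⟨D, hD⟩ := pv_sum_hc N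
  by_cases hd : D ≤ d
  · rw [(hD 0 x).2 d hd]
    have : pv (0 : ι → MvPolynomial σ ℂ) x = 0 := by ext; simp [pv]
    rw [this, map_zero]
  push Not at hd
  have h1 : (Polynomial.X * ∑ d ∈ Finset.range D, Polynomial.monomial d (L (pv (hc d N) x)) : Polynomial ℂ) = 0 := by
    apply Polynomial.funext
    intro t
    by_cases ht : t = 0
    · simp [ht]
    · have := h t ht
      rw [(hD t x).1, map_sum] at this
      simp only [map_smul, smul_eq_mul] at this
      rw [Polynomial.eval_mul, Polynomial.eval_finsetSum]
      simp only [Polynomial.eval_monomial, Polynomial.eval_X, Polynomial.eval_zero]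
      rw [Finset.sum_congr rfl fun d _ => mul_comm _ _, this, mul_zero]
  have h2 := (mul_eq_zero.1 h1).resolve_left Polynomial.X_ne_zero
  have h3 := congrArg (fun P => Polynomial.coeff P d) h2
  simpa [Polynomial.finsetSum_coeff, Polynomial.coeff_monomial, hd] using h3

/-- incidence defect -/
noncomputable def onL (W : Matrix (Fin q) (Fin p) ℂ) (j : Fin p) : Vec q p →ₗ[ℂ] ℂ where
  toFun v := ((v ∘ Sum.inl) ᵥ* W) j - v (Sum.inr j)
  map_add' a b := by
    have : (a + b) ∘ Sum.inl = a ∘ Sum.inl + b ∘ (Sum.inl : Fin q → Fin q ⊕ Fin p) := rfl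
    rw [this, add_vecMul]; simp; ring
  map_smul' c a := by
    have : (c • a) ∘ Sum.inl = c • (a ∘ (Sum.inl : Fin q → Fin q ⊕ Fin p)) := rfl
    rw [this, smul_vecMul]; simp; ring

lemma on_iff_onL {W : Matrix (Fin q) (Fin p) ℂ} {v : Vec q p} : On v W ↔ ∀ j, onL W j v = 0 := by
  rw [On, funext_iff]
  exact forall_congr' fun j => sub_eq_zero.symm

/-- the form as a linear functional -/
noncomputable def hfL (y : Vec q p) : Vec q p →ₗ[ℂ] ℂ where
  toFun x := hf x y
  map_add' a b := hf_add_left a b y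
  map_smul' c a := hf_smul_left c a y

lemma IsSec.hc {f : Matrix (Fin q) (Fin p) ℂ → Matrix (Fin q') (Fin p') ℂ} {N} (h : IsSec f N) (d : ℕ) :
    IsSec f (hc d N) := by
  intro Z hZ x hx
  rw [on_iff_onL]
  intro j
  exact hc_lin N (onL (f Z) j) (fun t _ => on_iff_onL.1 (h Z hZ _ (hx.smul t)) j) d

lemma isOpen_pos : IsOpen {x : Vec q p | 0 < hq x} := isOpen_lt continuous_const continuous_hq

lemma pos_nonempty (h : 0 < q) : {x : Vec q p | 0 < hq x}.Nonempty := by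
  refine ⟨eb (Sum.inl ⟨0, h⟩), ?_⟩
  have := hf_self (eb (Sum.inl ⟨0, h⟩) : Vec q p)
  rw [hf_eb, if_pos rfl, eps_inl] at this
  have h2 : hq (eb (Sum.inl ⟨0, h⟩) : Vec q p) = 1 := by exact_mod_cast this.symm
  show 0 < hq _
  rw [h2]; exact one_pos

lemma ne_zero_of_pos {x : Vec q p} (h : 0 < hq x) : x ≠ 0 := by
  rintro rfl
  have : hq (0 : Vec q p) = 0 := by
    have := hf_self (0 : Vec q p)
    rw [hf_zero_left] at this
    exact_mod_cast this.symm
  linarith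

lemma IsNull.hc {f : Matrix (Fin q) (Fin p) ℂ → Matrix (Fin q') (Fin p') ℂ} (hq0 : 0 < q) {N} (h : IsNull f N) {d : ℕ}
    (hd : hc d N ≠ 0) : IsNull f (hc d N) := by
  refine ⟨hd, h.2.1.hc d, fun Q hQ A hA => ?_⟩
  refine poly_zero_of_open isOpen_pos (pos_nonempty hq0) fun x hx => ?_
  have hx0 := ne_zero_of_pos hx
  rw [eval_cp]
  refine hc_lin N (hfL (pv Q (star (A *ᵥ x)))) (fun t ht => ?_) d
  exact h.orth hQ (smul_ne_zero ht hx0) (by rw [hf_smul_left, hA, mul_zero])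

lemma IsNull.div {f : Matrix (Fin q) (Fin p) ℂ → Matrix (Fin q') (Fin p') ℂ} (hf' : PH f) (hq0 : 0 < q) {N}
    {c : MvPolynomial (Fin q ⊕ Fin p) ℂ} (h : IsNull f (c • N)) : IsNull f N := by
  have hc0 : c ≠ 0 := by rintro rfl; exact h.1 (by simp)
  have hN0 : N ≠ 0 := by rintro rfl; exact h.1 (by simp)
  refine ⟨hN0, ?_, fun Q hQ A hA => ?_⟩
  · obtain ⟨x0, hx0, hcx⟩ : ∃ x0 : Vec q p, 0 < hq x0 ∧ MvPolynomial.eval x0 c ≠ 0 := by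
      by_contra! hcon
      exact hc0 (poly_zero_of_open isOpen_pos (pos_nonempty hq0) hcon)
    have hO : IsOpen {x : Vec q p | MvPolynomial.eval x c ≠ 0} := isOpen_ne_fun (diff_eval c).continuous continuous_const
    refine isSec_of_open hf'.1 hO (x0 := x0) hcx hx0 fun x hx Z hZ => ?_
    have h1 := h.2.1 Z hZ.1 x hZ.2
    have h2 : pv (c • N) x = MvPolynomial.eval x c • pv N x := by ext s; simp [pv]
    rw [h2] at h1
    exact (On_smul_iff hx).1 h1
  · have h1 := h.2.2 Q hQ A hA
    have h2 : cp A (c • N) Q = c * cp A N Q := by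
      simp only [cp, Pi.smul_apply, smul_eq_mul, Finset.mul_sum]
      exact Finset.sum_congr rfl fun s _ => by ring
    rw [h2] at h1
    exact (mul_eq_zero.1 h1).resolve_left hc0

lemma exists_hom_null {f : Matrix (Fin q) (Fin p) ℂ → Matrix (Fin q') (Fin p') ℂ} (hf' : PH f) (h2q : 2 ≤ q) (hp : q' < p) :
    ∃ d N, IsNull f N ∧ 1 ≤ d ∧ (∀ s, (N s).IsHomogeneous d) ∧
      ∀ c : MvPolynomial (Fin q ⊕ Fin p) ℂ, (∀ s, c ∣ N s) → c.totalDegree = 0 := by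
  classical
  have hq0 : 0 < q := by omega
  obtain ⟨N0, h0⟩ := exists_null hf' h2q hp
  obtain ⟨N1, h1, hmin⟩ := exists_min (fun N => IsNull f N) (fun N => Finset.univ.sup fun s => (N s).totalDegree) ⟨N0, h0⟩
  obtain ⟨d, hd⟩ : ∃ d, hc d N1 ≠ 0 := by
    by_contra! hcon
    apply h1.1
    ext1 s
    rw [← MvPolynomial.sum_homogeneousComponent (N1 s)]
    exact Finset.sum_eq_zero fun d _ => congrFun (hcon d) s
  have hN := h1.hc hq0 hd
  have hle : d ≤ Finset.univ.sup fun s => (N1 s).totalDegree := by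
    by_contra! hlt
    apply hd
    ext1 s
    exact MvPolynomial.homogeneousComponent_eq_zero _ _
      (lt_of_le_of_lt (Finset.le_sup (f := fun s => (N1 s).totalDegree) (Finset.mem_univ s)) hlt)
  have hmin' : ∀ N, IsNull f N → d ≤ Finset.univ.sup fun s => (N s).totalDegree := fun N hN => hle.trans (hmin N hN)
  have hhom : ∀ s, (hc d N1 s).IsHomogeneous d := fun s => MvPolynomial.homogeneousComponent_isHomogeneous _ _
  refine ⟨d, hc d N1, hN, ?_, hhom, fun c hdiv => ?_⟩
  · by_contra! hlt
    have hd0 : d = 0 := by omega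
    subst hd0
    have hcst : ∀ s, ∃ a : ℂ, hc 0 N1 s = MvPolynomial.C a := fun s =>
      ⟨_, MvPolynomial.totalDegree_eq_zero_iff_eq_C.1 (Nat.le_zero.1 (hhom s).totalDegree_le)⟩
    choose a ha using hcst
    have hpv : ∀ x, pv (hc 0 N1) x = a := fun x => by ext s; simp [pv, ha]
    have ha0 : a ≠ 0 := by
      rintro rfl
      apply hN.1; ext1 s; rw [ha]; simp
    let i0 : Fin q := ⟨0, hq0⟩
    let j0 : Fin p := ⟨0, by omega⟩
    have e1 : On (eb (Sum.inl i0) : Vec q p) 0 := on_eb_iff.2 (by simp)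
    have e2 := hN.2.1 0 zero_mem_dom _ e1
    rw [hpv] at e2
    have e3 := mem_dom_iff_on.1 (hf'.2.1 zero_mem_dom) a ha0 e2
    have e4 := hN.orth hN.2.1 (x := eb (Sum.inl i0) + eb (Sum.inr j0)) (y := eb (Sum.inl i0) + eb (Sum.inr j0)) (by
      intro h
      have := congrFun h (Sum.inl i0)
      simp [eb] at this) (by
      simp [hf_add_left, hf_add_right, hf_eb])
    rw [hpv, hf_self] at e4
    have : hq a = 0 := by exact_mod_cast e4
    linarith
  · by_contra hc0
    choose N' hN' using hdiv
    have hEq : hc d N1 = c • N' := by ext1 s; exact hN' s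
    rw [hEq] at hN
    have hc0' : c ≠ 0 := by rintro rfl; simp at hc0
    have h2 := hmin' N' (hN.div hf' hq0)
    have h3 : ∀ s, (N' s).totalDegree ≤ d - c.totalDegree ∧ (N' s ≠ 0 → c.totalDegree ≤ d) := by
      intro s
      by_cases hs : N' s = 0
      · simp [hs]
      · have h4 := (hhom s).totalDegree_le
        rw [hN', MvPolynomial.totalDegree_mul_of_isDomain hc0' hs] at h4
        exact ⟨by omega, fun _ => by omega⟩
    obtain ⟨s, hs⟩ : ∃ s, N' s ≠ 0 := by
      by_contra! hcon
      apply hN.1; ext1 s; simp [hcon s]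
    have h4 := (h3 s).2 hs
    have h5 : (Finset.univ.sup fun s => (N' s).totalDegree) ≤ d - c.totalDegree := Finset.sup_le fun s _ => (h3 s).1
    omega

end P10a
section P10b
variable {q p q' p' : ℕ}

lemma mem_cone {x : (Fin q → ℂ) × (Fin p → ℂ)} : x ∈ genBallCone q p ↔ 0 < hq (Sum.elim x.1 x.2 : Vec q p) := by
  rw [hq, sub_pos]; rfl

lemma part1_final {f : Matrix (Fin q) (Fin p) ℂ → Matrix (Fin q') (Fin p') ℂ} (hf' : PH f) (h2q : 2 ≤ q) (hp : q' < p) :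
    ∀ x ∈ genBallCone q p, ∃ y ∈ genBallCone q' p',
      ∀ Z ∈ typeIDomain q p, x.1 ᵥ* Z = x.2 → y.1 ᵥ* f Z = y.2 := by
  intro x hx
  rw [mem_cone] at hx
  obtain ⟨C, hC, hC0⟩ := part1 hf' ⟨0, by omega⟩ ⟨0, by omega⟩ hp hx
  obtain ⟨Z0, hZ0⟩ := exists_fib hx
  refine ⟨(C, C ᵥ* f Z0), ?_, fun Z hZ hZx => hC _ ⟨hZ, hZx⟩ _ hZ0⟩
  exact mem_dom_iff.1 (hf'.2.1 hZ0.1) C hC0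

lemma append_equiv (A : Fin q → ℂ) (B : Fin p → ℂ) : Fin.append A B ∘ finSumFinEquiv = Sum.elim A B := by
  ext s; cases s <;> simp

lemma eval_ren (A : Fin q → ℂ) (B : Fin p → ℂ) (P : MvPolynomial (Fin q ⊕ Fin p) ℂ) :
    MvPolynomial.eval (Fin.append A B) (MvPolynomial.rename finSumFinEquiv P) = MvPolynomial.eval (Sum.elim A B) P := by
  rw [MvPolynomial.eval_rename, append_equiv]

lemma dvd_ren {c : MvPolynomial (Fin (q + p)) ℂ} {P : MvPolynomial (Fin q ⊕ Fin p) ℂ}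
    (h : c ∣ MvPolynomial.rename finSumFinEquiv P) : MvPolynomial.rename finSumFinEquiv.symm c ∣ P := by
  have := map_dvd (MvPolynomial.rename (R := ℂ) (finSumFinEquiv (m := q) (n := p)).symm) h
  rwa [MvPolynomial.rename_rename, Equiv.symm_comp_self, MvPolynomial.rename_id_apply] at this

lemma part2_final {f : Matrix (Fin q) (Fin p) ℂ → Matrix (Fin q') (Fin p') ℂ} (hf' : PH f) (h2q : 2 ≤ q) (hp : q' < p) :
    ∃ (d : ℕ) (P1 : Fin q' → MvPolynomial (Fin (q + p)) ℂ)
        (P2 : Fin p' → MvPolynomial (Fin (q + p)) ℂ),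
      IsRatProperRep q p q' p' d P1 P2 ∧
      ∃ U : Set ((Fin q → ℂ) × (Fin p → ℂ)),
        IsOpen U ∧ U ⊆ genBallCone q p ∧ genBallCone q p ⊆ closure U ∧
        ∀ x ∈ U,
          (¬ ((∀ i, MvPolynomial.eval (Fin.append x.1 x.2) (P1 i) = 0) ∧
              (∀ j, MvPolynomial.eval (Fin.append x.1 x.2) (P2 j) = 0))) ∧
          ∀ Z ∈ typeIDomain q p, x.1 ᵥ* Z = x.2 →
            (fun i => MvPolynomial.eval (Fin.append x.1 x.2) (P1 i)) ᵥ* f Z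
              = fun j => MvPolynomial.eval (Fin.append x.1 x.2) (P2 j) := by
  obtain ⟨d, N, hN, hd, hhom, hdiv⟩ := exists_hom_null hf' h2q hp
  have hz : ∀ A B, ((∀ i, MvPolynomial.eval (Sum.elim A B) (N (Sum.inl i)) = 0) ∧
      (∀ j, MvPolynomial.eval (Sum.elim A B) (N (Sum.inr j)) = 0)) ↔ pv N (Sum.elim A B) = 0 := by
    intro A B
    rw [funext_iff, Sum.forall]; rfl
  refine ⟨d, fun i => MvPolynomial.rename finSumFinEquiv (N (Sum.inl i)),
    fun j => MvPolynomial.rename finSumFinEquiv (N (Sum.inr j)), ⟨hd, fun i => (hhom _).rename_isHomogeneous,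
    fun j => (hhom _).rename_isHomogeneous, ?_, ?_, ?_, ?_⟩, ?_⟩
  · rintro ⟨h1, h2⟩
    apply hN.1
    have hinj := MvPolynomial.rename_injective (R := ℂ) _ (finSumFinEquiv (m := q) (n := p)).injective
    ext1 s
    apply hinj
    rw [Pi.zero_apply, map_zero]
    cases s with
    | inl i => exact h1 i
    | inr j => exact h2 j
  · intro c h1 h2
    have := hdiv (MvPolynomial.rename finSumFinEquiv.symm c) (fun s => by
      cases s with
      | inl i => exact dvd_ren (h1 i)
      | inr j => exact dvd_ren (h2 j))
    rw [← MvPolynomial.totalDegree_renameEquiv (finSumFinEquiv (m := q) (n := p)).symm c]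
    exact this
  · intro A B hAB hne
    simp only [eval_ren] at hne ⊢
    rw [hz] at hne
    have hx : 0 < hq (Sum.elim A B : Vec q p) := (mem_cone (x := (A, B))).1 hAB
    obtain ⟨Z, hZ⟩ := exists_fib hx
    have := mem_dom_iff_on.1 (hf'.2.1 hZ.1) _ hne (hN.2.1 Z hZ.1 _ hZ.2)
    rw [hq, sub_pos] at this
    exact this
  · intro A B h0 hAB hne
    simp only [eval_ren]
    have hx0 : (Sum.elim A B : Vec q p) ≠ 0 := by
      intro h
      exact h0 ⟨funext fun i => congrFun h (Sum.inl i), funext fun j => congrFun h (Sum.inr j)⟩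
    have hself : hf (Sum.elim A B : Vec q p) (Sum.elim A B) = 0 := by
      rw [hf_self, hq]
      have : nsq A = nsq B := hAB
      simp [this]
    have := hN.orth hN.2.1 hx0 hself
    rw [hf_self] at this
    have h2 : hq (pv N (Sum.elim A B)) = 0 := by exact_mod_cast this
    rw [hq, sub_eq_zero] at h2
    exact h2
  · let e : (Fin q → ℂ) × (Fin p → ℂ) → Vec q p := fun x => Sum.elim x.1 x.2
    have he : Continuous e := by
      refine continuous_pi fun s => ?_
      cases s with
      | inl i => exact (continuous_apply i).comp continuous_fst
      | inr j => exact (continuous_apply j).comp continuous_snd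
    have hNc : Continuous (pv N) := hN.2.1.eSec.1.continuous
    have hO : IsOpen {x : Vec q p | 0 < hq x ∧ pv N x ≠ 0} := isOpen_pos.inter (isOpen_ne_fun hNc continuous_const)
    refine ⟨e ⁻¹' {x | 0 < hq x ∧ pv N x ≠ 0}, hO.preimage he, fun x hx => mem_cone.2 hx.1, ?_, ?_⟩
    · intro x hx
      rw [mem_cone] at hx
      rw [_root_.mem_closure_iff]
      intro V hV hxV
      by_contra hcon
      let e' : Vec q p → (Fin q → ℂ) × (Fin p → ℂ) := fun v => (v ∘ Sum.inl, v ∘ Sum.inr)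
      have he' : Continuous e' := cont_inl.prodMk cont_inr
      apply hN.1
      ext1 s
      refine poly_zero_of_open (isOpen_pos.inter (hV.preimage he')) ⟨e x, hx, ?_⟩ fun v hv => ?_
      · exact hxV
      · by_contra hne
        apply hcon
        have hev : e (e' v) = v := by ext s; cases s <;> rfl
        refine ⟨e' v, hv.2, ?_⟩
        show _ ∧ _
        rw [hev]
        exact ⟨hv.1, fun h => hne (congrFun h s)⟩
    · intro x hx
      simp only [eval_ren]
      rw [hz]
      exact ⟨hx.2, fun Z hZ h => hN.2.1 Z hZ (Sum.elim x.1 x.2) h⟩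

end P10b

end

section

open Filter Topology Metric
section P11a
variable {q p q' p' : ℕ}

/-- null sections, as entire maps -/
structure NC (f : Matrix (Fin q) (Fin p) ℂ → Matrix (Fin q') (Fin p') ℂ) (Q : Vec q p → Vec q' p') : Prop where
  ph : PH f
  sec : ESec f Q
  orth : ∀ x y, x ≠ 0 → hf x y = 0 → hf (Q x) (Q y) = 0
  cd : ContDiff ℂ 1 Q
  hom : ∃ d : ℕ, ∀ (t : ℂ) x, Q (t • x) = t ^ d • Q x

lemma cd_lin (g : Vec q p ≃ₗ[ℂ] Vec q p) : ContDiff ℂ 1 g :=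
  (LinearMap.toContinuousLinearMap (g : Vec q p →ₗ[ℂ] Vec q p)).contDiff

lemma NC.comp {f : Matrix (Fin q) (Fin p) ℂ → Matrix (Fin q') (Fin p') ℂ} {Q} (h : NC f Q)
    {g : Vec q p ≃ₗ[ℂ] Vec q p} (hg : IsU g) : NC (f ∘ act g) (Q ∘ g) where
  ph := h.ph.comp_act hg
  sec := h.sec.comp_act hg
  orth x y hx hxy := h.orth _ _ (by simpa using hx) (by rw [hg, hxy])
  cd := h.cd.comp (cd_lin g)
  hom := by
    obtain ⟨d, hd⟩ := h.hom
    exact ⟨d, fun t x => by simp [hd]⟩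

lemma cd_eval {σ : Type*} [Fintype σ] (P : MvPolynomial σ ℂ) : ContDiff ℂ 1 fun x : σ → ℂ => MvPolynomial.eval x P := by
  induction P using MvPolynomial.induction_on with
  | C a => simp only [MvPolynomial.eval_C]; exact contDiff_const
  | add p q hp hq => simp only [map_add]; exact hp.add hq
  | mul_X p i hp => simp only [map_mul, MvPolynomial.eval_X]; exact hp.mul (contDiff_apply ℂ ℂ i)

lemma exists_NC {f : Matrix (Fin q) (Fin p) ℂ → Matrix (Fin q') (Fin p') ℂ} (hf' : PH f) (h2q : 2 ≤ q) (hp : q' < p) :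
    ∃ Q, NC f Q ∧ ∃ x, 0 < hq x ∧ Q x ≠ 0 := by
  obtain ⟨d, N, hN, -, hd, -⟩ := exists_hom_null hf' h2q hp
  refine ⟨pv N, ⟨hf', hN.2.1.eSec, fun x y hx hxy => hN.orth hN.2.1 hx hxy, contDiff_pi.2 fun s => cd_eval (N s),
    d, fun t x => ?_⟩, ?_⟩
  · ext s; simp [pv, eval_smul_hom (hd s)]
  · by_contra! hcon
    apply hN.1
    ext1 s
    exact poly_zero_of_open isOpen_pos (pos_nonempty (by omega)) fun x hx => congrFun (hcon x hx) s

lemma cont_hf : Continuous fun x : Vec q p × Vec q p => hf x.1 x.2 := by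
  unfold hf
  fun_prop

lemma tendsto_hf {α : Type*} {l : Filter α} {a b : α → Vec q p} {a0 b0 : Vec q p} (ha : Tendsto a l (𝓝 a0))
    (hb : Tendsto b l (𝓝 b0)) : Tendsto (fun t => hf (a t) (b t)) l (𝓝 (hf a0 b0)) := by
  unfold hf
  exact tendsto_finsetSum _ fun s _ => ((tendsto_const_nhds).mul (tendsto_pi_nhds.1 ha s)).mul ((tendsto_pi_nhds.1 hb s).star)

lemma strict_lim {E F α : Type*} [NormedAddCommGroup E] [NormedSpace ℂ E] [NormedAddCommGroup F] [NormedSpace ℂ F]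
    {Q : E → F} {z : E} {D : E →L[ℂ] F} (hD : HasStrictFDerivAt Q D z) {l : Filter α} {x y w : α → E} {c : α → ℂ} {w0 : E}
    (hx : Tendsto x l (𝓝 z)) (hy : Tendsto y l (𝓝 z)) (hw : Tendsto w l (𝓝 w0)) (hc : ∀ᶠ t in l, c t ≠ 0)
    (hxy : ∀ᶠ t in l, x t - y t = c t • w t) :
    Tendsto (fun t => (c t)⁻¹ • (Q (x t) - Q (y t))) l (𝓝 (D w0)) := by
  have h1 := hD.isLittleO.comp_tendsto (hx.prodMk_nhds hy)
  have h2 : (fun t => (c t)⁻¹ • (Q (x t) - Q (y t)) - D (w t)) =o[l] fun t => w t := by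
    rw [Asymptotics.isLittleO_iff] at h1 ⊢
    intro ε hε
    filter_upwards [h1 hε, hc, hxy] with t h1 hc hxy
    simp only [Function.comp] at h1
    rw [hxy, map_smul] at h1
    have h3 : (c t)⁻¹ • (Q (x t) - Q (y t)) - D (w t) = (c t)⁻¹ • (Q (x t) - Q (y t) - c t • D (w t)) := by
      rw [smul_sub _ _ (c t • _), smul_smul, inv_mul_cancel₀ hc, one_smul]
    rw [h3, norm_smul, norm_inv]
    rw [norm_smul] at h1
    have : 0 < ‖c t‖ := norm_pos_iff.2 hc
    rw [inv_mul_le_iff₀ this]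
    linarith
  have h3 : Tendsto (fun t => (c t)⁻¹ • (Q (x t) - Q (y t)) - D (w t)) l (𝓝 0) := by
    have := (h2.trans_isBigO (hw.isBigO_one ℝ))
    exact (Asymptotics.isLittleO_one_iff ℝ).1 this
  have h4 := h3.add ((D.continuous.tendsto w0).comp hw)
  simpa using h4

lemma psd {F : Matrix (Fin q) (Fin p) ℂ} (hF : F ∈ Kset q p 1) {w : Vec q p} (hw : On w F) : 0 ≤ hq w := by
  have := hF (w ∘ Sum.inl)
  rw [hw] at this
  unfold hq
  linarith

lemma hq_add (x y : Vec q p) : hq (x + y) = hq x + hq y + 2 * (hf x y).re := by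
  have h := hf_self (x + y)
  rw [hf_add_left, hf_add_right, hf_add_right, hf_self, hf_self, ← hf_conj x y] at h
  have := congrArg Complex.re h
  simp at this
  linarith

lemma psd_cs {F : Matrix (Fin q) (Fin p) ℂ} (hF : F ∈ Kset q p 1) {w w' : Vec q p} (hw : On w F) (hw' : On w' F)
    (h0 : hq w = 0) : hf w w' = 0 := by
  by_contra hne
  set a := hf w w'
  have hpos : 0 < ‖a‖ ^ 2 := by positivity
  have key : ∀ t : ℝ, 0 ≤ hq w' - 2 * t * ‖a‖ ^ 2 := fun t => by
    have h1 := psd hF (hw'.add (hw.smul (-(t : ℂ) * star a)))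
    rw [hq_add, hq_smul, h0, hf_smul_right, ← hf_conj w w'] at h1
    have e : star (-(t : ℂ) * star a) * star a = ((-(t * ‖a‖ ^ 2) : ℝ) : ℂ) := by
      have : a * star a = ((‖a‖ ^ 2 : ℝ) : ℂ) := by
        have := Complex.mul_conj' a
        push_cast; exact this
      have h5 : star (-(t : ℂ) * star a) = -(t : ℂ) * a := by simp
      rw [h5, mul_assoc, this]; push_cast; ring
    change 0 ≤ hq w' + _ + 2 * (star (-(t : ℂ) * star a) * star a).re at h1
    rw [e, Complex.ofReal_re] at h1
    linarith
  have h2 := key (hq w' / ‖a‖ ^ 2 + 1)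
  have h3 : (hq w' / ‖a‖ ^ 2 + 1) * ‖a‖ ^ 2 = hq w' + ‖a‖ ^ 2 := by field_simp
  have h4 := key 0
  nlinarith

lemma bdry_std {f : Matrix (Fin q) (Fin p) ℂ → Matrix (Fin q') (Fin p') ℂ} (hf' : PH f) (i0 : Fin q) (j0 : Fin p) :
    ∃ F ∈ Kset q' p' 1, ∀ Q, ESec f Q → ∀ v : Vec q p, (∀ j, v (Sum.inr j) = if j = j0 then v (Sum.inl i0) else 0) →
      On (Q v) F := by
  let l : Filter ℂ := map ((↑) : ℝ → ℂ) (𝓝[<] (1 : ℝ))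
  let u := Ultrafilter.of l
  have hul : (u : Filter ℂ) ≤ l := Ultrafilter.of_le l
  have hl1 : Tendsto id l (𝓝 (1 : ℂ)) := by
    show Tendsto ((↑) : ℝ → ℂ) (𝓝[<] (1 : ℝ)) (𝓝 (1 : ℂ))
    exact (Complex.continuous_ofReal.tendsto' 1 1 (by simp)).mono_left nhdsWithin_le_nhds
  have hu : Bdry u := by
    constructor
    · apply hul
      show ∀ᶠ t : ℝ in 𝓝[<] (1 : ℝ), ‖(t : ℂ)‖ < 1
      filter_upwards [Ioo_mem_nhdsLT (show (0 : ℝ) < 1 by norm_num)] with t ht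
      rw [Complex.norm_real, Real.norm_eq_abs, abs_of_pos ht.1]; exact ht.2
    · have := (continuous_norm.tendsto (1 : ℂ)).comp (hl1.mono_left hul)
      simpa using this
  obtain ⟨ts, F, C, D, -, hts, -, -, h⟩ := boundary hf' i0 j0 u hu
  have e1 : ts = 1 := tendsto_nhds_unique hts (hl1.mono_left hul)
  subst e1
  obtain ⟨h1, -, -, h2⟩ := h 0 (zero_mem_flag i0 j0)
  refine ⟨F 0, h2, fun Q hQ v hv => ?_⟩
  have h3 : ∀ t : ℂ, On (gv (v ∘ Sum.inl) (0 + t • Matrix.single i0 j0 1)) (0 + t • Matrix.single i0 j0 1) := fun t => on_gv _ _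
  have hv' : v = gv (v ∘ Sum.inl) (0 + (1 : ℂ) • Matrix.single i0 j0 1) := by
    ext s
    rcases s with i | j
    · rfl
    · rw [gv_apply_inr, hv j, zero_add, one_smul, vecMul_E]; rfl
  have hl : Tendsto (fun t : ℂ => Q (gv (v ∘ Sum.inl) (0 + t • Matrix.single i0 j0 (1 : ℂ)))) u (𝓝 (Q v)) := by
    have hc : Continuous fun t : ℂ => Q (gv (v ∘ Sum.inl) (0 + t • Matrix.single i0 j0 (1 : ℂ))) :=
      hQ.1.continuous.comp (diff_gv.continuous.comp
        (f := fun t : ℂ => (v ∘ Sum.inl, 0 + t • Matrix.single i0 j0 (1 : ℂ))) (by fun_prop))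
    have := (hc.tendsto 1).comp hts
    rw [← hv'] at this
    exact this
  refine on_lim hl h1 ?_
  filter_upwards [hu.1] with t ht
  exact hQ.2 _ (line_mem (zero_mem_flag i0 j0) ht) _ (on_gv _ _)

lemma NC.kap {f : Matrix (Fin q) (Fin p) ℂ → Matrix (Fin q') (Fin p') ℂ} {Q} (h : NC f Q) {z e s s' : Vec q p}
    (hz0 : z ≠ 0) (hzz : hf z z = 0) (hzs : hf z s = 0) (hzs' : hf z s' = 0) (hse : hf s e = 0) (hze : hf z e = -1) :
    hf (fderiv ℂ Q z s) (fderiv ℂ Q z s') = - (hf s s' * hf (Q z) (fderiv ℂ Q z e)) := by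
  have hD : HasStrictFDerivAt Q (fderiv ℂ Q z) z := h.cd.contDiffAt.hasStrictFDerivAt one_ne_zero
  set D := fderiv ℂ Q z
  set μ := hf s' s
  have hsz := hf_symm_zero hzs
  have hs'z := hf_symm_zero hzs'
  let l : Filter ℝ := 𝓝[≠] 0
  have hl0 : Tendsto (fun t : ℝ => (t : ℂ)) l (𝓝 0) := by
    have : Tendsto (fun t : ℝ => (t : ℂ)) (𝓝 0) (𝓝 0) := Complex.continuous_ofReal.tendsto' 0 0 (by simp)
    exact this.mono_left nhdsWithin_le_nhds
  have hne : ∀ᶠ t : ℝ in l, (t : ℂ) ≠ 0 := by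
    filter_upwards [eventually_mem_nhdsWithin] with t ht
    exact_mod_cast ht
  let a : ℝ → Vec q p := fun t => z + (t : ℂ) • s
  let b : ℝ → Vec q p := fun t => z + (t : ℂ) • (s' + (t : ℂ) • μ • e)
  let b' : ℝ → Vec q p := fun t => z + (t : ℂ) • s'
  have ha : Tendsto a l (𝓝 z) := by
    have := (tendsto_const_nhds (x := z)).add (hl0.smul (tendsto_const_nhds (x := s)))
    rw [zero_smul, add_zero] at this; exact this
  have hb' : Tendsto b' l (𝓝 z) := by
    have := (tendsto_const_nhds (x := z)).add (hl0.smul (tendsto_const_nhds (x := s')))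
    rw [zero_smul, add_zero] at this; exact this
  have hw : Tendsto (fun t : ℝ => s' + (t : ℂ) • μ • e) l (𝓝 s') := by
    have := (tendsto_const_nhds (x := s')).add (hl0.smul (tendsto_const_nhds (x := μ • e)))
    simpa using this
  have hb : Tendsto b l (𝓝 z) := by
    have := (tendsto_const_nhds (x := z)).add (hl0.smul hw)
    rw [zero_smul, add_zero] at this; exact this
  have L1 := strict_lim hD (c := fun t : ℝ => (t : ℂ)) ha (tendsto_const_nhds (x := z)) (tendsto_const_nhds (x := s)) hne
    (Eventually.of_forall fun t => by simp [a])
  have L2 := strict_lim hD (c := fun t : ℝ => (t : ℂ)) hb (tendsto_const_nhds (x := z)) hw hne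
    (Eventually.of_forall fun t => by simp [b])
  have L3 := strict_lim hD (c := fun t : ℝ => (t : ℂ) ^ 2) hb hb' (tendsto_const_nhds (x := μ • e))
    (hne.mono fun t ht => pow_ne_zero 2 ht)
    (Eventually.of_forall fun t => by simp only [b, b', smul_add, smul_smul]; rw [← add_assoc, add_sub_cancel_left]; congr 1; ring)
  have L := (tendsto_hf L1 L2).add (tendsto_hf (tendsto_const_nhds (x := Q z)) L3)
  have hzero : ∀ᶠ t : ℝ in l, hf ((t : ℂ)⁻¹ • (Q (a t) - Q z)) ((t : ℂ)⁻¹ • (Q (b t) - Q z)) +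
      hf (Q z) (((t : ℂ) ^ 2)⁻¹ • (Q (b t) - Q (b' t))) = 0 := by
    filter_upwards [hne, ha.eventually (isOpen_ne.mem_nhds hz0)] with t ht hat
    have o1 : hf (Q (a t)) (Q (b t)) = 0 := by
      refine h.orth _ _ hat ?_
      simp only [a, b, hf_add_left, hf_add_right, hf_smul_left, hf_smul_right, hzz, hzs', hze, hsz, hse]
      have : star μ = hf s s' := hf_conj _ _
      have ht' : star (t : ℂ) = t := Complex.conj_ofReal t
      rw [this, ht']; ring
    have o2 : hf (Q (a t)) (Q z) = 0 := h.orth _ _ hat (by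
      simp only [a, hf_add_left, hf_smul_left, hzz, hsz, mul_zero, add_zero])
    have o3 : hf (Q z) (Q (b' t)) = 0 := h.orth _ _ hz0 (by
      simp only [b', hf_add_right, hf_smul_right, hzz, hzs', mul_zero, add_zero])
    have o4 : hf (Q z) (Q z) = 0 := h.orth _ _ hz0 hzz
    have ht' : star (t : ℂ)⁻¹ = (t : ℂ)⁻¹ := by rw [star_inv₀]; congr 1; exact Complex.conj_ofReal t
    have ht2 : star ((t : ℂ) ^ 2)⁻¹ = ((t : ℂ) ^ 2)⁻¹ := by rw [← inv_pow, star_pow, ht']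
    simp only [hf_smul_left, hf_smul_right, hf_sub_left, hf_sub_right, o1, o2, o3, o4, ht', ht2]
    field_simp
    ring
  have h0 := tendsto_nhds_unique (L.congr' hzero) tendsto_const_nhds
  rw [map_smul, hf_smul_right] at h0
  have : star μ = hf s s' := hf_conj _ _
  rw [this] at h0
  linear_combination h0
end P11a

end

section

open Filter Topology Metric
section P12a
variable {q p q' p' : ℕ}

/-- the slice space -/
def SS (q p : ℕ) (i0 : Fin q) : Submodule ℂ (Vec q p) where
  carrier := {x | (∀ j, x (Sum.inr j) = 0) ∧ x (Sum.inl i0) = 0}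
  add_mem' := fun {a b} ha hb => ⟨fun j => by simp [ha.1 j, hb.1 j], by simp [ha.2, hb.2]⟩
  zero_mem' := ⟨fun _ => rfl, rfl⟩
  smul_mem' := fun c {a} ha => ⟨fun j => by simp [ha.1 j], by simp [ha.2]⟩

lemma mem_SS {i0 : Fin q} {x : Vec q p} : x ∈ SS q p i0 ↔ (∀ j, x (Sum.inr j) = 0) ∧ x (Sum.inl i0) = 0 := Iff.rfl

lemma eb_mem_SS {i0 i : Fin q} (h : i ≠ i0) : (eb (Sum.inl i) : Vec q p) ∈ SS q p i0 :=
  ⟨fun j => by simp [eb], by simp [eb, h.symm]⟩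

lemma fderiv_lin {E F : Type*} [NormedAddCommGroup E] [NormedSpace ℂ E] [NormedAddCommGroup F] [NormedSpace ℂ F]
    {Q : E → F} (hQ : Differentiable ℂ Q) (T : F →L[ℂ] ℂ) {z s : E} (h : ∀ t : ℂ, T (Q (z + t • s)) = 0) :
    T (fderiv ℂ Q z s) = 0 := by
  have h1 : HasDerivAt (fun t : ℂ => z + t • s) s 0 := by
    simpa using ((hasDerivAt_id (0 : ℂ)).smul_const s).const_add z
  have h2 : HasFDerivAt Q (fderiv ℂ Q z) (z + (0 : ℂ) • s) := by
    rw [zero_smul, add_zero]; exact (hQ z).hasFDerivAt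
  have h3 := T.hasFDerivAt.comp_hasDerivAt (0 : ℂ) (h2.comp_hasDerivAt (0 : ℂ) h1)
  have h4 : (T ∘ Q ∘ fun t : ℂ => z + t • s) = fun _ => 0 := funext h
  have h5 : HasDerivAt (fun _ : ℂ => (0 : ℂ)) (T (fderiv ℂ Q z s)) 0 := h4 ▸ h3
  exact h5.unique (hasDerivAt_const _ _)

lemma NC.deriv_on {f : Matrix (Fin q) (Fin p) ℂ → Matrix (Fin q') (Fin p') ℂ} {Q} (h : NC f Q) {F : Matrix (Fin q') (Fin p') ℂ}
    {z s : Vec q p} (hF : ∀ t : ℂ, On (Q (z + t • s)) F) : On (fderiv ℂ Q z s) F := by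
  rw [on_iff_onL]
  intro j
  exact fderiv_lin h.sec.1 (LinearMap.toContinuousLinearMap (onL F j)) fun t => on_iff_onL.1 (hF t) j

lemma NC.deriv_orth {f : Matrix (Fin q) (Fin p) ℂ → Matrix (Fin q') (Fin p') ℂ} {Q} (h : NC f Q)
    {x z s : Vec q p} (hx : x ≠ 0) (hz : hf z x = 0) (hs : hf s x = 0) : hf (fderiv ℂ Q z s) (Q x) = 0 := by
  refine fderiv_lin h.sec.1 (LinearMap.toContinuousLinearMap (hfL (Q x))) fun t => ?_
  show hf _ _ = 0
  apply hf_symm_zero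
  refine h.orth _ _ hx ?_
  apply hf_symm_zero
  rw [hf_add_left, hf_smul_left, hz, hs, mul_zero, add_zero]

lemma NC.kpos {f : Matrix (Fin q) (Fin p) ℂ → Matrix (Fin q') (Fin p') ℂ} {Q} (h : NC f Q) (i0 : Fin q) (j0 : Fin p)
    {F : Matrix (Fin q') (Fin p') ℂ} (hF : On (Q (eb (Sum.inl i0) + eb (Sum.inr j0))) F)
    (hQ : Q (eb (Sum.inl i0) + eb (Sum.inr j0)) ≠ 0) (hzz : hq (Q (eb (Sum.inl i0) + eb (Sum.inr j0))) = 0) :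
    (hf (Q (eb (Sum.inl i0) + eb (Sum.inr j0))) (fderiv ℂ Q (eb (Sum.inl i0) + eb (Sum.inr j0)) (eb (Sum.inr j0)))).re < 0 := by
  set e : Vec q p := eb (Sum.inl i0)
  set e' : Vec q p := eb (Sum.inr j0)
  set z := e + e' with hz
  have hD : HasStrictFDerivAt Q (fderiv ℂ Q z) z := h.cd.contDiffAt.hasStrictFDerivAt one_ne_zero
  set D := fderiv ℂ Q z
  obtain ⟨c, hc, hop⟩ := hopf h.ph i0 j0
  let l : Filter ℝ := 𝓝[<] 1
  let x : ℝ → Vec q p := fun t => e + (t : ℂ) • e'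
  have hl1 : Tendsto (fun t : ℝ => (t : ℂ)) l (𝓝 1) := 
    (Complex.continuous_ofReal.tendsto' 1 1 (by simp)).mono_left nhdsWithin_le_nhds
  have hx : Tendsto x l (𝓝 z) := by
    have := (tendsto_const_nhds (x := e)).add (hl1.smul (tendsto_const_nhds (x := e')))
    rw [one_smul] at this; exact this
  have hIoo : ∀ᶠ t : ℝ in l, t ∈ Set.Ioo (0 : ℝ) 1 := Ioo_mem_nhdsLT (by norm_num)
  let δ : ℝ → Vec q' p' := fun t => ((t : ℂ) - 1)⁻¹ • (Q (x t) - Q z)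
  have hδ : Tendsto δ l (𝓝 (D e')) := by
    refine strict_lim hD (c := fun t : ℝ => (t : ℂ) - 1) hx (tendsto_const_nhds (x := z)) (tendsto_const_nhds (x := e')) ?_ ?_
    · filter_upwards [hIoo] with t ht
      rw [sub_ne_zero]
      exact_mod_cast ht.2.ne
    · refine Eventually.of_forall fun t => ?_
      simp only [x, hz, sub_smul, one_smul]; abel
  have hon : ∀ t ∈ Set.Ioo (0 : ℝ) 1, c * (1 - t) * nsq (Q (x t) ∘ Sum.inl) ≤ hq (Q (x t)) := by
    intro t ht
    have hn : ‖(t : ℂ)‖ = t := by rw [Complex.norm_real, Real.norm_eq_abs, abs_of_pos ht.1]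
    have hmem : (t : ℂ) • Matrix.single i0 j0 (1 : ℂ) ∈ typeIDomain q p := by
      have := line_mem (zero_mem_flag (q := q) (p := p) i0 j0) (t := (t : ℂ)) (by rw [hn]; exact ht.2)
      rwa [zero_add] at this
    have h1 : On (x t) ((t : ℂ) • Matrix.single i0 j0 (1 : ℂ)) := by
      show _ ᵥ* _ = _
      ext j
      rw [vecMul_smul, Pi.smul_apply, vecMul_E]
      by_cases hj : j = j0
      · subst hj; simp [x, e, e', eb]
      · simp [x, e, e', eb, hj]
    have h2 := h.sec.2 _ hmem _ h1
    have h3 := hop t (by rw [hn]; exact ht.2) (Q (x t) ∘ Sum.inl)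
    rw [h2, hn] at h3
    unfold hq
    linarith
  have hne : nsq (Q z ∘ Sum.inl) ≠ 0 := by
    intro h0
    apply hQ
    rw [hF.eq_gv]
    rw [nsq_eq_zero] at h0
    rw [h0]
    exact (On.eq_gv (On.zero F)).symm
  have hlim1 : Tendsto (fun t : ℝ => c * nsq (Q (x t) ∘ Sum.inl)) l (𝓝 (c * nsq (Q z ∘ Sum.inl))) := by
    have hcont : Continuous fun v => c * nsq (Q v ∘ Sum.inl) :=
      continuous_const.mul (continuous_nsq.comp (cont_inl.comp h.sec.1.continuous))
    exact (hcont.tendsto z).comp hx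
  have hlim2 : Tendsto (fun t : ℝ => (1 - t) * hq (δ t) - 2 * (hf (Q z) (δ t)).re) l
      (𝓝 ((1 - 1) * hq (D e') - 2 * (hf (Q z) (D e')).re)) := by
    have t1 : Tendsto (fun t : ℝ => t) l (𝓝 1) := tendsto_id.mono_left nhdsWithin_le_nhds
    have t2 : Tendsto (fun t => hq (δ t)) l (𝓝 (hq (D e'))) := (continuous_hq.tendsto _).comp hδ
    have t3 := (Complex.continuous_re.tendsto _).comp (tendsto_hf (tendsto_const_nhds (x := Q z)) hδ)
    exact ((t1.const_sub 1).mul t2).sub (t3.const_mul 2)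
  have hle : ∀ᶠ t in l, c * nsq (Q (x t) ∘ Sum.inl) ≤ (1 - t) * hq (δ t) - 2 * (hf (Q z) (δ t)).re := by
    filter_upwards [hIoo] with t ht
    have h1 := hon t ht
    have hne1 : (t : ℂ) - 1 ≠ 0 := by
      rw [sub_ne_zero]
      exact_mod_cast ht.2.ne
    have h2 : Q (x t) = Q z + ((t : ℂ) - 1) • δ t := by
      simp only [δ]; rw [smul_smul, mul_inv_cancel₀ hne1, one_smul]; abel
    have h3 : hq (Q (x t)) = (1 - t) * ((1 - t) * hq (δ t) - 2 * (hf (Q z) (δ t)).re) := by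
      have e1 : (t : ℂ) - 1 = ((t - 1 : ℝ) : ℂ) := by push_cast; rfl
      have e2 : star ((t - 1 : ℝ) : ℂ) = ((t - 1 : ℝ) : ℂ) := Complex.conj_ofReal _
      rw [h2, hq_add, hq_smul, hzz, hf_smul_right, e1, e2, Complex.re_ofReal_mul, Complex.norm_real, Real.norm_eq_abs, sq_abs]
      ring
    rw [h3] at h1
    have h4 : 0 < 1 - t := by linarith [ht.2]
    have : (1 - t) * (c * nsq (Q (x t) ∘ Sum.inl)) ≤ (1 - t) * ((1 - t) * hq (δ t) - 2 * (hf (Q z) (δ t)).re) := by linarith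
    exact le_of_mul_le_mul_left this h4
  have hfin := le_of_tendsto_of_tendsto hlim1 hlim2 hle
  have : 0 < nsq (Q z ∘ Sum.inl) := lt_of_le_of_ne (nsq_nonneg _) hne.symm
  nlinarith [mul_pos hc this]

lemma hf_SS {i0 : Fin q} {j0 : Fin p} {x : Vec q p} (hx : x ∈ SS q p i0) :
    hf (eb (Sum.inl i0) + eb (Sum.inr j0)) x = 0 ∧ hf x (eb (Sum.inr j0)) = 0 := by
  rw [hf_add_left, hf_eb_left, hf_eb_left, hf_eb_right, hx.2, hx.1]
  simp

lemma z_facts (i0 : Fin q) (j0 : Fin p) : (eb (Sum.inl i0) + eb (Sum.inr j0) : Vec q p) ≠ 0 ∧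
    hf (eb (Sum.inl i0) + eb (Sum.inr j0) : Vec q p) (eb (Sum.inl i0) + eb (Sum.inr j0)) = 0 ∧
    hf (eb (Sum.inl i0) + eb (Sum.inr j0) : Vec q p) (eb (Sum.inr j0)) = -1 := by
  refine ⟨fun h => ?_, ?_, ?_⟩
  · have := congrFun h (Sum.inl i0)
    simp [eb] at this
  · simp [hf_add_left, hf_add_right, hf_eb]
  · simp [hf_add_left, hf_add_right, hf_eb]

lemma NC.bdS {f : Matrix (Fin q) (Fin p) ℂ → Matrix (Fin q') (Fin p') ℂ} {Q} (h : NC f Q) {i0 i1 : Fin q} (hi : i1 ≠ i0)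
    (j0 : Fin p) (hQ : Q (eb (Sum.inl i0) + eb (Sum.inr j0)) ≠ 0) :
    ∃ F ∈ Kset q' p' 1, ∃ κ : ℝ, 0 < κ ∧ ∃ D : Vec q p →ₗ[ℂ] Vec q' p', ∃ w0 ≠ 0, On w0 F ∧ hq w0 = 0 ∧
      (∀ x ∈ SS q p i0, On (Q x) F) ∧ (∀ x ∈ SS q p i0, On (D x) F) ∧
      (∀ s ∈ SS q p i0, ∀ s' ∈ SS q p i0, hf (D s) (D s') = κ * hf s s') ∧
      (∀ s ∈ SS q p i0, ∀ x ∈ SS q p i0, x ≠ 0 → hf s x = 0 → hf (D s) (Q x) = 0) := by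
  obtain ⟨hz0, hzz, hze⟩ := z_facts (q := q) (p := p) i0 j0
  set z : Vec q p := eb (Sum.inl i0) + eb (Sum.inr j0) with hz
  obtain ⟨F, hFK, hF⟩ := bdry_std h.ph i0 j0
  have hFz : ∀ s ∈ SS q p i0, ∀ t : ℂ, On (Q (z + t • s)) F := fun s hs t => by
    refine hF Q h.sec _ fun j => ?_
    by_cases hj : j = j0
    · subst hj; simp [hz, eb, hs.1, hs.2]
    · simp [hz, eb, hs.1, hs.2, hj]
  have hFz0 : On (Q z) F := by simpa using hFz 0 (Submodule.zero_mem _) 0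
  have hqz : hq (Q z) = 0 := by
    have := h.orth z z hz0 hzz
    rw [hf_self] at this
    exact_mod_cast this
  have hkp := h.kpos i0 j0 hFz0 hQ hqz
  rw [← hz] at hkp
  have hk := fun s (hs : s ∈ SS q p i0) s' (hs' : s' ∈ SS q p i0) =>
    h.kap hz0 hzz (hf_SS hs).1 (hf_SS hs').1 (hf_SS hs).2 hze
  set κ' := hf (Q z) (fderiv ℂ Q z (eb (Sum.inr j0)))
  have h1 := hk _ (eb_mem_SS hi) _ (eb_mem_SS hi)
  rw [hf_self, hf_eb, if_pos rfl, eps_inl, one_mul] at h1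
  refine ⟨F, hFK, -κ'.re, by linarith, (fderiv ℂ Q z : Vec q p →ₗ[ℂ] Vec q' p'), Q z, hQ, hFz0, hqz, ?_, ?_, ?_, ?_⟩
  · intro x hx
    refine hF Q h.sec _ fun j => ?_
    rw [hx.1, hx.2]; simp
  · exact fun x hx => h.deriv_on (hFz x hx)
  · intro s hs s' hs'
    have h2 : ((-κ'.re : ℝ) : ℂ) = -κ' := by
      rw [← h1]
      have := congrArg Complex.re h1
      rw [Complex.ofReal_re] at this
      rw [this]; simp
    rw [h2]
    have := hk s hs s' hs'
    simp only [ContinuousLinearMap.coe_coe]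
    rw [this]; ring
  · intro s hs x hx hx0 hsx
    exact h.deriv_orth hx0 (hf_SS hx).1 hsx
end P12a

end

section

open Filter Topology Metric
section P13a
variable {q p q' p' : ℕ}

lemma perp_sub (T : Submodule ℂ (Vec q p)) (y : Vec q p) : ∃ T' : Submodule ℂ (Vec q p),
    (∀ x, x ∈ T' ↔ x ∈ T ∧ hf x y = 0) ∧ Module.finrank ℂ T ≤ Module.finrank ℂ T' + 1 := by
  let φ := (hfL y).domRestrict T
  refine ⟨(LinearMap.ker φ).map T.subtype, fun x => ?_, ?_⟩
  · constructor
    · rintro ⟨x', hx', rfl⟩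
      exact ⟨x'.2, hx'⟩
    · rintro ⟨h1, h2⟩
      exact ⟨⟨x, h1⟩, h2, rfl⟩
  · rw [Submodule.finrank_map_subtype_eq, ← LinearMap.finrank_range_add_finrank_ker φ, add_comm]
    have := Submodule.finrank_le (LinearMap.range φ)
    rw [Module.finrank_self] at this
    omega

lemma hf_self_ne {x : Vec q p} (h : 0 < hq x) : hf x x ≠ 0 := by
  rw [hf_self]; exact_mod_cast h.ne'

lemma frames {good : Vec q p → Prop} (ho : ∀ x, good x → ∀ᶠ y in 𝓝 x, good y)
    (hd : ∀ x v, good x → ∃ᶠ t in 𝓝 (0 : ℂ), good (v + t • (x - v))) (n : ℕ) :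
    ∀ T : Submodule ℂ (Vec q p), (∀ x ∈ T, x ≠ 0 → 0 < hq x) → n ≤ Module.finrank ℂ T → (∃ x ∈ T, good x) →
    ∃ v : Fin n → Vec q p, (∀ i, v i ∈ T ∧ good (v i)) ∧ ∀ i j, i ≠ j → hf (v i) (v j) = 0 := by
  induction n with
  | zero => exact fun T _ _ _ => ⟨fun i => i.elim0, fun i => i.elim0, fun i => i.elim0⟩
  | succ n ih =>
    intro T hT hn ⟨x0, hx0, hg0⟩
    obtain rfl | hn0 := Nat.eq_zero_or_pos n
    · exact ⟨fun _ => x0, fun _ => ⟨hx0, hg0⟩, fun i j hij => absurd (Fin.ext (by omega)) hij⟩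
    obtain ⟨T0, hT0, hT0'⟩ := perp_sub T x0
    obtain ⟨x1, hx1, hx1n⟩ : ∃ x ∈ T0, x ≠ 0 := by
      by_contra! hcon
      have : T0 = ⊥ := (Submodule.eq_bot_iff _).2 hcon
      rw [this, finrank_bot] at hT0'
      omega
    obtain ⟨hx1T, hx10⟩ := (hT0 x1).1 hx1
    have hx1p := hf_self_ne (hT x1 hx1T hx1n)
    let a : ℂ → Vec q p := fun t => x1 + t • (x0 - x1)
    have ha : Tendsto a (𝓝 0) (𝓝 x1) := by
      have : Continuous a := by unfold a; fun_prop
      exact this.tendsto' 0 x1 (by simp [a])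
    let y : ℂ → Vec q p := fun t => x0 - (hf x0 (a t) / hf (a t) (a t)) • a t
    have hy : Tendsto y (𝓝 0) (𝓝 x0) := by
      have h1 := (tendsto_hf (tendsto_const_nhds (x := x0)) ha).div (tendsto_hf ha ha) hx1p
      have h2 := (tendsto_const_nhds (x := x0)).sub (h1.smul ha)
      rw [hf_symm_zero hx10, zero_div, zero_smul, sub_zero] at h2
      exact h2
    have hne : ∀ᶠ t in 𝓝 (0 : ℂ), hf (a t) (a t) ≠ 0 := (tendsto_hf ha ha).eventually (isOpen_ne.mem_nhds hx1p)
    obtain ⟨t, hg1, hg2, hg3⟩ := ((hd x0 x1 hg0).and_eventually ((hy.eventually (ho x0 hg0)).and hne)).exists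
    have haT : a t ∈ T := T.add_mem hx1T (T.smul_mem _ (T.sub_mem hx0 hx1T))
    have hyT : y t ∈ T := T.sub_mem hx0 (T.smul_mem _ haT)
    have hya : hf (y t) (a t) = 0 := by
      simp only [y]
      rw [hf_sub_left, hf_smul_left, div_mul_cancel₀ _ hg3, sub_self]
    obtain ⟨T1, hT1, hT1'⟩ := perp_sub T (y t)
    obtain ⟨v, hv, hvo⟩ := ih T1 (fun x hx => hT x ((hT1 x).1 hx).1) (by omega)
      ⟨a t, (hT1 _).2 ⟨haT, hf_symm_zero hya⟩, hg1⟩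
    refine ⟨Fin.cons (y t) v, fun i => ?_, fun i j => ?_⟩
    · refine Fin.cases ?_ (fun i => ?_) i
      · exact ⟨hyT, hg2⟩
      · exact ⟨((hT1 _).1 (hv i).1).1, (hv i).2⟩
    · refine Fin.cases ?_ (fun i => ?_) i <;> refine Fin.cases ?_ (fun j => ?_) j
      · simp
      · intro _; exact hf_symm_zero ((hT1 _).1 (hv j).1).2
      · intro _; exact ((hT1 _).1 (hv i).1).2
      · intro hij; exact hvo i j fun h => hij (by rw [h])

/-- density from holomorphy -/
lemma freq_ne {φ : ℂ → ℂ} (hφ : Differentiable ℂ φ) (h1 : φ 1 ≠ 0) : ∃ᶠ t in 𝓝 (0 : ℂ), φ t ≠ 0 := by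
  intro hcon
  simp only [not_not] at hcon
  exact h1 (ident' isOpen_univ convex_univ hφ.differentiableOn (z0 := 0) trivial hcon trivial)

lemma finrank_SS (i0 : Fin q) : q - 1 ≤ Module.finrank ℂ (SS q p i0) := by
  have h1 : LinearIndependent ℂ fun i : {i : Fin q // i ≠ i0} => (⟨eb (Sum.inl i.1), eb_mem_SS i.2⟩ : SS q p i0) := by
    rw [Fintype.linearIndependent_iff]
    intro c hc i
    have := congrArg (fun x : SS q p i0 => x.1 (Sum.inl i.1)) hc
    simp only [Submodule.coe_sum, Submodule.coe_smul, Finset.sum_apply, Pi.smul_apply, smul_eq_mul, ZeroMemClass.coe_zero,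
      Pi.zero_apply] at this
    rw [Finset.sum_eq_single i] at this
    · simpa [eb] using this
    · intro j _ hj
      have : i.1 ≠ j.1 := fun h => hj (Subtype.ext h.symm)
      simp [eb, this]
    · simp
  have := h1.fintype_card_le_finrank
  simpa using this

lemma SS_pos {i0 : Fin q} {x : Vec q p} (hx : x ∈ SS q p i0) (h0 : x ≠ 0) : 0 < hq x := by
  have h1 : x ∘ (Sum.inr : Fin p → _) = 0 := funext hx.1
  have h2 : x ∘ (Sum.inl : Fin q → _) ≠ 0 := fun h => h0 (by
    ext s; rcases s with i | j
    · exact congrFun h i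
    · exact hx.1 j)
  unfold hq
  rw [h1, nsq_zero, sub_zero]
  exact nsq_pos h2

lemma card_psd {ι : Type*} [Fintype ι] {F : Matrix (Fin q) (Fin p) ℂ} (hF : F ∈ Kset q p 1) {w0 : Vec q p} (hw : w0 ≠ 0)
    (hw0 : On w0 F) (hwq : hq w0 = 0) (u : ι → Vec q p) (hu : ∀ i, On (u i) F) (hup : ∀ i, 0 < hq (u i))
    (huo : ∀ i j, i ≠ j → hf (u i) (u j) = 0) : Fintype.card ι + 1 ≤ q := by
  classical
  let V : Option ι → Vec q p := fun o => o.elim w0 u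
  have hli : LinearIndependent ℂ fun o => V o ∘ (Sum.inl : Fin q → Fin q ⊕ Fin p) := by
    rw [Fintype.linearIndependent_iff]
    intro c hc
    have hV : ∀ o, On (V o) F := fun o => by
      cases o with
      | none => exact hw0
      | some i => exact hu i
    have hWon : On (∑ o, c o • V o) F := by
      rw [on_iff_onL]
      intro j
      rw [map_sum]
      refine Finset.sum_eq_zero fun o _ => ?_
      rw [map_smul, on_iff_onL.1 (hV o) j, smul_zero]
    have hW0 : ∑ o, c o • V o = 0 := by
      rw [hWon.eq_gv]
      have : (∑ o, c o • V o) ∘ (Sum.inl : Fin q → Fin q ⊕ Fin p) = 0 := by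
        rw [← hc]; ext i; simp [Finset.sum_apply]
      rw [this]
      exact (On.eq_gv (On.zero F)).symm
    rw [Fintype.sum_option] at hW0
    have hsome : ∀ i, c (some i) = 0 := fun i => by
      have h1 := congrArg (fun x => hfL (u i) x) hW0
      simp only [map_add, map_sum, map_smul, map_zero] at h1
      rw [Finset.sum_eq_single i] at h1
      · have h2 : hfL (u i) (V none) = 0 := psd_cs hF hw0 (hu i) hwq
        rw [h2, smul_zero, zero_add, smul_eq_mul] at h1
        exact (mul_eq_zero.1 h1).resolve_right (hf_self_ne (hup i))
      · intro j _ hj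
        have : hfL (u i) (V (some j)) = 0 := huo j i hj
        rw [this, smul_zero]
      · simp
    intro o
    cases o with
    | some i => exact hsome i
    | none =>
      simp only [hsome, zero_smul, Finset.sum_const_zero, add_zero] at hW0
      exact (smul_eq_zero.1 hW0).resolve_right hw
  have := hli.fintype_card_le_finrank
  simpa using this

lemma E_null {Q : Vec q p → Vec q' p'} (hQd : Differentiable ℂ Q) (hor : ∀ x y, x ≠ 0 → hf x y = 0 → hf (Q x) (Q y) = 0)
    (hqq : q' + 2 ≤ 2 * q) {i0 : Fin q} {F : Matrix (Fin q') (Fin p') ℂ} (hF : F ∈ Kset q' p' 1)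
    {κ : ℝ} (hκ : 0 < κ) {D : Vec q p →ₗ[ℂ] Vec q' p'} {w0 : Vec q' p'} (hw : w0 ≠ 0) (hw0 : On w0 F) (hwq : hq w0 = 0)
    (hQF : ∀ x ∈ SS q p i0, On (Q x) F) (hDF : ∀ x ∈ SS q p i0, On (D x) F)
    (hDD : ∀ s ∈ SS q p i0, ∀ s' ∈ SS q p i0, hf (D s) (D s') = κ * hf s s')
    (hDQ : ∀ s ∈ SS q p i0, ∀ x ∈ SS q p i0, x ≠ 0 → hf s x = 0 → hf (D s) (Q x) = 0) :
    ∃ m : Vec q p → ℂ, (∀ x ∈ SS q p i0, x ≠ 0 → ∀ s ∈ SS q p i0, hf (Q x) (D s) = m x * κ * hf x s) ∧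
      ∀ x ∈ SS q p i0, x ≠ 0 → ∀ y ∈ SS q p i0, y ≠ 0 → hf (Q x) (Q y) = m x * star (m y) * κ * hf x y := by
  have hκ' : (κ : ℂ) ≠ 0 := by exact_mod_cast hκ.ne'
  let m : Vec q p → ℂ := fun x => hf (Q x) (D x) / (κ * hf x x)
  have hm : ∀ x ∈ SS q p i0, x ≠ 0 → ∀ s ∈ SS q p i0, hf (Q x) (D s) = m x * κ * hf x s := by
    intro x hx hx0 s hs
    have hxx := hf_self_ne (SS_pos hx hx0)
    set c := hf s x / hf x x
    have h1 : s - c • x ∈ SS q p i0 := Submodule.sub_mem _ hs (Submodule.smul_mem _ _ hx)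
    have h2 : hf (s - c • x) x = 0 := by
      rw [hf_sub_left, hf_smul_left, div_mul_cancel₀ _ hxx, sub_self]
    have h3 := hf_symm_zero (hDQ _ h1 x hx hx0 h2)
    have h2' := hf_symm_zero h2
    rw [map_sub, map_smul, hf_sub_right, hf_smul_right] at h3
    rw [hf_sub_right, hf_smul_right] at h2'
    have h4 : m x * κ * hf x x = hf (Q x) (D x) := by
      simp only [m]; field_simp
    linear_combination h3 - star c * h4 - m x * κ * h2'
  let E : Vec q p → Vec q' p' := fun x => Q x - m x • D x
  have hEF : ∀ x ∈ SS q p i0, On (E x) F := fun x hx => by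
    have := (hQF x hx).add ((hDF x hx).smul (-m x))
    rwa [neg_smul, ← sub_eq_add_neg] at this
  have hED : ∀ x ∈ SS q p i0, x ≠ 0 → ∀ s ∈ SS q p i0, hf (E x) (D s) = 0 := fun x hx hx0 s hs => by
    simp only [E]
    rw [hf_sub_left, hf_smul_left, hm x hx hx0 s hs, hDD x hx s hs]; ring
  have hEE : ∀ x ∈ SS q p i0, x ≠ 0 → ∀ y ∈ SS q p i0, y ≠ 0 → hf (E x) (E y) = hf (Q x) (Q y) - m x * star (m y) * κ * hf x y := by
    intro x hx hx0 y hy hy0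
    have h1 : hf (E x) (E y) = hf (E x) (Q y) - star (m y) * hf (E x) (D y) := by
      conv_lhs => rw [show E y = Q y - m y • D y from rfl, hf_sub_right, hf_smul_right]
    have h2 : hf (D x) (Q y) = star (m y) * κ * hf x y := by
      rw [← hf_conj, hm y hy hy0 x hx, star_mul', star_mul', hf_conj]
      congr 2
      exact Complex.conj_ofReal κ
    rw [h1, hED x hx hx0 y hy, mul_zero, sub_zero]
    simp only [E]
    rw [hf_sub_left, hf_smul_left, h2]; ring
  refine ⟨m, hm, fun x hx hx0 y hy hy0 => ?_⟩
  have key : ∀ x ∈ SS q p i0, x ≠ 0 → hq (E x) = 0 := by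
    intro x0 hx0 hx00
    by_contra hcon
    obtain ⟨k, hk⟩ : ∃ k, x0 (Sum.inl k) ≠ 0 := by
      by_contra! hc
      exact hx00 (by
        ext s; rcases s with i | j
        · exact hc i
        · exact hx0.1 j)
    have hki : k ≠ i0 := fun h => hk (by rw [h]; exact hx0.2)
    let G : Vec q p → Vec q' p' := fun x => (κ * x (Sum.inl k)) • Q x - hf (Q x) (D (eb (Sum.inl k))) • D x
    have hGE : ∀ x ∈ SS q p i0, x ≠ 0 → G x = (κ * x (Sum.inl k)) • E x := by
      intro x hx hx0
      have := hm x hx hx0 _ (eb_mem_SS hki)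
      rw [hf_eb_right] at this
      simp only [G, E]
      rw [this, smul_sub, smul_smul, eps_inl]
      congr 2; ring
    have hGd : Differentiable ℂ G := by
      have e1 : Differentiable ℂ fun x => hf (Q x) (D (eb (Sum.inl k))) :=
        (LinearMap.toContinuousLinearMap (hfL (D (eb (Sum.inl k))))).differentiable.comp hQd
      have e2 : Differentiable ℂ D := (LinearMap.toContinuousLinearMap D).differentiable
      have e3 : Differentiable ℂ fun x : Vec q p => (κ : ℂ) * x (Sum.inl k) := by fun_prop
      exact (e3.smul hQd).sub (e1.smul e2)
    have hGw : ∀ w, Differentiable ℂ fun x => hf (G x) w := fun w =>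
      (LinearMap.toContinuousLinearMap (hfL w)).differentiable.comp hGd
    obtain ⟨v, hv, hvo⟩ := frames (good := fun x => ∃ w, On w F ∧ hf (G x) w ≠ 0)
      (fun x ⟨w, hw, hx⟩ => by
        filter_upwards [(hGw w).continuous.continuousAt.eventually (isOpen_ne.mem_nhds hx)] with y hy
        exact ⟨w, hw, hy⟩)
      (fun x v ⟨w, hw, hx⟩ => by
        have := freq_ne (φ := fun t : ℂ => hf (G (v + t • (x - v))) w)
          ((hGw w).comp (f := fun t : ℂ => v + t • (x - v)) (by fun_prop)) (by simpa using hx)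
        exact this.mono fun t ht => ⟨w, hw, ht⟩)
      (q - 1) (SS q p i0) (fun x hx => SS_pos hx) (finrank_SS i0)
      ⟨x0, hx0, E x0, hEF x0 hx0, by
        rw [hGE x0 hx0 hx00, hf_smul_left, hf_self]
        refine mul_ne_zero (mul_ne_zero hκ' hk) ?_
        exact_mod_cast hcon⟩
    have hv0 : ∀ i, v i ≠ 0 ∧ 0 < hq (E (v i)) := fun i => by
      obtain ⟨hiS, w, hw, hgw⟩ := hv i
      have h0 : v i ≠ 0 := fun h0 => hgw (by
        simp only [G]
        rw [h0, map_zero, smul_zero, Pi.zero_apply, mul_zero, zero_smul, sub_zero, hf_zero_left])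
      refine ⟨h0, lt_of_le_of_ne (psd hF (hEF _ hiS)) fun h1 => hgw ?_⟩
      rw [hGE _ hiS h0, hf_smul_left, psd_cs hF (hEF _ hiS) hw h1.symm, mul_zero]
    have hcard := card_psd (ι := Fin (q - 1) ⊕ Fin (q - 1)) hF hw hw0 hwq (Sum.elim (fun i => D (v i)) (fun i => E (v i)))
      (by rintro (i | i)
          · exact hDF _ (hv i).1
          · exact hEF _ (hv i).1)
      (by rintro (i | i)
          · have h1 := hDD _ (hv i).1 _ (hv i).1
            rw [hf_self, hf_self] at h1
            have h2 : hq (D (v i)) = κ * hq (v i) := by exact_mod_cast h1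
            show 0 < hq (D (v i))
            rw [h2]
            exact mul_pos hκ (SS_pos (hv i).1 (hv0 i).1)
          · exact (hv0 i).2)
      (by rintro (i | i) (j | j) hij
          · show hf (D (v i)) (D (v j)) = 0
            rw [hDD _ (hv i).1 _ (hv j).1, hvo i j (fun h => hij (by rw [h])), mul_zero]
          · exact hf_symm_zero (hED _ (hv j).1 (hv0 j).1 _ (hv i).1)
          · exact hED _ (hv i).1 (hv0 i).1 _ (hv j).1
          · show hf (E (v i)) (E (v j)) = 0
            have h1 := hvo i j (fun h => hij (by rw [h]))
            rw [hEE _ (hv i).1 (hv0 i).1 _ (hv j).1 (hv0 j).1, hor _ _ (hv0 i).1 h1, h1]; ring)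
    simp at hcard
    omega
  have h1 := psd_cs hF (hEF x hx) (hEF y hy) (key x hx hx0)
  rw [hEE x hx hx0 y hy hy0] at h1
  linear_combination h1
end P13a

end

section

open Filter Topology Metric
section P14a
variable {q p q' p' : ℕ}

/-- the corrected derivative -/
noncomputable def Lam (Q : Vec q p → Vec q' p') (e : Vec q p) : Vec q p →ₗ[ℂ] Vec q' p' :=
  (fderiv ℂ Q e : Vec q p →ₗ[ℂ] Vec q' p') -
    (((hf (Q e) (Q e))⁻¹ • (hfL (Q e) ∘ₗ (fderiv ℂ Q e : Vec q p →ₗ[ℂ] Vec q' p')) - hfL e).smulRight (Q e))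

lemma Lam_apply (Q : Vec q p → Vec q' p') (e x : Vec q p) :
    Lam Q e x = fderiv ℂ Q e x - ((hf (Q e) (Q e))⁻¹ * hf (fderiv ℂ Q e x) (Q e) - hf x e) • Q e := rfl

lemma on_sub {x y : Vec q p} {Z} (hx : On x Z) (hy : On y Z) : On (x - y) Z := by
  have := hx.add (hy.smul (-1))
  rwa [neg_one_smul, ← sub_eq_add_neg] at this

lemma eq_of_hf {Z : Matrix (Fin q) (Fin p) ℂ} (hZ : Z ∈ typeIDomain q p) {v : Vec q p} (hv : On v Z) (h : hf v v = 0) :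
    v = 0 := by
  by_contra h0
  exact hf_self_ne (mem_dom_iff_on.1 hZ v h0 hv) h

lemma E1 {f : Matrix (Fin q) (Fin p) ℂ → Matrix (Fin q') (Fin p') ℂ} {Q} (h : NC f Q) (hqq : q' + 2 ≤ 2 * q)
    {i0 i1 : Fin q} (hi : i1 ≠ i0) (j0 : Fin p) (hQ : Q (eb (Sum.inl i0) + eb (Sum.inr j0)) ≠ 0)
    (hQ1 : Q (eb (Sum.inl i1)) ≠ 0) {x : Vec q p} (hx : x ∈ SS q p i0) (hx0 : x ≠ 0) (hQx : Q x ≠ 0) :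
    ∃ c : ℂ, c ≠ 0 ∧ Lam Q (eb (Sum.inl i1)) x = c • Q x ∧
      hf (c • Q x) (c • Q x) = hf (Q (eb (Sum.inl i1))) (Q (eb (Sum.inl i1))) * hf x x := by
  obtain ⟨F, hF, κ, hκ, D, w0, hw, hw0, hwq, hQF, hDF, hDD, hDQ⟩ := h.bdS hi j0 hQ
  obtain ⟨m, hm1, hm2⟩ := E_null h.sec.1 h.orth hqq hF hκ hw hw0 hwq hQF hDF hDD hDQ
  have hκ' : (κ : ℂ) ≠ 0 := by exact_mod_cast hκ.ne'
  set e : Vec q p := eb (Sum.inl i1) with he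
  have heS : e ∈ SS q p i0 := eb_mem_SS hi
  have hee : hf e e = 1 := by rw [he, hf_eb]; simp
  have he0 : e ≠ 0 := fun h0 => by rw [h0] at hee; simp at hee
  have hZ0 : f 0 ∈ typeIDomain q' p' := h.ph.2.1 zero_mem_dom
  have hon : ∀ y ∈ SS q p i0, On (Q y) (f 0) := fun y hy => h.sec.2 0 zero_mem_dom y (by
    show _ ᵥ* (0 : Matrix (Fin q) (Fin p) ℂ) = _
    rw [vecMul_zero]; exact (funext fun j => (hy.1 j).symm))
  have hmne : ∀ y ∈ SS q p i0, y ≠ 0 → Q y ≠ 0 → m y ≠ 0 := fun y hy hy0 hQy hmy => by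
    refine hQy (eq_of_hf hZ0 (hon y hy) ?_)
    rw [hm2 y hy hy0 y hy hy0, hmy]; ring
  have hme := hmne e heS he0 hQ1
  have hmx := hmne x hx hx0 hQx
  set A := (m e)⁻¹ • Q e with hA
  set B := (m x)⁻¹ • Q x with hB
  have hAy : ∀ y ∈ SS q p i0, y ≠ 0 → hf A (Q y) = star (m y) * κ * hf e y := fun y hy hy0 => by
    rw [hA, hf_smul_left, hm2 e heS he0 y hy hy0]; field_simp
  have hBy : ∀ y ∈ SS q p i0, y ≠ 0 → hf B (Q y) = star (m y) * κ * hf x y := fun y hy hy0 => by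
    rw [hB, hf_smul_left, hm2 x hx hx0 y hy hy0]; field_simp
  have hsme : star (m e) ≠ 0 := star_ne_zero.2 hme
  have hsmx : star (m x) ≠ 0 := star_ne_zero.2 hmx
  have hAA : hf A A = κ * hf e e := by
    conv_lhs => rw [hA, hf_smul_right, ← hA, hAy e heS he0, star_inv₀]
    field_simp
  have hAB : hf A B = κ * hf e x := by
    conv_lhs => rw [hB, hf_smul_right, hAy x hx hx0, star_inv₀]
    field_simp
  have hBA : hf B A = κ * hf x e := by
    conv_lhs => rw [hA, hf_smul_right, hBy e heS he0, star_inv₀]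
    field_simp
  have hBB : hf B B = κ * hf x x := by
    conv_lhs => rw [hB, hf_smul_right, ← hB, hBy x hx hx0, star_inv₀]
    field_simp
  have hOA : On A (f 0) := (hon e heS).smul _
  have hOB : On B (f 0) := (hon x hx).smul _
  clear_value A B
  have key : ∀ t : ℂ, e + t • x ≠ 0 → Q (e + t • x) = m (e + t • x) • (A + t • B) := by
    intro t ht
    have hv : e + t • x ∈ SS q p i0 := Submodule.add_mem _ heS (Submodule.smul_mem _ _ hx)
    rw [← sub_eq_zero]
    refine eq_of_hf hZ0 (on_sub (hon _ hv) ((hOA.add (hOB.smul _)).smul _)) ?_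
    have h1 : hf (A + t • B) (Q (e + t • x)) = star (m (e + t • x)) * κ * hf (e + t • x) (e + t • x) := by
      rw [hf_add_left, hf_smul_left, hAy _ hv ht, hBy _ hv ht, hf_add_left e, hf_smul_left t x]; ring
    have h2 : hf (A + t • B) (A + t • B) = κ * hf (e + t • x) (e + t • x) := by
      simp only [hf_add_left, hf_add_right, hf_smul_left, hf_smul_right, hAA, hAB, hBA, hBB]; ring
    have h3 : hf (Q (e + t • x)) (A + t • B) = m (e + t • x) * κ * hf (e + t • x) (e + t • x) := by
      rw [← hf_conj, h1]
      simp only [star_mul', star_star, hf_conj]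
      congr 2
      simp
    rw [hf_sub_left, hf_sub_right, hf_sub_right, hf_smul_left, hf_smul_left, hf_smul_right, hf_smul_right, h1, h2, h3,
      hm2 _ hv ht _ hv ht]
    ring
  -- derivative
  have hline : HasDerivAt (fun t : ℂ => e + t • x) x 0 := by
    simpa using ((hasDerivAt_id (0 : ℂ)).smul_const x).const_add e
  have hQl : HasDerivAt (fun t : ℂ => Q (e + t • x)) (fderiv ℂ Q e x) 0 := by
    have h2 : HasFDerivAt Q (fderiv ℂ Q e) (e + (0 : ℂ) • x) := by
      rw [zero_smul, add_zero]; exact (h.sec.1 e).hasFDerivAt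
    exact h2.comp_hasDerivAt (0 : ℂ) hline
  have hne : ∀ᶠ t : ℂ in 𝓝 0, hf (e + t • x) e ≠ 0 := by
    have hc : Continuous fun t : ℂ => hf (e + t • x) e := by
      simp only [hf_add_left, hf_smul_left]; fun_prop
    refine hc.continuousAt.eventually_ne ?_
    rw [zero_smul, add_zero, hee]; exact one_ne_zero
  have hM : (fun t : ℂ => m (e + t • x)) =ᶠ[𝓝 0] fun t : ℂ => hf (Q (e + t • x)) (D e) / (κ * hf (e + t • x) e) := by
    filter_upwards [hne] with t ht
    have h0 : e + t • x ≠ 0 := fun h0 => ht (by rw [h0, hf_zero_left])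
    rw [hm1 _ (Submodule.add_mem _ heS (Submodule.smul_mem _ _ hx)) h0 e heS]
    field_simp
  have hMd : DifferentiableAt ℂ (fun t : ℂ => m (e + t • x)) 0 := by
    refine DifferentiableAt.congr_of_eventuallyEq ?_ hM
    refine DifferentiableAt.div ?_ ?_ ?_
    · exact ((LinearMap.toContinuousLinearMap (hfL (D e))).differentiableAt).comp (0 : ℂ) hQl.differentiableAt
    · simp only [hf_add_left, hf_smul_left]; fun_prop
    · rw [zero_smul, add_zero, hee]; simpa using hκ'
  have hR : HasDerivAt (fun t : ℂ => m (e + t • x) • (A + t • B))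
      (m (e + (0 : ℂ) • x) • B + deriv (fun t : ℂ => m (e + t • x)) 0 • (A + (0 : ℂ) • B)) 0 := by
    refine hMd.hasDerivAt.smul ?_
    simpa using ((hasDerivAt_id (0 : ℂ)).smul_const B).const_add A
  have hQe : (fun t : ℂ => Q (e + t • x)) =ᶠ[𝓝 0] fun t : ℂ => m (e + t • x) • (A + t • B) := by
    filter_upwards [hne] with t ht
    exact key t fun h0 => ht (by rw [h0, hf_zero_left])
  have hD := hQl.unique (hR.congr_of_eventuallyEq hQe)
  rw [zero_smul, zero_smul, add_zero, add_zero] at hD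
  set M' := deriv (fun t : ℂ => m (e + t • x)) 0
  refine ⟨m e / m x, div_ne_zero hme hmx, ?_, ?_⟩
  · rw [Lam_apply, hD, hf_add_left, hf_smul_left (m e) B, hf_smul_left M' A, hBy e heS he0, hAy e heS he0, hm2 e heS he0 e heS he0, hee]
    rw [hA, hB, smul_smul, smul_smul, add_sub_assoc, ← sub_smul]
    have : M' * (m e)⁻¹ - ((m e * star (m e) * κ * 1)⁻¹ * (m e * (star (m e) * κ * hf x e) + M' * (star (m e) * κ * 1)) - hf x e) = 0 := by
      field_simp; ring
    rw [this, zero_smul, add_zero, div_eq_mul_inv]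
  · rw [hf_smul_left, hf_smul_right, hm2 x hx hx0 x hx hx0, hm2 e heS he0 e heS he0, hee, star_div₀]
    field_simp

end P14a

end

section

open Filter Topology Metric
section P15a
variable {q p q' p' : ℕ}

lemma phase (j0 : Fin p) {l : ℂ} (hl : ‖l‖ = 1) : ∃ g : Vec q p ≃ₗ[ℂ] Vec q p, IsU g ∧
    (∀ i, g (eb (Sum.inl i)) = eb (Sum.inl i)) ∧ g (eb (Sum.inr j0)) = l • eb (Sum.inr j0) := by
  classical
  obtain ⟨g, hg, h⟩ := witt (q := q) (p := p) Finset.univ (fun s => if s = Sum.inr j0 then l • eb s else eb s) (by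
    intro a _ b _
    have hl' : l * star l = 1 := by
      have := Complex.mul_conj l
      rw [Complex.normSq_eq_norm_sq, hl] at this
      simpa using this
    by_cases ha : a = Sum.inr j0 <;> by_cases hb : b = Sum.inr j0
    · subst ha; subst hb
      simp only [if_true, hf_smul_left, hf_smul_right, hf_eb]
      linear_combination hl' * eps (Sum.inr j0 : Fin q ⊕ Fin p)
    · have : a ≠ b := fun h => hb (h ▸ ha)
      simp [ha, hb, hf_smul_left, hf_eb, ha ▸ this]
    · have : a ≠ b := fun h => ha (h ▸ hb)
      simp [ha, hb, hf_smul_right, hf_eb, hb ▸ this]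
    · simp [ha, hb, hf_eb])
  exact ⟨g, hg, fun i => by simpa using h (Sum.inl i) (Finset.mem_univ _), by simpa using h (Sum.inr j0) (Finset.mem_univ _)⟩

lemma exists_phase {Q : Vec q p → Vec q' p'} (hQ : Differentiable ℂ Q) {a b : Vec q p} (h : Q a ≠ 0) :
    ∃ l : ℂ, ‖l‖ = 1 ∧ Q (a + l • b) ≠ 0 := by
  by_contra! hcon
  have hd : Differentiable ℂ fun t : ℂ => Q (a + t • b) := hQ.comp (by fun_prop)
  have := Complex.eqOn_closure_of_eqOn_frontier (f := fun t : ℂ => Q (a + t • b)) (g := fun _ => 0) (U := ball (0 : ℂ) 1)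
    isBounded_ball hd.diffContOnCl (differentiable_const _).diffContOnCl (fun t ht => by
      rw [frontier_ball _ one_ne_zero] at ht
      exact hcon t (by simpa using ht))
  have h0 := this (subset_closure (mem_ball_self one_pos))
  simp only [zero_smul, add_zero] at h0
  exact h h0

lemma Lam_comp {Q : Vec q p → Vec q' p'} (hQ : Differentiable ℂ Q) {g : Vec q p ≃ₗ[ℂ] Vec q p} (hg : IsU g) (e x : Vec q p) :
    Lam (Q ∘ g) e x = Lam Q (g e) (g x) := by
  have h1 : fderiv ℂ (Q ∘ g) e x = fderiv ℂ Q (g e) (g x) := by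
    have h2 : HasFDerivAt g (LinearMap.toContinuousLinearMap (g : Vec q p →ₗ[ℂ] Vec q p)) e :=
      (LinearMap.toContinuousLinearMap (g : Vec q p →ₗ[ℂ] Vec q p)).hasFDerivAt
    rw [((hQ (g e)).hasFDerivAt.comp e h2).fderiv]
    rfl
  rw [Lam_apply, Lam_apply, h1, hg]
  rfl

lemma E1' {f : Matrix (Fin q) (Fin p) ℂ → Matrix (Fin q') (Fin p') ℂ} {Q} (h : NC f Q) (hqq : q' + 2 ≤ 2 * q) (hq3 : 3 ≤ q)
    (hp : 0 < p) {a e y x : Vec q p} (haa : hf a a = 1) (hee : hf e e = 1) (hyy : hf y y = 1) (hae : hf a e = 0) (hay : hf a y = 0)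
    (hey : hf e y = 0) (hQa : Q a ≠ 0) (hQe : Q e ≠ 0) {α β : ℂ} (hx : x = α • e + β • y) (hx0 : x ≠ 0) (hQx : Q x ≠ 0) :
    ∃ c : ℂ, c ≠ 0 ∧ Lam Q e x = c • Q x ∧ hf (c • Q x) (c • Q x) = hf (Q e) (Q e) * hf x x := by
  classical
  let i0 : Fin q := ⟨0, by omega⟩
  let i1 : Fin q := ⟨1, by omega⟩
  let i2 : Fin q := ⟨2, by omega⟩
  let j0 : Fin p := ⟨0, hp⟩
  have h01 : i0 ≠ i1 := by simp [i0, i1]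
  have h02 : i0 ≠ i2 := by simp [i0, i2]
  have h12 : i1 ≠ i2 := by simp [i2, i1]
  obtain ⟨g, hg, hgy⟩ := witt (q := q) (p := p) {Sum.inl i0, Sum.inl i1, Sum.inl i2}
    (fun s => if s = Sum.inl i0 then a else if s = Sum.inl i1 then e else y) (by
      intro s hs t ht
      simp only [Finset.mem_insert, Finset.mem_singleton] at hs ht
      rcases hs with rfl | rfl | rfl <;> rcases ht with rfl | rfl | rfl <;>
        simp [h01, h02, h12, h01.symm, h02.symm, h12.symm, haa, hee, hyy, hae, hay, hey, hf_symm_zero hae, hf_symm_zero hay,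
          hf_symm_zero hey])
  have hg0 : g (eb (Sum.inl i0)) = a := by simpa using hgy (Sum.inl i0) (by simp)
  have hg1 : g (eb (Sum.inl i1)) = e := by simpa [h01.symm] using hgy (Sum.inl i1) (by simp)
  have hg2 : g (eb (Sum.inl i2)) = y := by simpa [h02.symm, h12.symm] using hgy (Sum.inl i2) (by simp)
  obtain ⟨l, hl, hQl⟩ := exists_phase h.sec.1 (b := g (eb (Sum.inr j0))) hQa
  obtain ⟨k, hk, hk1, hk2⟩ := phase (q := q) j0 hl
  have hU := hk.trans hg
  set G := k.trans g with hG
  have hG0 : G (eb (Sum.inl i0)) = a := by rw [hG, LinearEquiv.trans_apply, hk1, hg0]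
  have hG1 : G (eb (Sum.inl i1)) = e := by rw [hG, LinearEquiv.trans_apply, hk1, hg1]
  have hG2 : G (eb (Sum.inl i2)) = y := by rw [hG, LinearEquiv.trans_apply, hk1, hg2]
  have hG3 : G (eb (Sum.inr j0)) = l • g (eb (Sum.inr j0)) := by rw [hG, LinearEquiv.trans_apply, hk2, map_smul]
  have hxG : x = G (α • eb (Sum.inl i1) + β • eb (Sum.inl i2)) := by
    rw [map_add, map_smul, map_smul, hG1, hG2, hx]
  set x1 : Vec q p := α • eb (Sum.inl i1) + β • eb (Sum.inl i2) with hx1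
  have hxx : hf x x = hf x1 x1 := by rw [hxG, hU]
  have hres := E1 (h.comp hU) hqq h01.symm j0 (x := x1) (by
      rw [Function.comp_apply, map_add, hG0, hG3]; exact hQl) (by rw [Function.comp_apply, hG1]; exact hQe)
      (Submodule.add_mem _ (Submodule.smul_mem _ _ (eb_mem_SS h01.symm)) (Submodule.smul_mem _ _ (eb_mem_SS h02.symm)))
      (fun h0 => hx0 (by rw [hxG, h0, map_zero])) (by rw [Function.comp_apply, ← hxG]; exact hQx)
  rw [Lam_comp h.sec.1 hU, Function.comp_apply, Function.comp_apply, hG1, ← hxG, ← hxx] at hres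
  exact hres

end P15a

end

section

open Filter Topology Metric
section P16a
variable {q p q' p' : ℕ}

lemma normV {y : Vec q p} (h : 0 < hq y) : ∃ r : ℂ, r ≠ 0 ∧ hf (r • y) (r • y) = 1 := by
  have h1 : 0 < √(hq y) := Real.sqrt_pos.2 h
  have h3 : ((√(hq y) : ℝ) : ℂ) ≠ 0 := by exact_mod_cast h1.ne'
  refine ⟨((√(hq y) : ℝ) : ℂ)⁻¹, inv_ne_zero h3, ?_⟩
  have h2 : (hq y : ℂ) = ((√(hq y) : ℝ) : ℂ) * ((√(hq y) : ℝ) : ℂ) := by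
    rw [← Complex.ofReal_mul, Real.mul_self_sqrt h.le]
  have h4 : star (((√(hq y) : ℝ) : ℂ)⁻¹) = ((√(hq y) : ℝ) : ℂ)⁻¹ := by
    rw [star_inv₀]; congr 1; exact Complex.conj_ofReal _
  rw [hf_smul_left, hf_smul_right, h4, hf_self]
  generalize ((√(hq y) : ℝ) : ℂ) = r at *
  rw [h2]
  field_simp

lemma NC.smul_ne {f : Matrix (Fin q) (Fin p) ℂ → Matrix (Fin q') (Fin p') ℂ} {Q} (h : NC f Q) {r : ℂ} (hr : r ≠ 0) {x : Vec q p}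
    (hx : Q x ≠ 0) : Q (r • x) ≠ 0 := by
  obtain ⟨d, hd⟩ := h.hom
  rw [hd]
  exact smul_ne_zero (pow_ne_zero _ hr) hx

lemma ne_of_hf {x y : Vec q p} (h : hf x y ≠ 0) : x ≠ 0 := fun h0 => h (by rw [h0, hf_zero_left])

lemma E2 {f : Matrix (Fin q) (Fin p) ℂ → Matrix (Fin q') (Fin p') ℂ} {Q} (h : NC f Q) (hqq : q' + 2 ≤ 2 * q) (hq3 : 3 ≤ q)
    (hp : 0 < p) {a e y : Vec q p} (haa : hf a a = 1) (hee : hf e e = 1) (hyy : hf y y = 1) (hae : hf a e = 0) (hay : hf a y = 0)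
    (hey : hf e y = 0) (hQa : Q a ≠ 0) (hQe : Q e ≠ 0) (hQy : Q y ≠ 0) :
    ∀ᶠ x in 𝓝 y, ∃ c : ℂ, c ≠ 0 ∧ Lam Q e x = c • Q x ∧ hf (c • Q x) (c • Q x) = hf (Q e) (Q e) * hf x x := by
  have hQc : Continuous Q := h.sec.1.continuous
  let Y : Vec q p → Vec q p := fun x => x - hf x e • e
  let A : Vec q p → Vec q p := fun x => a - (hf a (Y x) / hf (Y x) (Y x)) • Y x
  have hYy : Y y = y := by simp [Y, hf_symm_zero hey]
  have hAy : A y = a := by simp [A, hYy, hay]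
  have hYt : Tendsto Y (𝓝 y) (𝓝 y) := by
    have := (tendsto_id (x := 𝓝 y)).sub ((tendsto_hf tendsto_id (tendsto_const_nhds (x := e))).smul (tendsto_const_nhds (x := e)))
    rw [hf_symm_zero hey, zero_smul, sub_zero] at this
    exact this
  have hYY := tendsto_hf hYt hYt
  have hAt : Tendsto A (𝓝 y) (𝓝 a) := by
    have := (tendsto_const_nhds (x := a)).sub (((tendsto_hf (tendsto_const_nhds (x := a)) hYt).div hYY (by
      rw [hyy]; exact one_ne_zero)).smul hYt)
    rw [hay, zero_div, zero_smul, sub_zero] at this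
    exact this
  have hqy : 0 < hq y := by
    rw [hf_self] at hyy
    have : hq y = 1 := by exact_mod_cast hyy
    linarith
  have hqa : 0 < hq a := by
    rw [hf_self] at haa
    have : hq a = 1 := by exact_mod_cast haa
    linarith
  filter_upwards [hYt.eventually ((continuous_hq.tendsto y).eventually (lt_mem_nhds hqy)),
    hAt.eventually ((continuous_hq.tendsto a).eventually (lt_mem_nhds hqa)),
    hAt.eventually (hQc.continuousAt.eventually_ne hQa), hQc.continuousAt.eventually_ne hQy,
    continuousAt_id.eventually_ne (ne_of_hf (x := y) (y := y) (by rw [hyy]; exact one_ne_zero))] with x h1 h2 h3 h4 h5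
  obtain ⟨r, hr, hr1⟩ := normV h1
  obtain ⟨s, hs, hs1⟩ := normV h2
  have hYe : hf (Y x) e = 0 := by
    simp [Y, hf_sub_left, hf_smul_left, hee]
  have hYn := hf_self_ne h1
  have hAY : hf (A x) (Y x) = 0 := by
    show hf (a - (hf a (Y x) / hf (Y x) (Y x)) • Y x) (Y x) = 0
    rw [hf_sub_left, hf_smul_left, div_mul_cancel₀ _ hYn, sub_self]
  have hAe : hf (A x) e = 0 := by
    show hf (a - (hf a (Y x) / hf (Y x) (Y x)) • Y x) e = 0
    rw [hf_sub_left, hf_smul_left, hae, hYe, mul_zero, sub_zero]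
  refine E1' h hqq hq3 hp hs1 hee hr1 ?_ ?_ ?_ (h.smul_ne hs h3) hQe (α := hf x e) (β := r⁻¹) ?_ h5 h4
  · rw [hf_smul_left, hAe, mul_zero]
  · rw [hf_smul_left, hf_smul_right, hAY, mul_zero, mul_zero]
  · rw [hf_smul_right, hf_symm_zero hYe, mul_zero]
  · rw [smul_smul, inv_mul_cancel₀ hr, one_smul]; simp [Y]

lemma glob {Λ : Vec q p →ₗ[ℂ] Vec q' p'} {C : ℂ} {x : Vec q p}
    (h : ∀ᶠ v in 𝓝 x, hf (Λ v) (Λ v) = C * hf v v) (v w : Vec q p) : hf (Λ v) (Λ w) = C * hf v w := by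
  have h1 : ∀ v, hf (Λ v) (Λ v) = C * hf v v := by
    intro v
    have ht1 : Tendsto (fun t : ℂ => x + t • v) (𝓝[≠] 0) (𝓝 x) := by
      have : Continuous fun t : ℂ => x + t • v := by fun_prop
      have := (this.tendsto 0).mono_left (nhdsWithin_le_nhds (s := {0}ᶜ))
      rwa [zero_smul, add_zero] at this
    have ht2 : Tendsto (fun t : ℂ => x - t • v) (𝓝[≠] 0) (𝓝 x) := by
      have : Continuous fun t : ℂ => x - t • v := by fun_prop
      have := (this.tendsto 0).mono_left (nhdsWithin_le_nhds (s := {0}ᶜ))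
      rwa [zero_smul, sub_zero] at this
    obtain ⟨t, ⟨e1, e2⟩, ht⟩ := (((ht1.eventually h).and (ht2.eventually h)).and eventually_mem_nhdsWithin).exists
    have e0 := h.self_of_nhds
    have ht0 : t ≠ 0 := ht
    have ht3 : star t ≠ 0 := star_ne_zero.2 ht0
    simp only [map_add, map_sub, map_smul, hf_add_left, hf_add_right, hf_sub_left, hf_sub_right, hf_smul_left, hf_smul_right] at e1 e2
    have : 2 * (t * star t) * (hf (Λ v) (Λ v) - C * hf v v) = 0 := by linear_combination e1 + e2 - 2 * e0
    rcases mul_eq_zero.1 this with h | h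
    · exact absurd h (mul_ne_zero two_ne_zero (mul_ne_zero ht0 ht3))
    · exact sub_eq_zero.1 h
  have a1 := h1 (v + w)
  have a2 := h1 (v + Complex.I • w)
  have a3 := h1 v
  have a4 := h1 w
  have hI : star Complex.I = - Complex.I := Complex.conj_I
  simp only [map_add, map_smul, hf_add_left, hf_add_right, hf_smul_left, hf_smul_right, hI] at a1 a2
  have hI2 := Complex.I_mul_I
  linear_combination (1/2) * (a1 - a3 - a4) + (Complex.I / 2) * (a2 - a3 - a4) + (- (1 / 2) * (hf (Λ w) (Λ v) - hf (Λ v) (Λ w) - C * hf w v + C * hf v w) + (Complex.I/2) * (hf (Λ w) (Λ w) - C * hf w w)) * hI2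

end P16a

end

section

open Filter Topology Metric
section P17a
variable {q p q' p' : ℕ}

lemma exists_frame {f : Matrix (Fin q) (Fin p) ℂ → Matrix (Fin q') (Fin p') ℂ} {Q} (h : NC f Q) (hq3 : 3 ≤ q)
    (hx : ∃ x, 0 < hq x ∧ Q x ≠ 0) : ∃ a e y : Vec q p, hf a a = 1 ∧ hf e e = 1 ∧ hf y y = 1 ∧ hf a e = 0 ∧ hf a y = 0 ∧
      hf e y = 0 ∧ Q a ≠ 0 ∧ Q e ≠ 0 ∧ Q y ≠ 0 := by
  obtain ⟨x, hx, hQx⟩ := hx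
  obtain ⟨g, hg, c, hc, hgx⟩ := witt_pos ⟨0, by omega⟩ hx
  let φ : (Fin q → ℂ) →ₗ[ℂ] Vec q p :=
    { toFun := fun A => g (Sum.elim A 0)
      map_add' := fun A B => by
        rw [← map_add]; congr 1; ext s; cases s <;> simp
      map_smul' := fun c A => by
        rw [← map_smul]; congr 1; ext s; cases s <;> simp }
  have hφ : ∀ A, φ A = g (Sum.elim A 0) := fun _ => rfl
  have hinj : Function.Injective φ := fun A B hAB => by
    have := g.injective hAB
    ext i
    exact congrFun this (Sum.inl i)
  have hfr : Module.finrank ℂ (LinearMap.range φ) = q := by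
    rw [LinearMap.finrank_range_of_inj hinj]; simp
  obtain ⟨v, hv, hvo⟩ := frames (good := fun x => Q x ≠ 0) (fun x hx => h.sec.1.continuous.continuousAt.eventually_ne hx)
    (fun x v hxv => by
      obtain ⟨s, hs⟩ : ∃ s, Q x s ≠ 0 := by
        by_contra! hcon; exact hxv (funext hcon)
      have hd : Differentiable ℂ fun t : ℂ => Q (v + t • (x - v)) s := by
        have h1 : Differentiable ℂ fun t : ℂ => Q (v + t • (x - v)) := h.sec.1.comp (by fun_prop)
        exact differentiable_pi.1 h1 s
      refine (freq_ne hd (by rw [one_smul, add_sub_cancel]; exact hs)).mono fun t ht h0 => ht (by rw [h0]; rfl))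
    3 (LinearMap.range φ) (by
      rintro _ ⟨A, rfl⟩ h0
      rw [hφ, hg.hq]
      have hA : A ≠ 0 := fun hA => h0 (by rw [hA, map_zero])
      unfold hq
      have e1 : (Sum.elim A (0 : Fin p → ℂ)) ∘ Sum.inl = A := rfl
      have e2 : (Sum.elim A (0 : Fin p → ℂ)) ∘ Sum.inr = 0 := rfl
      rw [e1, e2, nsq_zero, sub_zero]
      exact nsq_pos hA) (by rw [hfr]; exact hq3)
    ⟨c • x, ⟨Pi.single ⟨0, by omega⟩ 1, by
      rw [hφ, ← hgx]; congr 1; ext s; cases s <;> simp [eb, Pi.single_apply]⟩, h.smul_ne hc hQx⟩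
  have hpos : ∀ i, 0 < hq (v i) := by
    intro i
    obtain ⟨⟨A, hA⟩, hgd⟩ := hv i
    by_cases hA0 : A = 0
    · exfalso
      rw [hA0, map_zero] at hA
      rw [← hA] at hgd
      obtain ⟨Z, hZ⟩ := exists_fib hx
      refine hgd ?_
      -- homogeneity would give degree zero only; use orthogonality
      obtain ⟨d, hd⟩ := h.hom
      by_cases hd0 : d = 0
      · have hcst : ∀ y, Q y = Q 0 := fun y => by
          have := hd 0 y
          rw [zero_smul, hd0, pow_zero, one_smul] at this
          exact this.symm
        have hor := h.orth (eb (Sum.inl ⟨0, by omega⟩)) (eb (Sum.inl ⟨1, by omega⟩)) (fun h0 => by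
          have := congrFun h0 (Sum.inl ⟨0, by omega⟩); simp [eb] at this) (by rw [hf_eb]; simp)
        rw [hcst, hcst (eb _)] at hor
        exact eq_of_hf (h.ph.2.1 hZ.1) (hcst x ▸ h.sec.2 Z hZ.1 x hZ.2) hor
      · have := hd 0 0
        rw [zero_smul, zero_pow hd0, zero_smul] at this
        exact this
    · rw [← hA, hφ, hg.hq]
      unfold hq
      have e1 : (Sum.elim A (0 : Fin p → ℂ)) ∘ Sum.inl = A := rfl
      have e2 : (Sum.elim A (0 : Fin p → ℂ)) ∘ Sum.inr = 0 := rfl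
      rw [e1, e2, nsq_zero, sub_zero]
      exact nsq_pos hA0
  choose r hr hr1 using fun i => normV (hpos i)
  have ho : ∀ i j, i ≠ j → hf (r i • v i) (r j • v j) = 0 := fun i j hij => by
    rw [hf_smul_left, hf_smul_right, hvo i j hij, mul_zero, mul_zero]
  exact ⟨r 0 • v 0, r 1 • v 1, r 2 • v 2, hr1 0, hr1 1, hr1 2, ho 0 1 (by decide), ho 0 2 (by decide), ho 1 2 (by decide),
    h.smul_ne (hr 0) (hv 0).2, h.smul_ne (hr 1) (hv 1).2, h.smul_ne (hr 2) (hv 2).2⟩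

lemma exists_L {f : Matrix (Fin q) (Fin p) ℂ → Matrix (Fin q') (Fin p') ℂ} (hf' : PH f) (h2q : 2 ≤ q) (hp : q' < p)
    (hq3 : 3 ≤ q) (hqq : q' + 2 ≤ 2 * q) : ∃ L : Vec q p →ₗ[ℂ] Vec q' p', (∀ v w, hf (L v) (L w) = hf v w) ∧
      ∀ Z ∈ typeIDomain q p, ∀ x, On x Z → On (L x) (f Z) := by
  obtain ⟨Q, h, hx⟩ := exists_NC hf' h2q hp
  obtain ⟨a, e, y, haa, hee, hyy, hae, hay, hey, hQa, hQe, hQy⟩ := exists_frame h hq3 hx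
  have hE := E2 h hqq hq3 (by omega) haa hee hyy hae hay hey hQa hQe hQy
  have pos1 : ∀ {w : Vec q p}, hf w w = 1 → 0 < hq w := fun {w} hw => by
    rw [hf_self] at hw
    have : hq w = 1 := by exact_mod_cast hw
    linarith
  have hC : 0 < hq (Q e) := by
    obtain ⟨Z, hZ⟩ := exists_fib (pos1 hee)
    exact mem_dom_iff_on.1 (h.ph.2.1 hZ.1) _ hQe (h.sec.2 Z hZ.1 e hZ.2)
  have hG := glob (Λ := Lam Q e) (C := hf (Q e) (Q e)) (x := y) (hE.mono fun x ⟨c, _, h1, h2⟩ => by rw [h1, h2])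
  let N : Fin q' ⊕ Fin p' → MvPolynomial (Fin q ⊕ Fin p) ℂ := fun s =>
    ∑ t, MvPolynomial.C (Lam Q e (eb t) s) * MvPolynomial.X t
  have hN : ∀ x : Vec q p, pv N x = Lam Q e x := fun x => by
    conv_rhs => rw [sum_eb x, map_sum]
    ext s
    simp only [pv, N, map_sum, map_mul, MvPolynomial.eval_C, MvPolynomial.eval_X, Finset.sum_apply, map_smul, Pi.smul_apply, smul_eq_mul]
    exact Finset.sum_congr rfl fun t _ => mul_comm _ _
  obtain ⟨O, hOs, hO, hyO⟩ := _root_.eventually_nhds_iff.1 hE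
  have hS : IsSec f N := isSec_of_open hf'.1 hO hyO (pos1 hyy) fun x hxO Z hZ => by
    obtain ⟨c, _, h1, _⟩ := hOs x hxO
    rw [hN, h1]
    exact (h.sec.2 Z hZ.1 x hZ.2).smul c
  obtain ⟨r, hr, hr1⟩ := normV hC
  rw [hf_smul_left, hf_smul_right] at hr1
  refine ⟨r • Lam Q e, fun v w => ?_, fun Z hZ x hx => ?_⟩
  · rw [LinearMap.smul_apply, LinearMap.smul_apply, hf_smul_left, hf_smul_right, hG]
    linear_combination hf v w * hr1
  · have := hS Z hZ x hx
    rw [hN] at this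
    exact this.smul r

end P17a

end

section

open Filter Topology Metric
section P18a
variable {q p a b : ℕ}

/-- the standard isometric embedding -/
def iot (a b : ℕ) : Vec q p →ₗ[ℂ] Vec (q + a) (p + b) where
  toFun x := Sum.elim (Fin.append (x ∘ Sum.inl) 0) (Fin.append (x ∘ Sum.inr) 0)
  map_add' x y := by
    ext s
    rcases s with i | j
    · refine Fin.addCases (fun i => ?_) (fun i => ?_) i <;> simp
    · refine Fin.addCases (fun i => ?_) (fun i => ?_) j <;> simp
  map_smul' c x := by
    ext s
    rcases s with i | j
    · refine Fin.addCases (fun i => ?_) (fun i => ?_) i <;> simp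
    · refine Fin.addCases (fun i => ?_) (fun i => ?_) j <;> simp

lemma iot_apply (x : Vec q p) : iot a b x = Sum.elim (Fin.append (x ∘ Sum.inl) 0) (Fin.append (x ∘ Sum.inr) 0) := rfl

/-- index embedding -/
def ie (a b : ℕ) : Fin q ⊕ Fin p → Fin (q + a) ⊕ Fin (p + b) := Sum.map (Fin.castAdd a) (Fin.castAdd b)

lemma ie_inj : Function.Injective (ie a b : Fin q ⊕ Fin p → _) :=
  Sum.map_injective.2 ⟨Fin.castAdd_injective _ _, Fin.castAdd_injective _ _⟩

lemma eps_ie (s : Fin q ⊕ Fin p) : eps (ie a b s) = eps s := by cases s <;> simp [ie]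

lemma iot_eb (s : Fin q ⊕ Fin p) : iot a b (eb s) = eb (ie a b s) := by
  rw [iot_apply]
  ext t
  rcases s with i | j <;> rcases t with t | t <;> refine Fin.addCases (fun k => ?_) (fun k => ?_) t <;>
    simp [ie, eb, Pi.single_apply, Fin.ext_iff]
  · intro h; have := i.2; omega
  · intro h; have := j.2; omega

lemma iot_hf (x y : Vec q p) : hf (iot a b x) (iot a b y) = hf x y := by
  conv_lhs => rw [sum_eb x, map_sum, hf_sum_left]
  conv_rhs => rw [sum_eb x, hf_sum_left]
  refine Finset.sum_congr rfl fun s _ => ?_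
  rw [map_smul, hf_smul_left, hf_smul_left, iot_eb, hf_eb_left, hf_eb_left, eps_ie]
  congr 3
  rw [iot_apply]
  cases s <;> simp [ie]

lemma witt_iot (M : Vec q p →ₗ[ℂ] Vec (q + a) (p + b)) (hM : ∀ x y, hf (M x) (M y) = hf x y) :
    ∃ G : Vec (q + a) (p + b) ≃ₗ[ℂ] Vec (q + a) (p + b), IsU G ∧ ∀ x, G (iot a b x) = M x := by
  classical
  obtain ⟨G, hG, h⟩ := witt (q := q + a) (p := p + b) (Finset.univ.image (ie a b)) (Function.extend (ie a b) (fun s => M (eb s)) 0) (by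
    intro s hs t ht
    obtain ⟨s, -, rfl⟩ := Finset.mem_image.1 hs
    obtain ⟨t, -, rfl⟩ := Finset.mem_image.1 ht
    rw [ie_inj.extend_apply, ie_inj.extend_apply, hM, hf_eb, eps_ie]
    simp only [ie_inj.eq_iff])
  refine ⟨G, hG, fun x => ?_⟩
  conv_lhs => rw [sum_eb x, map_sum, map_sum]
  conv_rhs => rw [sum_eb x, map_sum]
  refine Finset.sum_congr rfl fun s _ => ?_
  rw [map_smul, map_smul, map_smul, iot_eb, h _ (Finset.mem_image_of_mem _ (Finset.mem_univ s)), ie_inj.extend_apply]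

lemma trans_dom {Z0 : Matrix (Fin q) (Fin p) ℂ} (hZ0 : Z0 ∈ typeIDomain q p) :
    ∃ g : Vec q p ≃ₗ[ℂ] Vec q p, IsU g ∧ act g 0 = Z0 := by
  classical
  rcases Nat.eq_zero_or_pos q with rfl | hq0
  · exact ⟨LinearEquiv.refl _ _, IsU.refl, by ext i; exact i.elim0⟩
  let φ : (Fin q → ℂ) →ₗ[ℂ] Vec q p :=
    { toFun := fun A => gv A Z0
      map_add' := fun A B => gv_add A B Z0
      map_smul' := fun c A => gv_smul c A Z0 }
  have hφ : ∀ A, φ A = gv A Z0 := fun _ => rfl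
  have hinj : Function.Injective φ := fun A B hAB => by
    ext i
    exact congrFun hAB (Sum.inl i)
  have hfr : Module.finrank ℂ (LinearMap.range φ) = q := by
    rw [LinearMap.finrank_range_of_inj hinj]; simp
  have hpos : ∀ x ∈ LinearMap.range φ, x ≠ 0 → 0 < hq x := by
    rintro _ ⟨A, rfl⟩ h0
    exact mem_dom_iff_on.1 hZ0 _ h0 (on_gv A Z0)
  obtain ⟨v, hv, hvo⟩ := frames (good := fun x : Vec q p => x ≠ 0) (fun x hx => continuousAt_id.eventually_ne hx)
    (fun x v hxv => by
      obtain ⟨s, hs⟩ : ∃ s, x s ≠ 0 := by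
        by_contra! hcon; exact hxv (funext hcon)
      have hd : Differentiable ℂ fun t : ℂ => (v + t • (x - v)) s := by
        have h1 : Differentiable ℂ fun t : ℂ => v + t • (x - v) := by fun_prop
        exact differentiable_pi.1 h1 s
      refine (freq_ne hd (by rw [one_smul, add_sub_cancel]; exact hs)).mono fun t ht h0 => ht (by rw [h0]; rfl))
    q (LinearMap.range φ) hpos hfr.ge
    ⟨φ (Pi.single ⟨0, hq0⟩ 1), ⟨_, rfl⟩, fun h0 => by
      rw [← map_zero φ] at h0
      have := congrFun (hinj h0) ⟨0, hq0⟩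
      simp at this⟩
  choose r hr hr1 using fun i => normV (hpos (v i) (hv i).1 (hv i).2)
  obtain ⟨g, hg, hgv⟩ := witt (q := q) (p := p) (Finset.univ.image Sum.inl) (Sum.elim (fun i => r i • v i) 0) (by
    intro s hs t ht
    obtain ⟨s, -, rfl⟩ := Finset.mem_image.1 hs
    obtain ⟨t, -, rfl⟩ := Finset.mem_image.1 ht
    by_cases hst : s = t
    · subst hst; simp [hr1]
    · simp [hst, hf_smul_left, hf_smul_right, hvo s t hst])
  refine ⟨g, hg, eq_of_on fun x hx => ?_⟩
  have h1 := on_act' hg zero_mem_dom hx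
  have h2 : ∀ j, g.symm x (Sum.inr j) = 0 := fun j => by
    have := congrFun h1 j
    rw [vecMul_zero] at this
    exact this.symm
  have h3 : x = φ (∑ i, g.symm x (Sum.inl i) • (r i • ((hv i).1).choose)) := by
    have h4 := sum_eb (g.symm x)
    rw [Fintype.sum_sum_type] at h4
    simp only [h2, zero_smul, Finset.sum_const_zero, add_zero] at h4
    have h5 := congrArg g h4
    rw [g.apply_symm_apply, map_sum] at h5
    refine h5.trans ?_
    rw [map_sum]
    refine Finset.sum_congr rfl fun i _ => ?_
    rw [map_smul, map_smul, map_smul, hgv _ (Finset.mem_image_of_mem _ (Finset.mem_univ i)), ((hv i).1).choose_spec]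
    rfl
  rw [h3]
  exact on_gv _ _

end P18a

end

section

open Filter Topology Metric
section P19a
variable {q p a b : ℕ}

/-- maps compatible with the standard embedding -/
structure KH (a b : ℕ) (k : Matrix (Fin q) (Fin p) ℂ → Matrix (Fin (q + a)) (Fin (p + b)) ℂ) : Prop where
  diff : DifferentiableOn ℂ k (typeIDomain q p)
  maps : Set.MapsTo k (typeIDomain q p) (typeIDomain (q + a) (p + b))
  on : ∀ Z ∈ typeIDomain q p, ∀ x, On x Z → On (iot a b x) (k Z)

lemma KH.row {k : Matrix (Fin q) (Fin p) ℂ → Matrix (Fin (q + a)) (Fin (p + b)) ℂ} (h : KH a b k) {Z} (hZ : Z ∈ typeIDomain q p)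
    (i : Fin q) : k Z (Fin.castAdd a i) = Fin.append (Z i) 0 := by
  have h1 := h.on Z hZ _ (on_gv (Pi.single i 1) Z)
  have h2 : Fin.append (Pi.single i (1 : ℂ)) (0 : Fin a → ℂ) = Pi.single (Fin.castAdd a i) 1 := by
    ext t
    refine Fin.addCases (fun k => ?_) (fun k => ?_) t <;> simp [Pi.single_apply, Fin.ext_iff]
    have := i.2; omega
  have h3 : Fin.append (Pi.single i (1 : ℂ)) (0 : Fin a → ℂ) ᵥ* k Z = Fin.append (Pi.single i 1 ᵥ* Z) 0 := h1
  rw [h2, Matrix.single_one_vecMul, Matrix.single_one_vecMul] at h3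
  exact h3

lemma KH.zero {k : Matrix (Fin q) (Fin p) ℂ → Matrix (Fin (q + a)) (Fin (p + b)) ℂ} (h : KH a b k) (hq0 : 0 < q)
    (r : Fin a) (j : Fin p) : k 0 (Fin.natAdd q r) (Fin.castAdd b j) = 0 := by
  let i0 : Fin q := ⟨0, hq0⟩
  have hmem : ∀ t : ℂ, ‖t‖ < 1 → 0 + t • Matrix.single i0 j 1 ∈ typeIDomain q p := fun t ht =>
    line_mem (zero_mem_flag i0 j) ht
  let φ : ℂ → ℂ := fun t => k (0 + t • Matrix.single i0 j 1) (Fin.natAdd q r) (Fin.castAdd b j)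
  have hφ : DifferentiableOn ℂ φ (ball 0 1) := by
    have h1 : DifferentiableOn ℂ (fun t : ℂ => k (0 + t • Matrix.single i0 j 1)) (ball 0 1) :=
      h.diff.comp (by fun_prop) fun t ht => hmem t (by simpa using ht)
    exact diff_entry h1 _ _
  have hb : ∀ t : ℂ, ‖t‖ < 1 → ‖φ t‖ ^ 2 ≤ 1 - ‖t‖ ^ 2 := by
    intro t ht
    have h1 := dom_le_col (h.maps (hmem t ht)) (Pi.single (Fin.castAdd b j) 1)
    have h2 : nsq (Pi.single (Fin.castAdd b j) 1 : Fin (p + b) → ℂ) = 1 := by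
      unfold nsq
      rw [Finset.sum_eq_single (Fin.castAdd b j)] <;> simp +contextual
    rw [h2, Matrix.mulVec_single_one] at h1
    unfold nsq at h1
    rw [Fin.sum_univ_add] at h1
    have h3 := Finset.single_le_sum (f := fun i => ‖(k (0 + t • Matrix.single i0 j 1)).col (Fin.castAdd b j) (Fin.castAdd a i)‖ ^ 2)
      (fun i _ => by positivity) (Finset.mem_univ i0)
    have h4 := Finset.single_le_sum (f := fun i => ‖(k (0 + t • Matrix.single i0 j 1)).col (Fin.castAdd b j) (Fin.natAdd q i)‖ ^ 2)
      (fun i _ => by positivity) (Finset.mem_univ r)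
    have h5 : (k (0 + t • Matrix.single i0 j 1)).col (Fin.castAdd b j) (Fin.castAdd a i0) = t := by
      show k (0 + t • Matrix.single i0 j 1) (Fin.castAdd a i0) (Fin.castAdd b j) = t
      rw [h.row (hmem t ht)]
      simp
    have h6 : (k (0 + t • Matrix.single i0 j 1)).col (Fin.castAdd b j) (Fin.natAdd q r) = φ t := rfl
    simp only [h5] at h3
    simp only [h6] at h4
    linarith
  have := maxp hφ (fun u hu => by
    have h1 : Tendsto (fun t : ℂ => √(1 - ‖t‖ ^ 2)) (u : Filter ℂ) (𝓝 0) := by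
      have := ((hu.2.pow 2).const_sub 1).sqrt
      simpa using this
    refine squeeze_zero_norm' ?_ h1
    filter_upwards [hu.1] with t ht
    exact Real.le_sqrt_of_sq_le (hb t ht)) (t := 0) (by simp)
  simpa [φ] using this

lemma KH.col {k : Matrix (Fin q) (Fin p) ℂ → Matrix (Fin (q + a)) (Fin (p + b)) ℂ} (h : KH a b k) (hq0 : 0 < q)
    {Z0} (hZ0 : Z0 ∈ typeIDomain q p) (r : Fin a) (j : Fin p) : k Z0 (Fin.natAdd q r) (Fin.castAdd b j) = 0 := by
  obtain ⟨g, hg, hgZ⟩ := trans_dom hZ0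
  obtain ⟨G, hG, hGg⟩ := witt_iot (a := a) (b := b) (iot a b ∘ₗ (g : Vec q p →ₗ[ℂ] Vec q p)) (fun x y => by
    simp only [LinearMap.comp_apply, LinearEquiv.coe_coe, iot_hf]; exact hg x y)
  have hGg' : ∀ x, G (iot a b x) = iot a b (g x) := hGg
  have hK : KH a b (act G.symm ∘ k ∘ act g) :=
    { diff := (diff_act hG.symm).comp (h.diff.comp (diff_act hg) fun _ => act_mem hg) fun Z hZ => h.maps (act_mem hg hZ)
      maps := fun Z hZ => act_mem hG.symm (h.maps (act_mem hg hZ))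
      on := fun Z hZ x hx => by
        have := on_act hG.symm (h.maps (act_mem hg hZ)) (h.on _ (act_mem hg hZ) _ (on_act hg hZ hx))
        rw [← hGg', G.symm_apply_apply] at this
        exact this }
  set W := (act G.symm ∘ k ∘ act g) 0 with hW
  have hW0 : ∀ (i) (j : Fin p), W i (Fin.castAdd b j) = 0 := by
    intro i j
    refine Fin.addCases (fun i => ?_) (fun i => ?_) i
    · rw [hW, hK.row zero_mem_dom]; simp
    · exact hK.zero hq0 i j
  have hWeq : W = act G.symm (k Z0) := by rw [hW, Function.comp_apply, Function.comp_apply, hgZ]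
  have key : ∀ w, On w (k Z0) → ∀ n : Vec q p, (∀ x, On x Z0 → hf x n = 0) → hf w (iot a b n) = 0 := by
    intro w hw n hn
    have h1 : On (G.symm w) W := hWeq ▸ on_act hG.symm (h.maps hZ0) hw
    have h2 : ∀ j, G.symm w (Sum.inr (Fin.castAdd b j)) = 0 := fun j => by
      have := congrFun h1 (Fin.castAdd b j)
      rw [Function.comp_apply] at this
      rw [← this]
      simp only [vecMul, dotProduct, hW0, mul_zero, Finset.sum_const_zero]
    have h3 : ∀ i, g.symm n (Sum.inl i) = 0 := fun i => by
      have h4 : On (g (eb (Sum.inl i))) Z0 := by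
        rw [← hgZ]
        exact on_act hg zero_mem_dom (on_eb_iff.2 fun j => rfl)
      have h5 := hn _ h4
      rw [← g.apply_symm_apply n, hg, hf_eb_left] at h5
      simpa using h5
    rw [← hG.symm, ← g.apply_symm_apply n, ← hGg', G.symm_apply_apply]
    rw [hf_eq, iot_apply]
    have e1 : (g.symm n) ∘ Sum.inl = 0 := funext h3
    rw [Sum.elim_comp_inl, Sum.elim_comp_inr, e1]
    simp [dotProduct, Fin.sum_univ_add, h2]
  have h7 := key (gv (Pi.single (Fin.natAdd q r) 1) (k Z0)) (on_gv _ _)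
    (Sum.elim (star (Z0 *ᵥ Pi.single j 1)) (star (Pi.single j 1))) (fun x hx => by
      rw [hx.eq_gv, hf_gv_col, sub_self, dotProduct_zero])
  rw [hf_eq, iot_apply] at h7
  simp only [gv_inl, gv_inr, Sum.elim_comp_inl, Sum.elim_comp_inr, Matrix.single_one_vecMul, single_one_dotProduct] at h7
  simpa [dotProduct, Fin.sum_univ_add, Pi.single_apply] using h7

lemma KH.block {k : Matrix (Fin q) (Fin p) ℂ → Matrix (Fin (q + a)) (Fin (p + b)) ℂ} (h : KH a b k) (hq0 : 0 < q) :
    ∃ hh : Matrix (Fin q) (Fin p) ℂ → Matrix (Fin a) (Fin b) ℂ, DifferentiableOn ℂ hh (typeIDomain q p) ∧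
      Set.MapsTo hh (typeIDomain q p) (typeIDomain a b) ∧ ∀ Z ∈ typeIDomain q p, k Z = diagBlock rfl rfl Z (hh Z) := by
  refine ⟨fun Z => of fun i j => k Z (Fin.natAdd q i) (Fin.natAdd p j), ?_, ?_, ?_⟩
  · exact diff_mat fun i j => diff_entry h.diff _ _
  · intro Z hZ
    rw [mem_dom_iff]
    intro A hA
    have h1 := (mem_dom_iff.1 (h.maps hZ)) (Fin.append 0 A) (fun h0 => hA (by
      ext i
      have := congrFun h0 (Fin.natAdd q i)
      simpa using this))
    have h2 : nsq (Fin.append (0 : Fin q → ℂ) A) = nsq A := by simp [nsq, Fin.sum_univ_add]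
    have h3 : Fin.append 0 A ᵥ* k Z = Fin.append 0 (A ᵥ* of fun i j => k Z (Fin.natAdd q i) (Fin.natAdd p j)) := by
      ext t
      refine Fin.addCases (fun j => ?_) (fun j => ?_) t
      · simp [vecMul, dotProduct, Fin.sum_univ_add, h.col hq0 hZ]
      · simp [vecMul, dotProduct, Fin.sum_univ_add]
    have h4 : ∀ B : Fin b → ℂ, nsq (Fin.append (0 : Fin p → ℂ) B) = nsq B := fun B => by simp [nsq, Fin.sum_univ_add]
    rw [h3, h2, h4] at h1
    exact h1
  · intro Z hZ
    ext s t
    refine Fin.addCases (fun i => ?_) (fun i => ?_) s <;> refine Fin.addCases (fun j => ?_) (fun j => ?_) t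
    · rw [h.row hZ]; simp [diagBlock]
    · rw [h.row hZ]; simp [diagBlock]
    · rw [h.col hq0 hZ]; simp [diagBlock]
    · simp [diagBlock]

lemma iso_le {q' p' : ℕ} (L : Vec q p →ₗ[ℂ] Vec q' p') (hL : ∀ v w, hf (L v) (L w) = hf v w) : q ≤ q' ∧ p ≤ p' := by
  have hLq : ∀ v, hq (L v) = hq v := fun v => by
    have := hL v v
    rw [hf_self, hf_self] at this
    exact_mod_cast this
  constructor
  · let φ : (Fin q → ℂ) →ₗ[ℂ] (Fin q' → ℂ) :=
      { toFun := fun A => L (Sum.elim A 0) ∘ Sum.inl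
        map_add' := fun A B => by
          have : (Sum.elim (A + B) 0 : Vec q p) = Sum.elim A 0 + Sum.elim B 0 := by ext s; cases s <;> simp
          rw [this, map_add]; rfl
        map_smul' := fun c A => by
          have : (Sum.elim (c • A) 0 : Vec q p) = c • (Sum.elim A 0 : Vec q p) := by ext s; cases s <;> simp
          rw [this, map_smul]; rfl }
    have hinj : Function.Injective φ := (injective_iff_map_eq_zero φ).2 fun A hA => by
      have h1 := hLq (Sum.elim A 0)
      have h2 : L (Sum.elim A 0) ∘ Sum.inl = 0 := hA
      unfold hq at h1
      rw [h2, Sum.elim_comp_inl, Sum.elim_comp_inr, nsq_zero, nsq_zero] at h1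
      by_contra h0
      linarith [nsq_pos h0, nsq_nonneg (L (Sum.elim A 0) ∘ Sum.inr)]
    simpa using LinearMap.finrank_le_finrank_of_injective hinj
  · let φ : (Fin p → ℂ) →ₗ[ℂ] (Fin p' → ℂ) :=
      { toFun := fun A => L (Sum.elim 0 A) ∘ Sum.inr
        map_add' := fun A B => by
          have : (Sum.elim 0 (A + B) : Vec q p) = (Sum.elim 0 A : Vec q p) + (Sum.elim 0 B : Vec q p) := by ext s; cases s <;> simp
          rw [this, map_add]; rfl
        map_smul' := fun c A => by
          have : (Sum.elim 0 (c • A) : Vec q p) = c • (Sum.elim 0 A : Vec q p) := by ext s; cases s <;> simp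
          rw [this, map_smul]; rfl }
    have hinj : Function.Injective φ := (injective_iff_map_eq_zero φ).2 fun A hA => by
      have h1 := hLq (Sum.elim 0 A)
      have h2 : L (Sum.elim 0 A) ∘ Sum.inr = 0 := hA
      unfold hq at h1
      rw [h2, Sum.elim_comp_inl, Sum.elim_comp_inr, nsq_zero, nsq_zero] at h1
      by_contra h0
      linarith [nsq_pos h0, nsq_nonneg (L (Sum.elim 0 A) ∘ Sum.inl)]
    simpa using LinearMap.finrank_le_finrank_of_injective hinj

lemma part3_core {q' p' : ℕ} (ha : q + a = q') (hb : p + b = p') (hq0 : 0 < q)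
    {f : Matrix (Fin q) (Fin p) ℂ → Matrix (Fin q') (Fin p') ℂ} (hf' : PH f)
    (L : Vec q p →ₗ[ℂ] Vec q' p') (hL : ∀ v w, hf (L v) (L w) = hf v w)
    (hon : ∀ Z ∈ typeIDomain q p, ∀ x, On x Z → On (L x) (f Z)) :
    ∃ (Φ : Matrix (Fin q') (Fin p') ℂ → Matrix (Fin q') (Fin p') ℂ)
      (ψ : Matrix (Fin q) (Fin p) ℂ → Matrix (Fin q) (Fin p) ℂ)
      (h : Matrix (Fin q) (Fin p) ℂ → Matrix (Fin a) (Fin b) ℂ),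
      IsAutOf Φ ∧ IsAutOf ψ ∧
      DifferentiableOn ℂ h (typeIDomain q p) ∧
      Set.MapsTo h (typeIDomain q p) (typeIDomain a b) ∧
      ∀ Z ∈ typeIDomain q p, f Z = Φ (diagBlock ha hb (ψ Z) (h (ψ Z))) := by
  subst ha hb
  obtain ⟨G, hG, hGL⟩ := witt_iot L hL
  have hK : KH a b (act G.symm ∘ f) :=
    { diff := (diff_act hG.symm).comp hf'.1 hf'.2.1
      maps := fun Z hZ => act_mem hG.symm (hf'.2.1 hZ)
      on := fun Z hZ x hx => by
        have := on_act hG.symm (hf'.2.1 hZ) (hon Z hZ x hx)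
        rw [← hGL, G.symm_apply_apply] at this
        exact this }
  obtain ⟨h, h1, h2, h3⟩ := hK.block hq0
  refine ⟨act G, id, h, isAut_act hG, ⟨fun _ hZ => hZ, differentiableOn_id, id, fun _ hZ => hZ, differentiableOn_id, fun _ _ => rfl,
    fun _ _ => rfl⟩, h1, h2, fun Z hZ => ?_⟩
  rw [id, ← h3 Z hZ, Function.comp_apply, act_act_symm hG (hf'.2.1 hZ)]

lemma part3_final {q' p' : ℕ} {f : Matrix (Fin q) (Fin p) ℂ → Matrix (Fin q') (Fin p') ℂ} (hf' : PH f) (h2q : 2 ≤ q)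
    (h3q' : 3 ≤ q') (hp : q' < p) (hqq : q' < 2 * q - 1) :
    ∃ (hqq : q + (q' - q) = q') (hpp : p + (p' - p) = p')
        (Φ : Matrix (Fin q') (Fin p') ℂ → Matrix (Fin q') (Fin p') ℂ)
        (ψ : Matrix (Fin q) (Fin p) ℂ → Matrix (Fin q) (Fin p) ℂ)
        (h : Matrix (Fin q) (Fin p) ℂ → Matrix (Fin (q' - q)) (Fin (p' - p)) ℂ),
        IsAutOf Φ ∧ IsAutOf ψ ∧
        DifferentiableOn ℂ h (typeIDomain q p) ∧
        Set.MapsTo h (typeIDomain q p) (typeIDomain (q' - q) (p' - p)) ∧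
        ∀ Z ∈ typeIDomain q p, f Z = Φ (diagBlock hqq hpp (ψ Z) (h (ψ Z))) := by
  obtain ⟨L, hL, hon⟩ := exists_L hf' h2q hp (by omega) (by omega)
  obtain ⟨hq', hp'⟩ := iso_le L hL
  exact ⟨by omega, by omega, part3_core (by omega) (by omega) (by omega) hf' L hL hon⟩

end P19a

end

/-- A proper holomorphic map `f : D^I_{q,p} → D^I_{q',p'}` with `p ≥ q ≥ 2` and
`p > q' ≥ 3` is fibral-image-preserving, admits a global rational proper moduli map
defined on a dense open subset of the cone over `D_{q,p}`, and if moreover `q' < 2q - 1`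
then `f` is of diagonal type. -/
theorem stmt_13 (p q p' q' : ℕ) (h0p' : 0 < p') (h2q : 2 ≤ q) (hqp : q ≤ p)
    (h3q' : 3 ≤ q') (hq'p : q' < p)
    (f : Matrix (Fin q) (Fin p) ℂ → Matrix (Fin q') (Fin p') ℂ)
    (hf : DifferentiableOn ℂ f (typeIDomain q p))
    (hfp : ProperOn f (typeIDomain q p) (typeIDomain q' p')) :
    (∀ x ∈ genBallCone q p, ∃ y ∈ genBallCone q' p',
      ∀ Z ∈ typeIDomain q p, x.1 ᵥ* Z = x.2 → y.1 ᵥ* f Z = y.2) ∧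
    (∃ (d : ℕ) (P1 : Fin q' → MvPolynomial (Fin (q + p)) ℂ)
        (P2 : Fin p' → MvPolynomial (Fin (q + p)) ℂ),
      IsRatProperRep q p q' p' d P1 P2 ∧
      ∃ U : Set ((Fin q → ℂ) × (Fin p → ℂ)),
        IsOpen U ∧ U ⊆ genBallCone q p ∧ genBallCone q p ⊆ closure U ∧
        ∀ x ∈ U,
          (¬ ((∀ i, MvPolynomial.eval (Fin.append x.1 x.2) (P1 i) = 0) ∧
              (∀ j, MvPolynomial.eval (Fin.append x.1 x.2) (P2 j) = 0))) ∧
          ∀ Z ∈ typeIDomain q p, x.1 ᵥ* Z = x.2 →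
            (fun i => MvPolynomial.eval (Fin.append x.1 x.2) (P1 i)) ᵥ* f Z
              = fun j => MvPolynomial.eval (Fin.append x.1 x.2) (P2 j)) ∧
    (q' < 2 * q - 1 →
      ∃ (hqq : q + (q' - q) = q') (hpp : p + (p' - p) = p')
        (Φ : Matrix (Fin q') (Fin p') ℂ → Matrix (Fin q') (Fin p') ℂ)
        (ψ : Matrix (Fin q) (Fin p) ℂ → Matrix (Fin q) (Fin p) ℂ)
        (h : Matrix (Fin q) (Fin p) ℂ → Matrix (Fin (q' - q)) (Fin (p' - p)) ℂ),
        IsAutOf Φ ∧ IsAutOf ψ ∧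
        DifferentiableOn ℂ h (typeIDomain q p) ∧
        Set.MapsTo h (typeIDomain q p) (typeIDomain (q' - q) (p' - p)) ∧
        ∀ Z ∈ typeIDomain q p, f Z = Φ (diagBlock hqq hpp (ψ Z) (h (ψ Z)))) := by
  exact ⟨part1_final ⟨hf, hfp⟩ h2q hq'p, part2_final ⟨hf, hfp⟩ h2q hq'p,
    fun h => part3_final ⟨hf, hfp⟩ h2q h3q' hq'p h⟩
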